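/- There exists A > 0 with the following property: for every bounded, open, connected, geodesically convex set Ω ⊆ ℍ² whose hyperbolic area ∫_Ω dA is at least A, and for every μ > 0 and every nonconstant function u, smooth on Ω and C¹ up to ∂Ω, with ∫_Ω u² dA < ∞ and ∫_Ω |∇u|² dx dy < ∞, satisfying −Δu = μu pointwise in Ω, the Neumann boundary condition, and such that μ is the least element of the positive Neumann spectrum in the variational sense, the function u has no critical points in Ω. -/

import Mathlib

open MeasureTheory Filter Set Topology

noncomputable section

/-- The upper half-plane model of the hyperbolic plane. -/
def H2 : Set (ℝ × ℝ) := {p | 0 < p.2}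

/-- Inverse hyperbolic cosine. -/
def arcosh (t : ℝ) : ℝ := Real.log (t + Real.sqrt (t ^ 2 - 1))

/-- Hyperbolic distance in the upper half-plane model. -/
def hypDist (a b : ℝ × ℝ) : ℝ :=
  arcosh (1 + ((a.1 - b.1) ^ 2 + (a.2 - b.2) ^ 2) / (2 * a.2 * b.2))

/-- Partial derivative in the `x` direction. -/
def pdx (u : ℝ × ℝ → ℝ) (p : ℝ × ℝ) : ℝ := fderiv ℝ u p (1, 0)

/-- Partial derivative in the `y` direction. -/
def pdy (u : ℝ × ℝ → ℝ) (p : ℝ × ℝ) : ℝ := fderiv ℝ u p (0, 1)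

/-- Squared Euclidean norm of the gradient. -/
def gradSq (u : ℝ × ℝ → ℝ) (p : ℝ × ℝ) : ℝ := pdx u p ^ 2 + pdy u p ^ 2

/-- The hyperbolic Laplacian `Δu = y²(u_xx + u_yy)`. -/
def hypLap (u : ℝ × ℝ → ℝ) (p : ℝ × ℝ) : ℝ :=
  p.2 ^ 2 * (pdx (pdx u) p + pdy (pdy u) p)

/-- Geodesic convexity in the hyperbolic metric. -/
def GeodesicallyConvex (Ω : Set (ℝ × ℝ)) : Prop :=
  ∀ a ∈ Ω, ∀ b ∈ Ω, ∀ c ∈ H2, hypDist a c + hypDist c b = hypDist a b → c ∈ Ω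

/-- `ν` is a Euclidean unit vector, the boundary of `Ω` has a tangent line at `q`
(the line through `q` orthogonal to `ν`), and `ν` points outward from `Ω`. -/
def IsOutwardNormalAt (Ω : Set (ℝ × ℝ)) (q ν : ℝ × ℝ) : Prop :=
  ν.1 ^ 2 + ν.2 ^ 2 = 1 ∧
  Tendsto (fun x : ℝ × ℝ =>
      |(x.1 - q.1) * ν.1 + (x.2 - q.2) * ν.2| /
        Real.sqrt ((x.1 - q.1) ^ 2 + (x.2 - q.2) ^ 2))
    (𝓝[frontier Ω \ {q}] q) (𝓝 0) ∧
  ∀ᶠ t in 𝓝[>] (0 : ℝ), q + t • ν ∉ Ω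

/-- The sum of a power series with real coefficients. -/
def psum (c : ℕ → ℝ) (t : ℝ) : ℝ := ∑' k, c k * t ^ k

/-- Polynomial growth of a coefficient sequence. -/
def PolyGrowth (c : ℕ → ℝ) : Prop := ∃ C : ℝ, ∃ j : ℕ, ∀ k, |c k| ≤ C * ((k : ℝ) + 1) ^ j

/-- Coefficients of the derived power series. -/
def dcoef (c : ℕ → ℝ) (k : ℕ) : ℝ := ((k : ℝ) + 1) * c (k + 1)

lemma PolyGrowth.dcoef {c : ℕ → ℝ} (h : PolyGrowth c) : PolyGrowth (dcoef c) := by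
  obtain ⟨C, j, h⟩ := h
  refine ⟨C * 2 ^ j, j + 1, fun k => ?_⟩
  have h1 := h (k + 1)
  have hC : 0 ≤ C := by simpa using (abs_nonneg _).trans (h 0)
  have hk : (0 : ℝ) ≤ k := k.cast_nonneg
  unfold _root_.dcoef
  rw [abs_mul, abs_of_pos (by positivity : (0 : ℝ) < (k : ℝ) + 1)]
  calc ((k : ℝ) + 1) * |c (k + 1)| ≤ ((k : ℝ) + 1) * (C * (2 * ((k : ℝ) + 1)) ^ j) := by
        refine mul_le_mul_of_nonneg_left (h1.trans ?_) (by positivity)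
        refine mul_le_mul_of_nonneg_left (pow_le_pow_left₀ (by positivity) ?_ _) hC
        push_cast; linarith
    _ = C * 2 ^ j * ((k : ℝ) + 1) ^ (j + 1) := by rw [mul_pow]; ring

lemma PolyGrowth.summable_norm {c : ℕ → ℝ} (h : PolyGrowth c) {t : ℝ} (ht : |t| < 1) :
    Summable fun k => ‖c k * t ^ k‖ := by
  obtain ⟨C, j, h⟩ := h
  have h0 : Summable fun k : ℕ => ((k : ℝ)) ^ j * |t| ^ k := by
    simpa using summable_pow_mul_geometric_of_norm_lt_one (R := ℝ) j (r := |t|) (by simpa using ht)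
  have h0' : Summable fun k : ℕ => C * 2 ^ j * (((k : ℝ)) ^ j * |t| ^ k) := h0.mul_left _
  have hC : 0 ≤ C := by simpa using (abs_nonneg _).trans (h 0)
  refine Summable.of_norm_bounded_eventually_nat h0' ?_
  filter_upwards [eventually_ge_atTop 1] with k hk
  have hk' : (1 : ℝ) ≤ k := by exact_mod_cast hk
  rw [norm_norm, Real.norm_eq_abs, abs_mul, abs_pow]
  calc |c k| * |t| ^ k ≤ (C * (2 * (k : ℝ)) ^ j) * |t| ^ k := by
        refine mul_le_mul_of_nonneg_right ((h k).trans ?_) (by positivity)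
        refine mul_le_mul_of_nonneg_left (pow_le_pow_left₀ (by positivity) ?_ _) hC
        linarith
    _ = _ := by rw [mul_pow]; ring

lemma PolyGrowth.summable {c : ℕ → ℝ} (h : PolyGrowth c) {t : ℝ} (ht : |t| < 1) :
    Summable fun k => c k * t ^ k := (h.summable_norm ht).of_norm

lemma PolyGrowth.hasDerivAt {c : ℕ → ℝ} (h : PolyGrowth c) {t : ℝ} (ht : |t| < 1) :
    HasDerivAt (psum c) (psum (_root_.dcoef c) t) t := by
  obtain ⟨r, hr1, hr2⟩ := exists_between ht
  have hr0 : 0 < r := (abs_nonneg t).trans_lt hr1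
  have hr : |r| < 1 := by rwa [abs_of_pos hr0]
  have hg : Summable fun k : ℕ => ‖_root_.dcoef c k * r ^ k‖ := h.dcoef.summable_norm hr
  have hu : Summable fun k : ℕ => |(k : ℝ) * c k * r ^ (k - 1)| := by
    rw [← summable_nat_add_iff 1]
    refine hg.congr fun k => ?_
    simp [_root_.dcoef]
  have := hasDerivAt_tsum_of_isPreconnected (𝕜 := ℝ) (F := ℝ) (t := Ioo (-r) r)
    (g := fun k t => c k * t ^ k) (g' := fun k t => (k : ℝ) * c k * t ^ (k - 1)) hu isOpen_Ioo
    isPreconnected_Ioo (y₀ := 0) (y := t)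
    (fun n y _ => by
      have := (hasDerivAt_pow n y).const_mul (c n)
      exact this.congr_deriv (by ring))
    (fun n y hy => by
      rw [Real.norm_eq_abs, abs_mul, abs_mul _ (r ^ _), abs_pow, abs_pow, abs_of_pos hr0]
      gcongr
      exact (abs_lt.2 hy).le)
    ⟨by linarith, hr0⟩ (h.summable (by simp)) (abs_lt.1 hr1)
  have e : (∑' k : ℕ, (k : ℝ) * c k * t ^ (k - 1)) = psum (_root_.dcoef c) t := by
    have hs : Summable fun k : ℕ => (k : ℝ) * c k * t ^ (k - 1) := by
      rw [← summable_nat_add_iff 1]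
      refine (h.dcoef.summable ht).congr fun k => ?_
      simp [_root_.dcoef]
    rw [hs.tsum_eq_zero_add]
    simp [psum, _root_.dcoef]
  rw [e] at this
  exact this

lemma PolyGrowth.contDiffOn {c : ℕ → ℝ} (h : PolyGrowth c) :
    ContDiffOn ℝ (⊤ : ℕ∞) (psum c) (Ioo (-1) 1) := by
  rw [contDiffOn_infty]
  intro n
  induction n generalizing c with
  | zero =>
    rw [Nat.cast_zero, contDiffOn_zero]
    exact fun t ht => (h.hasDerivAt (abs_lt.2 ht)).continuousAt.continuousWithinAt
  | succ n ih =>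
    rw [Nat.cast_succ, contDiffOn_succ_iff_deriv_of_isOpen isOpen_Ioo]
    refine ⟨fun t ht => (h.hasDerivAt (abs_lt.2 ht)).differentiableAt.differentiableWithinAt,
      by simp, ?_⟩
    exact (ih h.dcoef).congr fun t ht => (h.hasDerivAt (abs_lt.2 ht)).deriv

/-- State of the recursion for the coefficients of the radial eigenfunction. -/
def radState (μ : ℝ) : ℕ → ℝ × ℝ
  | 0 => (μ, μ)
  | k + 1 =>
    ((radState μ k).1 + ((radState μ k).2 - μ * (radState μ k).1 / ((k : ℝ) + 1) ^ 2),
      (radState μ k).2 - μ * (radState μ k).1 / ((k : ℝ) + 1) ^ 2)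

/-- Coefficients of the radial eigenfunction. -/
def radCoef (μ : ℝ) : ℕ → ℝ
  | 0 => 1
  | k + 1 => -(radState μ k).1 / ((k : ℝ) + 1) ^ 2

lemma radState_pos {μ : ℝ} (h0 : 0 < μ) (h1 : μ ≤ 1 / 8) (k : ℕ) :
    0 < (radState μ k).1 ∧ (radState μ k).1 ≤ 2 * ((k : ℝ) + 1) * (radState μ k).2 := by
  induction k with
  | zero => simp only [radState, Nat.cast_zero]; constructor <;> linarith
  | succ k ih =>
    obtain ⟨hD, hE⟩ := ih
    simp only [radState]
    set D := (radState μ k).1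
    set E := (radState μ k).2
    have hn : (1 : ℝ) ≤ (k : ℝ) + 1 := by linarith [k.cast_nonneg (α := ℝ)]
    push_cast
    set n := (k : ℝ) + 1
    have hn0 : 0 < n := by linarith
    have h2 : D ≤ (2 * n + 1) * (E - μ * D / n ^ 2) := by
      have hE' : D / (2 * n) ≤ E := by rw [div_le_iff₀ (by positivity)]; linarith
      have h3 : (2 * n + 1) * (D / (2 * n) - μ * D / n ^ 2) ≤
          (2 * n + 1) * (E - μ * D / n ^ 2) := by
        apply mul_le_mul_of_nonneg_left _ (by positivity); linarith
      refine le_trans ?_ h3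
      have h4 : (2 * n + 1) * (D / (2 * n) - μ * D / n ^ 2) - D =
          D * (n - 2 * μ * (2 * n + 1)) / (2 * n ^ 2) := by
        field_simp; ring
      have h5 : 0 ≤ D * (n - 2 * μ * (2 * n + 1)) / (2 * n ^ 2) := by
        apply div_nonneg (mul_nonneg hD.le _) (by positivity)
        nlinarith
      linarith
    have h6 : 0 < E - μ * D / n ^ 2 := by
      by_contra h; push Not at h
      nlinarith
    refine ⟨by linarith, ?_⟩
    nlinarith

lemma radCoef_succ_nonpos {μ : ℝ} (h0 : 0 < μ) (h1 : μ ≤ 1 / 8) (k : ℕ) :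
    radCoef μ (k + 1) ≤ 0 := by
  simp only [radCoef]
  exact div_nonpos_of_nonpos_of_nonneg (by linarith [(radState_pos h0 h1 k).1]) (by positivity)

lemma radState_snd (μ : ℝ) (n : ℕ) :
    (radState μ n).2 = μ + μ * ∑ k ∈ Finset.range n, radCoef μ (k + 1) := by
  induction n with
  | zero => simp [radState]
  | succ n ih =>
    rw [Finset.sum_range_succ, mul_add, ← add_assoc, ← ih]
    simp only [radState, radCoef]; ring

lemma radCoef_sum_le {μ : ℝ} (h0 : 0 < μ) (h1 : μ ≤ 1 / 8) (n : ℕ) :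
    ∑ k ∈ Finset.range n, -radCoef μ (k + 1) ≤ 1 := by
  have h := radState_pos h0 h1 n
  have h2 : 0 < (radState μ n).2 := by
    by_contra hh; push Not at hh
    have : 0 ≤ 2 * ((n : ℝ) + 1) := by positivity
    nlinarith [h.1, h.2]
  rw [radState_snd] at h2
  rw [Finset.sum_neg_distrib]
  nlinarith

lemma radCoef_summable {μ : ℝ} (h0 : 0 < μ) (h1 : μ ≤ 1 / 8) :
    Summable fun k => -radCoef μ (k + 1) :=
  summable_of_sum_range_le (fun k => by linarith [radCoef_succ_nonpos h0 h1 k])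
    (radCoef_sum_le h0 h1)

lemma radCoef_polyGrowth {μ : ℝ} (h0 : 0 < μ) (h1 : μ ≤ 1 / 8) : PolyGrowth (radCoef μ) := by
  refine ⟨1, 0, fun k => ?_⟩
  rw [pow_zero, mul_one]
  cases k with
  | zero => simp [radCoef]
  | succ k =>
    rw [abs_of_nonpos (radCoef_succ_nonpos h0 h1 k)]
    refine le_trans ?_ (radCoef_sum_le h0 h1 (k + 1))
    exact Finset.single_le_sum (f := fun k => -radCoef μ (k + 1))
      (fun i _ => by linarith [radCoef_succ_nonpos h0 h1 i]) (Finset.self_mem_range_succ k)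

/-- Existence of a positive decreasing radial solution of the eigenvalue equation in the
variable `t = tanh² (d / 2)`. -/
theorem exists_radial {μ : ℝ} (h0 : 0 < μ) (h1 : μ ≤ 1 / 8) :
    ∃ f : ℝ → ℝ, f 0 = 1 ∧ ContDiffOn ℝ (⊤ : ℕ∞) f (Ioo (-1) 1) ∧
      (∀ t ∈ Ico (0 : ℝ) 1, 0 < f t) ∧ (∀ t ∈ Ico (0 : ℝ) 1, deriv f t ≤ 0) ∧
      ∀ t ∈ Ioo (-1 : ℝ) 1,
        (1 - t) ^ 2 * (t * deriv (deriv f) t + deriv f t) = -μ * f t := by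
  have hg := radCoef_polyGrowth h0 h1
  have hd : ∀ t ∈ Ioo (-1 : ℝ) 1, deriv (psum (radCoef μ)) t = psum (dcoef (radCoef μ)) t :=
    fun t ht => (hg.hasDerivAt (abs_lt.2 ht)).deriv
  refine ⟨psum (radCoef μ), ?_, hg.contDiffOn, ?_, ?_, ?_⟩
  · rw [psum, tsum_eq_single 0]
    · simp [radCoef]
    · intro k hk; simp [hk]
  · intro t ht
    have hs := hg.summable (t := t) (abs_lt.2 ⟨by linarith [ht.1], ht.2⟩)
    rw [psum, hs.tsum_eq_zero_add]
    simp only [radCoef, pow_zero, mul_one]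
    have h2 : ∑' k, -(radCoef μ (k + 1) * t ^ (k + 1)) ≤ ∑' k, t * -radCoef μ (k + 1) := by
      refine Summable.tsum_le_tsum (fun k => ?_) ?_ ((radCoef_summable h0 h1).mul_left t)
      · have h3 : t ^ (k + 1) ≤ t := pow_le_of_le_one ht.1 ht.2.le (by simp)
        nlinarith [radCoef_succ_nonpos h0 h1 k]
      · exact ((summable_nat_add_iff 1).2 hs).neg
    rw [tsum_neg, tsum_mul_left] at h2
    have h4 : ∑' k, -radCoef μ (k + 1) ≤ 1 :=
      (radCoef_summable h0 h1).tsum_le_of_sum_range_le (radCoef_sum_le h0 h1)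
    have h5 : t * ∑' k, -radCoef μ (k + 1) ≤ t := by nlinarith [ht.1]
    have := ht.2
    simp only [radCoef] at h2 h5 ⊢
    linarith
  · intro t ht
    rw [hd t ⟨by linarith [ht.1], ht.2⟩, psum]
    refine tsum_nonpos fun k => ?_
    have := radCoef_succ_nonpos h0 h1 k
    have h3 : 0 ≤ t ^ k := pow_nonneg ht.1 k
    have h4 : (0 : ℝ) ≤ (k : ℝ) + 1 := by positivity
    unfold dcoef
    nlinarith [mul_nonneg h4 h3]
  · intro t ht
    have ht' := abs_lt.2 ht
    have e2 : deriv (deriv (psum (radCoef μ))) t = psum (dcoef (dcoef (radCoef μ))) t := by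
      have : deriv (psum (radCoef μ)) =ᶠ[𝓝 t] psum (dcoef (radCoef μ)) :=
        eventually_of_mem (isOpen_Ioo.mem_nhds ht) hd
      rw [this.deriv_eq]
      exact (hg.dcoef.hasDerivAt ht').deriv
    rw [e2, hd t ht]
    have hsD : Summable fun k => (radState μ k).1 * t ^ k := by
      have := (hg.dcoef.dcoef.summable ht')
      have h3 := (hg.dcoef.summable ht')
      have h4 : Summable fun k : ℕ => t * (dcoef (dcoef (radCoef μ)) k * t ^ k) := this.mul_left t
      have h5 : Summable fun k : ℕ => (k : ℝ) * (dcoef (radCoef μ) k * t ^ k) := by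
        rw [← summable_nat_add_iff 1]
        refine h4.congr fun k => ?_
        simp only [dcoef]; push_cast; ring
      refine (h5.add h3).neg.congr fun k => ?_
      simp only [dcoef, radCoef]
      have : (k : ℝ) + 1 ≠ 0 := by positivity
      field_simp
      ring
    have hS : t * psum (dcoef (dcoef (radCoef μ))) t + psum (dcoef (radCoef μ)) t =
        -∑' k, (radState μ k).1 * t ^ k := by
      have h3 := (hg.dcoef.summable ht')
      have h4 : Summable fun k : ℕ => t * (dcoef (dcoef (radCoef μ)) k * t ^ k) :=
        (hg.dcoef.dcoef.summable ht').mul_left t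
      have h5 : Summable fun k : ℕ => (k : ℝ) * (dcoef (radCoef μ) k * t ^ k) := by
        rw [← summable_nat_add_iff 1]
        refine h4.congr fun k => ?_
        simp only [dcoef]; push_cast; ring
      have e5 : t * psum (dcoef (dcoef (radCoef μ))) t =
          ∑' k : ℕ, (k : ℝ) * (dcoef (radCoef μ) k * t ^ k) := by
        rw [h5.tsum_eq_zero_add, psum, ← tsum_mul_left]
        simp only [Nat.cast_zero, zero_mul, zero_add]
        refine tsum_congr fun k => ?_
        simp only [dcoef]; push_cast; ring
      rw [e5, psum, ← h5.tsum_add h3, ← tsum_neg]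
      refine tsum_congr fun k => ?_
      simp only [dcoef, radCoef]
      have : (k : ℝ) + 1 ≠ 0 := by positivity
      field_simp
      ring
    rw [hS]
    set T := ∑' k, (radState μ k).1 * t ^ k with hT
    have hsD1 := (summable_nat_add_iff 1).2 hsD
    have hsD2 := (summable_nat_add_iff 2).2 hsD
    have T1 : T = μ + ∑' k, (radState μ (k + 1)).1 * t ^ (k + 1) := by
      rw [hT, hsD.tsum_eq_zero_add]; simp [radState]
    have T2 : ∑' k, (radState μ (k + 1)).1 * t ^ (k + 1) =
        (radState μ 1).1 * t + ∑' k, (radState μ (k + 2)).1 * t ^ (k + 2) := by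
      rw [hsD1.tsum_eq_zero_add]; simp
    have hs := hg.summable ht'
    have F1 : psum (radCoef μ) t = 1 + -μ * t + ∑' k, radCoef μ (k + 2) * t ^ (k + 2) := by
      rw [psum, hs.tsum_eq_zero_add, ((summable_nat_add_iff 1).2 hs).tsum_eq_zero_add]
      simp [radCoef, radState, add_assoc]
    have key : ∑' k, (radState μ (k + 2)).1 * t ^ (k + 2)
        - 2 * t * (∑' k, (radState μ (k + 1)).1 * t ^ (k + 1)) + t ^ 2 * T =
        μ * ∑' k, radCoef μ (k + 2) * t ^ (k + 2) := by
      rw [hT, ← tsum_mul_left, ← tsum_mul_left, ← tsum_mul_left,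
        ← hsD2.tsum_sub (hsD1.mul_left _),
        ← (hsD2.sub (hsD1.mul_left _)).tsum_add (hsD.mul_left _)]
      refine tsum_congr fun k => ?_
      simp only [radState, radCoef]
      push_cast
      ring
    have h7 : (radState μ 1).1 = 2 * μ - μ * μ := by simp [radState]; ring
    rw [F1]
    rw [h7] at T2
    linear_combination -key - (1 - 2 * t) * T1 - T2

lemma isOpen_H2 : IsOpen H2 := isOpen_lt continuous_const continuous_snd

lemma fderiv_apply_eq_pd (u : ℝ × ℝ → ℝ) (p v : ℝ × ℝ) :
    fderiv ℝ u p v = v.1 * pdx u p + v.2 * pdy u p := by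
  have : v = v.1 • ((1, 0) : ℝ × ℝ) + v.2 • ((0, 1) : ℝ × ℝ) := by ext <;> simp
  conv_lhs => rw [this, map_add, map_smul, map_smul]
  simp [pdx, pdy]

lemma pdx_congr {u v : ℝ × ℝ → ℝ} {p : ℝ × ℝ} (h : u =ᶠ[𝓝 p] v) : pdx u p = pdx v p := by
  rw [pdx, pdx, h.fderiv_eq]

lemma pdy_congr {u v : ℝ × ℝ → ℝ} {p : ℝ × ℝ} (h : u =ᶠ[𝓝 p] v) : pdy u p = pdy v p := by
  rw [pdy, pdy, h.fderiv_eq]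

lemma pdx_eventuallyEq {u v : ℝ × ℝ → ℝ} {p : ℝ × ℝ} (h : u =ᶠ[𝓝 p] v) :
    pdx u =ᶠ[𝓝 p] pdx v := by
  filter_upwards [h.fderiv (𝕜 := ℝ)] with x hx
  simp [pdx, hx]

lemma pdy_eventuallyEq {u v : ℝ × ℝ → ℝ} {p : ℝ × ℝ} (h : u =ᶠ[𝓝 p] v) :
    pdy u =ᶠ[𝓝 p] pdy v := by
  filter_upwards [h.fderiv (𝕜 := ℝ)] with x hx
  simp [pdy, hx]

section smooth
variable {Ω : Set (ℝ × ℝ)} {u v : ℝ × ℝ → ℝ} {p : ℝ × ℝ}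

lemma ContDiffOn.diffAt (hu : ContDiffOn ℝ (⊤ : ℕ∞) u Ω) (ho : IsOpen Ω) (hp : p ∈ Ω) :
    DifferentiableAt ℝ u p :=
  (hu.contDiffAt (ho.mem_nhds hp)).differentiableAt (by simp)

lemma ContDiffOn.fderiv_smooth (hu : ContDiffOn ℝ (⊤ : ℕ∞) u Ω) (ho : IsOpen Ω) :
    ContDiffOn ℝ (⊤ : ℕ∞) (fderiv ℝ u) Ω :=
  hu.fderiv_of_isOpen ho (by simp)

lemma ContDiffOn.pdx_smooth (hu : ContDiffOn ℝ (⊤ : ℕ∞) u Ω) (ho : IsOpen Ω) :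
    ContDiffOn ℝ (⊤ : ℕ∞) (pdx u) Ω :=
  (hu.fderiv_smooth ho).clm_apply contDiffOn_const

lemma ContDiffOn.pdy_smooth (hu : ContDiffOn ℝ (⊤ : ℕ∞) u Ω) (ho : IsOpen Ω) :
    ContDiffOn ℝ (⊤ : ℕ∞) (pdy u) Ω :=
  (hu.fderiv_smooth ho).clm_apply contDiffOn_const

end smooth

section rules
variable {u v : ℝ × ℝ → ℝ} {p : ℝ × ℝ}

lemma pdx_mul (hu : DifferentiableAt ℝ u p) (hv : DifferentiableAt ℝ v p) :
    pdx (fun x => u x * v x) p = pdx u p * v p + u p * pdx v p := by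
  rw [pdx, fderiv_fun_mul hu hv]; simp [pdx]; ring

lemma pdy_mul (hu : DifferentiableAt ℝ u p) (hv : DifferentiableAt ℝ v p) :
    pdy (fun x => u x * v x) p = pdy u p * v p + u p * pdy v p := by
  rw [pdy, fderiv_fun_mul hu hv]; simp [pdy]; ring

lemma pdx_add (hu : DifferentiableAt ℝ u p) (hv : DifferentiableAt ℝ v p) :
    pdx (fun x => u x + v x) p = pdx u p + pdx v p := by
  rw [pdx, fderiv_fun_add hu hv]; simp [pdx]

lemma pdy_add (hu : DifferentiableAt ℝ u p) (hv : DifferentiableAt ℝ v p) :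
    pdy (fun x => u x + v x) p = pdy u p + pdy v p := by
  rw [pdy, fderiv_fun_add hu hv]; simp [pdy]

lemma pdx_const_mul (c : ℝ) (hu : DifferentiableAt ℝ u p) :
    pdx (fun x => c * u x) p = c * pdx u p := by
  rw [pdx, fderiv_const_mul hu]; simp [pdx]

lemma pdy_const_mul (c : ℝ) (hu : DifferentiableAt ℝ u p) :
    pdy (fun x => c * u x) p = c * pdy u p := by
  rw [pdy, fderiv_const_mul hu]; simp [pdy]

lemma pdx_comp {f : ℝ → ℝ} (hf : DifferentiableAt ℝ f (u p)) (hu : DifferentiableAt ℝ u p) :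
    pdx (fun x => f (u x)) p = deriv f (u p) * pdx u p := by
  have := (hf.hasDerivAt.comp_hasFDerivAt p hu.hasFDerivAt).fderiv
  rw [pdx, show (fun x => f (u x)) = f ∘ u from rfl, this]; simp [pdx]

lemma pdy_comp {f : ℝ → ℝ} (hf : DifferentiableAt ℝ f (u p)) (hu : DifferentiableAt ℝ u p) :
    pdy (fun x => f (u x)) p = deriv f (u p) * pdy u p := by
  have := (hf.hasDerivAt.comp_hasFDerivAt p hu.hasFDerivAt).fderiv
  rw [pdy, show (fun x => f (u x)) = f ∘ u from rfl, this]; simp [pdy]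

lemma pdx_eq_of_hasDerivAt {d : ℝ} (hu : DifferentiableAt ℝ u p)
    (h : HasDerivAt (fun s => u (s, p.2)) d p.1) : pdx u p = d := by
  have h1 : HasDerivAt (fun s : ℝ => (s, p.2)) ((1 : ℝ), (0 : ℝ)) p.1 :=
    (hasDerivAt_id p.1).prodMk (hasDerivAt_const p.1 p.2)
  have h2 := HasFDerivAt.comp_hasDerivAt (x := p.1) (f := fun s : ℝ => (s, p.2))
    (l := u) (l' := fderiv ℝ u p) hu.hasFDerivAt h1
  exact h2.unique h

lemma pdy_eq_of_hasDerivAt {d : ℝ} (hu : DifferentiableAt ℝ u p)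
    (h : HasDerivAt (fun s => u (p.1, s)) d p.2) : pdy u p = d := by
  have h1 : HasDerivAt (fun s : ℝ => (p.1, s)) ((0 : ℝ), (1 : ℝ)) p.2 :=
    (hasDerivAt_const p.2 p.1).prodMk (hasDerivAt_id p.2)
  have h2 := HasFDerivAt.comp_hasDerivAt (x := p.2) (f := fun s : ℝ => (p.1, s))
    (l := u) (l' := fderiv ℝ u p) hu.hasFDerivAt h1
  exact h2.unique h

end rules

/-- The Laplacian of a linear combination. -/
lemma hypLap_add_const_mul {Ω : Set (ℝ × ℝ)} {u v : ℝ × ℝ → ℝ} {p : ℝ × ℝ} (c : ℝ)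
    (ho : IsOpen Ω) (hu : ContDiffOn ℝ (⊤ : ℕ∞) u Ω) (hv : ContDiffOn ℝ (⊤ : ℕ∞) v Ω)
    (hp : p ∈ Ω) : hypLap (fun x => u x + c * v x) p = hypLap u p + c * hypLap v p := by
  have hx : pdx (fun x => u x + c * v x) =ᶠ[𝓝 p] fun x => pdx u x + c * pdx v x := by
    filter_upwards [ho.mem_nhds hp] with q hq
    rw [pdx_add (hu.diffAt ho hq) ((hv.diffAt ho hq).const_mul c),
      pdx_const_mul c (hv.diffAt ho hq)]
  have hy : pdy (fun x => u x + c * v x) =ᶠ[𝓝 p] fun x => pdy u x + c * pdy v x := by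
    filter_upwards [ho.mem_nhds hp] with q hq
    rw [pdy_add (hu.diffAt ho hq) ((hv.diffAt ho hq).const_mul c),
      pdy_const_mul c (hv.diffAt ho hq)]
  have dux := (hu.pdx_smooth ho).diffAt ho hp
  have dvx := (hv.pdx_smooth ho).diffAt ho hp
  have duy := (hu.pdy_smooth ho).diffAt ho hp
  have dvy := (hv.pdy_smooth ho).diffAt ho hp
  rw [hypLap, pdx_congr hx, pdy_congr hy, pdx_add dux (dvx.const_mul c), pdx_const_mul c dvx,
    pdy_add duy (dvy.const_mul c), pdy_const_mul c dvy, hypLap, hypLap]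
  ring

lemma hasDerivAt_sub_sq (a x : ℝ) : HasDerivAt (fun s : ℝ => (s - a) ^ 2) (2 * (x - a)) x := by
  refine (((hasDerivAt_id x).sub_const a).fun_pow 2).congr_deriv ?_
  simp

lemma hasDerivAt_add_sq (a x : ℝ) : HasDerivAt (fun s : ℝ => (s + a) ^ 2) (2 * (x + a)) x := by
  refine (((hasDerivAt_id x).add_const a).fun_pow 2).congr_deriv ?_
  simp

/-- `tanh² (d / 2)` where `d` is the hyperbolic distance to `(a, b)`. -/
def tfun (a b : ℝ) (p : ℝ × ℝ) : ℝ :=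
  ((p.1 - a) ^ 2 + (p.2 - b) ^ 2) / ((p.1 - a) ^ 2 + (p.2 + b) ^ 2)

section tfun
variable {a b : ℝ} {p : ℝ × ℝ}

lemma tfun_den_pos (hb : 0 < b) (hp : p ∈ H2) : 0 < (p.1 - a) ^ 2 + (p.2 + b) ^ 2 := by
  have : 0 < p.2 := hp
  positivity

lemma one_sub_tfun (hb : 0 < b) (hp : p ∈ H2) :
    1 - tfun a b p = 4 * b * p.2 / ((p.1 - a) ^ 2 + (p.2 + b) ^ 2) := by
  have := (tfun_den_pos (a := a) hb hp).ne'
  rw [tfun]; field_simp; ring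

lemma tfun_mem (hb : 0 < b) (hp : p ∈ H2) : tfun a b p ∈ Ico (0 : ℝ) 1 := by
  have h := tfun_den_pos (a := a) hb hp
  have hp' : 0 < p.2 := hp
  refine ⟨div_nonneg (by positivity) h.le, ?_⟩
  have h1 := one_sub_tfun (a := a) hb hp
  have : 0 < 4 * b * p.2 / ((p.1 - a) ^ 2 + (p.2 + b) ^ 2) := by positivity
  linarith

lemma tfun_self (a b : ℝ) : tfun a b (a, b) = 0 := by simp [tfun]

lemma tfun_smooth (hb : 0 < b) : ContDiffOn ℝ (⊤ : ℕ∞) (tfun a b) H2 := by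
  unfold tfun
  refine ContDiffOn.div (by fun_prop) (by fun_prop) fun p hp => (tfun_den_pos hb hp).ne'

lemma pdx_tfun (hb : 0 < b) (hp : p ∈ H2) :
    pdx (tfun a b) p = 8 * b * (p.1 - a) * p.2 / ((p.1 - a) ^ 2 + (p.2 + b) ^ 2) ^ 2 := by
  have hM := (tfun_den_pos (a := a) hb hp).ne'
  apply pdx_eq_of_hasDerivAt ((tfun_smooth hb).diffAt isOpen_H2 hp)
  have h1 : HasDerivAt (fun s : ℝ => (s - a) ^ 2) (2 * (p.1 - a)) p.1 := hasDerivAt_sub_sq a p.1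
  have := (h1.add_const ((p.2 - b) ^ 2)).div (h1.add_const ((p.2 + b) ^ 2)) hM
  refine this.congr_deriv ?_
  field_simp; ring

lemma pdy_tfun (hb : 0 < b) (hp : p ∈ H2) :
    pdy (tfun a b) p = 4 * b * (p.2 ^ 2 - b ^ 2 - (p.1 - a) ^ 2) /
      ((p.1 - a) ^ 2 + (p.2 + b) ^ 2) ^ 2 := by
  have hM := (tfun_den_pos (a := a) hb hp).ne'
  apply pdy_eq_of_hasDerivAt ((tfun_smooth hb).diffAt isOpen_H2 hp)
  have h1 : HasDerivAt (fun s : ℝ => (s - b) ^ 2) (2 * (p.2 - b)) p.2 := hasDerivAt_sub_sq b p.2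
  have h2 : HasDerivAt (fun s : ℝ => (s + b) ^ 2) (2 * (p.2 + b)) p.2 := hasDerivAt_add_sq b p.2
  have := (h1.const_add ((p.1 - a) ^ 2)).div (h2.const_add ((p.1 - a) ^ 2)) hM
  refine this.congr_deriv ?_
  field_simp; ring

lemma gradSq_tfun (hb : 0 < b) (hp : p ∈ H2) :
    p.2 ^ 2 * gradSq (tfun a b) p = tfun a b p * (1 - tfun a b p) ^ 2 := by
  have hM := (tfun_den_pos (a := a) hb hp).ne'
  rw [gradSq, pdx_tfun hb hp, pdy_tfun hb hp, one_sub_tfun hb hp, tfun]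
  field_simp; ring

lemma hypLap_tfun (hb : 0 < b) (hp : p ∈ H2) :
    hypLap (tfun a b) p = (1 - tfun a b p) ^ 2 := by
  have hM := (tfun_den_pos (a := a) hb hp).ne'
  have sx := ((tfun_smooth (a := a) hb).pdx_smooth isOpen_H2).diffAt isOpen_H2 hp
  have sy := ((tfun_smooth (a := a) hb).pdy_smooth isOpen_H2).diffAt isOpen_H2 hp
  have dx : pdx (pdx (tfun a b)) p = 8 * b * p.2 * ((p.1 - a) ^ 2 + (p.2 + b) ^ 2
      - 4 * (p.1 - a) ^ 2) / ((p.1 - a) ^ 2 + (p.2 + b) ^ 2) ^ 3 := by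
    apply pdx_eq_of_hasDerivAt sx
    have h1 : HasDerivAt (fun s : ℝ => (s - a) ^ 2) (2 * (p.1 - a)) p.1 := hasDerivAt_sub_sq a p.1
    have h2 : HasDerivAt (fun s : ℝ => 8 * b * (s - a) * p.2) (8 * b * 1 * p.2) p.1 :=
      (((hasDerivAt_id p.1).sub_const a).const_mul _).mul_const _
    have := h2.div ((h1.add_const ((p.2 + b) ^ 2)).fun_pow 2) (pow_ne_zero 2 hM)
    refine (this.congr_deriv ?_).congr_of_eventuallyEq ?_
    · field_simp; ring
    · exact Eventually.of_forall fun s => by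
        simpa using pdx_tfun (a := a) (p := (s, p.2)) hb hp
  have dy : pdy (pdy (tfun a b)) p = (8 * b * p.2 * ((p.1 - a) ^ 2 + (p.2 + b) ^ 2)
      - 16 * b * (p.2 ^ 2 - b ^ 2 - (p.1 - a) ^ 2) * (p.2 + b)) /
        ((p.1 - a) ^ 2 + (p.2 + b) ^ 2) ^ 3 := by
    apply pdy_eq_of_hasDerivAt sy
    have h1 : HasDerivAt (fun s : ℝ => s ^ 2) (2 * p.2) p.2 := by
      simpa using hasDerivAt_pow 2 p.2
    have h2 : HasDerivAt (fun s : ℝ => (s + b) ^ 2) (2 * (p.2 + b)) p.2 := hasDerivAt_add_sq b p.2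
    have := (((h1.sub_const (b ^ 2)).sub_const ((p.1 - a) ^ 2)).const_mul (4 * b)).div
      ((h2.const_add ((p.1 - a) ^ 2)).fun_pow 2) (pow_ne_zero 2 hM)
    refine (this.congr_deriv ?_).congr_of_eventuallyEq ?_
    · field_simp; ring
    · filter_upwards [isOpen_Ioi.mem_nhds (show p.2 ∈ Ioi (0 : ℝ) from hp)] with s hs
      simpa using pdy_tfun (a := a) (p := (p.1, s)) hb hs
  rw [hypLap, dx, dy, one_sub_tfun hb hp]
  field_simp; ring

end tfun

/-- The Laplacian of a function of `tfun`. -/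
lemma hypLap_comp_tfun {a b : ℝ} (hb : 0 < b) {f : ℝ → ℝ}
    (hf : ContDiffOn ℝ (⊤ : ℕ∞) f (Ioo (-1) 1)) {p : ℝ × ℝ} (hp : p ∈ H2) :
    hypLap (fun x => f (tfun a b x)) p = (1 - tfun a b p) ^ 2 *
      (tfun a b p * deriv (deriv f) (tfun a b p) + deriv f (tfun a b p)) := by
  have hmem : ∀ q ∈ H2, tfun a b q ∈ Ioo (-1 : ℝ) 1 := fun q hq =>
    ⟨by linarith [(tfun_mem (a := a) hb hq).1], (tfun_mem hb hq).2⟩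
  have hf' : ContDiffOn ℝ (⊤ : ℕ∞) (deriv f) (Ioo (-1) 1) :=
    hf.deriv_of_isOpen isOpen_Ioo (by simp)
  have df : ∀ q ∈ H2, DifferentiableAt ℝ f (tfun a b q) := fun q hq =>
    (hf.contDiffAt (isOpen_Ioo.mem_nhds (hmem q hq))).differentiableAt (by simp)
  have df' : ∀ q ∈ H2, DifferentiableAt ℝ (deriv f) (tfun a b q) := fun q hq =>
    (hf'.contDiffAt (isOpen_Ioo.mem_nhds (hmem q hq))).differentiableAt (by simp)
  have st := tfun_smooth (a := a) hb
  have dt : ∀ q ∈ H2, DifferentiableAt ℝ (tfun a b) q := fun q hq => st.diffAt isOpen_H2 hq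
  have hx : pdx (fun x => f (tfun a b x)) =ᶠ[𝓝 p]
      fun x => deriv f (tfun a b x) * pdx (tfun a b) x := by
    filter_upwards [isOpen_H2.mem_nhds hp] with q hq
    exact pdx_comp (df q hq) (dt q hq)
  have hy : pdy (fun x => f (tfun a b x)) =ᶠ[𝓝 p]
      fun x => deriv f (tfun a b x) * pdy (tfun a b) x := by
    filter_upwards [isOpen_H2.mem_nhds hp] with q hq
    exact pdy_comp (df q hq) (dt q hq)
  have dc : DifferentiableAt ℝ (fun x => deriv f (tfun a b x)) p :=
    (df' p hp).comp p (dt p hp)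
  rw [hypLap, pdx_congr hx, pdy_congr hy,
    pdx_mul dc ((st.pdx_smooth isOpen_H2).diffAt isOpen_H2 hp),
    pdy_mul dc ((st.pdy_smooth isOpen_H2).diffAt isOpen_H2 hp),
    pdx_comp (df' p hp) (dt p hp), pdy_comp (df' p hp) (dt p hp)]
  have e1 := gradSq_tfun (a := a) hb hp
  have e2 := hypLap_tfun (a := a) hb hp
  rw [gradSq] at e1
  rw [hypLap] at e2
  linear_combination deriv (deriv f) (tfun a b p) * e1 + deriv f (tfun a b p) * e2

/-- Common denominator of the polar chart. -/
def polD (s : ℝ × ℝ) : ℝ := 1 - 2 * s.1 * Real.cos s.2 + s.1 ^ 2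

/-- First auxiliary function for the derivatives of the polar chart. -/
def polA (s : ℝ × ℝ) : ℝ := (1 - s.1 ^ 2) * Real.sin s.2 / polD s ^ 2

/-- Second auxiliary function for the derivatives of the polar chart. -/
def polB (s : ℝ × ℝ) : ℝ := (Real.cos s.2 * (1 + s.1 ^ 2) - 2 * s.1) / polD s ^ 2

/-- First coordinate of the conformal polar chart centred at `q`. -/
def polX (q s : ℝ × ℝ) : ℝ := q.1 - 2 * q.2 * (s.1 * Real.sin s.2) / polD s

/-- Second coordinate of the conformal polar chart centred at `q`. -/
def polY (q s : ℝ × ℝ) : ℝ := q.2 * (1 - s.1 ^ 2) / polD s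

/-- The conformal polar chart centred at `q`. -/
def pol (q s : ℝ × ℝ) : ℝ × ℝ := (polX q s, polY q s)

/-- The domain of the polar chart. -/
def polDom : Set (ℝ × ℝ) := {s | |s.1| < 1}

lemma isOpen_polDom : IsOpen polDom := isOpen_lt (by fun_prop) continuous_const

lemma polD_pos {s : ℝ × ℝ} (hs : s ∈ polDom) : 0 < polD s := by
  have h : |s.1| < 1 := hs
  have h1 : 2 * s.1 * Real.cos s.2 ≤ 2 * |s.1| := by
    have := abs_mul (s.1) (Real.cos s.2)
    have h2 := le_abs_self (s.1 * Real.cos s.2)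
    have h3 := Real.abs_cos_le_one s.2
    nlinarith [abs_nonneg s.1]
  have : s.1 ^ 2 = |s.1| ^ 2 := (sq_abs _).symm
  unfold polD
  rw [this]
  nlinarith

lemma polD_smooth : ContDiff ℝ (⊤ : ℕ∞) polD := by
  unfold polD
  have : ContDiff ℝ (⊤ : ℕ∞) fun s : ℝ × ℝ => Real.cos s.2 := Real.contDiff_cos.comp contDiff_snd
  fun_prop

lemma polX_smooth (q : ℝ × ℝ) : ContDiffOn ℝ (⊤ : ℕ∞) (polX q) polDom := by
  have : ContDiff ℝ (⊤ : ℕ∞) fun s : ℝ × ℝ => Real.sin s.2 := Real.contDiff_sin.comp contDiff_snd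
  unfold polX
  exact contDiffOn_const.sub (ContDiffOn.div (by fun_prop) polD_smooth.contDiffOn
    fun s hs => (polD_pos hs).ne')

lemma polY_smooth (q : ℝ × ℝ) : ContDiffOn ℝ (⊤ : ℕ∞) (polY q) polDom := by
  unfold polY
  exact ContDiffOn.div (by fun_prop) polD_smooth.contDiffOn fun s hs => (polD_pos hs).ne'

lemma polA_smooth : ContDiffOn ℝ (⊤ : ℕ∞) polA polDom := by
  have : ContDiff ℝ (⊤ : ℕ∞) fun s : ℝ × ℝ => Real.sin s.2 := Real.contDiff_sin.comp contDiff_snd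
  unfold polA
  exact ContDiffOn.div (by fun_prop) (polD_smooth.pow 2).contDiffOn
    fun s hs => (pow_pos (polD_pos hs) 2).ne'

lemma polB_smooth : ContDiffOn ℝ (⊤ : ℕ∞) polB polDom := by
  have : ContDiff ℝ (⊤ : ℕ∞) fun s : ℝ × ℝ => Real.cos s.2 := Real.contDiff_cos.comp contDiff_snd
  unfold polB
  exact ContDiffOn.div (by fun_prop) (polD_smooth.pow 2).contDiffOn
    fun s hs => (pow_pos (polD_pos hs) 2).ne'

lemma pol_smooth (q : ℝ × ℝ) : ContDiffOn ℝ (⊤ : ℕ∞) (pol q) polDom :=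
  (polX_smooth q).prodMk (polY_smooth q)

lemma pol_mem_H2 {q s : ℝ × ℝ} (hq : q ∈ H2) (hs : s ∈ polDom) : pol q s ∈ H2 := by
  have h : |s.1| < 1 := hs
  have h2 : 0 < 1 - s.1 ^ 2 := by
    have := (sq_lt_one_iff_abs_lt_one s.1).2 h; linarith
  have h3 : 0 < q.2 := hq
  have := polD_pos hs
  change 0 < polY q s
  unfold polY
  positivity

lemma pol_zero (q : ℝ × ℝ) (θ : ℝ) : pol q (0, θ) = q := by
  simp [pol, polX, polY, polD]

section derivs
variable {s : ℝ × ℝ}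

lemma hasDerivAt_polD_fst (s : ℝ × ℝ) :
    HasDerivAt (fun r => polD (r, s.2)) (2 * s.1 - 2 * Real.cos s.2) s.1 := by
  have h1 : HasDerivAt (fun r : ℝ => r ^ 2) (2 * s.1) s.1 := by simpa using hasDerivAt_pow 2 s.1
  have := ((((hasDerivAt_id s.1).const_mul 2).mul_const (Real.cos s.2)).const_sub 1).add h1
  refine this.congr_deriv ?_
  ring

lemma hasDerivAt_polD_snd (s : ℝ × ℝ) :
    HasDerivAt (fun t => polD (s.1, t)) (2 * s.1 * Real.sin s.2) s.2 := by
  have := (((Real.hasDerivAt_cos s.2).const_mul (2 * s.1)).const_sub 1).add_const (s.1 ^ 2)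
  refine this.congr_deriv ?_
  ring

lemma pdx_polX (q : ℝ × ℝ) (hs : s ∈ polDom) : pdx (polX q) s = -2 * q.2 * polA s := by
  have hD := (polD_pos hs).ne'
  apply pdx_eq_of_hasDerivAt ((polX_smooth q).diffAt isOpen_polDom hs)
  have := ((((hasDerivAt_id s.1).mul_const (Real.sin s.2)).const_mul (2 * q.2)).div
    (hasDerivAt_polD_fst s) hD).const_sub q.1
  refine this.congr_deriv ?_
  simp only [polA, id]
  field_simp
  simp only [polD]; ring

lemma pdy_polX (q : ℝ × ℝ) (hs : s ∈ polDom) : pdy (polX q) s = -2 * q.2 * s.1 * polB s := by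
  have hD := (polD_pos hs).ne'
  apply pdy_eq_of_hasDerivAt ((polX_smooth q).diffAt isOpen_polDom hs)
  have := ((((Real.hasDerivAt_sin s.2).const_mul s.1).const_mul (2 * q.2)).div
    (hasDerivAt_polD_snd s) hD).const_sub q.1
  refine this.congr_deriv ?_
  simp only [polB]
  field_simp
  simp only [polD]
  linear_combination (2 * s.1 ^ 2 * q.2) * Real.sin_sq_add_cos_sq s.2

lemma pdx_polY (q : ℝ × ℝ) (hs : s ∈ polDom) : pdx (polY q) s = 2 * q.2 * polB s := by
  have hD := (polD_pos hs).ne'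
  apply pdx_eq_of_hasDerivAt ((polY_smooth q).diffAt isOpen_polDom hs)
  have h1 : HasDerivAt (fun r : ℝ => r ^ 2) (2 * s.1) s.1 := by simpa using hasDerivAt_pow 2 s.1
  have := ((h1.const_sub 1).const_mul q.2).div (hasDerivAt_polD_fst s) hD
  refine this.congr_deriv ?_
  simp only [polB]
  field_simp
  simp only [polD]; ring

lemma pdy_polY (q : ℝ × ℝ) (hs : s ∈ polDom) : pdy (polY q) s = -2 * q.2 * s.1 * polA s := by
  have hD := (polD_pos hs).ne'
  apply pdy_eq_of_hasDerivAt ((polY_smooth q).diffAt isOpen_polDom hs)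
  have := (hasDerivAt_const s.2 (q.2 * (1 - s.1 ^ 2))).div (hasDerivAt_polD_snd s) hD
  refine this.congr_deriv ?_
  simp only [polA]
  field_simp
  ring

lemma polA_polB_fst (hs : s ∈ polDom) : polA s + s.1 * pdx polA s + pdy polB s = 0 := by
  have hD := (polD_pos hs).ne'
  have h1 : HasDerivAt (fun r : ℝ => r ^ 2) (2 * s.1) s.1 := by simpa using hasDerivAt_pow 2 s.1
  have dA := pdx_eq_of_hasDerivAt (polA_smooth.diffAt isOpen_polDom hs)
    (((h1.const_sub 1).mul_const (Real.sin s.2)).div ((hasDerivAt_polD_fst s).fun_pow 2)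
      (pow_ne_zero 2 hD))
  have dB := pdy_eq_of_hasDerivAt (polB_smooth.diffAt isOpen_polDom hs)
    ((((Real.hasDerivAt_cos s.2).mul_const (1 + s.1 ^ 2)).sub_const (2 * s.1)).div
      ((hasDerivAt_polD_snd s).fun_pow 2) (pow_ne_zero 2 hD))
  rw [dA, dB, polA]
  field_simp
  simp only [polD]
  ring

lemma polA_polB_snd (hs : s ∈ polDom) : polB s + s.1 * pdx polB s - pdy polA s = 0 := by
  have hD := (polD_pos hs).ne'
  have h1 : HasDerivAt (fun r : ℝ => r ^ 2) (2 * s.1) s.1 := by simpa using hasDerivAt_pow 2 s.1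
  have dB := pdx_eq_of_hasDerivAt (polB_smooth.diffAt isOpen_polDom hs)
    ((((h1.const_add 1).const_mul (Real.cos s.2)).sub ((hasDerivAt_id s.1).const_mul 2)).div
      ((hasDerivAt_polD_fst s).fun_pow 2) (pow_ne_zero 2 hD))
  have dA := pdy_eq_of_hasDerivAt (polA_smooth.diffAt isOpen_polDom hs)
    (((Real.hasDerivAt_sin s.2).const_mul (1 - s.1 ^ 2)).div
      ((hasDerivAt_polD_snd s).fun_pow 2) (pow_ne_zero 2 hD))
  rw [dA, dB, polB]
  simp only [Nat.cast_ofNat, Nat.reduceSub, pow_one, id, mul_one, Pi.sub_apply]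
  field_simp
  simp only [polD]
  have := Real.sin_sq s.2
  ring_nf
  simp only [this]
  ring

lemma polA_sq_add_polB_sq (hs : s ∈ polDom) : (polA s ^ 2 + polB s ^ 2) * polD s ^ 2 = 1 := by
  have hD := (polD_pos hs).ne'
  rw [polA, polB]
  field_simp
  simp only [polD]
  linear_combination ((1 - s.1 ^ 2) ^ 2) * Real.sin_sq_add_cos_sq s.2

end derivs

section pullback
variable {Ω : Set (ℝ × ℝ)} {v : ℝ × ℝ → ℝ} {q s : ℝ × ℝ}

lemma pdx_comp_pol (hv : DifferentiableAt ℝ v (pol q s)) (hs : s ∈ polDom) :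
    pdx (fun t => v (pol q t)) s =
      pdx v (pol q s) * (-2 * q.2 * polA s) + pdy v (pol q s) * (2 * q.2 * polB s) := by
  have hX := (polX_smooth q).diffAt isOpen_polDom hs
  have hY := (polY_smooth q).diffAt isOpen_polDom hs
  have := (hv.hasFDerivAt.comp s (hX.hasFDerivAt.prodMk hY.hasFDerivAt)).fderiv
  rw [pdx, show (fun t => v (pol q t)) = v ∘ pol q from rfl, this]
  rw [ContinuousLinearMap.comp_apply, ContinuousLinearMap.prod_apply]
  rw [show ((fderiv ℝ (polX q) s) (1, 0), (fderiv ℝ (polY q) s) (1, 0)) =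
    (pdx (polX q) s, pdx (polY q) s) from rfl, pdx_polX q hs, pdx_polY q hs]
  rw [fderiv_apply_eq_pd]
  ring

lemma pdy_comp_pol (hv : DifferentiableAt ℝ v (pol q s)) (hs : s ∈ polDom) :
    pdy (fun t => v (pol q t)) s =
      pdx v (pol q s) * (-2 * q.2 * (s.1 * polB s)) +
        pdy v (pol q s) * (-2 * q.2 * (s.1 * polA s)) := by
  have hX := (polX_smooth q).diffAt isOpen_polDom hs
  have hY := (polY_smooth q).diffAt isOpen_polDom hs
  have := (hv.hasFDerivAt.comp s (hX.hasFDerivAt.prodMk hY.hasFDerivAt)).fderiv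
  rw [pdy, show (fun t => v (pol q t)) = v ∘ pol q from rfl, this]
  rw [ContinuousLinearMap.comp_apply, ContinuousLinearMap.prod_apply]
  rw [show ((fderiv ℝ (polX q) s) (0, 1), (fderiv ℝ (polY q) s) (0, 1)) =
    (pdy (polX q) s, pdy (polY q) s) from rfl, pdy_polX q hs, pdy_polY q hs]
  rw [fderiv_apply_eq_pd]
  ring

/-- The hyperbolic Laplacian in the conformal polar chart. -/
lemma polar_laplacian (ho : IsOpen Ω) (hv : ContDiffOn ℝ (⊤ : ℕ∞) v Ω)
    (hs : s ∈ polDom) (hm : pol q s ∈ Ω) :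
    s.1 ^ 2 * pdx (pdx fun t => v (pol q t)) s + s.1 * pdx (fun t => v (pol q t)) s +
      pdy (pdy fun t => v (pol q t)) s =
        4 * s.1 ^ 2 / (1 - s.1 ^ 2) ^ 2 * hypLap v (pol q s) := by
  have hcont : ContinuousAt (pol q) s :=
    ((pol_smooth q).contDiffAt (isOpen_polDom.mem_nhds hs)).continuousAt
  have hev : ∀ᶠ t in 𝓝 s, t ∈ polDom ∧ pol q t ∈ Ω :=
    (show ∀ᶠ t in 𝓝 s, t ∈ polDom from isOpen_polDom.mem_nhds hs).and
      (hcont.eventually (ho.mem_nhds hm))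
  have ex : pdx (fun t => v (pol q t)) =ᶠ[𝓝 s] fun t => pdx v (pol q t) * (-2 * q.2 * polA t)
      + pdy v (pol q t) * (2 * q.2 * polB t) := by
    filter_upwards [hev] with t ht
    exact pdx_comp_pol (hv.diffAt ho ht.2) ht.1
  have ey : pdy (fun t => v (pol q t)) =ᶠ[𝓝 s] fun t =>
      pdx v (pol q t) * (-2 * q.2 * (t.1 * polB t)) +
        pdy v (pol q t) * (-2 * q.2 * (t.1 * polA t)) := by
    filter_upwards [hev] with t ht
    exact pdy_comp_pol (hv.diffAt ho ht.2) ht.1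
  have dpol : DifferentiableAt ℝ (pol q) s :=
    ((pol_smooth q).contDiffAt (isOpen_polDom.mem_nhds hs)).differentiableAt (by simp)
  have dvx := (hv.pdx_smooth ho).diffAt ho hm
  have dvy := (hv.pdy_smooth ho).diffAt ho hm
  have dvx' : DifferentiableAt ℝ (fun t => pdx v (pol q t)) s := dvx.comp s dpol
  have dvy' : DifferentiableAt ℝ (fun t => pdy v (pol q t)) s := dvy.comp s dpol
  have dA := polA_smooth.diffAt isOpen_polDom hs
  have dB := polB_smooth.diffAt isOpen_polDom hs
  have d1 : DifferentiableAt ℝ (fun t : ℝ × ℝ => t.1) s := differentiableAt_fst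
  have e1 : pdy (fun t : ℝ × ℝ => t.1) s = 0 := by
    simp [pdy, fderiv_fst]
  have dA1 := d1.fun_mul dA
  have dB1 := d1.fun_mul dB
  rw [pdx_congr ex, pdy_congr ey, ex.self_of_nhds]
  rw [pdx_add (dvx'.fun_mul (dA.const_mul _)) (dvy'.fun_mul (dB.const_mul _)),
    pdx_mul dvx' (dA.const_mul _), pdx_mul dvy' (dB.const_mul _), pdx_const_mul _ dA,
    pdx_const_mul _ dB, pdx_comp_pol dvx hs, pdx_comp_pol dvy hs,
    pdy_add (dvx'.fun_mul (dB1.const_mul _)) (dvy'.fun_mul (dA1.const_mul _)),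
    pdy_mul dvx' (dB1.const_mul _), pdy_mul dvy' (dA1.const_mul _), pdy_const_mul _ dA1,
    pdy_const_mul _ dB1, pdy_mul d1 dA, pdy_mul d1 dB, e1, pdy_comp_pol dvx hs,
    pdy_comp_pol dvy hs, hypLap]
  have k1 := polA_polB_fst hs
  have k2 := polA_polB_snd hs
  have k3 : 4 * s.1 ^ 2 / (1 - s.1 ^ 2) ^ 2 * (pol q s).2 ^ 2 =
      4 * q.2 ^ 2 * s.1 ^ 2 * (polA s ^ 2 + polB s ^ 2) := by
    have h : |s.1| < 1 := hs
    have h2 : 1 - s.1 ^ 2 ≠ 0 := by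
      have := (sq_lt_one_iff_abs_lt_one s.1).2 h; linarith
    have hD := (polD_pos hs).ne'
    have := polA_sq_add_polB_sq hs
    have h3 : polA s ^ 2 + polB s ^ 2 = 1 / polD s ^ 2 := by field_simp; linarith
    rw [h3]
    simp only [pol, polY]
    field_simp
  linear_combination (-2 * q.2 * s.1 * pdx v (pol q s)) * k1
    + (2 * q.2 * s.1 * pdy v (pol q s)) * k2
    - (pdx (pdx v) (pol q s) + pdy (pdy v) (pol q s)) * k3

end pullback

section param
variable {X : Type} [NormedAddCommGroup X] [NormedSpace ℝ X] [ProperSpace X]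

lemma hasFDerivAt_param_integral {E : Type} [NormedAddCommGroup E] [NormedSpace ℝ E]
    {f : X × ℝ → E} (hf : ContDiff ℝ 1 f) (a b : ℝ) (x : X) :
    HasFDerivAt (fun x => ∫ τ in a..b, f (x, τ))
      (∫ τ in a..b, (fderiv ℝ f (x, τ)).comp (ContinuousLinearMap.inl ℝ X ℝ)) x := by
  have hc : Continuous f := hf.continuous
  have hc' : Continuous (fderiv ℝ f) := hf.continuous_fderiv (by simp)
  have hc2 : Continuous fun p : X × ℝ =>
      (fderiv ℝ f p).comp (ContinuousLinearMap.inl ℝ X ℝ) :=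
    hc'.clm_comp continuous_const
  obtain ⟨C, hC⟩ := ((isCompact_closedBall x 1).prod
    (isCompact_uIcc (a := a) (b := b))).exists_bound_of_continuousOn hc2.continuousOn
  refine intervalIntegral.hasFDerivAt_integral_of_dominated_of_fderiv_le (𝕜 := ℝ)
    (F := fun x τ => f (x, τ))
    (F' := fun x τ => (fderiv ℝ f (x, τ)).comp (ContinuousLinearMap.inl ℝ X ℝ)) (bound := fun _ => C)
    (s := Metric.ball x 1) (Metric.ball_mem_nhds x one_pos) ?_ ?_ ?_ ?_ ?_ ?_
  · exact Eventually.of_forall fun y =>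
      (hc.comp (Continuous.prodMk_right y)).aestronglyMeasurable
  · exact (hc.comp (Continuous.prodMk_right x)).intervalIntegrable _ _
  · exact (hc2.comp (Continuous.prodMk_right x)).aestronglyMeasurable
  · refine Eventually.of_forall fun τ hτ y hy => ?_
    exact hC (y, τ) ⟨Metric.ball_subset_closedBall hy, uIoc_subset_uIcc hτ⟩
  · exact intervalIntegrable_const
  · refine Eventually.of_forall fun τ _ y _ => ?_
    exact ((hf.differentiable one_ne_zero) (y, τ)).hasFDerivAt.comp y (hasFDerivAt_prodMk_left y τ)

lemma contDiff_param_integral_nat (a b : ℝ) (n : ℕ) :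
    ∀ {E : Type} [NormedAddCommGroup E] [NormedSpace ℝ E] {f : X × ℝ → E},
      ContDiff ℝ (⊤ : ℕ∞) f → ContDiff ℝ n (fun x => ∫ τ in a..b, f (x, τ)) := by
  induction n with
  | zero =>
    intro E _ _ f hf
    rw [Nat.cast_zero, contDiff_zero]
    exact intervalIntegral.continuous_parametric_intervalIntegral_of_continuous'
      (f := fun x τ => f (x, τ)) hf.continuous a b
  | succ n ih =>
    intro E _ _ f hf
    have h := hasFDerivAt_param_integral (hf.of_le (by simp)) a b
    rw [Nat.cast_add, Nat.cast_one, contDiff_succ_iff_fderiv]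
    refine ⟨fun x => (h x).differentiableAt, by simp, ?_⟩
    rw [show fderiv ℝ (fun x => ∫ τ in a..b, f (x, τ)) = _ from funext fun x => (h x).fderiv]
    exact ih (f := fun p => (fderiv ℝ f p).comp (ContinuousLinearMap.inl ℝ X ℝ))
      ((hf.fderiv_right (m := (⊤ : ℕ∞)) (by simp)).clm_comp contDiff_const)

/-- Smoothness of parametric interval integrals. -/
lemma contDiff_param_integral {E : Type} [NormedAddCommGroup E] [NormedSpace ℝ E]
    {f : X × ℝ → E} (hf : ContDiff ℝ (⊤ : ℕ∞) f) (a b : ℝ) :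
    ContDiff ℝ (⊤ : ℕ∞) (fun x => ∫ τ in a..b, f (x, τ)) :=
  contDiff_infty.2 fun n => contDiff_param_integral_nat a b n hf

end param

lemma ContDiff.pdx_smooth {u : ℝ × ℝ → ℝ} (hu : ContDiff ℝ (⊤ : ℕ∞) u) :
    ContDiff ℝ (⊤ : ℕ∞) (pdx u) := by
  have := ContDiffOn.pdx_smooth hu.contDiffOn isOpen_univ
  exact contDiffOn_univ.1 this

lemma ContDiff.pdy_smooth {u : ℝ × ℝ → ℝ} (hu : ContDiff ℝ (⊤ : ℕ∞) u) :
    ContDiff ℝ (⊤ : ℕ∞) (pdy u) := by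
  have := ContDiffOn.pdy_smooth hu.contDiffOn isOpen_univ
  exact contDiffOn_univ.1 this

lemma hasDerivAt_fst {u : ℝ × ℝ → ℝ} (hu : Differentiable ℝ u) (x y : ℝ) :
    HasDerivAt (fun t => u (t, y)) (pdx u (x, y)) x := by
  have := (hu (x, y)).hasFDerivAt.comp_hasDerivAt x
    ((hasDerivAt_id x).prodMk (hasDerivAt_const x y))
  exact this

lemma hasDerivAt_snd {u : ℝ × ℝ → ℝ} (hu : Differentiable ℝ u) (x y : ℝ) :
    HasDerivAt (fun t => u (x, t)) (pdy u (x, y)) y := by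
  have := (hu (x, y)).hasFDerivAt.comp_hasDerivAt y
    ((hasDerivAt_const y x).prodMk (hasDerivAt_id y))
  exact this

/-- Hadamard division by the first coordinate. -/
lemma exists_div_fst {G : ℝ × ℝ → ℝ} (hG : ContDiff ℝ (⊤ : ℕ∞) G) (h0 : ∀ θ, G (0, θ) = 0)
    {T : ℝ} (hper : ∀ r θ, G (r, θ + T) = G (r, θ)) :
    ∃ H : ℝ × ℝ → ℝ, ContDiff ℝ (⊤ : ℕ∞) H ∧ (∀ s, G s = s.1 * H s) ∧
      ∀ r θ, H (r, θ + T) = H (r, θ) := by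
  refine ⟨fun s => ∫ τ in (0:ℝ)..1, pdx G (τ * s.1, s.2), ?_, ?_, ?_⟩
  · refine contDiff_param_integral (f := fun p : (ℝ × ℝ) × ℝ => pdx G (p.2 * p.1.1, p.1.2)) ?_ 0 1
    exact hG.pdx_smooth.comp (by fun_prop)
  · rintro ⟨r, θ⟩
    have hd : Differentiable ℝ G := hG.differentiable (by simp)
    have h1 : ∀ τ ∈ uIcc (0:ℝ) 1, HasDerivAt (fun τ => G (τ * r, θ)) (pdx G (τ * r, θ) * r) τ := by
      intro τ _
      have := (hasDerivAt_fst hd (τ * r) θ).comp τ ((hasDerivAt_id τ).mul_const r)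
      simpa [Function.comp_def] using this
    have hc : Continuous fun τ : ℝ => pdx G (τ * r, θ) :=
      hG.pdx_smooth.continuous.comp (by fun_prop)
    have := intervalIntegral.integral_eq_sub_of_hasDerivAt h1
      ((hc.mul continuous_const).intervalIntegrable _ _)
    rw [intervalIntegral.integral_mul_const] at this
    simp only [one_mul, zero_mul, h0, sub_zero] at this
    rw [← this, mul_comm]
  · intro r θ
    have : ∀ r, pdx G (r, θ + T) = pdx G (r, θ) := by
      intro r
      have hd : Differentiable ℝ G := hG.differentiable (by simp)
      have h1 := hasDerivAt_fst hd r (θ + T)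
      simp only [hper] at h1
      exact h1.unique (hasDerivAt_fst hd r θ)
    simp only [this]

/-- A continuous periodic function all of whose Fourier coefficients vanish is zero. -/
lemma eq_zero_of_fourier {g : ℝ → ℝ} (hg : Continuous g)
    (hper : ∀ θ, g (θ + 2 * Real.pi) = g θ)
    (hcos : ∀ k : ℕ, ∫ θ in (0:ℝ)..2 * Real.pi, g θ * Real.cos (k * θ) = 0)
    (hsin : ∀ k : ℕ, ∫ θ in (0:ℝ)..2 * Real.pi, g θ * Real.sin (k * θ) = 0) (θ : ℝ) :
    g θ = 0 := by
  have : Fact (0 < 2 * Real.pi) := ⟨Real.two_pi_pos⟩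
  have hp : Function.Periodic (fun θ => (g θ : ℂ)) (2 * Real.pi) := fun θ => by
    simp only [hper]
  have hc : Continuous hp.lift := by
    exact continuous_coinduced_dom.2 (Complex.continuous_ofReal.comp hg)
  let f : C(AddCircle (2 * Real.pi), ℂ) := ⟨hp.lift, hc⟩
  have hcoef : ∀ n : ℤ, fourierCoeff f n = 0 := by
    intro n
    rw [fourierCoeff_eq_intervalIntegral f n 0]
    have hI : ∀ x : ℝ, fourier (-n) (x : AddCircle (2 * Real.pi)) • f x =
        ((g x * Real.cos (n * x) : ℝ) : ℂ) - ((g x * Real.sin (n * x) : ℝ) : ℂ) * Complex.I := by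
      intro x
      rw [fourier_coe_apply]
      have h1 : (2 * Real.pi * Complex.I * ((-n : ℤ) : ℂ) * x / ((2 * Real.pi : ℝ) : ℂ)) =
          ((-(n * x) : ℝ) : ℂ) * Complex.I := by
        have : (Real.pi : ℂ) ≠ 0 := by exact_mod_cast Real.pi_ne_zero
        push_cast
        field_simp
      rw [h1, Complex.exp_mul_I, ← Complex.ofReal_cos, ← Complex.ofReal_sin, Real.cos_neg,
        Real.sin_neg]
      have h2 : f (x : AddCircle (2 * Real.pi)) = (g x : ℂ) := rfl
      rw [h2, smul_eq_mul]
      push_cast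
      ring
    have hcn : ∫ x in (0:ℝ)..2 * Real.pi, g x * Real.cos (n * x) = 0 := by
      obtain ⟨k, rfl | rfl⟩ := n.eq_nat_or_neg
      · simpa using hcos k
      · simpa using hcos k
    have hsn : ∫ x in (0:ℝ)..2 * Real.pi, g x * Real.sin (n * x) = 0 := by
      obtain ⟨k, rfl | rfl⟩ := n.eq_nat_or_neg
      · simpa using hsin k
      · simpa using hsin k
    simp only [hI, zero_add]
    have c1 : Continuous fun x : ℝ => g x * Real.cos (n * x) := by fun_prop
    have c2 : Continuous fun x : ℝ => g x * Real.sin (n * x) := by fun_prop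
    have i1 : Continuous fun x : ℝ => ((g x * Real.cos (n * x) : ℝ) : ℂ) :=
      Complex.continuous_ofReal.comp c1
    have i2 : Continuous fun x : ℝ => ((g x * Real.sin (n * x) : ℝ) : ℂ) * Complex.I :=
      (Complex.continuous_ofReal.comp c2).mul continuous_const
    rw [intervalIntegral.integral_sub (i1.intervalIntegrable _ _) (i2.intervalIntegrable _ _),
      intervalIntegral.integral_mul_const, intervalIntegral.integral_ofReal,
      intervalIntegral.integral_ofReal, hcn, hsn]
    simp
  have hs : Summable (fourierCoeff f) := by
    rw [show fourierCoeff f = fun _ => 0 from funext hcoef]; exact summable_zero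
  have := has_pointwise_sum_fourier_series_of_summable hs (θ : AddCircle (2 * Real.pi))
  simp only [hcoef, zero_smul] at this
  have h3 := this.unique hasSum_zero
  have h4 : f (θ : AddCircle (2 * Real.pi)) = (g θ : ℂ) := rfl
  rw [h4] at h3
  exact_mod_cast h3

/-- Uniqueness for the singular Cauchy problem `r²b'' + (2 * k + 1) r b' = -w r² b`, `b 0 = 0`. -/
lemma singular_ode_zero {b b1 b2 w : ℝ → ℝ} {r0 W : ℝ} (k : ℕ) (hr : 0 < r0)
    (h1 : ∀ r, HasDerivAt b (b1 r) r) (h2 : ∀ r, HasDerivAt b1 (b2 r) r) (h0 : b 0 = 0)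
    (heq : ∀ r ∈ Icc 0 r0, r ^ 2 * b2 r + (2 * k + 1) * r * b1 r = -(w r) * r ^ 2 * b r)
    (hw : ∀ r ∈ Icc 0 r0, |w r| ≤ W) (hW : W * r0 ^ 2 < 1) : ∀ r ∈ Icc 0 r0, b r = 0 := by
  have hbc : Continuous b := continuous_iff_continuousAt.2 fun r => (h1 r).continuousAt
  have hb1c : Continuous b1 := continuous_iff_continuousAt.2 fun r => (h2 r).continuousAt
  obtain ⟨rm, hrm, hmax⟩ := isCompact_Icc.exists_isMaxOn (nonempty_Icc.2 hr.le)
    (hbc.abs.continuousOn (s := Icc 0 r0))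
  set M := |b rm| with hM
  have hM0 : 0 ≤ M := abs_nonneg _
  have hle : ∀ r ∈ Icc 0 r0, |b r| ≤ M := fun r hr => hmax hr
  have hW0 : 0 ≤ W := (abs_nonneg _).trans (hw 0 ⟨le_rfl, hr.le⟩)
  have hb1 : ∀ r ∈ Ioc 0 r0, |b1 r| ≤ W * M * r := by
    intro r hr'
    have hd : ∀ x ∈ Ioo 0 r, HasDerivAt (fun x => x ^ (2 * k + 1) * b1 x)
        (-(w x) * x ^ (2 * k + 1) * b x) x := by
      intro x hx
      have := (hasDerivAt_pow (2 * k + 1) x).mul (h2 x)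
      refine this.congr_deriv ?_
      have e := heq x ⟨hx.1.le, hx.2.le.trans hr'.2⟩
      have hx0 : x ≠ 0 := hx.1.ne'
      apply mul_left_cancel₀ hx0
      push_cast
      have : x ^ (2 * k + 1) = x ^ (2 * k) * x := pow_succ _ _
      rw [this]
      linear_combination (x ^ (2 * k)) * e
    obtain ⟨ξ, hξ, he⟩ := exists_hasDerivAt_eq_slope (fun x => x ^ (2 * k + 1) * b1 x) _ hr'.1
      (Continuous.continuousOn (by fun_prop)) hd
    simp only [ne_eq, Nat.add_eq_zero_iff, one_ne_zero, and_false, not_false_eq_true, zero_pow,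
      zero_mul, sub_zero] at he
    rw [eq_div_iff hr'.1.ne'] at he
    have hξ' : ξ ∈ Icc 0 r0 := ⟨hξ.1.le, hξ.2.le.trans hr'.2⟩
    have p1 : 0 < r ^ (2 * k + 1) := pow_pos hr'.1 _
    have p2 : ξ ^ (2 * k + 1) ≤ r ^ (2 * k + 1) := pow_le_pow_left₀ hξ.1.le hξ.2.le _
    have p3 : 0 ≤ ξ ^ (2 * k + 1) := pow_nonneg hξ.1.le _
    have e2 : r ^ (2 * k + 1) * |b1 r| = |w ξ| * ξ ^ (2 * k + 1) * |b ξ| * r := by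
      have := congrArg abs he
      rw [abs_mul, abs_mul, abs_mul, abs_mul, abs_neg, abs_of_pos hr'.1, abs_of_pos p1,
        abs_of_nonneg p3] at this
      exact this.symm
    have e3 : |w ξ| * ξ ^ (2 * k + 1) * |b ξ| * r ≤ W * r ^ (2 * k + 1) * M * r := by
      have := hw ξ hξ'
      have := hle ξ hξ'
      have := hr'.1.le
      gcongr
    rw [← e2] at e3
    nlinarith
  have hMM : M ≤ W * r0 ^ 2 * M := by
    rcases hrm.1.eq_or_lt with h | h
    · rw [hM, ← h, h0]; simp
    obtain ⟨ξ, hξ, he⟩ := exists_hasDerivAt_eq_slope b b1 h hbc.continuousOn fun x _ => h1 x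
    rw [h0, sub_zero, sub_zero, eq_div_iff h.ne'] at he
    have hξ' : ξ ∈ Ioc 0 r0 := ⟨hξ.1, hξ.2.le.trans hrm.2⟩
    have e1 := hb1 ξ hξ'
    have e4 : M = |b1 ξ| * rm := by rw [hM, ← he, abs_mul, abs_of_pos h]
    have e5 : |b1 ξ| * rm ≤ (W * M * r0) * r0 := by
      have := hξ'.2
      have := hrm.2
      have : |b1 ξ| ≤ W * M * r0 := e1.trans (by gcongr)
      gcongr
    rw [← e4] at e5
    linarith
  have : M = 0 := by nlinarith
  intro r hr
  have := hle r hr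
  rw [‹M = 0›] at this
  exact abs_nonpos_iff.1 this

section modes

/-- The equation satisfied by `H` when `r ^ m * H` is the polar form of a solution. -/
structure IsMode (m : ℕ) (w : ℝ → ℝ) (ρ : ℝ) (H : ℝ × ℝ → ℝ) : Prop where
  smooth : ContDiff ℝ (⊤ : ℕ∞) H
  per : ∀ r θ, H (r, θ + 2 * Real.pi) = H (r, θ)
  eqn : ∀ s : ℝ × ℝ, |s.1| < ρ →
    s.1 ^ 2 * pdx (pdx H) s + (2 * m + 1) * s.1 * pdx H s + (m : ℝ) ^ 2 * H s + pdy (pdy H) s =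
      -(w s.1) * s.1 ^ 2 * H s

variable {m : ℕ} {w : ℝ → ℝ} {ρ : ℝ} {H : ℝ × ℝ → ℝ}

lemma IsMode.step (h : IsMode m w ρ H) (hw : ContinuousAt w 0)
    (h0 : ∀ θ, H (0, θ) = 0) :
    ∃ H', IsMode (m + 1) w ρ H' ∧ ∀ s, H s = s.1 * H' s := by
  obtain ⟨H', hs, hH, hp⟩ := exists_div_fst h.smooth h0 h.per
  have d : Differentiable ℝ H' := hs.differentiable (by simp)
  have dx : Differentiable ℝ (pdx H') := hs.pdx_smooth.differentiable (by simp)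
  have dy : Differentiable ℝ (pdy H') := hs.pdy_smooth.differentiable (by simp)
  have d1 : Differentiable ℝ (fun t : ℝ × ℝ => t.1) := differentiable_fst
  have a1 : ∀ s, pdx (fun t : ℝ × ℝ => t.1) s = 1 := fun s => by simp [pdx, fderiv_fst]
  have a2 : ∀ s, pdy (fun t : ℝ × ℝ => t.1) s = 0 := fun s => by simp [pdy, fderiv_fst]
  have e : H = fun s => s.1 * H' s := funext hH
  have ex : pdx H = fun s => H' s + s.1 * pdx H' s := by
    funext s
    rw [e, pdx_mul (d1 s) (d s), a1]; ring
  have ey : pdy H = fun s => s.1 * pdy H' s := by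
    funext s
    rw [e, pdy_mul (d1 s) (d s), a2]; ring
  have exx : ∀ s, pdx (pdx H) s = 2 * pdx H' s + s.1 * pdx (pdx H') s := by
    intro s
    rw [ex, pdx_add (d s) ((d1 s).fun_mul (dx s)), pdx_mul (d1 s) (dx s), a1]; ring
  have eyy : ∀ s, pdy (pdy H) s = s.1 * pdy (pdy H') s := by
    intro s
    rw [ey, pdy_mul (d1 s) (dy s), a2]; ring
  refine ⟨H', ⟨hs, hp, ?_⟩, hH⟩
  have main : ∀ s : ℝ × ℝ, |s.1| < ρ → s.1 ≠ 0 →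
      s.1 ^ 2 * pdx (pdx H') s + (2 * ((m + 1 : ℕ) : ℝ) + 1) * s.1 * pdx H' s +
        ((m + 1 : ℕ) : ℝ) ^ 2 * H' s + pdy (pdy H') s + w s.1 * s.1 ^ 2 * H' s = 0 := by
    intro s hs h0
    have := h.eqn s hs
    rw [exx, eyy, ex, hH] at this
    apply mul_left_cancel₀ h0
    push_cast
    linear_combination this
  rintro ⟨r, θ⟩ hr
  by_cases hr0 : r = 0
  · subst hr0
    have hc : ContinuousAt (fun r : ℝ => r ^ 2 * pdx (pdx H') (r, θ) +
        (2 * ((m + 1 : ℕ) : ℝ) + 1) * r * pdx H' (r, θ) +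
        ((m + 1 : ℕ) : ℝ) ^ 2 * H' (r, θ) + pdy (pdy H') (r, θ) + w r * r ^ 2 * H' (r, θ)) 0 := by
      have c0 : Continuous H' := hs.continuous
      have c1 : Continuous (pdx H') := hs.pdx_smooth.continuous
      have c2 : Continuous (pdx (pdx H')) := hs.pdx_smooth.pdx_smooth.continuous
      have c3 : Continuous (pdy (pdy H')) := hs.pdy_smooth.pdy_smooth.continuous
      refine ContinuousAt.add (Continuous.continuousAt (by fun_prop))
        ((hw.mul (Continuous.continuousAt (by fun_prop))).mul
          (Continuous.continuousAt (by fun_prop)))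
    have hev : ∀ᶠ r in 𝓝[≠] (0 : ℝ), r ^ 2 * pdx (pdx H') (r, θ) +
        (2 * ((m + 1 : ℕ) : ℝ) + 1) * r * pdx H' (r, θ) +
        ((m + 1 : ℕ) : ℝ) ^ 2 * H' (r, θ) + pdy (pdy H') (r, θ) +
          w r * r ^ 2 * H' (r, θ) = 0 := by
      have h1 : ∀ᶠ r in 𝓝 (0 : ℝ), |r| < ρ :=
        (continuous_abs.tendsto 0).eventually (gt_mem_nhds hr)
      filter_upwards [nhdsWithin_le_nhds h1, self_mem_nhdsWithin] with r hr hne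
      exact main (r, θ) hr hne
    have := tendsto_nhds_unique (hc.tendsto.mono_left nhdsWithin_le_nhds)
      (tendsto_const_nhds.congr' (hev.mono fun _ h => h.symm))
    linear_combination this
  · linear_combination main (r, θ) hr hr0

lemma hasDerivAt_param_integral {f : ℝ × ℝ → ℝ} (hf : ContDiff ℝ (⊤ : ℕ∞) f) (a b r : ℝ) :
    HasDerivAt (fun r => ∫ τ in a..b, f (r, τ)) (∫ τ in a..b, pdx f (r, τ)) r := by
  have h := (hasFDerivAt_param_integral (hf.of_le (by simp)) a b r).hasDerivAt
  have hc : Continuous fun τ : ℝ =>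
      (fderiv ℝ f (r, τ)).comp (ContinuousLinearMap.inl ℝ ℝ ℝ) := by
    have : Continuous (fderiv ℝ f) := hf.continuous_fderiv (by simp)
    exact (this.comp (Continuous.prodMk_right r)).clm_comp continuous_const
  rw [ContinuousLinearMap.intervalIntegral_apply (hc.intervalIntegrable _ _)] at h
  exact h

lemma IsMode.integral_zero (h : IsMode m w ρ H) (h0 : ∀ θ, H (0, θ) = 0) {g g1 : ℝ → ℝ}
    (hg : ContDiff ℝ (⊤ : ℕ∞) g) (hg1 : ∀ x, HasDerivAt g (g1 x) x)
    (hg2 : ∀ x, HasDerivAt g1 (-(m : ℝ) ^ 2 * g x) x)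
    (p0 : g (2 * Real.pi) = g 0) (p1 : g1 (2 * Real.pi) = g1 0) {r0 W : ℝ} (hr : 0 < r0)
    (hrρ : r0 < ρ) (hw : ∀ r ∈ Icc 0 r0, |w r| ≤ W) (hW : W * r0 ^ 2 < 1) {r : ℝ}
    (hr' : r ∈ Icc 0 r0) : ∫ θ in (0:ℝ)..2 * Real.pi, H (r, θ) * g θ = 0 := by
  have hs := h.smooth
  have d : Differentiable ℝ H := hs.differentiable (by simp)
  have dx : Differentiable ℝ (pdx H) := hs.pdx_smooth.differentiable (by simp)
  have dy : Differentiable ℝ (pdy H) := hs.pdy_smooth.differentiable (by simp)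
  have gs : ContDiff ℝ (⊤ : ℕ∞) (fun s : ℝ × ℝ => g s.2) := hg.comp contDiff_snd
  have gd : Differentiable ℝ (fun s : ℝ × ℝ => g s.2) := gs.differentiable (by simp)
  have gx : ∀ s, pdx (fun s : ℝ × ℝ => g s.2) s = 0 := fun s =>
    pdx_eq_of_hasDerivAt (gd s) (by simpa using hasDerivAt_const s.1 (g s.2))
  have ex : ∀ s, pdx (fun s : ℝ × ℝ => H s * g s.2) s = pdx H s * g s.2 := fun s => by
    rw [pdx_mul (d s) (gd s), gx]; ring
  have exx : ∀ s, pdx (fun s : ℝ × ℝ => pdx H s * g s.2) s = pdx (pdx H) s * g s.2 := fun s => by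
    rw [pdx_mul (dx s) (gd s), gx]; ring
  have h1 := hasDerivAt_param_integral (hs.mul gs) 0 (2 * Real.pi)
  have h2 := hasDerivAt_param_integral (hs.pdx_smooth.mul gs) 0 (2 * Real.pi)
  simp only [ex] at h1
  simp only [exx] at h2
  have c0 : Continuous H := hs.continuous
  have cx : Continuous (pdx H) := hs.pdx_smooth.continuous
  have cxx : Continuous (pdx (pdx H)) := hs.pdx_smooth.pdx_smooth.continuous
  have cy : Continuous (pdy H) := hs.pdy_smooth.continuous
  have cyy : Continuous (pdy (pdy H)) := hs.pdy_smooth.pdy_smooth.continuous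
  have cg : Continuous g := hg.continuous
  have cg1 : Continuous g1 := continuous_iff_continuousAt.2 fun x => (hg2 x).continuousAt
  have ibp : ∀ r, ∫ θ in (0:ℝ)..2 * Real.pi, pdy (pdy H) (r, θ) * g θ =
      ∫ θ in (0:ℝ)..2 * Real.pi, H (r, θ) * (-(m : ℝ) ^ 2 * g θ) := by
    intro r
    have hper := h.per r 0
    have hpery : pdy H (r, 0 + 2 * Real.pi) = pdy H (r, 0) := by
      have e1 := (hasDerivAt_snd d r (0 + 2 * Real.pi)).comp_add_const 0 (2 * Real.pi)
      simp only [h.per] at e1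
      exact e1.unique (hasDerivAt_snd d r 0)
    rw [zero_add] at hper hpery
    have key : ∀ θ ∈ uIcc (0:ℝ) (2 * Real.pi),
        HasDerivAt (fun θ => pdy H (r, θ) * g θ - H (r, θ) * g1 θ)
          (pdy (pdy H) (r, θ) * g θ - H (r, θ) * (-(m : ℝ) ^ 2 * g θ)) θ := by
      intro θ _
      have := ((hasDerivAt_snd dy r θ).mul (hg1 θ)).sub ((hasDerivAt_snd d r θ).mul (hg2 θ))
      refine this.congr_deriv ?_
      ring
    have k1 : Continuous fun θ => pdy (pdy H) (r, θ) * g θ := by fun_prop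
    have k2 : Continuous fun θ => H (r, θ) * (-(m : ℝ) ^ 2 * g θ) := by fun_prop
    have := intervalIntegral.integral_eq_sub_of_hasDerivAt key
      ((k1.sub k2).intervalIntegrable _ _)
    rw [intervalIntegral.integral_sub (k1.intervalIntegrable _ _) (k2.intervalIntegrable _ _),
      hper, hpery, p0, p1, sub_self] at this
    linarith
  refine singular_ode_zero (w := w) m hr h1 h2 (by simp [h0]) ?_ hw hW r hr'
  intro r hr
  have hlt : |r| < ρ := by rw [abs_of_nonneg hr.1]; exact hr.2.trans_lt hrρ
  have I1 : Continuous fun θ => pdx (pdx H) (r, θ) * g θ := by fun_prop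
  have I2 : Continuous fun θ => pdx H (r, θ) * g θ := by fun_prop
  have I3 : Continuous fun θ => H (r, θ) * g θ := by fun_prop
  have I4 : Continuous fun θ => pdy (pdy H) (r, θ) * g θ := by fun_prop
  have hsum : ∫ θ in (0:ℝ)..2 * Real.pi, ((r ^ 2 * (pdx (pdx H) (r, θ) * g θ) +
      (2 * m + 1) * r * (pdx H (r, θ) * g θ)) + ((m : ℝ) ^ 2 + w r * r ^ 2) * (H (r, θ) * g θ)) +
      pdy (pdy H) (r, θ) * g θ = 0 := by
    refine (intervalIntegral.integral_congr (g := fun _ => 0) fun θ _ => ?_).trans (by simp)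
    linear_combination g θ * h.eqn (r, θ) hlt
  rw [intervalIntegral.integral_add (Continuous.intervalIntegrable (by fun_prop) _ _)
      (I4.intervalIntegrable _ _),
    intervalIntegral.integral_add (Continuous.intervalIntegrable (by fun_prop) _ _)
      (Continuous.intervalIntegrable (by fun_prop) _ _),
    intervalIntegral.integral_add (Continuous.intervalIntegrable (by fun_prop) _ _)
      (Continuous.intervalIntegrable (by fun_prop) _ _), ibp] at hsum
  have e5 : ∫ θ in (0:ℝ)..2 * Real.pi, H (r, θ) * (-(m : ℝ) ^ 2 * g θ) =
      -(m : ℝ) ^ 2 * ∫ θ in (0:ℝ)..2 * Real.pi, H (r, θ) * g θ := by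
    rw [← intervalIntegral.integral_const_mul]
    congr 1; funext θ; ring
  rw [e5] at hsum
  simp only [intervalIntegral.integral_const_mul] at hsum
  linear_combination hsum

/-- A solution in polar form either has a nontrivial leading mode or vanishes near the centre. -/
lemma mode_dichotomy {G : ℝ × ℝ → ℝ} (h : IsMode 0 w ρ G) (hw0 : ContinuousAt w 0) {r0 W : ℝ}
    (hr : 0 < r0) (hrρ : r0 < ρ) (hw : ∀ r ∈ Icc 0 r0, |w r| ≤ W) (hW : W * r0 ^ 2 < 1) :
    (∃ m H, IsMode m w ρ H ∧ (∀ s, G s = s.1 ^ m * H s) ∧ ∃ θ, H (0, θ) ≠ 0) ∨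
      ∀ r ∈ Icc 0 r0, ∀ θ, G (r, θ) = 0 := by
  by_cases hA : ∃ m H, IsMode m w ρ H ∧ (∀ s, G s = s.1 ^ m * H s) ∧ ∃ θ, H (0, θ) ≠ 0
  · exact Or.inl hA
  right
  push Not at hA
  have hB : ∀ m : ℕ, ∃ H, IsMode m w ρ H ∧ ∀ s, G s = s.1 ^ m * H s := by
    intro m
    induction m with
    | zero => exact ⟨G, h, fun s => by simp⟩
    | succ m ih =>
      obtain ⟨H, hH, hG⟩ := ih
      obtain ⟨H', hH', hHH⟩ := hH.step hw0 (hA m H hH hG)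
      exact ⟨H', hH', fun s => by rw [hG, hHH]; ring⟩
  intro r hr' θ
  have key : ∀ (m : ℕ) (g g1 : ℝ → ℝ), ContDiff ℝ (⊤ : ℕ∞) g → (∀ x, HasDerivAt g (g1 x) x) →
      (∀ x, HasDerivAt g1 (-(m : ℝ) ^ 2 * g x) x) → g (2 * Real.pi) = g 0 →
      g1 (2 * Real.pi) = g1 0 → ∫ θ in (0:ℝ)..2 * Real.pi, G (r, θ) * g θ = 0 := by
    intro m g g1 hg hg1 hg2 p0 p1
    obtain ⟨H, hH, hG⟩ := hB m
    have := hH.integral_zero (hA m H hH hG) hg hg1 hg2 p0 p1 hr hrρ hw hW hr'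
    simp only [hG, mul_assoc]
    rw [intervalIntegral.integral_const_mul, this, mul_zero]
  have hlin : ∀ (k : ℕ) (x : ℝ), HasDerivAt (fun x : ℝ => (k : ℝ) * x) k x := fun k x => by
    simpa using (hasDerivAt_id x).const_mul (k : ℝ)
  refine eq_zero_of_fourier (g := fun θ => G (r, θ)) (h.smooth.continuous.comp (by fun_prop))
    (h.per r) ?_ ?_ θ
  · intro k
    have e1 : Real.cos (k * (2 * Real.pi)) = 1 := Real.cos_nat_mul_two_pi k
    have e2 : Real.sin (k * (2 * Real.pi)) = 0 := by
      rw [show (k : ℝ) * (2 * Real.pi) = ((2 * k : ℕ) : ℝ) * Real.pi by push_cast; ring]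
      exact Real.sin_nat_mul_pi _
    refine key k (fun x => Real.cos (k * x)) (fun x => -Real.sin (k * x) * k) ?_ ?_ ?_ ?_ ?_
    · exact Real.contDiff_cos.comp (by fun_prop)
    · exact fun x => (Real.hasDerivAt_cos _).comp x (hlin k x)
    · intro x
      refine ((((Real.hasDerivAt_sin _).comp x (hlin k x)).neg).mul_const (k : ℝ)).congr_deriv ?_
      ring
    · simp [e1]
    · simp [e2]
  · intro k
    have e1 : Real.cos (k * (2 * Real.pi)) = 1 := Real.cos_nat_mul_two_pi k
    have e2 : Real.sin (k * (2 * Real.pi)) = 0 := by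
      rw [show (k : ℝ) * (2 * Real.pi) = ((2 * k : ℕ) : ℝ) * Real.pi by push_cast; ring]
      exact Real.sin_nat_mul_pi _
    refine key k (fun x => Real.sin (k * x)) (fun x => Real.cos (k * x) * k) ?_ ?_ ?_ ?_ ?_
    · exact Real.contDiff_sin.comp (by fun_prop)
    · exact fun x => (Real.hasDerivAt_sin _).comp x (hlin k x)
    · intro x
      refine (((Real.hasDerivAt_cos _).comp x (hlin k x)).mul_const (k : ℝ)).congr_deriv ?_
      ring
    · simp [e2]
    · simp [e1]

/-- The leading angular profile is a multiple of a cosine. -/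
lemma IsMode.profile (h : IsMode m w ρ H) (hρ : 0 < ρ) (hne : ∃ θ, H (0, θ) ≠ 0) :
    ∃ A θ0 : ℝ, A ≠ 0 ∧ (m ≠ 0 → 0 < A) ∧ ∀ θ, H (0, θ) = A * Real.cos (m * (θ - θ0)) := by
  have hs := h.smooth
  have d : Differentiable ℝ H := hs.differentiable (by simp)
  have dy : Differentiable ℝ (pdy H) := hs.pdy_smooth.differentiable (by simp)
  have e : ∀ θ, pdy (pdy H) (0, θ) = -(m : ℝ) ^ 2 * H (0, θ) := fun θ => by
    have := h.eqn (0, θ) (by simpa using hρ)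
    simp only at this
    linear_combination this
  by_cases hm : m = 0
  · subst hm
    have hc : ∀ θ, pdy H (0, θ) = pdy H (0, 0) := fun θ =>
      is_const_of_deriv_eq_zero (f := fun θ => pdy H (0, θ))
        (fun x => (hasDerivAt_snd dy 0 x).differentiableAt)
        (fun x => by rw [(hasDerivAt_snd dy 0 x).deriv, e]; simp) θ 0
    have hl : ∀ θ, H (0, θ) - pdy H (0, 0) * θ = H (0, 0) - pdy H (0, 0) * 0 := fun θ => by
      have hd : ∀ x, HasDerivAt (fun θ => H (0, θ) - pdy H (0, 0) * θ) 0 x := fun x => by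
        refine ((hasDerivAt_snd d 0 x).sub ((hasDerivAt_id x).const_mul _)).congr_deriv ?_
        rw [hc]; ring
      exact is_const_of_deriv_eq_zero (f := fun θ => H (0, θ) - pdy H (0, 0) * θ)
        (fun x => (hd x).differentiableAt) (fun x => (hd x).deriv) θ 0
    have hz : pdy H (0, 0) = 0 := by
      have h1 := hl (2 * Real.pi)
      have h2 := h.per 0 0
      rw [zero_add] at h2
      have : pdy H (0, 0) * (2 * Real.pi) = 0 := by linarith
      rcases mul_eq_zero.1 this with h | h
      · exact h
      · exact absurd h Real.two_pi_pos.ne'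
    simp only [hz, zero_mul, sub_zero] at hl
    refine ⟨H (0, 0), 0, ?_, fun h => absurd rfl h, fun θ => by simp [hl]⟩
    obtain ⟨θ, hθ⟩ := hne
    rwa [hl] at hθ
  · have hm' : (m : ℝ) ≠ 0 := Nat.cast_ne_zero.2 hm
    set a := H (0, 0)
    set c := pdy H (0, 0) / m
    have hlin : ∀ x : ℝ, HasDerivAt (fun x : ℝ => (m : ℝ) * x) m x := fun x => by
      simpa using (hasDerivAt_id x).const_mul (m : ℝ)
    have hcos : ∀ x, HasDerivAt (fun x : ℝ => Real.cos (m * x)) (-Real.sin (m * x) * m) x :=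
      fun x => (Real.hasDerivAt_cos _).comp x (hlin x)
    have hsin : ∀ x, HasDerivAt (fun x : ℝ => Real.sin (m * x)) (Real.cos (m * x) * m) x :=
      fun x => (Real.hasDerivAt_sin _).comp x (hlin x)
    have hU : ∀ θ, H (0, θ) = a * Real.cos (m * θ) + c * Real.sin (m * θ) := by
      set Q := fun θ => H (0, θ) - (a * Real.cos (m * θ) + c * Real.sin (m * θ))
      set Q1 := fun θ => pdy H (0, θ) -
        (a * (-Real.sin (m * θ) * m) + c * (Real.cos (m * θ) * m))
      have q1 : ∀ x, HasDerivAt Q (Q1 x) x := fun x =>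
        (hasDerivAt_snd d 0 x).sub (((hcos x).const_mul a).add ((hsin x).const_mul c))
      have q2 : ∀ x, HasDerivAt Q1 (-(m : ℝ) ^ 2 * Q x) x := fun x => by
        refine ((hasDerivAt_snd dy 0 x).sub ((((hsin x).neg.mul_const (m : ℝ)).const_mul a).add
          (((hcos x).mul_const (m : ℝ)).const_mul c))).congr_deriv ?_
        rw [e]; simp only [Q]; ring
      have hE : ∀ x, HasDerivAt (fun x => Q1 x ^ 2 + (m : ℝ) ^ 2 * Q x ^ 2) 0 x := fun x => by
        refine (((q2 x).fun_pow 2).add (((q1 x).fun_pow 2).const_mul ((m : ℝ) ^ 2))).congr_deriv ?_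
        simp; ring
      intro θ
      have := is_const_of_deriv_eq_zero (fun x => (hE x).differentiableAt)
        (fun x => (hE x).deriv) θ 0
      have z0 : Q 0 = 0 := by simp [Q, a]
      have z1 : Q1 0 = 0 := by simp [Q1, c]; field_simp; simp
      simp only [z0, z1] at this
      have h3 : (m : ℝ) ^ 2 * Q θ ^ 2 = 0 := by
        nlinarith [sq_nonneg (Q1 θ), sq_nonneg ((m:ℝ) * Q θ)]
      have h4 : Q θ = 0 := by
        rcases mul_eq_zero.1 h3 with h | h
        · exact absurd (pow_eq_zero_iff (two_ne_zero) |>.1 h) hm'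
        · exact pow_eq_zero_iff (two_ne_zero) |>.1 h
      simp only [Q] at h4
      linarith
    set ζ : ℂ := ⟨a, c⟩
    have hζ : ζ ≠ 0 := by
      intro h0
      have ha : a = 0 := congrArg Complex.re h0
      have hc : c = 0 := congrArg Complex.im h0
      obtain ⟨θ, hθ⟩ := hne
      rw [hU, ha, hc] at hθ
      simp at hθ
    refine ⟨‖ζ‖, ζ.arg / m, norm_ne_zero_iff.2 hζ, fun _ => norm_pos_iff.2 hζ, fun θ => ?_⟩
    have k1 : ‖ζ‖ * Real.cos ζ.arg = a := Complex.norm_mul_cos_arg ζ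
    have k2 : ‖ζ‖ * Real.sin ζ.arg = c := Complex.norm_mul_sin_arg ζ
    rw [hU, mul_sub, mul_div_cancel₀ _ hm', Real.cos_sub, ← k1, ← k2]
    ring

end modes

lemma pol_per (q : ℝ × ℝ) (r θ : ℝ) : pol q (r, θ + 2 * Real.pi) = pol q (r, θ) := by
  simp [pol, polX, polY, polD]

/-- Polar coordinates around `q` cover the half-plane. -/
lemma exists_polar {q p : ℝ × ℝ} (hq : q ∈ H2) (hp : p ∈ H2) :
    ∃ r θ : ℝ, 0 ≤ r ∧ r < 1 ∧ r ^ 2 = tfun q.1 q.2 p ∧ pol q (r, θ) = p := by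
  have hq2 : 0 < q.2 := hq
  have hp2 : 0 < p.2 := hp
  have hN := tfun_den_pos (a := q.1) hq2 hp
  set N := (p.1 - q.1) ^ 2 + (p.2 + q.2) ^ 2 with hNdef
  set ζ : ℂ := ⟨((p.1 - q.1) ^ 2 + p.2 ^ 2 - q.2 ^ 2) / N, -2 * q.2 * (p.1 - q.1) / N⟩ with hζ
  have hsq : ‖ζ‖ ^ 2 = tfun q.1 q.2 p := by
    rw [← Complex.normSq_eq_norm_sq, Complex.normSq_apply]
    simp only [hζ, tfun]
    rw [← hNdef]
    field_simp
    rw [hNdef]; ring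
  have hmem := tfun_mem (a := q.1) hq2 hp
  rw [← hsq] at hmem
  have hlt : ‖ζ‖ < 1 := by nlinarith [hmem.2, norm_nonneg ζ]
  have k1 : ‖ζ‖ * Real.cos ζ.arg = ζ.re := Complex.norm_mul_cos_arg ζ
  have k2 : ‖ζ‖ * Real.sin ζ.arg = ζ.im := Complex.norm_mul_sin_arg ζ
  refine ⟨‖ζ‖, ζ.arg, norm_nonneg _, hlt, hsq, ?_⟩
  have hs2 : ‖ζ‖ ^ 2 = ((p.1 - q.1) ^ 2 + (p.2 - q.2) ^ 2) / N := by rw [hsq]; rfl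
  have hD : polD (‖ζ‖, ζ.arg) = 4 * q.2 ^ 2 / N := by
    simp only [polD]
    rw [mul_assoc, k1, hs2, hζ]
    field_simp
    rw [hNdef]; ring
  have e1 : polX q (‖ζ‖, ζ.arg) = p.1 := by
    simp only [polX]
    rw [hD, k2, hζ]
    field_simp
    ring
  have e2 : polY q (‖ζ‖, ζ.arg) = p.2 := by
    simp only [polY]
    rw [hD, hs2]
    field_simp
    rw [hNdef]; ring
  exact Prod.ext e1 e2

lemma tfun_pol {q s : ℝ × ℝ} (hq : q ∈ H2) (hs : s ∈ polDom) :
    tfun q.1 q.2 (pol q s) = s.1 ^ 2 := by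
  have hq2 : 0 < q.2 := hq
  have hD := polD_pos hs
  have hm : pol q s ∈ H2 := pol_mem_H2 hq hs
  have hN := tfun_den_pos (a := q.1) hq2 hm
  rw [tfun, div_eq_iff hN.ne']
  simp only [pol, polX, polY]
  field_simp
  have := Real.sin_sq s.2
  simp only [polD]
  ring_nf
  simp only [this]
  ring

/-- Uniformity in the angle of an open condition along the centre. -/
lemma uniform_angle {Q : ℝ × ℝ → Prop} (hper : ∀ r θ, Q (r, θ + 2 * Real.pi) ↔ Q (r, θ))
    (h : ∀ θ, ∀ᶠ s in 𝓝 ((0 : ℝ), θ), Q s) : ∃ δ > 0, ∀ r, |r| < δ → ∀ θ, Q (r, θ) := by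
  have h1 := isCompact_Icc (a := (0:ℝ)) (b := 2 * Real.pi) |>.eventually_forall_of_forall_eventually
    (x₀ := (0:ℝ)) (P := fun r θ => Q (r, θ)) fun y _ => h y
  obtain ⟨δ, hδ, hb⟩ := Metric.eventually_nhds_iff.1 h1
  refine ⟨δ, hδ, fun r hr θ => ?_⟩
  have hn : ∀ (n : ℕ) (θ : ℝ), Q (r, θ + n * (2 * Real.pi)) ↔ Q (r, θ) := by
    intro n
    induction n with
    | zero => simp
    | succ n ih =>
      intro θ
      rw [← ih θ, ← hper r (θ + n * (2 * Real.pi))]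
      push_cast
      rw [show θ + ((n : ℝ) + 1) * (2 * Real.pi) = θ + n * (2 * Real.pi) + 2 * Real.pi by ring]
  have hz : ∀ (n : ℤ), Q (r, θ + n * (2 * Real.pi)) ↔ Q (r, θ) := by
    intro n
    obtain ⟨k, rfl | rfl⟩ := n.eq_nat_or_neg
    · simpa using hn k θ
    · rw [← hn k (θ + _)]
      push_cast
      rw [show θ + -(k : ℝ) * (2 * Real.pi) + k * (2 * Real.pi) = θ by ring]
  obtain ⟨n, hn, -⟩ := existsUnique_sub_zsmul_mem_Ico Real.two_pi_pos θ 0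
  rw [← hz (-n)]
  refine hb (by simpa using hr) _ ?_
  rw [zsmul_eq_mul, zero_add] at hn
  push_cast
  rw [show θ + -(n : ℝ) * (2 * Real.pi) = θ - n * (2 * Real.pi) by ring]
  exact ⟨hn.1, hn.2.le⟩

/-- Polar normal form of a function near `q`. -/
structure LocalForm (z : ℝ × ℝ → ℝ) (Ω : Set (ℝ × ℝ)) (q : ℝ × ℝ) (m : ℕ) (A θ0 ρ : ℝ)
    (H : ℝ × ℝ → ℝ) : Prop where
  rho_pos : 0 < ρ
  rho_lt : ρ < 1
  amp_ne : A ≠ 0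
  amp_pos : m ≠ 0 → 0 < A
  smooth : ContDiff ℝ (⊤ : ℕ∞) H
  per : ∀ r θ, H (r, θ + 2 * Real.pi) = H (r, θ)
  profile : ∀ θ, H (0, θ) = A * Real.cos (m * (θ - θ0))
  mem : ∀ s : ℝ × ℝ, |s.1| < ρ → pol q s ∈ Ω
  val : ∀ s : ℝ × ℝ, |s.1| < ρ → z (pol q s) = s.1 ^ m * H s

theorem local_structure {Ω : Set (ℝ × ℝ)} {z : ℝ × ℝ → ℝ} {μ : ℝ} {q : ℝ × ℝ} (ho : IsOpen Ω)
    (hΩ : Ω ⊆ H2) (hμ : 0 < μ) (hz : ContDiffOn ℝ (⊤ : ℕ∞) z Ω)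
    (heq : ∀ p ∈ Ω, -hypLap z p = μ * z p) (hq : q ∈ Ω) :
    (∀ᶠ p in 𝓝 q, z p = 0) ∨ ∃ m A θ0 ρ H, LocalForm z Ω q m A θ0 ρ H := by
  have hqH := hΩ hq
  obtain ⟨ρ1, hρ1, hmem⟩ := uniform_angle (Q := fun s => s ∈ polDom ∧ pol q s ∈ Ω)
    (fun r θ => by rw [pol_per]; rfl) (fun θ => by
      have h0 : ((0 : ℝ), θ) ∈ polDom := by simp [polDom]
      have h1 : ∀ᶠ s in 𝓝 ((0 : ℝ), θ), s ∈ polDom := isOpen_polDom.mem_nhds h0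
      refine h1.and ?_
      refine ((pol_smooth q).contDiffAt (isOpen_polDom.mem_nhds h0)).continuousAt.eventually ?_
      rw [pol_zero]
      exact ho.mem_nhds hq)
  set ρ := min (ρ1 / 4) (1 / 2) with hρdef
  have hρ : 0 < ρ := lt_min (by positivity) (by norm_num)
  have hρ' : ρ ≤ 1 / 2 := min_le_right _ _
  have hρ1' : 2 * ρ < ρ1 := by have := min_le_left (ρ1 / 4) (1 / 2); linarith
  let χ : ContDiffBump (0 : ℝ) := ⟨ρ, 2 * ρ, hρ, by linarith⟩
  set G : ℝ × ℝ → ℝ := fun s => χ s.1 * z (pol q s) with hG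
  have hGe : ∀ s : ℝ × ℝ, |s.1| < ρ → G s = z (pol q s) := by
    intro s hs
    have : χ s.1 = 1 := χ.one_of_mem_closedBall (by simpa using hs.le)
    rw [hG]; simp only [this, one_mul]
  have hGs : ContDiff ℝ (⊤ : ℕ∞) G := by
    rw [contDiff_iff_contDiffAt]
    intro s
    by_cases hs : |s.1| < ρ1
    · obtain ⟨hs1, hs2⟩ := hmem s.1 hs s.2
      refine ContDiffAt.mul (χ.contDiff.contDiffAt.comp s contDiffAt_fst) ?_
      exact (hz.contDiffAt (ho.mem_nhds hs2)).comp s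
        ((pol_smooth q).contDiffAt (isOpen_polDom.mem_nhds hs1))
    · have hev : G =ᶠ[𝓝 s] fun _ => 0 := by
        have : ∀ᶠ t : ℝ × ℝ in 𝓝 s, 2 * ρ < |t.1| :=
          (continuous_fst.abs.tendsto s).eventually (lt_mem_nhds (by linarith))
        filter_upwards [this] with t ht
        have : χ t.1 = 0 := χ.zero_of_le_dist (by simpa using ht.le)
        rw [hG]; simp only [this, zero_mul]
      exact contDiffAt_const.congr_of_eventuallyEq hev
  set w : ℝ → ℝ := fun r => 4 * μ / (1 - r ^ 2) ^ 2 with hw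
  have hmode : IsMode 0 w ρ G := by
    refine ⟨hGs, fun r θ => by simp only [hG, pol_per], fun s hs => ?_⟩
    have hs' : |s.1| < ρ1 := by linarith
    obtain ⟨hs1, hs2⟩ := hmem s.1 hs' s.2
    have hev : G =ᶠ[𝓝 s] fun t => z (pol q t) := by
      have : ∀ᶠ t : ℝ × ℝ in 𝓝 s, |t.1| < ρ :=
        (continuous_fst.abs.tendsto s).eventually (gt_mem_nhds hs)
      filter_upwards [this] with t ht using hGe t ht
    have := polar_laplacian ho hz hs1 hs2
    rw [pdx_congr (pdx_eventuallyEq hev), pdx_congr hev, pdy_congr (pdy_eventuallyEq hev),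
      hGe s hs]
    have e := heq _ hs2
    have e' : hypLap z (pol q s) = -(μ * z (pol q s)) := by linarith
    rw [e'] at this
    simp only [hw, Nat.cast_zero]
    linear_combination this
  have hwc : ContinuousAt w 0 := by
    have : ContinuousAt (fun r : ℝ => (1 - r ^ 2) ^ 2) 0 := by fun_prop
    exact continuousAt_const.div this (by norm_num)
  set r0 := min (ρ / 2) (1 / (4 * (μ + 1))) with hr0
  have hr0p : 0 < r0 := lt_min (by positivity) (by positivity)
  have hr0ρ : r0 < ρ := (min_le_left _ _).trans_lt (by linarith)
  have hr02 : r0 ≤ 1 / (4 * (μ + 1)) := min_le_right _ _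
  have hW : 8 * μ * r0 ^ 2 < 1 := by
    rw [le_div_iff₀ (by positivity)] at hr02
    nlinarith [mul_pos hμ hr0p]
  have hwb : ∀ r ∈ Icc 0 r0, |w r| ≤ 8 * μ := by
    intro r hr
    have h1 : r ≤ 1 / 4 := by
      have := min_le_left (ρ / 2) (1 / (4 * (μ + 1)))
      linarith [hr.2]
    have h2 : (15 : ℝ) / 16 ≤ 1 - r ^ 2 := by nlinarith [hr.1]
    have h3 : (1 : ℝ) / 2 ≤ (1 - r ^ 2) ^ 2 := by nlinarith
    simp only [hw]
    rw [abs_of_pos (by positivity), div_le_iff₀ (by linarith)]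
    nlinarith
  rcases mode_dichotomy hmode hwc hr0p hr0ρ hwb hW with ⟨m, H, hH, hGH, hne⟩ | hzero
  · right
    obtain ⟨A, θ0, hA, hA', hp⟩ := hH.profile hρ hne
    refine ⟨m, A, θ0, ρ, H, hρ, by linarith, hA, hA', hH.smooth, hH.per, hp, ?_, ?_⟩
    · exact fun s hs => (hmem s.1 (by linarith) s.2).2
    · intro s hs
      rw [← hGe s hs, hGH]
  · left
    have ht : ContinuousAt (tfun q.1 q.2) q :=
      ((tfun_smooth (a := q.1) hqH).contDiffAt (isOpen_H2.mem_nhds hqH)).continuousAt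
    have h0 : tfun q.1 q.2 q = 0 := tfun_self q.1 q.2
    have hev : ∀ᶠ p in 𝓝 q, tfun q.1 q.2 p < r0 ^ 2 :=
      ht.eventually (gt_mem_nhds (by rw [h0]; positivity))
    filter_upwards [hev, isOpen_H2.mem_nhds hqH] with p hp hpH
    obtain ⟨r, θ, hr, -, hr2, rfl⟩ := exists_polar hqH hpH
    rw [← hr2] at hp
    have hrr : r < r0 := lt_of_pow_lt_pow_left₀ 2 hr0p.le hp
    rw [← hGe (r, θ) (by simp only; rw [abs_of_nonneg hr]; linarith)]
    exact hzero r ⟨hr, hrr.le⟩ θ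

section nodal

variable {Ω : Set (ℝ × ℝ)} {z : ℝ × ℝ → ℝ} {q : ℝ × ℝ} {m : ℕ} {A θ0 ρ : ℝ} {H : ℝ × ℝ → ℝ}

lemma mem_polDom_of_lt (h : ρ < 1) {s : ℝ × ℝ} (hs : |s.1| < ρ) : s ∈ polDom := hs.trans h

lemma eventually_polar (hq : q ∈ H2) {δ : ℝ} (hδ : 0 < δ) :
    ∀ᶠ p in 𝓝 q, ∃ r θ, 0 ≤ r ∧ r < δ ∧ r < 1 ∧ pol q (r, θ) = p := by
  have ht : ContinuousAt (tfun q.1 q.2) q :=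
    ((tfun_smooth (a := q.1) hq).contDiffAt (isOpen_H2.mem_nhds hq)).continuousAt
  have h0 : tfun q.1 q.2 q = 0 := tfun_self q.1 q.2
  have hev : ∀ᶠ p in 𝓝 q, tfun q.1 q.2 p < δ ^ 2 :=
    ht.eventually (gt_mem_nhds (by rw [h0]; positivity))
  filter_upwards [hev, isOpen_H2.mem_nhds hq] with p hp hpH
  obtain ⟨r, θ, hr, hr1, hr2, h⟩ := exists_polar hq hpH
  rw [← hr2] at hp
  exact ⟨r, θ, hr, lt_of_pow_lt_pow_left₀ 2 hδ.le hp, hr1, h⟩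

lemma tendsto_pol (q : ℝ × ℝ) (θ : ℝ) : Tendsto (fun r => pol q (r, θ)) (𝓝 0) (𝓝 q) := by
  have h0 : ((0 : ℝ), θ) ∈ polDom := by simp [polDom]
  have := ((pol_smooth q).contDiffAt (isOpen_polDom.mem_nhds h0)).continuousAt
  have h2 : Tendsto (fun r : ℝ => (r, θ)) (𝓝 0) (𝓝 (0, θ)) :=
    (Continuous.prodMk_left θ).tendsto 0
  have h3 := this.tendsto.comp h2
  rw [pol_zero] at h3
  exact h3

namespace LocalForm

lemma tendsto_H (h : LocalForm z Ω q m A θ0 ρ H) (θ : ℝ) :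
    Tendsto (fun r => H (r, θ)) (𝓝 0) (𝓝 (A * Real.cos (m * (θ - θ0)))) := by
  rw [← h.profile]
  exact ((h.smooth.continuous.comp (Continuous.prodMk_left θ)).tendsto 0)

/-- Near `q` on a fixed ray the sign is that of the profile. -/
lemma eventually_pos (h : LocalForm z Ω q m A θ0 ρ H) {θ : ℝ}
    (hθ : 0 < A * Real.cos (m * (θ - θ0))) :
    ∀ᶠ r in 𝓝[>] (0 : ℝ), pol q (r, θ) ∈ Ω ∧ 0 < z (pol q (r, θ)) := by
  have h1 : ∀ᶠ r in 𝓝 (0 : ℝ), |r| < ρ :=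
    (continuous_abs.tendsto 0).eventually (gt_mem_nhds (by simpa using h.rho_pos))
  filter_upwards [nhdsWithin_le_nhds h1, self_mem_nhdsWithin,
    nhdsWithin_le_nhds ((h.tendsto_H θ).eventually (lt_mem_nhds hθ))] with r hr hr0 hH
  refine ⟨h.mem _ hr, ?_⟩
  rw [h.val _ hr]
  exact mul_pos (pow_pos hr0 _) hH

lemma eventually_neg (h : LocalForm z Ω q m A θ0 ρ H) {θ : ℝ}
    (hθ : A * Real.cos (m * (θ - θ0)) < 0) :
    ∀ᶠ r in 𝓝[>] (0 : ℝ), pol q (r, θ) ∈ Ω ∧ z (pol q (r, θ)) < 0 := by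
  have h1 : ∀ᶠ r in 𝓝 (0 : ℝ), |r| < ρ :=
    (continuous_abs.tendsto 0).eventually (gt_mem_nhds (by simpa using h.rho_pos))
  filter_upwards [nhdsWithin_le_nhds h1, self_mem_nhdsWithin,
    nhdsWithin_le_nhds ((h.tendsto_H θ).eventually (gt_mem_nhds hθ))] with r hr hr0 hH
  refine ⟨h.mem _ hr, ?_⟩
  rw [h.val _ hr]
  exact mul_neg_of_pos_of_neg (pow_pos hr0 _) hH

lemma order_ne_zero (h : LocalForm z Ω q m A θ0 ρ H) (hz : z q = 0) : m ≠ 0 := by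
  rintro rfl
  have := h.val (0, 0) (by simpa using h.rho_pos)
  rw [pol_zero, hz, h.profile] at this
  simp at this
  exact h.amp_ne this.symm

lemma exists_pos (h : LocalForm z Ω q m A θ0 ρ H) (hz : z q = 0) {U : Set (ℝ × ℝ)}
    (hU : U ∈ 𝓝 q) : ∃ p ∈ U, 0 < z p := by
  have hA := h.amp_pos (h.order_ne_zero hz)
  have h1 := h.eventually_pos (θ := θ0) (by simpa using hA)
  have h2 : ∀ᶠ r in 𝓝[>] (0 : ℝ), pol q (r, θ0) ∈ U :=
    nhdsWithin_le_nhds ((tendsto_pol q θ0).eventually hU)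
  obtain ⟨r, hr⟩ := (h1.and h2).exists
  exact ⟨_, hr.2, hr.1.2⟩

lemma order_ge_two (h : LocalForm z Ω q m A θ0 ρ H) (ho : IsOpen Ω)
    (hs : ContDiffOn ℝ (⊤ : ℕ∞) z Ω) (hq : q ∈ Ω) (hz : z q = 0) (hd : fderiv ℝ z q = 0) :
    2 ≤ m := by
  have hm := h.order_ne_zero hz
  have hA := h.amp_pos hm
  by_contra hlt
  have hm1 : m = 1 := by omega
  subst hm1
  have h0 : ((0 : ℝ), θ0) ∈ polDom := by simp [polDom]
  have hp0 := pol_zero q θ0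
  have e1 : pdx (fun t => z (pol q t)) (0, θ0) = 0 := by
    rw [pdx_comp_pol (by rw [hp0]; exact hs.diffAt ho hq) h0, hp0]
    simp [pdx, pdy, hd]
  have hev : (fun t => z (pol q t)) =ᶠ[𝓝 ((0 : ℝ), θ0)] fun t => t.1 * H t := by
    have : ∀ᶠ t : ℝ × ℝ in 𝓝 ((0 : ℝ), θ0), |t.1| < ρ :=
      (continuous_fst.abs.tendsto ((0 : ℝ), θ0)).eventually
        (gt_mem_nhds (by simpa using h.rho_pos))
    filter_upwards [this] with t ht
    rw [h.val t ht, pow_one]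
  rw [pdx_congr hev, pdx_mul differentiableAt_fst
    (h.smooth.differentiable (by simp)).differentiableAt] at e1
  have a1 : pdx (fun t : ℝ × ℝ => t.1) (0, θ0) = 1 := by simp [pdx, fderiv_fst]
  rw [a1, h.profile] at e1
  simp at e1
  exact hA.ne' e1

lemma uniform_nondeg (h : LocalForm z Ω q m A θ0 ρ H) :
    ∃ δ > 0, ∀ r, |r| < δ → ∀ θ, H (r, θ) ≠ 0 ∨ pdy H (r, θ) ≠ 0 := by
  have hd : Differentiable ℝ H := h.smooth.differentiable (by simp)
  refine uniform_angle (Q := fun s => H s ≠ 0 ∨ pdy H s ≠ 0) ?_ ?_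
  · intro r θ
    have e1 := (hasDerivAt_snd hd r (θ + 2 * Real.pi)).comp_add_const θ (2 * Real.pi)
    simp only [h.per] at e1
    rw [h.per, e1.unique (hasDerivAt_snd hd r θ)]
  · intro θ
    have hne : H (0, θ) ≠ 0 ∨ pdy H (0, θ) ≠ 0 := by
      by_contra hcon
      push Not at hcon
      obtain ⟨h1, h2⟩ := hcon
      have hlin : HasDerivAt (fun x : ℝ => (m : ℝ) * (x - θ0)) m θ := by
        simpa using ((hasDerivAt_id θ).sub_const θ0).const_mul (m : ℝ)
      have e2 := ((Real.hasDerivAt_cos _).comp θ hlin).const_mul A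
      have e3 := hasDerivAt_snd hd 0 θ
      simp only [h.profile] at e3
      have e4 := e3.unique e2
      rw [h2] at e4
      rw [h.profile] at h1
      have hc := (mul_eq_zero.1 h1).resolve_left h.amp_ne
      by_cases hm : m = 0
      · subst hm; simp at hc
      have e5 := (mul_eq_zero.1 e4.symm).resolve_left h.amp_ne
      have e6 := (mul_eq_zero.1 e5).resolve_right (Nat.cast_ne_zero.2 hm)
      have := Real.sin_sq_add_cos_sq ((m : ℝ) * (θ - θ0))
      rw [hc, neg_eq_zero.1 e6] at this
      norm_num at this
    have c0 : Continuous H := h.smooth.continuous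
    have c1 : Continuous (pdy H) := h.smooth.pdy_smooth.continuous
    rcases hne with hne | hne
    · exact (c0.continuousAt.eventually_ne hne).mono fun _ h => Or.inl h
    · exact (c1.continuousAt.eventually_ne hne).mono fun _ h => Or.inr h

/-- Critical zeros are isolated. -/
lemma isolated (h : LocalForm z Ω q m A θ0 ρ H) (ho : IsOpen Ω) (hΩ : Ω ⊆ H2)
    (hs : ContDiffOn ℝ (⊤ : ℕ∞) z Ω) (hq : q ∈ Ω) :
    ∀ᶠ p in 𝓝[≠] q, z p = 0 → fderiv ℝ z p ≠ 0 := by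
  obtain ⟨δ, hδ, hnd⟩ := h.uniform_nondeg
  have hd : Differentiable ℝ H := h.smooth.differentiable (by simp)
  have hev := eventually_polar (hΩ hq) (lt_min hδ h.rho_pos)
  filter_upwards [nhdsWithin_le_nhds hev, self_mem_nhdsWithin] with p hp hne hzp hdp
  obtain ⟨r, θ, hr0, hr, -, rfl⟩ := hp
  have hrδ : |r| < δ := by rw [abs_of_nonneg hr0]; exact hr.trans_le (min_le_left _ _)
  have hrρ : |r| < ρ := by rw [abs_of_nonneg hr0]; exact hr.trans_le (min_le_right _ _)
  have hr' : r ≠ 0 := by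
    rintro rfl
    exact hne (pol_zero q θ)
  have hsd : ((r, θ) : ℝ × ℝ) ∈ polDom := mem_polDom_of_lt h.rho_lt hrρ
  have hm := h.mem (r, θ) hrρ
  rw [h.val (r, θ) hrρ] at hzp
  have hH : H (r, θ) = 0 := (mul_eq_zero.1 hzp).resolve_left (pow_ne_zero _ hr')
  have hH' := (hnd r hrδ θ).resolve_left (not_not.2 hH)
  have e1 : pdy (fun t => z (pol q t)) (r, θ) = 0 := by
    rw [pdy_comp_pol (hs.diffAt ho hm) hsd]
    simp [pdx, pdy, hdp]
  have hev : (fun t => z (pol q t)) =ᶠ[𝓝 (r, θ)] fun t => t.1 ^ m * H t := by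
    have : ∀ᶠ t : ℝ × ℝ in 𝓝 (r, θ), |t.1| < ρ :=
      (continuous_fst.abs.tendsto (r, θ)).eventually (gt_mem_nhds hrρ)
    filter_upwards [this] with t ht
    rw [h.val t ht]
  have hfst : DifferentiableAt ℝ (fun t : ℝ × ℝ => t.1 ^ m) (r, θ) := by fun_prop
  rw [pdy_congr hev, pdy_mul hfst hd.differentiableAt] at e1
  have a2 : pdy (fun t : ℝ × ℝ => t.1 ^ m) (r, θ) = 0 :=
    pdy_eq_of_hasDerivAt hfst (hasDerivAt_const θ (r ^ m))
  rw [a2, hH] at e1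
  simp [hr', hH'] at e1

end LocalForm

/-- Unique continuation. -/
theorem unique_continuation {μ : ℝ} (ho : IsOpen Ω) (hΩ : Ω ⊆ H2) (hc : IsPreconnected Ω)
    (hμ : 0 < μ) (hz : ContDiffOn ℝ (⊤ : ℕ∞) z Ω) (heq : ∀ p ∈ Ω, -hypLap z p = μ * z p) :
    (∀ p ∈ Ω, z p = 0) ∨ ∀ q ∈ Ω, ∃ m A θ0 ρ H, LocalForm z Ω q m A θ0 ρ H := by
  set U := {q | ∀ᶠ p in 𝓝 q, z p = 0} with hU
  set V := {q | ∀ᶠ p in 𝓝[≠] q, z p = 0 → fderiv ℝ z p ≠ 0} with hV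
  have hUV : ∀ q, (∃ᶠ p in 𝓝[≠] q, p ∈ U) → q ∉ V := by
    intro q hf hv
    obtain ⟨p, hpU, hp⟩ := (hf.and_eventually hv).exists
    have : z =ᶠ[𝓝 p] fun _ => 0 := hpU
    refine hp this.self_of_nhds ?_
    rw [this.fderiv_eq]; simp
  have hUo : IsOpen U := isOpen_iff_mem_nhds.2 fun q hq => hq.eventually_nhds
  by_cases hall : ∃ q ∈ Ω, q ∈ U
  · left
    have hne : ∀ q ∈ Ω, q ∈ U ∨ q ∈ V := fun q hq => by
      rcases local_structure ho hΩ hμ hz heq hq with h | ⟨m, A, θ0, ρ, H, h⟩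
      · exact Or.inl h
      · exact Or.inr (h.isolated ho hΩ hz hq)
    have hsub : Ω ⊆ U := by
      refine hc.subset_of_closure_inter_subset hUo ?_ ?_
      · obtain ⟨q, hq, hqU⟩ := hall
        exact ⟨q, hq, hqU⟩
      · rintro q ⟨hqc, hq⟩
        by_contra hqU
        refine hUV q ?_ ((hne q hq).resolve_left hqU)
        have h1 : ∃ᶠ p in 𝓝 q, p ∈ U := mem_closure_iff_frequently.1 hqc
        rw [frequently_nhdsWithin_iff]
        refine h1.mono fun p hp => ⟨hp, ?_⟩
        rintro rfl
        exact hqU hp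
    exact fun p hp => (hsub hp).self_of_nhds
  · right
    intro q hq
    push Not at hall
    rcases local_structure ho hΩ hμ hz heq hq with h | h
    · exact absurd h (hall q hq)
    · exact h

/-- Punctured neighbourhoods contain preconnected punctured neighbourhoods. -/
lemma exists_punctured_preconnected (hq : q ∈ H2) {U : Set (ℝ × ℝ)} (hU : U ∈ 𝓝 q) :
    ∃ P : Set (ℝ × ℝ), P ⊆ U ∧ IsPreconnected P ∧ P ∈ 𝓝[≠] q ∧ q ∉ P := by
  obtain ⟨δ, hδ, h⟩ := uniform_angle (Q := fun s => s ∈ polDom ∧ pol q s ∈ U)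
    (fun r θ => by rw [pol_per]; rfl) (fun θ => by
      have h0 : ((0 : ℝ), θ) ∈ polDom := by simp [polDom]
      have h1 : ∀ᶠ s in 𝓝 ((0 : ℝ), θ), s ∈ polDom := isOpen_polDom.mem_nhds h0
      refine h1.and ?_
      refine ((pol_smooth q).contDiffAt (isOpen_polDom.mem_nhds h0)).continuousAt.eventually ?_
      rwa [pol_zero])
  have hb : ∀ s ∈ Ioo 0 δ ×ˢ (univ : Set ℝ), s ∈ polDom ∧ pol q s ∈ U := fun s hs =>
    h s.1 (by rw [abs_of_pos hs.1.1]; exact hs.1.2) s.2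
  refine ⟨pol q '' (Ioo 0 δ ×ˢ univ), ?_, ?_, ?_, ?_⟩
  · rintro _ ⟨s, hs, rfl⟩
    exact (hb s hs).2
  · refine (isPreconnected_Ioo.prod isPreconnected_univ).image _ ?_
    exact (pol_smooth q).continuousOn.mono fun s hs => (hb s hs).1
  · filter_upwards [nhdsWithin_le_nhds (eventually_polar hq hδ), self_mem_nhdsWithin] with p hp hne
    obtain ⟨r, θ, hr0, hr, -, rfl⟩ := hp
    refine ⟨(r, θ), ⟨⟨lt_of_le_of_ne hr0 ?_, hr⟩, mem_univ _⟩, rfl⟩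
    rintro rfl
    exact hne (pol_zero q θ)
  · rintro ⟨s, hs, he⟩
    have h1 := tfun_pol hq (hb s hs).1
    rw [he, tfun_self] at h1
    have : 0 < s.1 := hs.1.1
    nlinarith

/-- A boundary component of a negativity domain contains a non-critical point. -/
lemma exists_regular_frontier {D : Set (ℝ × ℝ)} (ho : IsOpen Ω) (hΩ : Ω ⊆ H2)
    (hz : ContDiffOn ℝ (⊤ : ℕ∞) z Ω)
    (hloc : ∀ q ∈ Ω, ∃ m A θ0 ρ H, LocalForm z Ω q m A θ0 ρ H)
    (hDneg : ∀ p ∈ D, z p < 0) (hfr : ∀ p ∈ Ω ∩ frontier D, z p = 0)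
    (hne : (Ω ∩ frontier D).Nonempty) (hDo : IsOpen D) :
    ∃ q ∈ Ω ∩ frontier D, fderiv ℝ z q ≠ 0 := by
  by_contra hcon
  push Not at hcon
  obtain ⟨q, hqΩ, hqD⟩ := hne
  obtain ⟨m, A, θ0, ρ, H, h⟩ := hloc q hqΩ
  have hz0 := hfr q ⟨hqΩ, hqD⟩
  have h1 : {p | p ≠ q → p ∉ frontier D} ∩ Ω ∈ 𝓝 q := by
    have h3 := eventually_nhdsWithin_iff.1 (h.isolated ho hΩ hz hqΩ)
    filter_upwards [h3, ho.mem_nhds hqΩ] with p hp hpΩ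
    exact ⟨fun hpq hpD => hp hpq (hfr p ⟨hpΩ, hpD⟩) (hcon p ⟨hpΩ, hpD⟩), hpΩ⟩
  obtain ⟨P, hPU, hPc, hPn, hqP⟩ := exists_punctured_preconnected (hΩ hqΩ) h1
  have hPfr : ∀ p ∈ P, p ∉ frontier D := fun p hp => (hPU hp).1 (by rintro rfl; exact hqP hp)
  have hqnD : q ∉ D := fun hq => by
    have := hDneg q hq
    linarith
  have hPD : (P ∩ D).Nonempty := by
    have hqc : q ∈ closure D := frontier_subset_closure hqD
    have h2 : ∃ᶠ p in 𝓝 q, p ∈ D := mem_closure_iff_frequently.1 hqc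
    have h4 := eventually_nhdsWithin_iff.1 hPn
    obtain ⟨p, hpD, hp⟩ := (h2.and_eventually h4).exists
    exact ⟨p, hp (by rintro rfl; exact hqnD hpD), hpD⟩
  have hsub : P ⊆ D := by
    refine hPc.subset_of_closure_inter_subset hDo hPD ?_
    rintro p ⟨hpc, hp⟩
    by_contra hpD
    refine hPfr p hp ?_
    rw [frontier, hDo.interior_eq]
    exact ⟨hpc, hpD⟩
  have h5 : insert q P ∈ 𝓝 q := insert_mem_nhds_iff.2 hPn
  obtain ⟨p, hp, hpos⟩ := h.exists_pos hz0 h5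
  rcases hp with rfl | hp
  · linarith
  · linarith [hDneg p (hsub hp)]

end nodal

/-- Bounded domains of the hyperbolic plane. -/
structure BddDom (Ω : Set (ℝ × ℝ)) : Prop where
  nonempty : Ω.Nonempty
  isOpen : IsOpen Ω
  preconn : IsPreconnected Ω
  compact : IsCompact (closure Ω)
  closure_sub : closure Ω ⊆ H2

/-- The variational inequality characterizing a lower bound for the Neumann spectrum. -/
def VarIneq (Ω : Set (ℝ × ℝ)) (μ : ℝ) : Prop :=
  ∀ w : ℝ × ℝ → ℝ, ContDiffOn ℝ (⊤ : ℕ∞) w Ω →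
    (∫ p in Ω, w p / p.2 ^ 2) = 0 →
    IntegrableOn (fun p : ℝ × ℝ => w p ^ 2 / p.2 ^ 2) Ω volume →
    IntegrableOn (gradSq w) Ω volume →
    μ * ∫ p in Ω, w p ^ 2 / p.2 ^ 2 ≤ ∫ p in Ω, gradSq w p

namespace BddDom
variable {Ω : Set (ℝ × ℝ)} (D : BddDom Ω)
include D

lemma sub : Ω ⊆ H2 := subset_closure.trans D.closure_sub

lemma volume_lt_top : volume Ω < ⊤ :=
  (measure_mono subset_closure).trans_lt D.compact.measure_lt_top

lemma exists_y : ∃ y0 > 0, ∀ p ∈ closure Ω, y0 ≤ p.2 := by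
  obtain ⟨p0, hp0, hmin⟩ := D.compact.exists_isMinOn (D.nonempty.mono subset_closure)
    continuous_snd.continuousOn
  exact ⟨p0.2, D.closure_sub hp0, fun p hp => hmin hp⟩

lemma exists_dens : ∃ C > 0, ∀ p ∈ closure Ω, 1 / p.2 ^ 2 ≤ C := by
  obtain ⟨y0, hy0, h⟩ := D.exists_y
  refine ⟨1 / y0 ^ 2, by positivity, fun p hp => ?_⟩
  have := h p hp
  gcongr

lemma integrableOn {f : ℝ × ℝ → ℝ} (hf : AEStronglyMeasurable f (volume.restrict Ω)) {C : ℝ}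
    (hb : ∀ p ∈ Ω, |f p| ≤ C) : IntegrableOn f Ω := by
  refine IntegrableOn.of_bound D.volume_lt_top hf C ?_
  exact (ae_restrict_mem D.isOpen.measurableSet).mono fun p hp => by simpa using hb p hp

lemma integrableOn_of_cont {f : ℝ × ℝ → ℝ} (hf : ContinuousOn f Ω) {C : ℝ}
    (hb : ∀ p ∈ Ω, |f p| ≤ C) : IntegrableOn f Ω :=
  D.integrableOn (hf.aestronglyMeasurable D.isOpen.measurableSet) hb

omit D in
lemma measurable_dens : AEStronglyMeasurable (fun p : ℝ × ℝ => 1 / p.2 ^ 2)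
    (volume.restrict Ω) := by
  refine (Measurable.aestronglyMeasurable ?_)
  fun_prop

lemma integrableOn_div {f : ℝ × ℝ → ℝ} (hf : AEStronglyMeasurable f (volume.restrict Ω)) {C : ℝ}
    (hb : ∀ p ∈ Ω, |f p| ≤ C) : IntegrableOn (fun p => f p / p.2 ^ 2) Ω := by
  obtain ⟨K, hK, h⟩ := D.exists_dens
  have e : (fun p : ℝ × ℝ => f p / p.2 ^ 2) = fun p => f p * (1 / p.2 ^ 2) := by
    funext p; ring
  rw [e]
  refine D.integrableOn (hf.mul measurable_dens) (C := C * K) fun p hp => ?_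
  have h1 := h p (subset_closure hp)
  have h2 := hb p hp
  have h3 : (0 : ℝ) ≤ 1 / p.2 ^ 2 := by positivity
  rw [abs_mul, abs_of_nonneg h3]
  have := abs_nonneg (f p)
  have : 0 ≤ C := this.trans h2
  gcongr

lemma integrableOn_div_of_cont {f : ℝ × ℝ → ℝ} (hf : ContinuousOn f Ω) {C : ℝ}
    (hb : ∀ p ∈ Ω, |f p| ≤ C) : IntegrableOn (fun p => f p / p.2 ^ 2) Ω :=
  D.integrableOn_div (hf.aestronglyMeasurable D.isOpen.measurableSet) hb

lemma area_pos : 0 < ∫ p in Ω, 1 / p.2 ^ 2 := by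
  have hi : IntegrableOn (fun p : ℝ × ℝ => 1 / p.2 ^ 2) Ω :=
    D.integrableOn_div_of_cont (f := fun _ => 1) continuousOn_const (C := 1) (by simp)
  rw [setIntegral_pos_iff_support_of_nonneg_ae
    ((ae_restrict_mem D.isOpen.measurableSet).mono fun p _ => by simp only [Pi.zero_apply]; positivity) hi]
  have : Function.support (fun p : ℝ × ℝ => 1 / p.2 ^ 2) ∩ Ω = Ω := by
    refine inter_eq_right.2 fun p hp => ?_
    have : 0 < p.2 := D.sub hp
    simp only [Function.mem_support]
    positivity
  rw [this]
  exact D.isOpen.measure_pos _ D.nonempty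

/-- The variational inequality for functions of arbitrary mean. -/
lemma varIneq_general {μ : ℝ} (hv : VarIneq Ω μ) {w : ℝ × ℝ → ℝ}
    (hw : ContDiffOn ℝ (⊤ : ℕ∞) w Ω) {C : ℝ} (hb : ∀ p ∈ Ω, |w p| ≤ C)
    (hg : IntegrableOn (gradSq w) Ω) :
    μ * ((∫ p in Ω, w p ^ 2 / p.2 ^ 2) - (∫ p in Ω, w p / p.2 ^ 2) ^ 2 / ∫ p in Ω, 1 / p.2 ^ 2) ≤
      ∫ p in Ω, gradSq w p := by
  set A := ∫ p in Ω, 1 / p.2 ^ 2 with hA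
  have hApos : 0 < A := D.area_pos
  set M := ∫ p in Ω, w p / p.2 ^ 2
  set c := M / A
  have i0 : IntegrableOn (fun p : ℝ × ℝ => 1 / p.2 ^ 2) Ω :=
    D.integrableOn_div_of_cont (f := fun _ => 1) continuousOn_const (C := 1) (by simp)
  have i1 : IntegrableOn (fun p : ℝ × ℝ => w p / p.2 ^ 2) Ω :=
    D.integrableOn_div_of_cont hw.continuousOn hb
  have i2 : IntegrableOn (fun p : ℝ × ℝ => w p ^ 2 / p.2 ^ 2) Ω :=
    D.integrableOn_div_of_cont (hw.continuousOn.pow 2) (C := C ^ 2) fun p hp => by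
      rw [abs_pow]; exact pow_le_pow_left₀ (abs_nonneg _) (hb p hp) 2
  have hgr : ∀ p ∈ Ω, gradSq (fun p => w p - c) p = gradSq w p := by
    intro p hp
    simp [gradSq, pdx, pdy, fderiv_sub_const]
  have e0 : ∫ p in Ω, (w p - c) / p.2 ^ 2 = 0 := by
    have : ∀ p : ℝ × ℝ, (w p - c) / p.2 ^ 2 = w p / p.2 ^ 2 - c * (1 / p.2 ^ 2) := fun p => by ring
    simp only [this]
    rw [integral_sub i1 (i0.const_mul c), integral_const_mul, ← hA]
    simp only [c]
    field_simp
    simp [M]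
  have e2 : ∫ p in Ω, (w p - c) ^ 2 / p.2 ^ 2 = (∫ p in Ω, w p ^ 2 / p.2 ^ 2) - M ^ 2 / A := by
    have : ∀ p : ℝ × ℝ, (w p - c) ^ 2 / p.2 ^ 2 =
        (w p ^ 2 / p.2 ^ 2 - (2 * c) * (w p / p.2 ^ 2)) + c ^ 2 * (1 / p.2 ^ 2) := fun p => by ring
    simp only [this]
    have i3 : IntegrableOn (fun p : ℝ × ℝ => w p ^ 2 / p.2 ^ 2 - (2 * c) * (w p / p.2 ^ 2)) Ω :=
      i2.sub (i1.const_mul _)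
    rw [integral_add i3 (i0.const_mul _), integral_sub i2 (i1.const_mul _),
      integral_const_mul, integral_const_mul, ← hA]
    simp only [c]
    field_simp
    ring
  have := hv (fun p => w p - c) (hw.sub contDiffOn_const) e0 ?_ ?_
  · rw [e2, setIntegral_congr_fun D.isOpen.measurableSet hgr] at this
    exact this
  · have : (fun p : ℝ × ℝ => (w p - c) ^ 2 / p.2 ^ 2) = fun p =>
        (w p ^ 2 / p.2 ^ 2 - (2 * c) * (w p / p.2 ^ 2)) + c ^ 2 * (1 / p.2 ^ 2) := by
      funext p; ring
    rw [this]
    exact (i2.sub (i1.const_mul _)).add (i0.const_mul _)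
  · exact hg.congr_fun (fun p hp => (hgr p hp).symm) D.isOpen.measurableSet

end BddDom

lemma exists_cutoff_line : ∃ (ψ : ℝ → ℝ) (L : ℝ), ContDiff ℝ (⊤ : ℕ∞) ψ ∧ 0 ≤ L ∧
    (∀ t, 0 ≤ ψ t ∧ ψ t ≤ 1) ∧ (∀ t, |t| ≤ 1 → ψ t = 1) ∧ (∀ t, 2 ≤ |t| → ψ t = 0) ∧
    (∀ t, |deriv ψ t| ≤ L) ∧ ∀ t, 2 ≤ |t| → deriv ψ t = 0 := by
  let b : ContDiffBump (0 : ℝ) := ⟨1, 2, by norm_num, by norm_num⟩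
  have hb : ContDiff ℝ (⊤ : ℕ∞) (b : ℝ → ℝ) := b.contDiff
  have hc : HasCompactSupport (b : ℝ → ℝ) := b.hasCompactSupport
  obtain ⟨L, hL⟩ := hc.deriv.exists_bound_of_continuous
    (hb.continuous_deriv (by simp : (1 : WithTop ℕ∞) ≤ _))
  have h0 : ∀ t, 2 ≤ |t| → b t = 0 := fun t ht => b.zero_of_le_dist (by simpa using ht)
  refine ⟨b, L, hb, (norm_nonneg _).trans (hL 0), fun t => ⟨b.nonneg, b.le_one⟩, fun t ht => ?_,
    h0, hL, fun t ht => ?_⟩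
  · exact b.one_of_mem_closedBall (by simpa using ht)
  · have hmin : IsLocalMin (b : ℝ → ℝ) t :=
      Eventually.of_forall fun s => by rw [h0 t ht]; exact b.nonneg
    exact hmin.deriv_eq_zero

lemma volume_closedBall_plane (a : ℝ × ℝ) {r : ℝ} (hr : 0 ≤ r) :
    volume.real (Metric.closedBall a r) = 4 * r ^ 2 := by
  rw [← closedBall_prod_same, Measure.volume_eq_prod, measureReal_prod_prod]
  simp only [Measure.real, Real.volume_closedBall]
  rw [ENNReal.toReal_ofReal (mul_nonneg zero_le_two hr)]
  ring

lemma exists_grid_point {d r : ℝ} (h : |d| ≤ 2 * r) :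
    ∃ i ∈ Finset.range 4, |d - ((i : ℝ) - 3 / 2) * r| ≤ r / 2 := by
  have := abs_le.1 h
  rcases le_total d (-r) with h1 | h1
  · exact ⟨0, by simp, abs_le.2 ⟨by push_cast; linarith, by push_cast; linarith⟩⟩
  rcases le_total d 0 with h2 | h2
  · exact ⟨1, by simp, abs_le.2 ⟨by push_cast; linarith, by push_cast; linarith⟩⟩
  rcases le_total d r with h3 | h3
  · exact ⟨2, by simp, abs_le.2 ⟨by push_cast; linarith, by push_cast; linarith⟩⟩
  · exact ⟨3, by simp, abs_le.2 ⟨by push_cast; linarith, by push_cast; linarith⟩⟩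

/-- Hyperbolic area of the part of `Ω` in `S`. -/
def areaIn (Ω S : Set (ℝ × ℝ)) : ℝ := ∫ p in Ω, S.indicator (fun p : ℝ × ℝ => 1 / p.2 ^ 2) p

namespace BddDom
variable {Ω : Set (ℝ × ℝ)} (D : BddDom Ω)
include D

lemma integrableOn_one_div : IntegrableOn (fun p : ℝ × ℝ => 1 / p.2 ^ 2) Ω :=
  D.integrableOn_div_of_cont (f := fun _ => 1) continuousOn_const (C := 1) (by simp)

lemma integrableOn_indicator {S : Set (ℝ × ℝ)} (hS : MeasurableSet S) :
    IntegrableOn (S.indicator (fun p : ℝ × ℝ => 1 / p.2 ^ 2)) Ω :=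
  D.integrableOn_one_div.indicator hS

lemma exists_scale : ∃ (a : ℝ × ℝ) (r : ℝ), 0 < r ∧
    (∫ p in Ω, 1 / p.2 ^ 2) / 32 ≤ areaIn Ω (Metric.closedBall a r) ∧
    ∀ a', areaIn Ω (Metric.closedBall a' (r / 2)) ≤ (∫ p in Ω, 1 / p.2 ^ 2) / 32 := by
  set A := ∫ p in Ω, 1 / p.2 ^ 2 with hA
  have hApos : 0 < A := D.area_pos
  obtain ⟨C, hC, hdens⟩ := D.exists_dens
  obtain ⟨R, hR⟩ := D.compact.isBounded.subset_closedBall 0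
  set R0 := max R 1
  have hR0 : 0 < R0 := lt_max_of_lt_right one_pos
  have hsub : Ω ⊆ Metric.closedBall 0 R0 :=
    (subset_closure.trans hR).trans (Metric.closedBall_subset_closedBall (le_max_left _ _))
  have hsmall : ∀ a r, 0 ≤ r → areaIn Ω (Metric.closedBall a r) ≤ C * (4 * r ^ 2) := by
    intro a r hr
    have hm : MeasurableSet (Metric.closedBall a r) := Metric.isClosed_closedBall.measurableSet
    have hfin : volume (Metric.closedBall a r) ≠ ⊤ := (isCompact_closedBall a r).measure_lt_top.ne
    calc areaIn Ω (Metric.closedBall a r)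
        ≤ ∫ p in Ω, (Metric.closedBall a r).indicator (fun _ => C) p := by
          refine setIntegral_mono_on (D.integrableOn_indicator hm) ?_ D.isOpen.measurableSet ?_
          · exact ((integrableOn_const hfin).integrable_indicator hm).integrableOn
          · intro p hp
            by_cases hpb : p ∈ Metric.closedBall a r
            · simpa [hpb] using hdens p (subset_closure hp)
            · simp [hpb]
      _ ≤ ∫ p, (Metric.closedBall a r).indicator (fun _ => C) p := by
          refine setIntegral_le_integral ((integrableOn_const hfin).integrable_indicator hm) ?_
          exact Eventually.of_forall fun p => indicator_nonneg (fun _ _ => hC.le) p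
      _ = C * (4 * r ^ 2) := by
          rw [integral_indicator hm, setIntegral_const, volume_closedBall_plane a hr, smul_eq_mul,
            mul_comm]
  let Q : ℕ → Prop := fun n => ∀ a, areaIn Ω (Metric.closedBall a (R0 / 2 ^ n)) ≤ A / 32
  have hex : ∃ n, Q n := by
    have hlim : Tendsto (fun n : ℕ => C * (4 * (R0 / 2 ^ n) ^ 2)) atTop (𝓝 0) := by
      have h1 : Tendsto (fun n : ℕ => R0 / 2 ^ n) atTop (𝓝 0) :=
        tendsto_const_nhds.div_atTop (tendsto_pow_atTop_atTop_of_one_lt (by norm_num))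
      simpa using ((h1.pow 2).const_mul 4).const_mul C
    obtain ⟨n, hn⟩ := (hlim.eventually (gt_mem_nhds (by positivity : 0 < A / 32))).exists
    exact ⟨n, fun a => (hsmall a _ (by positivity)).trans hn.le⟩
  classical
  have hn0 : ¬ Q 0 := by
    intro h
    have h1 := h 0
    have h2 : areaIn Ω (Metric.closedBall 0 (R0 / 2 ^ 0)) = A := by
      rw [hA, areaIn]
      refine setIntegral_congr_fun D.isOpen.measurableSet fun p hp => ?_
      exact indicator_of_mem (by simpa using hsub hp) _
    rw [h2] at h1
    linarith
  obtain ⟨k, hk⟩ : ∃ k, Nat.find hex = k + 1 :=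
    Nat.exists_eq_succ_of_ne_zero fun h => hn0 (h ▸ Nat.find_spec hex)
  have h1 : Q (k + 1) := hk ▸ Nat.find_spec hex
  have h2 : ¬ Q k := Nat.find_min hex (by omega)
  simp only [Q, not_forall, not_le] at h2
  obtain ⟨a, ha⟩ := h2
  refine ⟨a, R0 / 2 ^ k, by positivity, ha.le, fun a' => ?_⟩
  have := h1 a'
  rwa [pow_succ, ← div_div] at this

lemma area_double {a : ℝ × ℝ} {r c : ℝ}
    (h : ∀ a', areaIn Ω (Metric.closedBall a' (r / 2)) ≤ c) :
    areaIn Ω (Metric.closedBall a (2 * r)) ≤ 16 * c := by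
  let B : ℕ × ℕ → Set (ℝ × ℝ) := fun i => Metric.closedBall
    (a.1 + ((i.1 : ℝ) - 3 / 2) * r, a.2 + ((i.2 : ℝ) - 3 / 2) * r) (r / 2)
  have hB : ∀ i, MeasurableSet (B i) := fun i => Metric.isClosed_closedBall.measurableSet
  calc areaIn Ω (Metric.closedBall a (2 * r))
      ≤ ∫ p in Ω, ∑ i ∈ Finset.range 4 ×ˢ Finset.range 4,
          (B i).indicator (fun p : ℝ × ℝ => 1 / p.2 ^ 2) p := by
        refine setIntegral_mono_on
          (D.integrableOn_indicator Metric.isClosed_closedBall.measurableSet) ?_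
          D.isOpen.measurableSet ?_
        · exact integrable_finsetSum _ fun i _ => D.integrableOn_indicator (hB i)
        · intro p _
          have hnn : ∀ i ∈ Finset.range 4 ×ˢ Finset.range 4,
              0 ≤ (B i).indicator (fun p : ℝ × ℝ => 1 / p.2 ^ 2) p := fun i _ =>
            indicator_nonneg (fun q _ => by positivity) p
          by_cases hp : p ∈ Metric.closedBall a (2 * r)
          · rw [indicator_of_mem hp]
            rw [← closedBall_prod_same] at hp
            obtain ⟨i, hi, hi'⟩ := exists_grid_point hp.1
            obtain ⟨j, hj, hj'⟩ := exists_grid_point hp.2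
            have hm : p ∈ B (i, j) := by
              simp only [B]
              rw [← closedBall_prod_same]
              constructor
              · rw [Metric.mem_closedBall, Real.dist_eq]; convert hi' using 2; ring
              · rw [Metric.mem_closedBall, Real.dist_eq]; convert hj' using 2; ring
            have := Finset.single_le_sum hnn (Finset.mk_mem_product hi hj)
            rwa [indicator_of_mem hm] at this
          · rw [indicator_of_notMem hp]
            exact Finset.sum_nonneg hnn
    _ = ∑ i ∈ Finset.range 4 ×ˢ Finset.range 4, areaIn Ω (B i) := by
        rw [integral_finsetSum _ fun i _ => D.integrableOn_indicator (hB i)]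
        rfl
    _ ≤ ∑ i ∈ Finset.range 4 ×ˢ Finset.range 4, c := Finset.sum_le_sum fun i _ => h _
    _ = 16 * c := by simp

end BddDom

/-- On domains of large area the first positive Neumann eigenvalue is small. -/
theorem exists_area_eigenvalue_small : ∃ A : ℝ, 0 < A ∧ ∀ (Ω : Set (ℝ × ℝ)) (μ : ℝ), BddDom Ω →
    VarIneq Ω μ → A ≤ (∫ p in Ω, 1 / p.2 ^ 2) → μ ≤ 1 / 8 := by
  obtain ⟨ψ, L, hψ, hL, h01, h1, h2, hd, hd0⟩ := exists_cutoff_line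
  refine ⟨16384 * L ^ 2 + 1, by positivity, fun Ω μ D hv hA => ?_⟩
  set A := ∫ p in Ω, 1 / p.2 ^ 2 with hAdef
  have hApos : 0 < A := D.area_pos
  obtain ⟨a, r, hr, hbig, hhalf⟩ := D.exists_scale
  have hdouble := D.area_double (a := a) hhalf
  rw [← hAdef] at hbig hdouble
  set S := Metric.closedBall a (2 * r) with hS
  have hSm : MeasurableSet S := Metric.isClosed_closedBall.measurableSet
  let φ : ℝ × ℝ → ℝ := fun p => ψ ((p.1 - a.1) / r) * ψ ((p.2 - a.2) / r)
  have hφ : ContDiff ℝ (⊤ : ℕ∞) φ := by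
    refine ContDiff.mul (hψ.comp ?_) (hψ.comp ?_) <;> fun_prop
  have hφ01 : ∀ p, 0 ≤ φ p ∧ φ p ≤ 1 := fun p =>
    ⟨mul_nonneg (h01 _).1 (h01 _).1, mul_le_one₀ (h01 _).2 (h01 _).1 (h01 _).2⟩
  have hout : ∀ p, p ∉ S → 2 ≤ |(p.1 - a.1) / r| ∨ 2 ≤ |(p.2 - a.2) / r| := by
    intro p hp
    by_contra hcon
    push Not at hcon
    apply hp
    rw [hS, ← closedBall_prod_same]
    constructor
    · have := hcon.1
      rw [abs_div, abs_of_pos hr, div_lt_iff₀ hr] at this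
      rw [Metric.mem_closedBall, Real.dist_eq]; exact this.le
    · have := hcon.2
      rw [abs_div, abs_of_pos hr, div_lt_iff₀ hr] at this
      rw [Metric.mem_closedBall, Real.dist_eq]; exact this.le
  have hφ0 : ∀ p, p ∉ S → φ p = 0 := by
    intro p hp
    rcases hout p hp with h | h <;> simp [φ, h2 _ h]
  have hφ1 : ∀ p, p ∈ Metric.closedBall a r → φ p = 1 := by
    intro p hp
    rw [← closedBall_prod_same] at hp
    have e : ∀ d : ℝ, |d| ≤ r → |d / r| ≤ 1 := fun d hd => by
      rw [abs_div, abs_of_pos hr, div_le_one hr]; exact hd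
    simp only [φ]
    rw [h1 _ (e _ hp.1), h1 _ (e _ hp.2), one_mul]
  have hψd : ∀ t, HasDerivAt ψ (deriv ψ t) t := fun t =>
    (hψ.differentiable (by simp)).differentiableAt.hasDerivAt
  have hpx : ∀ p, pdx φ p = deriv ψ ((p.1 - a.1) / r) / r * ψ ((p.2 - a.2) / r) := by
    intro p
    refine pdx_eq_of_hasDerivAt (hφ.differentiable (by simp)).differentiableAt ?_
    have := ((hψd ((p.1 - a.1) / r)).comp p.1
      (((hasDerivAt_id p.1).sub_const a.1).div_const r)).mul_const (ψ ((p.2 - a.2) / r))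
    exact this.congr_deriv (by ring)
  have hpy : ∀ p, pdy φ p = ψ ((p.1 - a.1) / r) * (deriv ψ ((p.2 - a.2) / r) / r) := by
    intro p
    refine pdy_eq_of_hasDerivAt (hφ.differentiable (by simp)).differentiableAt ?_
    have := ((hψd ((p.2 - a.2) / r)).comp p.2
      (((hasDerivAt_id p.2).sub_const a.2).div_const r)).const_mul (ψ ((p.1 - a.1) / r))
    exact this.congr_deriv (by ring)
  have hgS : ∀ p, gradSq φ p ≤ S.indicator (fun _ => 2 * (L / r) ^ 2) p := by
    intro p
    rw [gradSq, hpx, hpy]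
    by_cases hp : p ∈ S
    · rw [indicator_of_mem hp]
      have e : ∀ s t : ℝ, (deriv ψ s / r * ψ t) ^ 2 ≤ (L / r) ^ 2 := by
        intro s t
        rw [sq_le_sq, abs_mul, abs_div, abs_of_pos hr, abs_of_nonneg (div_nonneg hL hr.le),
          abs_of_nonneg (h01 t).1]
        calc |deriv ψ s| / r * ψ t ≤ L / r * 1 := by
              have h3 := h01 t
              have := hd s
              gcongr
              exacts [h3.1, h3.2]
          _ = L / r := mul_one _
      have e1 := e ((p.1 - a.1) / r) ((p.2 - a.2) / r)
      have e2 := e ((p.2 - a.2) / r) ((p.1 - a.1) / r)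
      rw [mul_comm] at e2
      linarith
    · rw [indicator_of_notMem hp]
      rcases hout p hp with h | h <;> simp [hd0 _ h, h2 _ h]
  have hfinS : volume S ≠ ⊤ := (isCompact_closedBall a (2 * r)).measure_lt_top.ne
  have hgc : ContinuousOn (gradSq φ) Ω := by
    have h := (hφ.pdx_smooth.continuous.pow 2).add (hφ.pdy_smooth.continuous.pow 2)
    exact h.continuousOn
  have hgi : IntegrableOn (gradSq φ) Ω := by
    refine D.integrableOn_of_cont hgc (C := 2 * (L / r) ^ 2) fun p _ => ?_
    rw [abs_of_nonneg (by unfold gradSq; positivity)]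
    refine (hgS p).trans ?_
    by_cases hp : p ∈ S
    · rw [indicator_of_mem hp]
    · rw [indicator_of_notMem hp]; positivity
  have hE : ∫ p in Ω, gradSq φ p ≤ 32 * L ^ 2 := by
    have hind : Integrable (S.indicator (fun _ : ℝ × ℝ => 2 * (L / r) ^ 2)) :=
      (integrableOn_const hfinS).integrable_indicator hSm
    calc ∫ p in Ω, gradSq φ p ≤ ∫ p in Ω, S.indicator (fun _ => 2 * (L / r) ^ 2) p :=
          setIntegral_mono_on hgi hind.integrableOn D.isOpen.measurableSet fun p _ => hgS p
      _ ≤ ∫ p, S.indicator (fun _ => 2 * (L / r) ^ 2) p :=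
          setIntegral_le_integral hind
            (Eventually.of_forall fun p => indicator_nonneg (fun _ _ => by positivity) p)
      _ = 32 * L ^ 2 := by
          rw [integral_indicator hSm, setIntegral_const,
            volume_closedBall_plane a (by positivity), smul_eq_mul]
          field_simp
          ring
  have hb : ∀ p ∈ Ω, |φ p| ≤ 1 := fun p _ => by
    rw [abs_of_nonneg (hφ01 p).1]; exact (hφ01 p).2
  have hvar := D.varIneq_general hv hφ.contDiffOn hb hgi
  rw [← hAdef] at hvar
  set m := ∫ p in Ω, φ p / p.2 ^ 2
  set M := ∫ p in Ω, φ p ^ 2 / p.2 ^ 2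
  have i1 : IntegrableOn (fun p : ℝ × ℝ => φ p / p.2 ^ 2) Ω :=
    D.integrableOn_div_of_cont hφ.continuous.continuousOn hb
  have i2 : IntegrableOn (fun p : ℝ × ℝ => φ p ^ 2 / p.2 ^ 2) Ω :=
    D.integrableOn_div_of_cont (hφ.continuous.pow 2).continuousOn (C := 1) fun p hp => by
      rw [abs_pow]; exact pow_le_one₀ (abs_nonneg _) (hb p hp)
  have hM : A / 32 ≤ M := by
    refine hbig.trans (setIntegral_mono_on
      (D.integrableOn_indicator Metric.isClosed_closedBall.measurableSet) i2
      D.isOpen.measurableSet fun p _ => ?_)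
    by_cases hp : p ∈ Metric.closedBall a r
    · rw [indicator_of_mem hp, hφ1 p hp, one_pow]
    · rw [indicator_of_notMem hp]; positivity
  have hCS : m ^ 2 / A ≤ M / 2 := by
    set l := 2 * m / A
    have i3 : IntegrableOn (fun p : ℝ × ℝ => φ p ^ 2 / p.2 ^ 2 - 2 * l * (φ p / p.2 ^ 2)) Ω :=
      i2.sub (i1.const_mul _)
    have h0 : 0 ≤ ∫ p in Ω, (φ p ^ 2 / p.2 ^ 2 - 2 * l * (φ p / p.2 ^ 2) +
        l ^ 2 * S.indicator (fun p : ℝ × ℝ => 1 / p.2 ^ 2) p) := by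
      refine integral_nonneg fun p => ?_
      by_cases hp : p ∈ S
      · simp only [Pi.zero_apply]
        rw [indicator_of_mem hp]
        have : φ p ^ 2 / p.2 ^ 2 - 2 * l * (φ p / p.2 ^ 2) + l ^ 2 * (1 / p.2 ^ 2) =
          (φ p - l) ^ 2 / p.2 ^ 2 := by ring
        rw [this]; positivity
      · simp [indicator_of_notMem hp, hφ0 p hp]
    rw [integral_add i3 ((D.integrableOn_indicator hSm).const_mul _),
      integral_sub i2 (i1.const_mul _), integral_const_mul, integral_const_mul] at h0
    change 0 ≤ M - 2 * l * m + l ^ 2 * areaIn Ω S at h0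
    have h3 : l ^ 2 * areaIn Ω S ≤ l ^ 2 * (A / 2) := by
      gcongr; linarith
    have h4 : M - 2 * l * m + l ^ 2 * (A / 2) = M - 2 * (m ^ 2 / A) := by
      simp only [l]; field_simp; ring
    linarith
  by_contra hcon
  push Not at hcon
  have h5 : (1 / 8 : ℝ) * (A / 64) ≤ μ * (M - m ^ 2 / A) := by
    have : A / 64 ≤ M - m ^ 2 / A := by linarith
    gcongr
  nlinarith

/-- The denominator of the Klein chart. -/
def kleinDen (p z : ℝ × ℝ) : ℝ := (z.1 - p.1) ^ 2 + z.2 ^ 2 + p.2 ^ 2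

/-- The Klein disc chart centred at `p`. -/
def klein (p z : ℝ × ℝ) : ℝ × ℝ :=
  (((z.1 - p.1) ^ 2 + z.2 ^ 2 - p.2 ^ 2) / kleinDen p z, -(2 * p.2 * (z.1 - p.1)) / kleinDen p z)

/-- The inverse of the Klein disc chart. -/
def kleinInv (p κ : ℝ × ℝ) : ℝ × ℝ :=
  (p.1 - p.2 * κ.2 / (1 - κ.1), p.2 * Real.sqrt (1 - (κ.1 ^ 2 + κ.2 ^ 2)) / (1 - κ.1))

/-- The open unit disc. -/
def unitDisc : Set (ℝ × ℝ) := {κ | κ.1 ^ 2 + κ.2 ^ 2 < 1}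

lemma isOpen_unitDisc : IsOpen unitDisc :=
  isOpen_lt (by fun_prop) continuous_const

lemma unitDisc_fst {κ : ℝ × ℝ} (h : κ ∈ unitDisc) : 0 < 1 - κ.1 := by
  have : κ.1 ^ 2 + κ.2 ^ 2 < 1 := h
  nlinarith [sq_nonneg κ.2]

lemma kleinInv_smooth (p : ℝ × ℝ) : ContDiffOn ℝ (⊤ : ℕ∞) (kleinInv p) unitDisc := by
  unfold kleinInv
  refine ContDiffOn.prodMk (ContDiffOn.sub contDiffOn_const (ContDiffOn.div ?_ ?_ ?_))
    (ContDiffOn.div (ContDiffOn.mul contDiffOn_const (ContDiffOn.sqrt ?_ ?_)) ?_ ?_)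
  · fun_prop
  · fun_prop
  · exact fun κ hκ => (unitDisc_fst hκ).ne'
  · fun_prop
  · exact fun κ hκ => (sub_pos.2 hκ).ne'
  · fun_prop
  · exact fun κ hκ => (unitDisc_fst hκ).ne'

lemma klein_self (p : ℝ × ℝ) : klein p p = 0 := by
  simp [klein]

section
variable {p : ℝ × ℝ} (hp : p ∈ H2)
include hp

lemma kleinDen_pos (z : ℝ × ℝ) : 0 < kleinDen p z := by
  have : 0 < p.2 := hp
  unfold kleinDen; positivity

lemma klein_normSq (z : ℝ × ℝ) :
    (klein p z).1 ^ 2 + (klein p z).2 ^ 2 = 1 - (2 * p.2 * z.2 / kleinDen p z) ^ 2 := by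
  have := kleinDen_pos hp z
  simp only [klein]
  field_simp
  unfold kleinDen; ring

lemma klein_mem_unitDisc {z : ℝ × ℝ} (hz : z ∈ H2) : klein p z ∈ unitDisc := by
  have h1 := kleinDen_pos hp z
  have h2 : 0 < p.2 := hp
  have h3 : 0 < z.2 := hz
  rw [unitDisc, mem_ofPred_eq, klein_normSq hp]
  have : 0 < (2 * p.2 * z.2 / kleinDen p z) ^ 2 := by positivity
  linarith

lemma klein_one_sub (z : ℝ × ℝ) : 1 - (klein p z).1 = 2 * p.2 ^ 2 / kleinDen p z := by
  have := kleinDen_pos hp z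
  simp only [klein]
  field_simp
  unfold kleinDen; ring

lemma kleinInv_klein {z : ℝ × ℝ} (hz : z ∈ H2) : kleinInv p (klein p z) = z := by
  have h1 := kleinDen_pos hp z
  have h2 : 0 < p.2 := hp
  have h3 : 0 < z.2 := hz
  have hs : Real.sqrt (1 - ((klein p z).1 ^ 2 + (klein p z).2 ^ 2)) =
      2 * p.2 * z.2 / kleinDen p z := by
    rw [klein_normSq hp, sub_sub_cancel, Real.sqrt_sq (by positivity)]
  refine Prod.ext ?_ ?_
  · simp only [kleinInv]
    rw [klein_one_sub hp]
    simp only [klein]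
    field_simp
    ring
  · simp only [kleinInv]
    rw [klein_one_sub hp, hs]
    field_simp

lemma kleinInv_mem_H2 {κ : ℝ × ℝ} (hκ : κ ∈ unitDisc) : kleinInv p κ ∈ H2 := by
  have h2 : 0 < p.2 := hp
  have h1 := unitDisc_fst hκ
  have h3 : 0 < 1 - (κ.1 ^ 2 + κ.2 ^ 2) := sub_pos.2 hκ
  have := Real.sqrt_pos.2 h3
  simp only [H2, kleinInv, mem_ofPred_eq]
  positivity

lemma klein_kleinInv {κ : ℝ × ℝ} (hκ : κ ∈ unitDisc) : klein p (kleinInv p κ) = κ := by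
  have h2 : 0 < p.2 := hp
  have h1 := unitDisc_fst hκ
  have h3 : 0 ≤ 1 - (κ.1 ^ 2 + κ.2 ^ 2) := (sub_pos.2 hκ).le
  have hs := Real.sq_sqrt h3
  have hd : kleinDen p (kleinInv p κ) = 2 * p.2 ^ 2 / (1 - κ.1) := by
    simp only [kleinDen, kleinInv, div_pow, mul_pow, hs]
    field_simp
    ring
  refine Prod.ext ?_ ?_
  · have e : (klein p (kleinInv p κ)).1 = 1 - 2 * p.2 ^ 2 / kleinDen p (kleinInv p κ) := by
      have := klein_one_sub hp (kleinInv p κ)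
      linarith
    rw [e, hd]
    field_simp
    ring
  · simp only [klein]
    rw [hd]
    simp only [kleinInv]
    field_simp
    ring

lemma klein_smooth : ContDiff ℝ (⊤ : ℕ∞) (klein p) := by
  have h := fun z => (kleinDen_pos hp z).ne'
  unfold klein
  refine ContDiff.prodMk (ContDiff.div ?_ ?_ h) (ContDiff.div ?_ ?_ h)
  all_goals first | fun_prop | (unfold kleinDen; fun_prop)

lemma klein_injOn : InjOn (klein p) H2 := fun x hx y hy h => by
  rw [← kleinInv_klein hp hx, h, kleinInv_klein hp hy]

lemma klein_image_eq {Ω : Set (ℝ × ℝ)} (hΩ : Ω ⊆ H2) :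
    klein p '' Ω = unitDisc ∩ kleinInv p ⁻¹' Ω := by
  ext κ
  constructor
  · rintro ⟨z, hz, rfl⟩
    exact ⟨klein_mem_unitDisc hp (hΩ hz), by rwa [mem_preimage, kleinInv_klein hp (hΩ hz)]⟩
  · rintro ⟨h1, h2⟩
    exact ⟨_, h2, klein_kleinInv hp h1⟩

lemma klein_image_isOpen {Ω : Set (ℝ × ℝ)} (hΩ : Ω ⊆ H2) (ho : IsOpen Ω) :
    IsOpen (klein p '' Ω) := by
  rw [klein_image_eq hp hΩ]
  exact (kleinInv_smooth p).continuousOn.isOpen_inter_preimage isOpen_unitDisc ho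

lemma klein_pol {r : ℝ} (hr : |r| < 1) (θ : ℝ) :
    klein p (pol p (r, θ)) =
      (2 * r / (1 + r ^ 2) * Real.cos θ, 2 * r / (1 + r ^ 2) * Real.sin θ) := by
  have h2 : 0 < p.2 := hp
  have hD : 0 < polD (r, θ) := polD_pos hr
  have hd : kleinDen p (pol p (r, θ)) = 2 * p.2 ^ 2 * (1 + r ^ 2) / polD (r, θ) := by
    simp only [kleinDen, pol, polX, polY]
    field_simp
    simp only [polD]
    linear_combination (4 * r ^ 2 * p.2 ^ 2) * Real.sin_sq_add_cos_sq θ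
  refine Prod.ext ?_ ?_
  · have e : (klein p (pol p (r, θ))).1 = 1 - 2 * p.2 ^ 2 / kleinDen p (pol p (r, θ)) := by
      have := klein_one_sub hp (pol p (r, θ))
      linarith
    rw [e, hd]
    field_simp
    simp only [polD]
    ring
  · simp only [klein]
    rw [hd]
    simp only [pol, polX]
    field_simp
    ring

lemma klein_fderiv (z v : ℝ × ℝ) : fderiv ℝ (klein p) z v =
    (v.1 * (4 * p.2 ^ 2 * (z.1 - p.1) / kleinDen p z ^ 2) +
      v.2 * (4 * p.2 ^ 2 * z.2 / kleinDen p z ^ 2),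
     v.1 * (-(2 * p.2) / kleinDen p z + 4 * p.2 * (z.1 - p.1) ^ 2 / kleinDen p z ^ 2) +
      v.2 * (4 * p.2 * (z.1 - p.1) * z.2 / kleinDen p z ^ 2)) := by
  have hN := (kleinDen_pos hp z).ne'
  have hd : DifferentiableAt ℝ (klein p) z := (klein_smooth hp).differentiable (by simp) z
  have hx : HasDerivAt (fun s => kleinDen p (s, z.2)) (2 * (z.1 - p.1)) z.1 := by
    change HasDerivAt (fun s => (s - p.1) ^ 2 + z.2 ^ 2 + p.2 ^ 2) (2 * (z.1 - p.1)) z.1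
    exact ((hasDerivAt_sub_sq p.1 z.1).add_const _).add_const _
  have hy : HasDerivAt (fun s => kleinDen p (z.1, s)) (2 * z.2) z.2 := by
    change HasDerivAt (fun s => (z.1 - p.1) ^ 2 + s ^ 2 + p.2 ^ 2) (2 * z.2) z.2
    have h1 : HasDerivAt (fun s : ℝ => s ^ 2) (2 * z.2) z.2 := by
      simpa using hasDerivAt_pow 2 z.2
    exact (h1.const_add _).add_const _
  have e1 : fderiv ℝ (fun w => (klein p w).1) z v = (fderiv ℝ (klein p) z v).1 := by
    rw [hd.hasFDerivAt.fst.fderiv (𝕜 := ℝ)]; rfl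
  have e2 : fderiv ℝ (fun w => (klein p w).2) z v = (fderiv ℝ (klein p) z v).2 := by
    rw [hd.hasFDerivAt.snd.fderiv (𝕜 := ℝ)]; rfl
  have c1 : ∀ w, (klein p w).1 = 1 - 2 * p.2 ^ 2 / kleinDen p w := fun w => by
    rw [← klein_one_sub hp]; ring
  refine Prod.ext ?_ ?_
  · rw [← e1, fderiv_apply_eq_pd]
    congr 2
    · refine pdx_eq_of_hasDerivAt hd.fst ?_
      simp only [c1]
      have := ((hasDerivAt_const z.1 (2 * p.2 ^ 2)).fun_div hx hN).const_sub 1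
      exact this.congr_deriv (by field_simp; ring)
    · refine pdy_eq_of_hasDerivAt hd.fst ?_
      simp only [c1]
      have := ((hasDerivAt_const z.2 (2 * p.2 ^ 2)).fun_div hy hN).const_sub 1
      exact this.congr_deriv (by field_simp; ring)
  · rw [← e2, fderiv_apply_eq_pd]
    congr 2
    · refine pdx_eq_of_hasDerivAt hd.snd ?_
      simp only [klein]
      have h1 : HasDerivAt (fun s => -(2 * p.2 * (s - p.1))) (-(2 * p.2 * 1)) z.1 :=
        (((hasDerivAt_id z.1).sub_const p.1).const_mul _).neg
      have := h1.fun_div hx hN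
      exact this.congr_deriv (by field_simp; ring)
    · refine pdy_eq_of_hasDerivAt hd.snd ?_
      simp only [klein]
      have := (hasDerivAt_const z.2 (-(2 * p.2 * (z.1 - p.1)))).fun_div hy hN
      exact this.congr_deriv (by field_simp; ring)

lemma klein_fderiv_norm (z : ℝ × ℝ) : ‖fderiv ℝ (klein p) z‖ ≤ 16 / p.2 := by
  have h2 : 0 < p.2 := hp
  have hN := kleinDen_pos hp z
  have key : ∀ s : ℝ, |s| ≤ 4 * p.2 * kleinDen p z → |s / kleinDen p z ^ 2| ≤ 4 / p.2 := by
    intro s hs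
    rw [abs_div, abs_of_pos (pow_pos hN 2), div_le_div_iff₀ (by positivity) h2]
    have : p.2 ^ 2 ≤ kleinDen p z := by unfold kleinDen; nlinarith [sq_nonneg z.2, sq_nonneg (z.1 - p.1)]
    calc |s| * p.2 ≤ 4 * p.2 * kleinDen p z * p.2 := by gcongr
      _ = 4 * kleinDen p z * p.2 ^ 2 := by ring
      _ ≤ 4 * kleinDen p z * kleinDen p z := by gcongr
      _ = _ := by ring
  have hNe : kleinDen p z = (z.1 - p.1) ^ 2 + z.2 ^ 2 + p.2 ^ 2 := rfl
  have k1 := key (4 * p.2 ^ 2 * (z.1 - p.1)) (by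
    rw [hNe, abs_le]
    constructor <;>
      nlinarith [mul_nonneg h2.le (sq_nonneg (z.1 - p.1 + p.2)), mul_nonneg h2.le (sq_nonneg z.2),
        mul_nonneg h2.le (sq_nonneg (z.1 - p.1 - p.2)), pow_pos h2 3, mul_nonneg h2.le (sq_nonneg (z.1 - p.1))])
  have k2 := key (4 * p.2 ^ 2 * z.2) (by
    rw [hNe, abs_le]
    constructor <;>
      nlinarith [mul_nonneg h2.le (sq_nonneg (z.2 + p.2)), mul_nonneg h2.le (sq_nonneg z.2),
        mul_nonneg h2.le (sq_nonneg (z.2 - p.2)), pow_pos h2 3, mul_nonneg h2.le (sq_nonneg (z.1 - p.1))])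
  have k3 := key (-(2 * p.2) * kleinDen p z + 4 * p.2 * (z.1 - p.1) ^ 2) (by
    rw [hNe, abs_le]
    constructor <;>
      nlinarith [mul_nonneg h2.le (sq_nonneg z.2), pow_pos h2 3,
        mul_nonneg h2.le (sq_nonneg (z.1 - p.1))])
  have k4 := key (4 * p.2 * (z.1 - p.1) * z.2) (by
    rw [hNe, abs_le]
    constructor <;>
      nlinarith [mul_nonneg h2.le (sq_nonneg (z.1 - p.1 + z.2)), mul_nonneg h2.le (sq_nonneg z.2),
        mul_nonneg h2.le (sq_nonneg (z.1 - p.1 - z.2)), pow_pos h2 3, mul_nonneg h2.le (sq_nonneg (z.1 - p.1))])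
  have k3' : -(2 * p.2) / kleinDen p z + 4 * p.2 * (z.1 - p.1) ^ 2 / kleinDen p z ^ 2 =
      (-(2 * p.2) * kleinDen p z + 4 * p.2 * (z.1 - p.1) ^ 2) / kleinDen p z ^ 2 := by
    field_simp
  refine ContinuousLinearMap.opNorm_le_bound _ (by positivity) fun v => ?_
  rw [klein_fderiv hp, k3']
  have v1 : |v.1| ≤ ‖v‖ := norm_fst_le v
  have v2 : |v.2| ≤ ‖v‖ := norm_snd_le v
  have comb : ∀ s t : ℝ, |s| ≤ 4 / p.2 → |t| ≤ 4 / p.2 →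
      ‖v.1 * s + v.2 * t‖ ≤ 16 / p.2 * ‖v‖ := by
    intro s t hs ht
    have hv := norm_nonneg v
    calc ‖v.1 * s + v.2 * t‖ ≤ |v.1| * |s| + |v.2| * |t| := by
          rw [← abs_mul, ← abs_mul]; exact norm_add_le _ _
      _ ≤ ‖v‖ * (4 / p.2) + ‖v‖ * (4 / p.2) := by gcongr
      _ ≤ 16 / p.2 * ‖v‖ := by
          have : 0 ≤ ‖v‖ / p.2 := by positivity
          have e1 : ‖v‖ * (4 / p.2) = 4 * (‖v‖ / p.2) := by ring
          have e2 : 16 / p.2 * ‖v‖ = 16 * (‖v‖ / p.2) := by ring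
          rw [e1, e2]; linarith
  exact norm_prod_le_iff.2 ⟨comb _ _ k1 k2, comb _ _ k3 k4⟩

lemma exists_klein_lipschitz : ∃ C, LipschitzWith C (klein p) := by
  have h2 : 0 < p.2 := hp
  refine ⟨⟨16 / p.2, by positivity⟩, ?_⟩
  refine lipschitzWith_of_nnnorm_fderiv_le ((klein_smooth hp).differentiable (by simp)) fun z => ?_
  exact klein_fderiv_norm hp z

lemma klein_radial {z : ℝ × ℝ} (hz : z ∈ H2) :
    fderiv ℝ (klein p) z (pdx (tfun p.1 p.2) z, pdy (tfun p.1 p.2) z) =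
      ((1 - tfun p.1 p.2 z) ^ 3 / (2 * z.2 ^ 2 * (1 + tfun p.1 p.2 z))) • klein p z := by
  have h2 : 0 < p.2 := hp
  have h3 : 0 < z.2 := hz
  have hN := kleinDen_pos hp z
  have hM := tfun_den_pos (a := p.1) h2 hz
  set M := (z.1 - p.1) ^ 2 + (z.2 + p.2) ^ 2 with hMd
  have e : 1 + tfun p.1 p.2 z = 2 * kleinDen p z / M := by
    have := one_sub_tfun (a := p.1) h2 hz
    rw [← hMd] at this
    have e2 : 1 + tfun p.1 p.2 z = 2 - 4 * p.2 * z.2 / M := by linarith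
    rw [e2]
    field_simp
    rw [hMd, kleinDen]; ring
  rw [klein_fderiv hp, pdx_tfun h2 hz, pdy_tfun h2 hz, e, one_sub_tfun h2 hz, ← hMd]
  refine Prod.ext ?_ ?_
  · simp only [klein, Prod.smul_mk, smul_eq_mul]
    field_simp
    ring
  · simp only [klein, Prod.smul_mk, smul_eq_mul]
    field_simp
    unfold kleinDen; ring

end

/-- The hyperbolic cosine of the distance. -/
def coshDist (a b : ℝ × ℝ) : ℝ := 1 + ((a.1 - b.1) ^ 2 + (a.2 - b.2) ^ 2) / (2 * a.2 * b.2)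

lemma exists_geodesic_point {a b : ℝ × ℝ} (ha : a ∈ H2) (hb : b ∈ H2) {s t : ℝ} (hs : 0 < s)
    (ht : 0 < t) : ∃ c ∈ H2, hypDist a c + hypDist c b = hypDist a b ∧
      c.1 * (s / a.2 + t / b.2) = s * a.1 / a.2 + t * b.1 / b.2 ∧
      (c.1 ^ 2 + c.2 ^ 2) * (s / a.2 + t / b.2) =
        s * (a.1 ^ 2 + a.2 ^ 2) / a.2 + t * (b.1 ^ 2 + b.2 ^ 2) / b.2 := by
  have ha2 : 0 < a.2 := ha
  have hb2 : 0 < b.2 := hb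
  set C := coshDist a b with hC
  have hC1 : 1 ≤ C := by
    rw [hC, coshDist, le_add_iff_nonneg_right]; positivity
  set n2 := s ^ 2 + t ^ 2 + 2 * s * t * C with hn2
  have hn2pos : 0 < n2 := by positivity
  set n := Real.sqrt n2 with hn
  have hnpos : 0 < n := Real.sqrt_pos.2 hn2pos
  have hnsq : n ^ 2 = n2 := Real.sq_sqrt hn2pos.le
  set α := s / a.2 + t / b.2 with hα
  have hαpos : 0 < α := by positivity
  set c : ℝ × ℝ := ((s * a.1 / a.2 + t * b.1 / b.2) / α, n / α) with hc
  have hc2 : 0 < c.2 := by simp only [hc]; positivity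
  have hsum : (c.1 ^ 2 + c.2 ^ 2) * α =
      s * (a.1 ^ 2 + a.2 ^ 2) / a.2 + t * (b.1 ^ 2 + b.2 ^ 2) / b.2 := by
    simp only [hc]
    rw [div_pow, div_pow, hnsq, ← add_div, div_mul_eq_mul_div, div_eq_iff (by positivity)]
    rw [hn2, hC, coshDist, hα]
    field_simp
    ring
  have hfst : c.1 * α = s * a.1 / a.2 + t * b.1 / b.2 := by
    simp only [hc]; field_simp
  have hsnd : c.2 * α = n := by simp only [hc]; field_simp
  have form : ∀ e : ℝ × ℝ, 0 < e.2 →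
      coshDist e c = (s * coshDist e a + t * coshDist e b) / n := by
    intro e he
    rw [eq_div_iff hnpos.ne', ← hsnd]
    have e1 : coshDist e c * (c.2 * α) =
        (e.1 ^ 2 + e.2 ^ 2) * α / (2 * e.2) + (c.1 ^ 2 + c.2 ^ 2) * α / (2 * e.2) -
          e.1 * (c.1 * α) / e.2 := by
      rw [coshDist]; field_simp; ring
    rw [e1, hsum, hfst, coshDist, coshDist, hα]
    field_simp
    ring
  have self : ∀ e : ℝ × ℝ, coshDist e e = 1 := fun e => by simp [coshDist]
  have symm : ∀ e f : ℝ × ℝ, coshDist e f = coshDist f e := fun e f => by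
    simp only [coshDist]; ring
  have h1 : coshDist a c = (s + t * C) / n := by rw [form a ha2, self, mul_one]
  have h2 : coshDist c b = (s * C + t) / n := by
    rw [symm, form b hb2, self, mul_one, symm b a]
  set w := Real.sqrt (C ^ 2 - 1) with hw
  have hwsq : w ^ 2 = C ^ 2 - 1 := Real.sq_sqrt (by nlinarith)
  have hw0 : 0 ≤ w := Real.sqrt_nonneg _
  have s1 : Real.sqrt (((s + t * C) / n) ^ 2 - 1) = t * w / n := by
    rw [show ((s + t * C) / n) ^ 2 - 1 = (t * w / n) ^ 2 by
      rw [div_pow, div_pow, hnsq, mul_pow, hwsq]; field_simp; rw [hn2]; ring]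
    exact Real.sqrt_sq (by positivity)
  have s2 : Real.sqrt (((s * C + t) / n) ^ 2 - 1) = s * w / n := by
    rw [show ((s * C + t) / n) ^ 2 - 1 = (s * w / n) ^ 2 by
      rw [div_pow, div_pow, hnsq, mul_pow, hwsq]; field_simp; rw [hn2]; ring]
    exact Real.sqrt_sq (by positivity)
  refine ⟨c, hc2, ?_, hfst, hsum⟩
  change arcosh (coshDist a c) + arcosh (coshDist c b) = arcosh (coshDist a b)
  rw [h1, h2, ← hC, arcosh, arcosh, arcosh, s1, s2, ← hw,
    ← Real.log_mul (by positivity) (by positivity)]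
  congr 1
  field_simp
  rw [hnsq, hn2]
  linear_combination (s * t) * hwsq

/-- Image of a geodesically convex set in the Klein chart is convex. -/
lemma klein_image_convex {p : ℝ × ℝ} (hp : p ∈ H2) {Ω : Set (ℝ × ℝ)} (hΩ : Ω ⊆ H2)
    (hc : GeodesicallyConvex Ω) : Convex ℝ (klein p '' Ω) := by
  rw [convex_iff_forall_pos]
  rintro _ ⟨a, ha, rfl⟩ _ ⟨b, hb, rfl⟩ l k hl hk hlk
  have ha2 : 0 < a.2 := hΩ ha
  have hb2 : 0 < b.2 := hΩ hb
  have h2 : 0 < p.2 := hp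
  have hNa := kleinDen_pos hp a
  have hNb := kleinDen_pos hp b
  obtain ⟨c, hcH, hcd, h1, h3⟩ := exists_geodesic_point (hΩ ha) (hΩ hb)
    (s := l * a.2 / kleinDen p a) (t := k * b.2 / kleinDen p b) (by positivity) (by positivity)
  refine ⟨c, hc a ha b hb c hcH hcd, ?_⟩
  have hNc := kleinDen_pos hp c
  have ea : l * a.2 / kleinDen p a / a.2 = l / kleinDen p a := by field_simp
  have eb : k * b.2 / kleinDen p b / b.2 = k / kleinDen p b := by field_simp
  have fa : ∀ s, l * a.2 / kleinDen p a * s / a.2 = l / kleinDen p a * s := fun s => by field_simp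
  have fb : ∀ s, k * b.2 / kleinDen p b * s / b.2 = k / kleinDen p b * s := fun s => by field_simp
  rw [ea, eb, fa, fb] at h1 h3
  set A := l / kleinDen p a with hA
  set B := k / kleinDen p b with hB
  have hl' : l = A * kleinDen p a := by rw [hA]; field_simp
  have hk' : k = B * kleinDen p b := by rw [hB]; field_simp
  have hN : kleinDen p c * (A + B) = 1 := by
    rw [← hlk, hl', hk']
    unfold kleinDen
    linear_combination h3 - 2 * p.1 * h1
  have hAB : A + B ≠ 0 := fun h => by rw [h, mul_zero] at hN; exact zero_ne_one hN
  have hNinv : 1 / kleinDen p c = A + B := by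
    rw [div_eq_iff hNc.ne', mul_comm]; exact hN.symm
  refine Prod.ext ?_ ?_
  · simp only [klein, Prod.fst_add, Prod.smul_mk, smul_eq_mul]
    rw [div_eq_mul_one_div, hNinv, hl', hk']
    field_simp
    linear_combination h3 - 2 * p.1 * h1
  · simp only [klein, Prod.snd_add, Prod.smul_mk, smul_eq_mul]
    rw [div_eq_mul_one_div, hNinv, hl', hk']
    field_simp
    linear_combination (-1 : ℝ) * h1

/-- The Minkowski gauge of a domain in the Klein chart. -/
def kg (Ω : Set (ℝ × ℝ)) (p z : ℝ × ℝ) : ℝ := gauge (klein p '' Ω) (klein p z)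

/-- Radial projection to the boundary in the Klein chart. -/
def kproj (Ω : Set (ℝ × ℝ)) (p z : ℝ × ℝ) : ℝ × ℝ :=
  kleinInv p ((kg Ω p z)⁻¹ • klein p z)

lemma gauge_hasFDerivAt_smul {S : Set (ℝ × ℝ)} {ℓ : ℝ × ℝ →L[ℝ] ℝ} {κ : ℝ × ℝ}
    (h : HasFDerivAt (gauge S) ℓ κ) {s : ℝ} (hs : 0 < s) : HasFDerivAt (gauge S) ℓ (s • κ) := by
  have e : gauge S = fun x => s * gauge S (s⁻¹ • x) := by
    funext x
    rw [gauge_smul_of_nonneg (inv_pos.2 hs).le, smul_eq_mul, mul_inv_cancel_left₀ hs.ne']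
  have h1 : HasFDerivAt (fun x : ℝ × ℝ => s⁻¹ • x) (s⁻¹ • ContinuousLinearMap.id ℝ (ℝ × ℝ)) (s • κ) :=
    (hasFDerivAt_id _).const_smul s⁻¹
  have h2 : HasFDerivAt (gauge S) ℓ (s⁻¹ • s • κ) := by rwa [inv_smul_smul₀ hs.ne']
  have h3 := (h2.comp (s • κ) h1).const_mul s
  rw [e]
  refine h3.congr_fderiv ?_
  ext <;> simp [hs.ne']

lemma gauge_euler {S : Set (ℝ × ℝ)} {ℓ : ℝ × ℝ →L[ℝ] ℝ} {κ : ℝ × ℝ}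
    (h : HasFDerivAt (gauge S) ℓ κ) : ℓ κ = gauge S κ := by
  have h1 : HasDerivAt (fun t : ℝ => t • κ) κ 1 := by
    simpa using (hasDerivAt_id (1 : ℝ)).smul_const κ
  have h0 : HasFDerivAt (gauge S) ℓ ((1 : ℝ) • κ) := by rwa [one_smul]
  have h2 : HasDerivAt (fun t : ℝ => gauge S (t • κ)) (ℓ κ) 1 :=
    HasFDerivAt.comp_hasDerivAt (1 : ℝ) (f := fun t : ℝ => t • κ) h0 h1
  have h3 : HasDerivAt (fun t : ℝ => t * gauge S κ) (gauge S κ) 1 := by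
    simpa using (hasDerivAt_id (1 : ℝ)).mul_const (gauge S κ)
  refine h2.unique (h3.congr_of_eventuallyEq ?_)
  filter_upwards [lt_mem_nhds (zero_lt_one' ℝ)] with t ht
  rw [gauge_smul_of_nonneg ht.le, smul_eq_mul]

/-- A bounded geodesically convex domain with a base point. -/
structure ConvDom (Ω : Set (ℝ × ℝ)) (p : ℝ × ℝ) : Prop extends BddDom Ω where
  conv : GeodesicallyConvex Ω
  mem : p ∈ Ω

namespace ConvDom
variable {Ω : Set (ℝ × ℝ)} {p : ℝ × ℝ} (D : ConvDom Ω p)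
include D

lemma base : p ∈ H2 := D.sub D.mem

lemma isOpen_image : IsOpen (klein p '' Ω) := klein_image_isOpen D.base D.sub D.isOpen

lemma convex_image : Convex ℝ (klein p '' Ω) := klein_image_convex D.base D.sub D.conv

lemma zero_mem : (0 : ℝ × ℝ) ∈ klein p '' Ω := ⟨p, D.mem, klein_self p⟩

lemma nhds_zero : klein p '' Ω ∈ 𝓝 (0 : ℝ × ℝ) := D.isOpen_image.mem_nhds D.zero_mem

lemma exists_gauge_lipschitz : ∃ C, LipschitzWith C (gauge (klein p '' Ω)) :=
  D.convex_image.lipschitz_gauge D.nhds_zero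

lemma exists_kg_lipschitz : ∃ C, LipschitzWith C (kg Ω p) := by
  obtain ⟨C1, h1⟩ := D.exists_gauge_lipschitz
  obtain ⟨C2, h2⟩ := exists_klein_lipschitz D.base
  exact ⟨_, h1.comp h2⟩

lemma kg_continuous : Continuous (kg Ω p) := by
  obtain ⟨C, h⟩ := D.exists_kg_lipschitz
  exact h.continuous

lemma gauge_lt_one_iff {κ : ℝ × ℝ} : gauge (klein p '' Ω) κ < 1 ↔ κ ∈ klein p '' Ω := by
  have h := setOfPred_gauge_lt_one_eq_self_of_isOpen D.convex_image D.zero_mem D.isOpen_image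
  rw [Set.ext_iff] at h
  exact h κ

lemma klein_mem_image {z : ℝ × ℝ} (hz : z ∈ H2) : klein p z ∈ klein p '' Ω ↔ z ∈ Ω :=
  ⟨fun ⟨_, hw, h⟩ => (klein_injOn D.base (D.sub hw) hz h) ▸ hw, fun h => mem_image_of_mem _ h⟩

lemma kg_lt_one_iff {z : ℝ × ℝ} (hz : z ∈ H2) : kg Ω p z < 1 ↔ z ∈ Ω := by
  rw [kg, D.gauge_lt_one_iff, D.klein_mem_image hz]

lemma kg_le_one {z : ℝ × ℝ} (hz : z ∈ closure Ω) : kg Ω p z ≤ 1 :=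
  closure_minimal (fun _ hw => ((D.kg_lt_one_iff (D.sub hw)).2 hw).le)
    (isClosed_le D.kg_continuous continuous_const) hz

lemma kg_frontier {q : ℝ × ℝ} (hq : q ∈ frontier Ω) : kg Ω p q = 1 := by
  rw [D.isOpen.frontier_eq] at hq
  refine le_antisymm (D.kg_le_one hq.1) (not_lt.1 fun h => hq.2 ?_)
  exact (D.kg_lt_one_iff (D.closure_sub hq.1)).1 h

lemma closure_image : closure (klein p '' Ω) = klein p '' closure Ω := by
  have hk : Continuous (klein p) := (klein_smooth D.base).continuous
  exact (image_closure_of_isCompact D.compact hk.continuousOn).symm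

lemma closure_image_sub : closure (klein p '' Ω) ⊆ unitDisc := by
  rw [D.closure_image]
  rintro _ ⟨z, hz, rfl⟩
  exact klein_mem_unitDisc D.base (D.closure_sub hz)

lemma kproj_arg {z : ℝ × ℝ} (h0 : 0 < kg Ω p z) :
    (kg Ω p z)⁻¹ • klein p z ∈ closure (klein p '' Ω) := by
  rw [← gauge_le_one_iff_mem_closure D.convex_image D.nhds_zero,
    gauge_smul_of_nonneg (inv_pos.2 h0).le, smul_eq_mul]
  exact (inv_mul_cancel₀ h0.ne').le

lemma klein_kproj {z : ℝ × ℝ} (h0 : 0 < kg Ω p z) :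
    klein p (kproj Ω p z) = (kg Ω p z)⁻¹ • klein p z :=
  klein_kleinInv D.base (D.closure_image_sub (D.kproj_arg h0))

lemma kproj_mem {z : ℝ × ℝ} (h0 : 0 < kg Ω p z) : kproj Ω p z ∈ frontier Ω := by
  have hH : kproj Ω p z ∈ H2 := kleinInv_mem_H2 D.base (D.closure_image_sub (D.kproj_arg h0))
  have h1 := D.kproj_arg h0
  rw [D.closure_image, ← D.klein_kproj h0] at h1
  obtain ⟨w, hw, hwe⟩ := h1
  have : w = kproj Ω p z := klein_injOn D.base (D.closure_sub hw) hH hwe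
  rw [D.isOpen.frontier_eq, ← this]
  refine ⟨hw, fun hmem => ?_⟩
  have h2 := (D.kg_lt_one_iff (D.sub hmem)).2 hmem
  rw [this, kg, D.klein_kproj h0, gauge_smul_of_nonneg (inv_pos.2 h0).le, smul_eq_mul] at h2
  exact h2.ne (inv_mul_cancel₀ h0.ne')

lemma kproj_eq {z : ℝ × ℝ} (hz : z ∈ H2) (h1 : kg Ω p z = 1) : kproj Ω p z = z := by
  rw [kproj, h1, inv_one, one_smul, kleinInv_klein D.base hz]

lemma kproj_continuousOn : ContinuousOn (kproj Ω p) {z | 0 < kg Ω p z} := by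
  have h1 : ContinuousOn (fun z => (kg Ω p z)⁻¹ • klein p z) {z | 0 < kg Ω p z} :=
    (D.kg_continuous.continuousOn.inv₀ fun z hz => (ne_of_gt hz)).smul
      (klein_smooth D.base).continuous.continuousOn
  exact (kleinInv_smooth p).continuousOn.comp h1 fun z hz => D.closure_image_sub (D.kproj_arg hz)

lemma uniqueDiffOn : UniqueDiffOn ℝ (closure Ω) := by
  intro z hz
  have hzH := D.closure_sub hz
  have hne : (interior (klein p '' Ω)).Nonempty := by
    rw [D.isOpen_image.interior_eq]
    exact ⟨0, D.zero_mem⟩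
  have hu : UniqueDiffOn ℝ (closure (klein p '' Ω)) :=
    uniqueDiffOn_convex D.convex_image.closure (hne.mono (interior_mono subset_closure))
  have hκ : klein p z ∈ closure (klein p '' Ω) := D.closure_image ▸ mem_image_of_mem _ hz
  have hd : HasFDerivAt (kleinInv p) (fderiv ℝ (kleinInv p) (klein p z)) (klein p z) :=
    ((kleinInv_smooth p).contDiffAt (isOpen_unitDisc.mem_nhds
      (D.closure_image_sub hκ))).differentiableAt (by simp) |>.hasFDerivAt
  have hk : HasFDerivAt (klein p) (fderiv ℝ (klein p) z) z :=
    ((klein_smooth D.base).differentiable (by simp) z).hasFDerivAt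
  have hcomp := hd.comp z hk
  have hid : HasFDerivAt (kleinInv p ∘ klein p) (ContinuousLinearMap.id ℝ (ℝ × ℝ)) z := by
    refine (hasFDerivAt_id z).congr_of_eventuallyEq ?_
    filter_upwards [isOpen_H2.mem_nhds hzH] with w hw
    simp [kleinInv_klein D.base hw]
  have heq := hcomp.unique hid
  have hsurj : Function.Surjective (fderiv ℝ (kleinInv p) (klein p z)) := fun v =>
    ⟨fderiv ℝ (klein p) z v, by simpa using congrArg (fun L => L v) heq⟩
  have := (hd.hasFDerivWithinAt (s := closure (klein p '' Ω))).uniqueDiffWithinAt (hu _ hκ)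
    hsurj.denseRange
  rw [kleinInv_klein D.base hzH, D.closure_image, image_image] at this
  refine this.mono ?_
  rintro _ ⟨w, hw, rfl⟩
  beta_reduce
  rwa [kleinInv_klein D.base (D.closure_sub hw)]

lemma exists_gauge_deriv {z : ℝ × ℝ} (hz : z ∈ H2) (hd : DifferentiableAt ℝ (kg Ω p) z) :
    ∃ ℓ : ℝ × ℝ →L[ℝ] ℝ, HasFDerivAt (gauge (klein p '' Ω)) ℓ (klein p z) := by
  have h1 : DifferentiableAt ℝ (kleinInv p) (klein p z) :=
    ((kleinInv_smooth p).contDiffAt (isOpen_unitDisc.mem_nhds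
      (klein_mem_unitDisc D.base hz))).differentiableAt (by simp)
  have h2 : DifferentiableAt ℝ (kg Ω p) (kleinInv p (klein p z)) := by
    rwa [kleinInv_klein D.base hz]
  have h3 := h2.comp (klein p z) h1
  refine ⟨_, (h3.congr_of_eventuallyEq ?_).hasFDerivAt⟩
  filter_upwards [isOpen_unitDisc.mem_nhds (klein_mem_unitDisc D.base hz)] with κ hκ
  simp [kg, klein_kleinInv D.base hκ]

lemma kg_hasFDerivAt {z : ℝ × ℝ} {ℓ : ℝ × ℝ →L[ℝ] ℝ}
    (h : HasFDerivAt (gauge (klein p '' Ω)) ℓ (klein p z)) :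
    HasFDerivAt (kg Ω p) (ℓ.comp (fderiv ℝ (klein p) z)) z :=
  h.comp z ((klein_smooth D.base).differentiable (by simp) z).hasFDerivAt

lemma kg_radial {z : ℝ × ℝ} (hz : z ∈ H2) (hd : DifferentiableAt ℝ (kg Ω p) z) :
    fderiv ℝ (kg Ω p) z (pdx (tfun p.1 p.2) z, pdy (tfun p.1 p.2) z) =
      (1 - tfun p.1 p.2 z) ^ 3 / (2 * z.2 ^ 2 * (1 + tfun p.1 p.2 z)) * kg Ω p z := by
  obtain ⟨ℓ, hℓ⟩ := D.exists_gauge_deriv hz hd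
  rw [(D.kg_hasFDerivAt hℓ).fderiv (𝕜 := ℝ), ContinuousLinearMap.comp_apply,
    klein_radial D.base hz, map_smul, gauge_euler hℓ, smul_eq_mul]
  rfl

lemma isOutwardNormalAt {q : ℝ × ℝ} (hq : q ∈ frontier Ω) (hd : DifferentiableAt ℝ (kg Ω p) q)
    {v : ℝ × ℝ} (hv : v = (pdx (kg Ω p) q, pdy (kg Ω p) q)) (hv0 : v ≠ 0) :
    IsOutwardNormalAt Ω q ((Real.sqrt (v.1 ^ 2 + v.2 ^ 2))⁻¹ • v) := by
  have hpos : 0 < v.1 ^ 2 + v.2 ^ 2 := by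
    by_contra hcon
    apply hv0
    have h1 : v.1 = 0 := by nlinarith [sq_nonneg v.1, sq_nonneg v.2]
    have h2 : v.2 = 0 := by nlinarith [sq_nonneg v.1, sq_nonneg v.2]
    exact Prod.ext h1 h2
  set N := Real.sqrt (v.1 ^ 2 + v.2 ^ 2) with hN
  have hN0 : 0 < N := Real.sqrt_pos.2 hpos
  have hNsq : N ^ 2 = v.1 ^ 2 + v.2 ^ 2 := Real.sq_sqrt hpos.le
  have hL : ∀ w, fderiv ℝ (kg Ω p) q w = w.1 * v.1 + w.2 * v.2 := fun w => by
    rw [fderiv_apply_eq_pd, hv]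
  have hq1 := D.kg_frontier hq
  refine ⟨?_, ?_, ?_⟩
  · simp only [Prod.smul_fst, Prod.smul_snd, smul_eq_mul]
    rw [mul_pow, mul_pow, ← mul_add, ← hNsq, inv_pow, inv_mul_cancel₀ (by positivity)]
  · have ho := hd.hasFDerivAt.isLittleO
    rw [Metric.tendsto_nhds]
    intro ε hε
    have h1 := (ho.def (c := ε * N / 2) (by positivity)).filter_mono
      (nhdsWithin_le_nhds (s := frontier Ω \ {q}))
    filter_upwards [h1, self_mem_nhdsWithin] with x hx hxf
    rw [D.kg_frontier hxf.1, hq1, hL, sub_self, zero_sub, norm_neg, Real.norm_eq_abs] at hx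
    simp only [Prod.fst_sub, Prod.snd_sub] at hx
    set E := Real.sqrt ((x.1 - q.1) ^ 2 + (x.2 - q.2) ^ 2) with hE
    have hxE : ‖x - q‖ ≤ E := by
      rw [Prod.norm_def, Prod.fst_sub, Prod.snd_sub, Real.norm_eq_abs, Real.norm_eq_abs]
      refine max_le (Real.abs_le_sqrt ?_) (Real.abs_le_sqrt ?_)
      · nlinarith [sq_nonneg (x.2 - q.2)]
      · nlinarith [sq_nonneg (x.1 - q.1)]
    have hE0 : 0 < E := (norm_pos_iff.2 (sub_ne_zero.2 hxf.2)).trans_le hxE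
    rw [Real.dist_eq, sub_zero, abs_of_nonneg (by positivity), div_lt_iff₀ hE0]
    simp only [Prod.smul_fst, Prod.smul_snd, smul_eq_mul]
    have e : (x.1 - q.1) * (N⁻¹ * v.1) + (x.2 - q.2) * (N⁻¹ * v.2) =
        N⁻¹ * ((x.1 - q.1) * v.1 + (x.2 - q.2) * v.2) := by ring
    rw [e, abs_mul, abs_of_pos (inv_pos.2 hN0), inv_mul_lt_iff₀ hN0]
    have : ε * N / 2 * ‖x - q‖ ≤ ε * N / 2 * E := by gcongr
    nlinarith [mul_pos (mul_pos hε hN0) hE0]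
  · have hg : HasDerivAt (fun t : ℝ => q + t • (N⁻¹ • v)) (N⁻¹ • v) 0 := by
      simpa using ((hasDerivAt_id (0 : ℝ)).smul_const (N⁻¹ • v)).const_add q
    have hd0 : HasFDerivAt (kg Ω p) (fderiv ℝ (kg Ω p) q) (q + (0 : ℝ) • (N⁻¹ • v)) := by
      simpa using hd.hasFDerivAt
    have hf := HasFDerivAt.comp_hasDerivAt (0 : ℝ) (f := fun t : ℝ => q + t • (N⁻¹ • v)) hd0 hg
    have e : fderiv ℝ (kg Ω p) q (N⁻¹ • v) = N := by
      rw [hL]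
      simp only [Prod.smul_fst, Prod.smul_snd, smul_eq_mul]
      field_simp
      linarith
    rw [e, hasDerivAt_iff_tendsto_slope_zero] at hf
    have h1 := (hf.eventually_const_lt hN0).filter_mono
      (nhdsWithin_mono 0 (fun t (ht : 0 < t) => ht.ne' : Ioi (0 : ℝ) ⊆ {0}ᶜ))
    have hH : ∀ᶠ t in 𝓝[>] (0 : ℝ), q + t • (N⁻¹ • v) ∈ H2 := by
      have hc : ContinuousAt (fun t : ℝ => q + t • (N⁻¹ • v)) 0 := hg.continuousAt
      refine (hc.eventually_mem (isOpen_H2.mem_nhds ?_)).filter_mono nhdsWithin_le_nhds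
      simpa using D.closure_sub (frontier_subset_closure hq)
    filter_upwards [h1, hH, self_mem_nhdsWithin] with t ht htH ht0 hmem
    have ht0 : 0 < t := ht0
    have h3 := (D.kg_lt_one_iff htH).2 hmem
    simp only [Function.comp_apply, zero_add, zero_smul, add_zero, hq1, smul_eq_mul] at ht
    have h4 : 0 < kg Ω p (q + t • N⁻¹ • v) - 1 := by
      by_contra hcon
      have := mul_nonpos_of_nonneg_of_nonpos (inv_pos.2 ht0).le (not_lt.1 hcon)
      linarith
    linarith

lemma neumann_normal {u : ℝ × ℝ → ℝ}
    (hn : ∀ q ∈ frontier Ω, ∀ ν : ℝ × ℝ, IsOutwardNormalAt Ω q ν →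
      fderivWithin ℝ u (closure Ω) q ν = 0)
    {q : ℝ × ℝ} (hq : q ∈ frontier Ω) (hd : DifferentiableAt ℝ (kg Ω p) q) :
    fderivWithin ℝ u (closure Ω) q (pdx (kg Ω p) q, pdy (kg Ω p) q) = 0 := by
  by_cases h0 : (pdx (kg Ω p) q, pdy (kg Ω p) q) = (0 : ℝ × ℝ)
  · rw [h0, map_zero]
  have h := hn q hq _ (D.isOutwardNormalAt hq hd rfl h0)
  rw [map_smul, smul_eq_zero] at h
  refine h.resolve_left (inv_ne_zero (Real.sqrt_ne_zero'.2 ?_))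
  by_contra hcon
  apply h0
  have h1 : pdx (kg Ω p) q = 0 := by nlinarith [sq_nonneg (pdx (kg Ω p) q), sq_nonneg (pdy (kg Ω p) q)]
  have h2 : pdy (kg Ω p) q = 0 := by nlinarith [sq_nonneg (pdx (kg Ω p) q), sq_nonneg (pdy (kg Ω p) q)]
  rw [h1, h2]; rfl

/-- The normal derivative of a Neumann function is uniformly small near the boundary. -/
lemma exists_shell {u : ℝ × ℝ → ℝ} (hu : ContDiffOn ℝ 1 u (closure Ω))
    (hn : ∀ q ∈ frontier Ω, ∀ ν : ℝ × ℝ, IsOutwardNormalAt Ω q ν →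
      fderivWithin ℝ u (closure Ω) q ν = 0) {δ : ℝ} (hδ : 0 < δ) :
    ∃ c < 1, ∀ x ∈ Ω, c < kg Ω p x → DifferentiableAt ℝ (kg Ω p) x →
      |fderiv ℝ (kg Ω p) x (pdx u x, pdy u x)| ≤ δ := by
  obtain ⟨C, hC⟩ := D.exists_gauge_lipschitz
  let G : ℝ × ℝ → ℝ × ℝ := fun y =>
    (fderivWithin ℝ u (closure Ω) y (1, 0), fderivWithin ℝ u (closure Ω) y (0, 1))
  have hGc : ContinuousOn G (closure Ω) := by
    have h := hu.continuousOn_fderivWithin D.uniqueDiffOn le_rfl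
    exact (h.clm_apply continuousOn_const).prodMk (h.clm_apply continuousOn_const)
  let F : ℝ × ℝ → ℝ × ℝ := fun y => fderiv ℝ (klein p) y (G y)
  have hFc : ContinuousOn F (closure Ω) :=
    ((klein_smooth D.base).continuous_fderiv (by simp)).continuousOn.clm_apply hGc
  let T : Set (ℝ × ℝ) := closure Ω ∩ {y | 1 / 2 ≤ kg Ω p y}
  have hT : IsCompact T := D.compact.inter_right (isClosed_le continuous_const D.kg_continuous)
  have hpos : ∀ y ∈ T, 0 < kg Ω p y := fun y hy => by
    have : 1 / 2 ≤ kg Ω p y := hy.2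
    linarith
  let Ψ : ℝ × ℝ → ℝ := fun y => C * ‖F y - F (kproj Ω p y)‖
  have hΨc : ContinuousOn Ψ T := by
    refine continuousOn_const.mul (ContinuousOn.norm ((hFc.mono inter_subset_left).sub ?_))
    refine hFc.comp (D.kproj_continuousOn.mono hpos) fun y hy => ?_
    exact frontier_subset_closure (D.kproj_mem (hpos y hy))
  have hΨ1 : ∀ y ∈ T, kg Ω p y = 1 → Ψ y = 0 := fun y hy h1 => by
    simp [Ψ, D.kproj_eq (D.closure_sub hy.1) h1]
  have key : ∀ x ∈ Ω, x ∈ T → DifferentiableAt ℝ (kg Ω p) x →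
      |fderiv ℝ (kg Ω p) x (pdx u x, pdy u x)| ≤ Ψ x := by
    intro x hx hxT hd
    obtain ⟨ℓ, hℓ⟩ := D.exists_gauge_deriv (D.sub hx) hd
    have h0 := hpos x hxT
    have hq := D.kproj_mem h0
    have hℓq : HasFDerivAt (gauge (klein p '' Ω)) ℓ (klein p (kproj Ω p x)) := by
      rw [D.klein_kproj h0]
      exact gauge_hasFDerivAt_smul hℓ (inv_pos.2 h0)
    have hdq := D.kg_hasFDerivAt hℓq
    have hN := D.neumann_normal hn hq hdq.differentiableAt
    have e0 : ∀ (L : ℝ × ℝ →L[ℝ] ℝ) (v : ℝ × ℝ), L v = v.1 * L (1, 0) + v.2 * L (0, 1) := by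
      intro L v
      conv_lhs => rw [show v = v.1 • ((1 : ℝ), (0 : ℝ)) + v.2 • ((0 : ℝ), (1 : ℝ)) by
        ext <;> simp]
      rw [map_add, map_smul, map_smul, smul_eq_mul, smul_eq_mul]
    have e1 : ℓ (F (kproj Ω p x)) = 0 := by
      rw [← hN, e0 (fderivWithin ℝ u (closure Ω) (kproj Ω p x))]
      have : ℓ (F (kproj Ω p x)) = fderiv ℝ (kg Ω p) (kproj Ω p x) (G (kproj Ω p x)) := by
        rw [hdq.fderiv (𝕜 := ℝ)]; rfl
      rw [this, fderiv_apply_eq_pd]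
      simp only [G]
      ring
    have e2 : G x = (pdx u x, pdy u x) := by
      have : fderivWithin ℝ u (closure Ω) x = fderiv ℝ u x :=
        fderivWithin_of_mem_nhds (mem_of_superset (D.isOpen.mem_nhds hx) subset_closure)
      simp only [G, this]; rfl
    have e3 : fderiv ℝ (kg Ω p) x (pdx u x, pdy u x) = ℓ (F x - F (kproj Ω p x)) := by
      rw [map_sub, e1, sub_zero, (D.kg_hasFDerivAt hℓ).fderiv (𝕜 := ℝ), ← e2]; rfl
    rw [e3]
    exact (ℓ.le_opNorm _).trans (mul_le_mul_of_nonneg_right (hℓ.le_of_lipschitz hC) (norm_nonneg _))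
  have hB : IsCompact (T ∩ Ψ ⁻¹' Ici δ) :=
    hT.of_isClosed_subset (hΨc.preimage_isClosed_of_isClosed hT.isClosed isClosed_Ici)
      inter_subset_left
  rcases (T ∩ Ψ ⁻¹' Ici δ).eq_empty_or_nonempty with he | hne
  · refine ⟨1 / 2, by norm_num, fun x hx hc hd => ?_⟩
    have hxT : x ∈ T := ⟨subset_closure hx, hc.le⟩
    have : x ∉ T ∩ Ψ ⁻¹' Ici δ := by rw [he]; exact notMem_empty x
    have h2 : Ψ x < δ := by
      by_contra hcon
      exact this ⟨hxT, not_lt.1 hcon⟩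
    exact (key x hx hxT hd).trans h2.le
  · obtain ⟨y, hy, hmax⟩ := hB.exists_isMaxOn hne D.kg_continuous.continuousOn
    have hy1 : kg Ω p y < 1 := by
      refine lt_of_le_of_ne (D.kg_le_one hy.1.1) fun h1 => ?_
      have h2 : δ ≤ Ψ y := hy.2
      rw [hΨ1 y hy.1 h1] at h2
      linarith
    refine ⟨kg Ω p y, hy1, fun x hx hc hd => ?_⟩
    have hxT : x ∈ T := ⟨subset_closure hx, (hy.1.2 : (1 / 2 : ℝ) ≤ _).trans hc.le⟩
    have h2 : Ψ x < δ := by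
      by_contra hcon
      exact (hmax ⟨hxT, not_lt.1 hcon⟩).not_gt hc
    exact (key x hx hxT hd).trans h2.le

end ConvDom

lemma exists_compact_cutoff {K Ω : Set (ℝ × ℝ)} (hK : IsCompact K) (ho : IsOpen Ω) (h : K ⊆ Ω) :
    ∃ θ : ℝ × ℝ → ℝ, ContDiff ℝ (⊤ : ℕ∞) θ ∧ HasCompactSupport θ ∧ tsupport θ ⊆ Ω ∧
      ∀ᶠ x in 𝓝ˢ K, θ x = 1 := by
  obtain ⟨L, hL, hKL, hLΩ⟩ := exists_compact_between hK ho h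
  obtain ⟨f, hf1, hf0, -⟩ := exists_contMDiffMap_one_nhds_of_subset_interior (n := (⊤ : ℕ∞))
    (modelWithCornersSelf ℝ (ℝ × ℝ)) hK.isClosed hKL
  have hs : tsupport f ⊆ L := closure_minimal (fun x hx => by
    by_contra hcon
    exact hx (hf0 x hcon)) hL.isClosed
  exact ⟨f, f.contMDiff.contDiff, hL.of_isClosed_subset (isClosed_tsupport _) hs, hs.trans hLΩ, hf1⟩

section parts
variable {Ω : Set (ℝ × ℝ)} {χ V : ℝ × ℝ → ℝ} {K : NNReal}

/-- Multiplying by a cutoff makes a function on `Ω` globally `C¹` with compact support. -/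
lemma exists_extension (ho : IsOpen Ω) {S : Set (ℝ × ℝ)} (hS : IsCompact S) (hs : S ⊆ Ω)
    (hV : ContDiffOn ℝ 1 V Ω) :
    ∃ W : ℝ × ℝ → ℝ, ContDiff ℝ 1 W ∧ HasCompactSupport W ∧ ∀ x ∈ S, W =ᶠ[𝓝 x] V := by
  obtain ⟨θ, hθ, hθc, hθΩ, hθ1⟩ := exists_compact_cutoff hS ho hs
  refine ⟨fun x => θ x * V x, ?_, hθc.mul_right, fun x hx => ?_⟩
  · rw [contDiff_iff_contDiffAt]
    intro x
    by_cases hx : x ∈ Ω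
    · exact (hθ.of_le (by simp)).contDiffAt.mul (hV.contDiffAt (ho.mem_nhds hx))
    · have : (fun x => θ x * V x) =ᶠ[𝓝 x] fun _ => 0 := by
        filter_upwards [(isClosed_tsupport θ).isOpen_compl.mem_nhds (fun h => hx (hθΩ h))] with y hy
        rw [image_eq_zero_of_notMem_tsupport hy, zero_mul]
      exact contDiffAt_const.congr_of_eventuallyEq this
  · filter_upwards [eventually_nhdsSet_iff_forall.1 hθ1 x hx] with y hy
    rw [hy, one_mul]

lemma parts_aux (ho : IsOpen Ω) (hχ : LipschitzWith K χ) (hc : HasCompactSupport χ)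
    (hs : tsupport χ ⊆ Ω) (hV : ContDiffOn ℝ 1 V Ω) (v : ℝ × ℝ) :
    IntegrableOn (fun x => χ x * fderiv ℝ V x v) Ω ∧
    IntegrableOn (fun x => fderiv ℝ χ x v * V x) Ω ∧
    ∫ x in Ω, χ x * fderiv ℝ V x v = -∫ x in Ω, fderiv ℝ χ x v * V x := by
  obtain ⟨W, hW, hWc, hWV⟩ := exists_extension ho hc hs hV
  obtain ⟨L, hL⟩ := hW.lipschitzWith_of_hasCompactSupport hWc one_ne_zero
  have hmain := LipschitzWith.integral_lineDeriv_mul_eq (μ := volume) hL hχ hc v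
  have e1 : (fun x => lineDeriv ℝ W x v * χ x) = fun x => χ x * fderiv ℝ V x v := by
    funext x
    by_cases hx : x ∈ tsupport χ
    · rw [(hW.differentiable one_ne_zero x).lineDeriv_eq_fderiv, (hWV x hx).fderiv_eq, mul_comm]
    · rw [image_eq_zero_of_notMem_tsupport hx, mul_zero, zero_mul]
  have hz : ∀ x, x ∉ tsupport χ → fderiv ℝ χ x = 0 := fun x hx => by
    have : χ =ᶠ[𝓝 x] fun _ => 0 := by
      filter_upwards [(isClosed_tsupport χ).isOpen_compl.mem_nhds hx] with y hy
      exact image_eq_zero_of_notMem_tsupport hy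
    rw [this.fderiv_eq, fderiv_fun_const]; rfl
  have e2 : (fun x => lineDeriv ℝ χ x (-v) * W x) =ᵐ[volume] fun x => -(fderiv ℝ χ x v * V x) := by
    filter_upwards [hχ.ae_differentiableAt] with x hd
    rw [hd.lineDeriv_eq_fderiv, map_neg]
    by_cases hx : x ∈ tsupport χ
    · rw [(hWV x hx).eq_of_nhds, neg_mul]
    · simp [hz x hx]
  have e3 : (fun x => fderiv ℝ χ x v * W x) = fun x => fderiv ℝ χ x v * V x := by
    funext x
    by_cases hx : x ∈ tsupport χ
    · rw [(hWV x hx).eq_of_nhds]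
    · simp [hz x hx]
  have i1 : Integrable (fun x => χ x * fderiv ℝ V x v) := by
    have : (fun x => χ x * fderiv ℝ V x v) = fun x => χ x * fderiv ℝ W x v := by
      funext x
      by_cases hx : x ∈ tsupport χ
      · rw [(hWV x hx).fderiv_eq]
      · rw [image_eq_zero_of_notMem_tsupport hx, zero_mul, zero_mul]
    rw [this]
    refine Continuous.integrable_of_hasCompactSupport ?_ hc.mul_right
    exact hχ.continuous.mul ((hW.continuous_fderiv one_ne_zero).clm_apply continuous_const)
  have i2 : Integrable (fun x => fderiv ℝ χ x v * V x) := by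
    rw [← e3]
    refine (hW.continuous.integrable_of_hasCompactSupport hWc).bdd_mul (c := K * ‖v‖)
      (measurable_fderiv_apply_const ℝ χ v).aestronglyMeasurable ?_
    refine Eventually.of_forall fun x => ((fderiv ℝ χ x).le_opNorm v).trans ?_
    gcongr
    exact norm_fderiv_le_of_lipschitz ℝ hχ
  have s1 : ∀ x ∉ Ω, χ x * fderiv ℝ V x v = 0 := fun x hx => by
    rw [image_eq_zero_of_notMem_tsupport (fun h => hx (hs h)), zero_mul]
  have s2 : ∀ x ∉ Ω, fderiv ℝ χ x v * V x = 0 := fun x hx => by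
    simp [hz x (fun h => hx (hs h))]
  refine ⟨i1.integrableOn, i2.integrableOn, ?_⟩
  rw [setIntegral_eq_integral_of_forall_compl_eq_zero s1,
    setIntegral_eq_integral_of_forall_compl_eq_zero s2, ← e1, hmain, integral_congr_ae e2,
    integral_neg]

/-- Integration by parts against a compactly supported Lipschitz function. -/
lemma parts (ho : IsOpen Ω) (hχ : LipschitzWith K χ) (hc : HasCompactSupport χ)
    (hs : tsupport χ ⊆ Ω) {V1 V2 : ℝ × ℝ → ℝ} (h1 : ContDiffOn ℝ 1 V1 Ω)
    (h2 : ContDiffOn ℝ 1 V2 Ω) :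
    IntegrableOn (fun x => χ x * (pdx V1 x + pdy V2 x)) Ω ∧
    IntegrableOn (fun x => fderiv ℝ χ x (V1 x, V2 x)) Ω ∧
    ∫ x in Ω, χ x * (pdx V1 x + pdy V2 x) = -∫ x in Ω, fderiv ℝ χ x (V1 x, V2 x) := by
  obtain ⟨a1, b1, c1⟩ := parts_aux ho hχ hc hs h1 (1, 0)
  obtain ⟨a2, b2, c2⟩ := parts_aux ho hχ hc hs h2 (0, 1)
  have e1 : (fun x => χ x * (pdx V1 x + pdy V2 x)) =
      fun x => χ x * fderiv ℝ V1 x (1, 0) + χ x * fderiv ℝ V2 x (0, 1) := by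
    funext x; rw [pdx, pdy]; ring
  have e2 : (fun x => fderiv ℝ χ x (V1 x, V2 x)) =
      fun x => fderiv ℝ χ x (1, 0) * V1 x + fderiv ℝ χ x (0, 1) * V2 x := by
    funext x; rw [fderiv_apply_eq_pd, pdx, pdy]; ring
  rw [e1, e2]
  refine ⟨a1.add a2, b1.add b2, ?_⟩
  rw [integral_add a1 a2, integral_add b1 b2, c1, c2]
  ring

end parts

/-- A smooth monotone step from `0` to `1` whose derivative is bounded by `M`. -/
structure StepFun (S : ℝ → ℝ) (M : ℝ) : Prop where
  smooth : ContDiff ℝ (⊤ : ℕ∞) S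
  bound_nonneg : 0 ≤ M
  nonneg : ∀ t, 0 ≤ S t
  le_one : ∀ t, S t ≤ 1
  zero : ∀ t, t ≤ 0 → S t = 0
  one : ∀ t, 1 ≤ t → S t = 1
  pos : ∀ t, 0 < t → 0 < S t
  deriv_nonneg : ∀ t, 0 ≤ deriv S t
  deriv_le : ∀ t, deriv S t ≤ M
  deriv_zero : ∀ t, t ≤ 0 → deriv S t = 0
  deriv_one : ∀ t, 1 ≤ t → deriv S t = 0

lemma exists_step : ∃ S M, StepFun S M := by
  have hS : ContDiff ℝ (⊤ : ℕ∞) Real.smoothTransition := Real.smoothTransition.contDiff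
  have hm : Monotone Real.smoothTransition := Real.smoothTransition.monotone
  have h0 : ∀ t, t ≤ 0 → deriv Real.smoothTransition t = 0 := fun t ht => by
    have : IsLocalMin Real.smoothTransition t := by
      refine Eventually.of_forall fun s => ?_
      rw [Real.smoothTransition.zero_of_nonpos ht]
      exact Real.smoothTransition.nonneg s
    exact this.deriv_eq_zero
  have h1 : ∀ t, 1 ≤ t → deriv Real.smoothTransition t = 0 := fun t ht => by
    have : IsLocalMax Real.smoothTransition t := by
      refine Eventually.of_forall fun s => ?_
      rw [Real.smoothTransition.one_of_one_le ht]
      exact Real.smoothTransition.le_one s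
    exact this.deriv_eq_zero
  have hn : ∀ t, 0 ≤ deriv Real.smoothTransition t := fun t => hm.deriv_nonneg
  obtain ⟨M, hM⟩ := (isCompact_Icc (a := (0 : ℝ)) (b := 1)).exists_bound_of_continuousOn
    (hS.continuous_deriv (by simp : (1 : WithTop ℕ∞) ≤ _)).continuousOn
  have hM0 : 0 ≤ M := (norm_nonneg _).trans (hM 0 (by simp))
  refine ⟨_, M, hS, hM0, Real.smoothTransition.nonneg, Real.smoothTransition.le_one,
    fun t => Real.smoothTransition.zero_of_nonpos, fun t => Real.smoothTransition.one_of_one_le,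
    fun t => Real.smoothTransition.pos_of_pos, hn, fun t => ?_, h0, h1⟩
  by_cases h : t ∈ Icc (0 : ℝ) 1
  · exact (le_abs_self _).trans (hM t h)
  · rw [mem_Icc, not_and_or, not_le, not_le] at h
    rcases h with h | h
    · rw [h0 t h.le]; exact hM0
    · rw [h1 t h.le]; exact hM0

lemma StepFun.lipschitz {S : ℝ → ℝ} {M : ℝ} (h : StepFun S M) :
    LipschitzWith M.toNNReal S := by
  refine lipschitzWith_of_nnnorm_deriv_le (h.smooth.differentiable (by simp)) fun t => ?_
  rw [← NNReal.coe_le_coe, coe_nnnorm, Real.norm_eq_abs, abs_of_nonneg (h.deriv_nonneg t),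
    Real.coe_toNNReal _ h.bound_nonneg]
  exact h.deriv_le t

lemma StepFun.differentiableAt {S : ℝ → ℝ} {M : ℝ} (h : StepFun S M) (t : ℝ) :
    DifferentiableAt ℝ S t := h.smooth.differentiable (by simp) t

lemma StepFun.continuous_deriv {S : ℝ → ℝ} {M : ℝ} (h : StepFun S M) : Continuous (deriv S) :=
  h.smooth.continuous_deriv (by simp : (1 : WithTop ℕ∞) ≤ _)

/-- A bounded solution with bounded gradient and asymptotically nonnegative normal derivative. -/
structure SuperSol (Ω : Set (ℝ × ℝ)) (p : ℝ × ℝ) (μ : ℝ) (z : ℝ × ℝ → ℝ) : Prop where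
  smooth : ContDiffOn ℝ (⊤ : ℕ∞) z Ω
  bdd : ∃ B, ∀ x ∈ Ω, |z x| ≤ B ∧ |pdx z x| ≤ B ∧ |pdy z x| ≤ B
  eq : ∀ x ∈ Ω, -hypLap z x = μ * z x
  shell : ∀ δ > 0, ∃ c < 1, ∀ x ∈ Ω, c < kg Ω p x → DifferentiableAt ℝ (kg Ω p) x →
    -δ ≤ fderiv ℝ (kg Ω p) x (pdx z x, pdy z x)

namespace ConvDom
variable {Ω : Set (ℝ × ℝ)} {p : ℝ × ℝ} (D : ConvDom Ω p)
include D

lemma exists_global_gauge : ∃ (G : ℝ × ℝ → ℝ) (K : NNReal), LipschitzWith K G ∧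
    (∀ x ∈ Ω, G x = kg Ω p x) ∧ ∀ x ∉ Ω, 1 ≤ G x := by
  obtain ⟨y0, hy0, hy⟩ := D.exists_y
  obtain ⟨K, hK⟩ := D.exists_kg_lipschitz
  have h1 := (lipschitzWith_smul (β := ℝ) (y0⁻¹ : ℝ)).comp
    (Metric.lipschitz_infDist_pt (closure Ω))
  refine ⟨_, _, hK.add h1, fun x hx => ?_, fun x hx => ?_⟩
  · simp [Metric.infDist_zero_of_mem (subset_closure hx)]
  · have h0 : 0 ≤ kg Ω p x := gauge_nonneg _
    simp only [Function.comp_apply, smul_eq_mul]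
    by_cases hH : x ∈ H2
    · have h2 : 1 ≤ kg Ω p x := not_lt.1 fun h => hx ((D.kg_lt_one_iff hH).1 h)
      have h3 : 0 ≤ y0⁻¹ * Metric.infDist x (closure Ω) :=
        mul_nonneg (inv_pos.2 hy0).le Metric.infDist_nonneg
      linarith
    · have h2 : y0 ≤ Metric.infDist x (closure Ω) := by
        rw [Metric.le_infDist (D.nonempty.mono subset_closure)]
        intro w hw
        have h3 : x.2 ≤ 0 := not_lt.1 hH
        have h4 := hy w hw
        have h5 : |x.2 - w.2| ≤ dist x w := by
          rw [Prod.dist_eq, ← Real.dist_eq]; exact le_max_right _ _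
        have := neg_le_abs (x.2 - w.2)
        linarith
      have h3 : y0⁻¹ * y0 ≤ y0⁻¹ * Metric.infDist x (closure Ω) := by gcongr
      rw [inv_mul_cancel₀ hy0.ne'] at h3
      linarith

lemma shell_parts {S : ℝ → ℝ} {M : ℝ} (hS : StepFun S M) {ε : ℝ} (hε : 0 < ε)
    {V1 V2 : ℝ × ℝ → ℝ} (h1 : ContDiffOn ℝ 1 V1 Ω) (h2 : ContDiffOn ℝ 1 V2 Ω) :
    IntegrableOn (fun x => S ((1 - ε - kg Ω p x) / ε) * (pdx V1 x + pdy V2 x)) Ω ∧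
    IntegrableOn (fun x => deriv S ((1 - ε - kg Ω p x) / ε) *
      fderiv ℝ (kg Ω p) x (V1 x, V2 x)) Ω ∧
    ∫ x in Ω, S ((1 - ε - kg Ω p x) / ε) * (pdx V1 x + pdy V2 x) =
      ε⁻¹ * ∫ x in Ω, deriv S ((1 - ε - kg Ω p x) / ε) *
        fderiv ℝ (kg Ω p) x (V1 x, V2 x) := by
  obtain ⟨G, K, hG, hGin, hGout⟩ := D.exists_global_gauge
  let χ : ℝ × ℝ → ℝ := fun x => S (ε⁻¹ • (1 - ε - G x))
  have hχ : LipschitzWith _ χ := hS.lipschitz.comp ((lipschitzWith_smul (β := ℝ) (ε⁻¹ : ℝ)).comp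
    ((LipschitzWith.const (1 - ε)).sub hG))
  have hsub : tsupport χ ⊆ {x | G x ≤ 1 - ε} := by
    refine closure_minimal (fun x hx => ?_) (isClosed_le hG.continuous continuous_const)
    by_contra hcon
    have hcon' : 1 - ε < G x := not_le.1 hcon
    refine hx (hS.zero _ ?_)
    exact mul_nonpos_of_nonneg_of_nonpos (inv_pos.2 hε).le (by linarith)
  have hs : tsupport χ ⊆ Ω := fun x hx => by
    by_contra hcon
    have h3 : G x ≤ 1 - ε := hsub hx
    have := hGout x hcon
    linarith
  have hc : HasCompactSupport χ :=
    D.compact.of_isClosed_subset (isClosed_tsupport _) (hs.trans subset_closure)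
  obtain ⟨i1, i2, e⟩ := parts D.isOpen hχ hc hs h1 h2
  have c1 : ∀ x ∈ Ω, χ x * (pdx V1 x + pdy V2 x) =
      S ((1 - ε - kg Ω p x) / ε) * (pdx V1 x + pdy V2 x) := fun x hx => by
    simp only [χ, hGin x hx, smul_eq_mul]
    rw [div_eq_inv_mul]
  have c2 : ∀ᵐ x ∂(volume.restrict Ω), fderiv ℝ χ x (V1 x, V2 x) =
      -ε⁻¹ * (deriv S ((1 - ε - kg Ω p x) / ε) * fderiv ℝ (kg Ω p) x (V1 x, V2 x)) := by
    obtain ⟨K', hK'⟩ := D.exists_kg_lipschitz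
    filter_upwards [ae_restrict_mem D.isOpen.measurableSet,
      ae_restrict_of_ae hK'.ae_differentiableAt] with x hx hd
    have hev : χ =ᶠ[𝓝 x] fun x => S ((1 - ε - kg Ω p x) / ε) := by
      filter_upwards [D.isOpen.mem_nhds hx] with y hy
      simp only [χ, hGin y hy, smul_eq_mul]
      rw [div_eq_inv_mul]
    have hin : HasFDerivAt (fun x => (1 - ε - kg Ω p x) / ε)
        (ε⁻¹ • -fderiv ℝ (kg Ω p) x) x := by
      simpa [div_eq_inv_mul] using (hd.hasFDerivAt.const_sub (1 - ε)).const_mul ε⁻¹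
    have := (hS.differentiableAt _).hasDerivAt.comp_hasFDerivAt x hin
    rw [hev.fderiv_eq, show (fun x => S ((1 - ε - kg Ω p x) / ε)) =
      S ∘ fun x => (1 - ε - kg Ω p x) / ε from rfl, this.fderiv (𝕜 := ℝ)]
    simp only [smul_apply, neg_apply, smul_eq_mul]
    ring
  have i3 : IntegrableOn (fun x => -ε⁻¹ * (deriv S ((1 - ε - kg Ω p x) / ε) *
      fderiv ℝ (kg Ω p) x (V1 x, V2 x))) Ω := i2.congr c2
  refine ⟨i1.congr_fun c1 D.isOpen.measurableSet, ?_, ?_⟩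
  · have := i3.const_mul (-ε)
    refine this.congr (Eventually.of_forall fun x => ?_)
    simp only
    field_simp
  · rw [← setIntegral_congr_fun D.isOpen.measurableSet c1, e, integral_congr_ae c2,
      integral_const_mul]
    ring

lemma integrableOn_step {S : ℝ → ℝ} {M : ℝ} (hS : StepFun S M) (ε : ℝ) :
    IntegrableOn (fun x => deriv S ((1 - ε - kg Ω p x) / ε)) Ω := by
  refine D.integrableOn_of_cont (C := M) (Continuous.continuousOn ?_) fun x _ => ?_
  · exact hS.continuous_deriv.comp ((continuous_const.sub D.kg_continuous).div_const _)
  · rw [abs_of_nonneg (hS.deriv_nonneg _)]; exact hS.deriv_le _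

lemma shell_mass {S : ℝ → ℝ} {M : ℝ} (hS : StepFun S M) :
    ∃ C, ∀ ε, 0 < ε → ε < 1 / 4 →
      ε⁻¹ * ∫ x in Ω, deriv S ((1 - ε - kg Ω p x) / ε) ≤ C := by
  have hb : 0 < p.2 := D.base
  let lam : ℝ × ℝ → ℝ := fun z =>
    (1 - tfun p.1 p.2 z) ^ 3 / (2 * z.2 ^ 2 * (1 + tfun p.1 p.2 z))
  have htc : ContinuousOn (tfun p.1 p.2) (closure Ω) :=
    (tfun_smooth hb).continuousOn.mono D.closure_sub
  have hlpos : ∀ z ∈ closure Ω, 0 < lam z := fun z hz => by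
    have ht := tfun_mem (a := p.1) hb (D.closure_sub hz)
    have hz2 : 0 < z.2 := D.closure_sub hz
    have h1 : 0 < 1 - tfun p.1 p.2 z := by linarith [ht.2]
    have h2 : 0 < 1 + tfun p.1 p.2 z := by linarith [ht.1]
    positivity
  have hlc : ContinuousOn lam (closure Ω) := by
    refine ContinuousOn.div ((continuousOn_const.sub htc).pow 3)
      ((continuousOn_const.mul (continuous_snd.continuousOn.pow 2)).mul
        (continuousOn_const.add htc)) fun z hz => ?_
    have ht := tfun_mem (a := p.1) hb (D.closure_sub hz)
    have hz2 : 0 < z.2 := D.closure_sub hz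
    have h2 : 0 < 1 + tfun p.1 p.2 z := by linarith [ht.1]
    positivity
  obtain ⟨z0, hz0, hmin⟩ := D.compact.exists_isMinOn (D.nonempty.mono subset_closure) hlc
  have hc1 := hlpos z0 hz0
  refine ⟨2 / lam z0 * ∫ x in Ω, 1 / x.2 ^ 2, fun ε hε hε4 => ?_⟩
  have hts : ContDiffOn ℝ (⊤ : ℕ∞) (tfun p.1 p.2) Ω := (tfun_smooth hb).mono D.sub
  obtain ⟨i1, i2, e⟩ := D.shell_parts hS hε ((hts.pdx_smooth D.isOpen).of_le (by simp))
    ((hts.pdy_smooth D.isOpen).of_le (by simp))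
  have hle1 : ∫ x in Ω, S ((1 - ε - kg Ω p x) / ε) *
      (pdx (pdx (tfun p.1 p.2)) x + pdy (pdy (tfun p.1 p.2)) x) ≤ ∫ x in Ω, 1 / x.2 ^ 2 := by
    refine setIntegral_mono_on i1 D.integrableOn_one_div D.isOpen.measurableSet fun x hx => ?_
    have hl := hypLap_tfun (a := p.1) hb (D.sub hx)
    have hx2 : 0 < x.2 := D.sub hx
    have ht := tfun_mem (a := p.1) hb (D.sub hx)
    rw [hypLap] at hl
    have h3 : pdx (pdx (tfun p.1 p.2)) x + pdy (pdy (tfun p.1 p.2)) x =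
        (1 - tfun p.1 p.2 x) ^ 2 * (1 / x.2 ^ 2) := by
      rw [← hl]; field_simp
    rw [h3]
    have h4 : (0 : ℝ) ≤ 1 / x.2 ^ 2 := by positivity
    have h5 : S ((1 - ε - kg Ω p x) / ε) * (1 - tfun p.1 p.2 x) ^ 2 ≤ 1 := by
      have h6 : (1 - tfun p.1 p.2 x) ^ 2 ≤ 1 := by nlinarith [ht.1, ht.2]
      nlinarith [hS.nonneg ((1 - ε - kg Ω p x) / ε), hS.le_one ((1 - ε - kg Ω p x) / ε),
        sq_nonneg (1 - tfun p.1 p.2 x)]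
    nlinarith
  have hle2 : ∫ x in Ω, lam z0 / 2 * deriv S ((1 - ε - kg Ω p x) / ε) ≤
      ∫ x in Ω, deriv S ((1 - ε - kg Ω p x) / ε) *
        fderiv ℝ (kg Ω p) x (pdx (tfun p.1 p.2) x, pdy (tfun p.1 p.2) x) := by
    refine setIntegral_mono_ae_restrict ((D.integrableOn_step hS ε).const_mul _) i2 ?_
    obtain ⟨K', hK'⟩ := D.exists_kg_lipschitz
    filter_upwards [ae_restrict_mem D.isOpen.measurableSet,
      ae_restrict_of_ae hK'.ae_differentiableAt] with x hx hd
    rw [D.kg_radial (D.sub hx) hd, mul_comm (lam z0 / 2)]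
    by_cases h1 : 1 ≤ (1 - ε - kg Ω p x) / ε
    · rw [hS.deriv_one _ h1]; simp
    · refine mul_le_mul_of_nonneg_left ?_ (hS.deriv_nonneg _)
      rw [not_le, div_lt_one hε] at h1
      have h2 : lam z0 ≤ lam x := hmin (subset_closure hx)
      have h3 : 1 / 2 ≤ kg Ω p x := by linarith
      show lam z0 / 2 ≤ lam x * kg Ω p x
      nlinarith
  rw [integral_const_mul] at hle2
  rw [e] at hle1
  have h7 : ε⁻¹ * (lam z0 / 2 * ∫ x in Ω, deriv S ((1 - ε - kg Ω p x) / ε)) ≤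
      ∫ x in Ω, 1 / x.2 ^ 2 :=
    (mul_le_mul_of_nonneg_left hle2 (inv_pos.2 hε).le).trans hle1
  rw [div_mul_eq_mul_div, le_div_iff₀ hc1]
  linarith

variable {z η : ℝ × ℝ → ℝ} {μ B : ℝ}

lemma integrableOn_energy (hz : SuperSol Ω p μ z) (hη : ContDiffOn ℝ (⊤ : ℕ∞) η Ω)
    (hB : ∀ x ∈ Ω, |η x| ≤ B ∧ |pdx η x| ≤ B ∧ |pdy η x| ≤ B) :
    IntegrableOn (fun x => pdx z x * pdx η x + pdy z x * pdy η x - μ * (z x * η x / x.2 ^ 2)) Ω := by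
  obtain ⟨B', hB'⟩ := hz.bdd
  have hm : ∀ {a b : ℝ}, |a| ≤ B' → |b| ≤ B → |a * b| ≤ B' * B := fun ha hb => by
    rw [abs_mul]
    exact mul_le_mul ha hb (abs_nonneg _) ((abs_nonneg _).trans ha)
  have hs := hz.smooth
  have i1 : IntegrableOn (fun x => pdx z x * pdx η x) Ω := D.integrableOn_of_cont
    ((hs.pdx_smooth D.isOpen).continuousOn.mul (hη.pdx_smooth D.isOpen).continuousOn)
    fun x hx => hm (hB' x hx).2.1 (hB x hx).2.1
  have i2 : IntegrableOn (fun x => pdy z x * pdy η x) Ω := D.integrableOn_of_cont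
    ((hs.pdy_smooth D.isOpen).continuousOn.mul (hη.pdy_smooth D.isOpen).continuousOn)
    fun x hx => hm (hB' x hx).2.2 (hB x hx).2.2
  have i3 : IntegrableOn (fun x => z x * η x / x.2 ^ 2) Ω := D.integrableOn_div_of_cont
    (f := fun x => z x * η x) (hs.continuousOn.mul hη.continuousOn)
    fun x hx => hm (hB' x hx).1 (hB x hx).1
  exact (i1.add i2).sub (i3.const_mul μ)

/-- Weak formulation of the differential inequality satisfied by a supersolution. -/
lemma weak_ineq (hz : SuperSol Ω p μ z) (hη : ContDiffOn ℝ (⊤ : ℕ∞) η Ω)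
    (hη0 : ∀ x ∈ Ω, η x ≤ 0) (hB : ∀ x ∈ Ω, |η x| ≤ B ∧ |pdx η x| ≤ B ∧ |pdy η x| ≤ B) :
    ∫ x in Ω, (pdx z x * pdx η x + pdy z x * pdy η x - μ * (z x * η x / x.2 ^ 2)) ≤ 0 := by
  set Φ : ℝ × ℝ → ℝ := fun x =>
    pdx z x * pdx η x + pdy z x * pdy η x - μ * (z x * η x / x.2 ^ 2) with hΦ
  have hi : IntegrableOn Φ Ω := D.integrableOn_energy hz hη hB
  obtain ⟨S, M, hS⟩ := exists_step
  obtain ⟨C, hC⟩ := D.shell_mass hS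
  have hB0 : 0 ≤ B := by
    obtain ⟨x, hx⟩ := D.nonempty
    exact (abs_nonneg _).trans (hB x hx).1
  have hlim : Tendsto (fun ε => ∫ x in Ω, S ((1 - ε - kg Ω p x) / ε) * Φ x) (𝓝[>] 0)
      (𝓝 (∫ x in Ω, Φ x)) := by
    refine tendsto_integral_filter_of_dominated_convergence (fun x => |Φ x|) ?_ ?_ hi.abs ?_
    · refine Eventually.of_forall fun ε => AEStronglyMeasurable.mul ?_ hi.aestronglyMeasurable
      exact (hS.smooth.continuous.comp ((continuous_const.sub D.kg_continuous).div_const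
        _)).aestronglyMeasurable
    · refine Eventually.of_forall fun ε => Eventually.of_forall fun x => ?_
      rw [Real.norm_eq_abs, abs_mul, abs_of_nonneg (hS.nonneg _)]
      exact mul_le_of_le_one_left (abs_nonneg _) (hS.le_one _)
    · filter_upwards [ae_restrict_mem D.isOpen.measurableSet] with x hx
      have h1 := (D.kg_lt_one_iff (D.sub hx)).2 hx
      refine tendsto_const_nhds.congr' ?_
      have h2 : ∀ᶠ ε in 𝓝[>] (0 : ℝ), ε < (1 - kg Ω p x) / 2 :=
        mem_nhdsWithin_of_mem_nhds (Iio_mem_nhds (by linarith))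
      filter_upwards [h2, self_mem_nhdsWithin] with ε he hε
      have hε : 0 < ε := hε
      rw [hS.one, one_mul]
      rw [le_div_iff₀ hε]
      linarith
  have hdiv : ∀ x ∈ Ω, pdx (fun x => η x * pdx z x) x + pdy (fun x => η x * pdy z x) x = Φ x := by
    intro x hx
    rw [pdx_mul (hη.diffAt D.isOpen hx) ((hz.smooth.pdx_smooth D.isOpen).diffAt D.isOpen hx),
      pdy_mul (hη.diffAt D.isOpen hx) ((hz.smooth.pdy_smooth D.isOpen).diffAt D.isOpen hx)]
    have h1 := hz.eq x hx
    have hx2 : 0 < x.2 := D.sub hx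
    have h2 : pdx (pdx z) x + pdy (pdy z) x = -(μ * z x) / x.2 ^ 2 := by
      rw [← h1, hypLap]; field_simp
    have h3 : pdx (pdx z) x = -(μ * z x) / x.2 ^ 2 - pdy (pdy z) x := by linarith
    rw [h3, hΦ]
    ring
  have hbound : ∀ δ > 0, ∫ x in Ω, Φ x ≤ B * δ * C := by
    intro δ hδ
    obtain ⟨c, hc1, hc⟩ := hz.shell δ hδ
    refine le_of_tendsto hlim ?_
    have h1 : ∀ᶠ ε in 𝓝[>] (0 : ℝ), ε < 1 / 4 :=
      mem_nhdsWithin_of_mem_nhds (Iio_mem_nhds (by norm_num))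
    have h2 : ∀ᶠ ε in 𝓝[>] (0 : ℝ), ε < (1 - c) / 2 :=
      mem_nhdsWithin_of_mem_nhds (Iio_mem_nhds (by linarith))
    filter_upwards [h1, h2, self_mem_nhdsWithin] with ε he1 he2 hε
    have hε : 0 < ε := hε
    obtain ⟨i1, i2, e⟩ := D.shell_parts hS hε
      ((hη.mul (hz.smooth.pdx_smooth D.isOpen)).of_le (by simp))
      ((hη.mul (hz.smooth.pdy_smooth D.isOpen)).of_le (by simp))
    rw [← setIntegral_congr_fun D.isOpen.measurableSet
      (fun x hx => congrArg (S ((1 - ε - kg Ω p x) / ε) * ·) (hdiv x hx)), e]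
    have h3 : ∫ x in Ω, deriv S ((1 - ε - kg Ω p x) / ε) *
        fderiv ℝ (kg Ω p) x (η x * pdx z x, η x * pdy z x) ≤
        ∫ x in Ω, B * δ * deriv S ((1 - ε - kg Ω p x) / ε) := by
      refine setIntegral_mono_ae_restrict i2 ((D.integrableOn_step hS ε).const_mul _) ?_
      obtain ⟨K', hK'⟩ := D.exists_kg_lipschitz
      filter_upwards [ae_restrict_mem D.isOpen.measurableSet,
        ae_restrict_of_ae hK'.ae_differentiableAt] with x hx hd
      rw [mul_comm (B * δ)]
      by_cases h1 : 1 ≤ (1 - ε - kg Ω p x) / ε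
      · rw [hS.deriv_one _ h1]; simp
      · refine mul_le_mul_of_nonneg_left ?_ (hS.deriv_nonneg _)
        rw [not_le, div_lt_one hε] at h1
        have h4 := hc x hx (by linarith) hd
        rw [show (η x * pdx z x, η x * pdy z x) = η x • (pdx z x, pdy z x) from rfl, map_smul,
          smul_eq_mul]
        have h5 := (abs_le.1 (hB x hx).1).1
        nlinarith [hη0 x hx]
    rw [integral_const_mul] at h3
    calc _ ≤ ε⁻¹ * (B * δ * ∫ x in Ω, deriv S ((1 - ε - kg Ω p x) / ε)) :=
          mul_le_mul_of_nonneg_left h3 (inv_pos.2 hε).le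
      _ = B * δ * (ε⁻¹ * ∫ x in Ω, deriv S ((1 - ε - kg Ω p x) / ε)) := by ring
      _ ≤ _ := mul_le_mul_of_nonneg_left (hC ε hε he1) (by positivity)
  refine le_of_forall_pos_le_add fun e he => ?_
  have hK : 0 < |B * C| + 1 := by positivity
  refine (hbound (e / (|B * C| + 1)) (by positivity)).trans ?_
  have : B * (e / (|B * C| + 1)) * C = (B * C) * e / (|B * C| + 1) := by ring
  rw [this, zero_add, div_le_iff₀ hK]
  nlinarith [le_abs_self (B * C)]

end ConvDom

namespace ConvDom
variable {Ω : Set (ℝ × ℝ)} {p : ℝ × ℝ} (D : ConvDom Ω p)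
include D

lemma superSol {μ : ℝ} {u f : ℝ × ℝ → ℝ} {g : ℝ → ℝ} {c : ℝ} (hc : 0 ≤ c)
    (hf : f = fun x => g (tfun p.1 p.2 x))
    (hg : ContDiffOn ℝ (⊤ : ℕ∞) g (Ioo (-1) 1)) (hg' : ∀ t ∈ Ico (0 : ℝ) 1, deriv g t ≤ 0)
    (hode : ∀ t ∈ Ioo (-1 : ℝ) 1, (1 - t) ^ 2 * (t * deriv (deriv g) t + deriv g t) = -μ * g t)
    (hu : ContDiffOn ℝ (⊤ : ℕ∞) u Ω) (hu1 : ContDiffOn ℝ 1 u (closure Ω))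
    (heq : ∀ x ∈ Ω, -hypLap u x = μ * u x)
    (hn : ∀ q ∈ frontier Ω, ∀ ν : ℝ × ℝ, IsOutwardNormalAt Ω q ν →
      fderivWithin ℝ u (closure Ω) q ν = 0) :
    SuperSol Ω p μ (fun x => u x + -c * f x) := by
  have hb : 0 < p.2 := D.base
  have hm : ∀ x ∈ H2, tfun p.1 p.2 x ∈ Ioo (-1 : ℝ) 1 := fun x hx => by
    have := tfun_mem (a := p.1) hb hx
    exact ⟨by linarith [this.1], this.2⟩
  have hfH : ContDiffOn ℝ (⊤ : ℕ∞) f H2 := by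
    rw [hf]; exact hg.comp (tfun_smooth hb) hm
  have hfs : ContDiffOn ℝ (⊤ : ℕ∞) f Ω := hfH.mono D.sub
  have hpx : ∀ x ∈ Ω, pdx (fun x => u x + -c * f x) x = pdx u x + -c * pdx f x := fun x hx => by
    rw [pdx_add (hu.diffAt D.isOpen hx) ((hfs.diffAt D.isOpen hx).const_mul _),
      pdx_const_mul _ (hfs.diffAt D.isOpen hx)]
  have hpy : ∀ x ∈ Ω, pdy (fun x => u x + -c * f x) x = pdy u x + -c * pdy f x := fun x hx => by
    rw [pdy_add (hu.diffAt D.isOpen hx) ((hfs.diffAt D.isOpen hx).const_mul _),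
      pdy_const_mul _ (hfs.diffAt D.isOpen hx)]
  refine ⟨hu.add (contDiffOn_const.mul hfs), ?_, fun x hx => ?_, fun δ hδ => ?_⟩
  · have hbd : ∀ {h : ℝ × ℝ → ℝ}, ContinuousOn h (closure Ω) → ∃ B, ∀ x ∈ Ω, |h x| ≤ B :=
      fun {h} hh => by
        obtain ⟨B, hB⟩ := D.compact.exists_bound_of_continuousOn hh
        exact ⟨B, fun x hx => hB x (subset_closure hx)⟩
    have hw : ∀ x ∈ Ω, fderivWithin ℝ u (closure Ω) x = fderiv ℝ u x := fun x hx =>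
      fderivWithin_of_mem_nhds (mem_of_superset (D.isOpen.mem_nhds hx) subset_closure)
    have hwc := hu1.continuousOn_fderivWithin D.uniqueDiffOn le_rfl
    obtain ⟨B1, h1⟩ := hbd (hu1.continuousOn.add
      (continuousOn_const.mul (hfH.continuousOn.mono D.closure_sub)) :
      ContinuousOn (fun x => u x + -c * f x) (closure Ω))
    obtain ⟨B2, h2⟩ := hbd ((hwc.clm_apply (continuousOn_const (c := ((1 : ℝ), (0 : ℝ))))).add
      (continuousOn_const.mul ((hfH.pdx_smooth isOpen_H2).continuousOn.mono D.closure_sub)) :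
      ContinuousOn (fun x => fderivWithin ℝ u (closure Ω) x (1, 0) + -c * pdx f x) (closure Ω))
    obtain ⟨B3, h3⟩ := hbd ((hwc.clm_apply (continuousOn_const (c := ((0 : ℝ), (1 : ℝ))))).add
      (continuousOn_const.mul ((hfH.pdy_smooth isOpen_H2).continuousOn.mono D.closure_sub)) :
      ContinuousOn (fun x => fderivWithin ℝ u (closure Ω) x (0, 1) + -c * pdy f x) (closure Ω))
    refine ⟨max B1 (max B2 B3), fun x hx => ⟨(h1 x hx).trans (le_max_left _ _), ?_, ?_⟩⟩
    · rw [hpx x hx]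
      have := h2 x hx
      rw [Pi.add_apply, hw x hx] at this
      exact this.trans ((le_max_left _ _).trans (le_max_right _ _))
    · rw [hpy x hx]
      have := h3 x hx
      rw [Pi.add_apply, hw x hx] at this
      exact this.trans ((le_max_right _ _).trans (le_max_right _ _))
  · rw [hypLap_add_const_mul (-c) D.isOpen hu hfs hx]
    have h1 := heq x hx
    have h2 : hypLap f x = -μ * f x := by
      rw [hf, hypLap_comp_tfun hb hg (D.sub hx)]
      exact hode _ (hm x (D.sub hx))
    rw [h2]
    linarith
  · obtain ⟨c1, hc1, h⟩ := D.exists_shell hu1 hn hδ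
    refine ⟨c1, hc1, fun x hx hk hd => ?_⟩
    have h1 := (abs_le.1 (h x hx hk hd)).1
    have hgd : DifferentiableAt ℝ g (tfun p.1 p.2 x) :=
      (hg.contDiffAt (isOpen_Ioo.mem_nhds (hm x (D.sub hx)))).differentiableAt (by simp)
    have htd := (tfun_smooth (a := p.1) hb).diffAt isOpen_H2 (D.sub hx)
    have e1 : pdx f x = deriv g (tfun p.1 p.2 x) * pdx (tfun p.1 p.2) x := by
      rw [hf]; exact pdx_comp hgd htd
    have e2 : pdy f x = deriv g (tfun p.1 p.2 x) * pdy (tfun p.1 p.2) x := by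
      rw [hf]; exact pdy_comp hgd htd
    have e : (pdx (fun x => u x + -c * f x) x, pdy (fun x => u x + -c * f x) x) =
        (pdx u x, pdy u x) + (-c * deriv g (tfun p.1 p.2 x)) •
          (pdx (tfun p.1 p.2) x, pdy (tfun p.1 p.2) x) := by
      rw [hpx x hx, hpy x hx, e1, e2]
      ext <;> simp [mul_assoc]
    rw [e, map_add, map_smul, D.kg_radial (D.sub hx) hd, smul_eq_mul]
    have ht := tfun_mem (a := p.1) hb (D.sub hx)
    have hx2 : 0 < x.2 := D.sub hx
    have h3 : 0 ≤ 1 - tfun p.1 p.2 x := by linarith [ht.2]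
    have h4 : 0 ≤ 1 + tfun p.1 p.2 x := by linarith [ht.1]
    have h5 : 0 ≤ kg Ω p x := gauge_nonneg _
    have h6 : 0 ≤ -c * deriv g (tfun p.1 p.2 x) := by nlinarith [hg' _ ht]
    have : 0 ≤ -c * deriv g (tfun p.1 p.2 x) *
      ((1 - tfun p.1 p.2 x) ^ 3 / (2 * x.2 ^ 2 * (1 + tfun p.1 p.2 x)) * kg Ω p x) := by positivity
    linarith

/-- A Neumann eigenfunction with nonzero eigenvalue has mean zero. -/
lemma mean_zero {μ : ℝ} (hμ : 0 < μ) {u : ℝ × ℝ → ℝ} (h1 : SuperSol Ω p μ u)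
    (h2 : SuperSol Ω p μ (fun x => -u x)) : ∫ x in Ω, u x / x.2 ^ 2 = 0 := by
  have hB : ∀ x ∈ Ω, |(-1 : ℝ)| ≤ 1 ∧ |pdx (fun _ => (-1 : ℝ)) x| ≤ 1 ∧
      |pdy (fun _ => (-1 : ℝ)) x| ≤ 1 := fun x _ => by simp [pdx, pdy]
  have a1 := D.weak_ineq h1 (contDiffOn_const (c := (-1 : ℝ))) (fun x _ => by norm_num) hB
  have a2 := D.weak_ineq h2 (contDiffOn_const (c := (-1 : ℝ))) (fun x _ => by norm_num) hB
  have e1 : ∀ x : ℝ × ℝ, pdx u x * pdx (fun _ => (-1 : ℝ)) x + pdy u x * pdy (fun _ => (-1 : ℝ)) x -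
      μ * (u x * -1 / x.2 ^ 2) = μ * (u x / x.2 ^ 2) := fun x => by simp [pdx, pdy]; ring
  have e2 : ∀ x : ℝ × ℝ, pdx (fun x => -u x) x * pdx (fun _ => (-1 : ℝ)) x +
      pdy (fun x => -u x) x * pdy (fun _ => (-1 : ℝ)) x -
      μ * (-u x * -1 / x.2 ^ 2) = -μ * (u x / x.2 ^ 2) := fun x => by
    simp [pdx, pdy]
  simp only [e1, integral_const_mul] at a1
  simp only [e2, integral_const_mul] at a2
  nlinarith

end ConvDom

/-- A smooth truncation, the identity far to the left of the origin and zero near it. -/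
structure TruncFun (F : ℝ → ℝ) (M : ℝ) : Prop where
  smooth : ContDiff ℝ (⊤ : ℕ∞) F
  bound_nonneg : 0 ≤ M
  zero : ∀ s, -1 ≤ s → F s = 0
  nonpos : ∀ s, F s ≤ 0
  id_of_lt : ∀ s, s < -2 → F s = s
  abs_le : ∀ s, |F s| ≤ |s|
  deriv_le : ∀ s, |deriv F s| ≤ M
  deriv_id : ∀ s, s < -2 → deriv F s = 1

lemma exists_trunc : ∃ F M, TruncFun F M := by
  obtain ⟨S, M, hS⟩ := exists_step
  have hd : ∀ s, HasDerivAt (fun s => s * S (-s - 1)) (S (-s - 1) - s * deriv S (-s - 1)) s := by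
    intro s
    have h1 : HasDerivAt (fun s : ℝ => -s - 1) (-1) s := (hasDerivAt_id s).neg.sub_const 1
    have h2 := (hS.differentiableAt (-s - 1)).hasDerivAt.comp s h1
    refine ((hasDerivAt_id s).mul h2).congr_deriv ?_
    simp only [id, Function.comp_apply]
    ring
  refine ⟨fun s => s * S (-s - 1), 1 + 2 * M, ?_, ?_, fun s hs => ?_, fun s => ?_, fun s hs => ?_,
    fun s => ?_, fun s => ?_, fun s hs => ?_⟩
  · exact contDiff_id.mul (hS.smooth.comp (contDiff_id.neg.sub contDiff_const))
  · have := hS.bound_nonneg; positivity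
  · rw [hS.zero _ (by linarith), mul_zero]
  · rcases le_total s 0 with h | h
    · exact mul_nonpos_of_nonpos_of_nonneg h (hS.nonneg _)
    · rw [hS.zero _ (by linarith), mul_zero]
  · rw [hS.one _ (by linarith), mul_one]
  · rw [abs_mul, abs_of_nonneg (hS.nonneg _)]
    exact mul_le_of_le_one_right (abs_nonneg _) (hS.le_one _)
  · rw [(hd s).deriv]
    have hM := hS.bound_nonneg
    have h0 := hS.nonneg (-s - 1)
    have h1 := hS.le_one (-s - 1)
    have h2 := hS.deriv_nonneg (-s - 1)
    have h3 := hS.deriv_le (-s - 1)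
    rcases le_total (-s - 1) 0 with h | h
    · rw [hS.deriv_zero _ h, hS.zero _ h]; simp; positivity
    · rcases le_total 1 (-s - 1) with h' | h'
      · rw [hS.deriv_one _ h', hS.one _ h']; simp; positivity
      · rw [abs_le]
        constructor <;> nlinarith
  · rw [(hd s).deriv, hS.one _ (by linarith), hS.deriv_one _ (by linarith)]; ring

/-- A splitting of the negative set of `z` in `Ω` into two disjoint open pieces. -/
structure Split (Ω : Set (ℝ × ℝ)) (z : ℝ × ℝ → ℝ) (D1 D2 : Set (ℝ × ℝ)) : Prop where
  open1 : IsOpen D1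
  open2 : IsOpen D2
  disj : Disjoint D1 D2
  union : D1 ∪ D2 = {x | x ∈ Ω ∧ z x < 0}

namespace Split
variable {Ω D1 D2 : Set (ℝ × ℝ)} {z : ℝ × ℝ → ℝ} {F : ℝ → ℝ} {M ε : ℝ}

lemma symm (h : Split Ω z D1 D2) : Split Ω z D2 D1 :=
  ⟨h.open2, h.open1, h.disj.symm, by rw [union_comm]; exact h.union⟩

lemma sub (h : Split Ω z D1 D2) {x : ℝ × ℝ} (hx : x ∈ D1) : x ∈ Ω ∧ z x < 0 := by
  have : x ∈ {x | x ∈ Ω ∧ z x < 0} := h.union ▸ Or.inl hx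
  exact this

lemma notMem (h : Split Ω z D1 D2) {x : ℝ × ℝ} (hx : x ∈ D1) : x ∉ D2 :=
  fun h2 => disjoint_left.1 h.disj hx h2

/-- The truncation of `z` restricted to one piece of the splitting. -/
def tr (F : ℝ → ℝ) (z : ℝ × ℝ → ℝ) (D1 : Set (ℝ × ℝ)) (ε : ℝ) : ℝ × ℝ → ℝ :=
  D1.indicator fun x => ε * F (z x / ε)

lemma tr_local_mem (h : Split Ω z D1 D2) {x : ℝ × ℝ} (hx : x ∈ D1) :
    tr F z D1 ε =ᶠ[𝓝 x] fun x => ε * F (z x / ε) := by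
  filter_upwards [h.open1.mem_nhds hx] with y hy
  exact indicator_of_mem hy _

lemma tr_local_notMem (h : Split Ω z D1 D2) (ho : IsOpen Ω) (hz : ContinuousOn z Ω)
    (hF : TruncFun F M) (hε : 0 < ε) {x : ℝ × ℝ} (hx : x ∈ Ω) (hx1 : x ∉ D1) :
    tr F z D1 ε =ᶠ[𝓝 x] fun _ => 0 := by
  by_cases hx2 : x ∈ D2
  · filter_upwards [h.open2.mem_nhds hx2] with y hy
    exact indicator_of_notMem (h.symm.notMem hy) _
  · have hz0 : 0 ≤ z x := by
      by_contra hcon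
      have : x ∈ D1 ∪ D2 := by rw [h.union]; exact ⟨hx, not_le.1 hcon⟩
      exact this.elim hx1 hx2
    have hc : ContinuousAt z x := hz.continuousAt (ho.mem_nhds hx)
    filter_upwards [hc.eventually (lt_mem_nhds (show -ε < z x by linarith))] with y hy
    by_cases hy1 : y ∈ D1
    · rw [tr, indicator_of_mem hy1, hF.zero, mul_zero]
      rw [le_div_iff₀ hε]; linarith
    · exact indicator_of_notMem hy1 _

lemma tr_smooth (h : Split Ω z D1 D2) (ho : IsOpen Ω) (hz : ContDiffOn ℝ (⊤ : ℕ∞) z Ω)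
    (hF : TruncFun F M) (hε : 0 < ε) : ContDiffOn ℝ (⊤ : ℕ∞) (tr F z D1 ε) Ω := by
  intro x hx
  refine ContDiffAt.contDiffWithinAt ?_
  by_cases hx1 : x ∈ D1
  · refine ContDiffAt.congr_of_eventuallyEq ?_ (h.tr_local_mem hx1)
    exact contDiffAt_const.mul (hF.smooth.contDiffAt.comp x
      ((hz.contDiffAt (ho.mem_nhds hx)).div_const ε))
  · exact contDiffAt_const.congr_of_eventuallyEq
      (h.tr_local_notMem ho hz.continuousOn hF hε hx hx1)

lemma pdx_tr (h : Split Ω z D1 D2) (ho : IsOpen Ω) (hz : ContDiffOn ℝ (⊤ : ℕ∞) z Ω)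
    (hF : TruncFun F M) (hε : 0 < ε) {x : ℝ × ℝ} (hx : x ∈ Ω) :
    pdx (tr F z D1 ε) x = D1.indicator (fun x => deriv F (z x / ε) * pdx z x) x := by
  by_cases hx1 : x ∈ D1
  · have hzd := hz.diffAt ho hx
    have hFd : DifferentiableAt ℝ (fun t => ε * F (t / ε)) (z x) :=
      ((hF.smooth.differentiable (by simp)).comp (differentiable_id.div_const ε)).const_mul ε _
    have hd : deriv (fun t => ε * F (t / ε)) (z x) = deriv F (z x / ε) := by
      have h1 : HasDerivAt (fun t : ℝ => t / ε) (1 / ε) (z x) := (hasDerivAt_id _).div_const ε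
      have h2 := (((hF.smooth.differentiable (by simp)) (z x / ε)).hasDerivAt.comp (z x) h1).const_mul ε
      rw [show (fun t => ε * F (t / ε)) = fun t => ε * (F ∘ fun t => t / ε) t from rfl, h2.deriv]
      field_simp
    rw [indicator_of_mem hx1, pdx_congr (h.tr_local_mem hx1), ← hd]
    exact pdx_comp (f := fun t => ε * F (t / ε)) hFd hzd
  · rw [indicator_of_notMem hx1, pdx_congr (h.tr_local_notMem ho hz.continuousOn hF hε hx hx1)]
    simp [pdx]

lemma pdy_tr (h : Split Ω z D1 D2) (ho : IsOpen Ω) (hz : ContDiffOn ℝ (⊤ : ℕ∞) z Ω)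
    (hF : TruncFun F M) (hε : 0 < ε) {x : ℝ × ℝ} (hx : x ∈ Ω) :
    pdy (tr F z D1 ε) x = D1.indicator (fun x => deriv F (z x / ε) * pdy z x) x := by
  by_cases hx1 : x ∈ D1
  · have hzd := hz.diffAt ho hx
    have hFd : DifferentiableAt ℝ (fun t => ε * F (t / ε)) (z x) :=
      ((hF.smooth.differentiable (by simp)).comp (differentiable_id.div_const ε)).const_mul ε _
    have hd : deriv (fun t => ε * F (t / ε)) (z x) = deriv F (z x / ε) := by
      have h1 : HasDerivAt (fun t : ℝ => t / ε) (1 / ε) (z x) := (hasDerivAt_id _).div_const ε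
      have h2 := (((hF.smooth.differentiable (by simp)) (z x / ε)).hasDerivAt.comp (z x) h1).const_mul ε
      rw [show (fun t => ε * F (t / ε)) = fun t => ε * (F ∘ fun t => t / ε) t from rfl, h2.deriv]
      field_simp
    rw [indicator_of_mem hx1, pdy_congr (h.tr_local_mem hx1), ← hd]
    exact pdy_comp (f := fun t => ε * F (t / ε)) hFd hzd
  · rw [indicator_of_notMem hx1, pdy_congr (h.tr_local_notMem ho hz.continuousOn hF hε hx hx1)]
    simp [pdy]

lemma tr_nonpos (hF : TruncFun F M) (hε : 0 < ε) (x : ℝ × ℝ) : tr F z D1 ε x ≤ 0 := by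
  by_cases hx : x ∈ D1
  · rw [tr, indicator_of_mem hx]
    exact mul_nonpos_of_nonneg_of_nonpos hε.le (hF.nonpos _)
  · rw [tr, indicator_of_notMem hx]

lemma abs_tr_le (hF : TruncFun F M) (hε : 0 < ε) (x : ℝ × ℝ) : |tr F z D1 ε x| ≤ |z x| := by
  by_cases hx : x ∈ D1
  · rw [tr, indicator_of_mem hx, abs_mul, abs_of_pos hε]
    calc ε * |F (z x / ε)| ≤ ε * |z x / ε| :=
          mul_le_mul_of_nonneg_left (hF.abs_le _) hε.le
      _ = |z x| := by rw [abs_div, abs_of_pos hε]; field_simp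
  · rw [tr, indicator_of_notMem hx]; simp

lemma abs_pdx_tr_le (h : Split Ω z D1 D2) (ho : IsOpen Ω) (hz : ContDiffOn ℝ (⊤ : ℕ∞) z Ω)
    (hF : TruncFun F M) (hε : 0 < ε) {x : ℝ × ℝ} (hx : x ∈ Ω) :
    |pdx (tr F z D1 ε) x| ≤ M * |pdx z x| := by
  rw [h.pdx_tr ho hz hF hε hx]
  by_cases hx1 : x ∈ D1
  · rw [indicator_of_mem hx1, abs_mul]
    exact mul_le_mul_of_nonneg_right (hF.deriv_le _) (abs_nonneg _)
  · rw [indicator_of_notMem hx1, abs_zero]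
    exact mul_nonneg hF.bound_nonneg (abs_nonneg _)

lemma abs_pdy_tr_le (h : Split Ω z D1 D2) (ho : IsOpen Ω) (hz : ContDiffOn ℝ (⊤ : ℕ∞) z Ω)
    (hF : TruncFun F M) (hε : 0 < ε) {x : ℝ × ℝ} (hx : x ∈ Ω) :
    |pdy (tr F z D1 ε) x| ≤ M * |pdy z x| := by
  rw [h.pdy_tr ho hz hF hε hx]
  by_cases hx1 : x ∈ D1
  · rw [indicator_of_mem hx1, abs_mul]
    exact mul_le_mul_of_nonneg_right (hF.deriv_le _) (abs_nonneg _)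
  · rw [indicator_of_notMem hx1, abs_zero]
    exact mul_nonneg hF.bound_nonneg (abs_nonneg _)

lemma tr_limit (h : Split Ω z D1 D2) (ho : IsOpen Ω) (hz : ContDiffOn ℝ (⊤ : ℕ∞) z Ω)
    (hF : TruncFun F M) {x : ℝ × ℝ} (hx : x ∈ Ω) :
    ∀ᶠ ε in 𝓝[>] (0 : ℝ), tr F z D1 ε x = D1.indicator z x ∧
      pdx (tr F z D1 ε) x = D1.indicator (pdx z) x ∧
      pdy (tr F z D1 ε) x = D1.indicator (pdy z) x := by
  by_cases hx1 : x ∈ D1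
  · have hz0 := (h.sub hx1).2
    have h2 : ∀ᶠ ε in 𝓝[>] (0 : ℝ), ε < -z x / 2 :=
      mem_nhdsWithin_of_mem_nhds (Iio_mem_nhds (by linarith))
    filter_upwards [h2, self_mem_nhdsWithin] with ε h2 hε
    have hε : 0 < ε := hε
    have h3 : z x / ε < -2 := by rw [div_lt_iff₀ hε]; linarith
    rw [h.pdx_tr ho hz hF hε hx, h.pdy_tr ho hz hF hε hx, tr]
    simp only [indicator_of_mem hx1, hF.id_of_lt _ h3, hF.deriv_id _ h3, one_mul]
    refine ⟨by field_simp, trivial, trivial⟩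
  · filter_upwards [self_mem_nhdsWithin] with ε hε
    rw [h.pdx_tr ho hz hF hε hx, h.pdy_tr ho hz hF hε hx, tr]
    simp [indicator_of_notMem hx1]

end Split

lemma BddDom.tendsto_integral {Ω : Set (ℝ × ℝ)} (D : BddDom Ω) {Φ : ℝ → ℝ × ℝ → ℝ}
    {Φ0 : ℝ × ℝ → ℝ} {C : ℝ}
    (hm : ∀ ε > 0, AEStronglyMeasurable (Φ ε) (volume.restrict Ω))
    (hb : ∀ ε > 0, ∀ x ∈ Ω, |Φ ε x| ≤ C)
    (hl : ∀ x ∈ Ω, ∀ᶠ ε in 𝓝[>] (0 : ℝ), Φ ε x = Φ0 x) :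
    Tendsto (fun ε => ∫ x in Ω, Φ ε x) (𝓝[>] 0) (𝓝 (∫ x in Ω, Φ0 x)) := by
  refine tendsto_integral_filter_of_dominated_convergence (fun _ => C) ?_ ?_ ?_ ?_
  · filter_upwards [self_mem_nhdsWithin] with ε hε using hm ε hε
  · filter_upwards [self_mem_nhdsWithin] with ε hε
    filter_upwards [ae_restrict_mem D.isOpen.measurableSet] with x hx using hb ε hε x hx
  · have : IsFiniteMeasure (volume.restrict Ω) := ⟨by simpa using D.volume_lt_top⟩
    exact integrable_const C
  · filter_upwards [ae_restrict_mem D.isOpen.measurableSet] with x hx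
    exact tendsto_const_nhds.congr' ((hl x hx).mono fun ε h => h.symm)

/-- The density of the bilinear form associated with `-Δ - μ`. -/
def enDens (μ : ℝ) (z η : ℝ × ℝ → ℝ) (x : ℝ × ℝ) : ℝ :=
  pdx z x * pdx η x + pdy z x * pdy η x - μ * (z x * η x / x.2 ^ 2)

namespace BddDom
variable {Ω : Set (ℝ × ℝ)} {μ : ℝ} {z η : ℝ × ℝ → ℝ} {B : ℝ} (D : BddDom Ω)
include D

lemma enDens_continuousOn (hz : ContDiffOn ℝ (⊤ : ℕ∞) z Ω) (hη : ContDiffOn ℝ (⊤ : ℕ∞) η Ω) :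
    ContinuousOn (enDens μ z η) Ω := by
  have h1 := (hz.pdx_smooth D.isOpen).continuousOn
  have h2 := (hz.pdy_smooth D.isOpen).continuousOn
  have h3 := (hη.pdx_smooth D.isOpen).continuousOn
  have h4 := (hη.pdy_smooth D.isOpen).continuousOn
  have h5 := hz.continuousOn
  have h6 := hη.continuousOn
  refine ((h1.mul h3).add (h2.mul h4)).sub (continuousOn_const.mul ((h5.mul h6).div ?_ ?_))
  · fun_prop
  · intro x hx
    have : 0 < x.2 := D.sub hx
    positivity

lemma exists_enDens_bound (μ B : ℝ) : ∃ C, ∀ z η : ℝ × ℝ → ℝ, ∀ x ∈ Ω,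
    (|z x| ≤ B ∧ |pdx z x| ≤ B ∧ |pdy z x| ≤ B) → (|η x| ≤ B ∧ |pdx η x| ≤ B ∧ |pdy η x| ≤ B) →
    |enDens μ z η x| ≤ C := by
  obtain ⟨K, hK, h⟩ := D.exists_dens
  refine ⟨B * B + B * B + |μ| * (B * B * K), fun z η x hx hz hη => ?_⟩
  have hB : 0 ≤ B := (abs_nonneg _).trans hz.1
  have hm : ∀ {a b : ℝ}, |a| ≤ B → |b| ≤ B → |a * b| ≤ B * B := fun ha hb => by
    rw [abs_mul]
    exact mul_le_mul ha hb (abs_nonneg _) hB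
  have h1 := hm hz.2.1 hη.2.1
  have h2 := hm hz.2.2 hη.2.2
  have h3 : |μ * (z x * η x / x.2 ^ 2)| ≤ |μ| * (B * B * K) := by
    rw [abs_mul, div_eq_mul_one_div, abs_mul (z x * η x), abs_of_nonneg (show 0 ≤ 1 / x.2 ^ 2 by positivity)]
    exact mul_le_mul_of_nonneg_left (mul_le_mul (hm hz.1 hη.1) (h x (subset_closure hx))
      (by positivity) (by positivity)) (abs_nonneg _)
  rw [enDens]
  calc _ ≤ |pdx z x * pdx η x + pdy z x * pdy η x| + |μ * (z x * η x / x.2 ^ 2)| := abs_sub _ _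
    _ ≤ |pdx z x * pdx η x| + |pdy z x * pdy η x| + |μ * (z x * η x / x.2 ^ 2)| := by
      gcongr; exact abs_add_le _ _
    _ ≤ _ := by gcongr

lemma enDens_integrableOn (hz : ContDiffOn ℝ (⊤ : ℕ∞) z Ω) (hη : ContDiffOn ℝ (⊤ : ℕ∞) η Ω)
    (hzB : ∀ x ∈ Ω, |z x| ≤ B ∧ |pdx z x| ≤ B ∧ |pdy z x| ≤ B)
    (hηB : ∀ x ∈ Ω, |η x| ≤ B ∧ |pdx η x| ≤ B ∧ |pdy η x| ≤ B) :
    IntegrableOn (enDens μ z η) Ω := by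
  obtain ⟨C, hC⟩ := D.exists_enDens_bound μ B
  exact D.integrableOn_of_cont (D.enDens_continuousOn hz hη)
    fun x hx => hC z η x hx (hzB x hx) (hηB x hx)

end BddDom

namespace ConvDom
variable {Ω D1 D2 : Set (ℝ × ℝ)} {p : ℝ × ℝ} {μ : ℝ} {z η : ℝ × ℝ → ℝ} {B : ℝ}
  (D : ConvDom Ω p)
include D

lemma exists_split_bounds (hz : SuperSol Ω p μ z) (hs : Split Ω z D1 D2) : ∃ F M B,
    TruncFun F M ∧ 0 ≤ B ∧ (∀ x ∈ Ω, |z x| ≤ B ∧ |pdx z x| ≤ B ∧ |pdy z x| ≤ B) ∧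
    (∀ ε > 0, ∀ x ∈ Ω, |Split.tr F z D1 ε x| ≤ B ∧ |pdx (Split.tr F z D1 ε) x| ≤ B ∧
      |pdy (Split.tr F z D1 ε) x| ≤ B) ∧
    (∀ ε > 0, ∀ x ∈ Ω, |Split.tr F z D2 ε x| ≤ B ∧ |pdx (Split.tr F z D2 ε) x| ≤ B ∧
      |pdy (Split.tr F z D2 ε) x| ≤ B) := by
  obtain ⟨F, M, hF⟩ := exists_trunc
  obtain ⟨B, hB⟩ := hz.bdd
  have hM := hF.bound_nonneg
  have hB0 : 0 ≤ B := (abs_nonneg _).trans (hB p D.mem).1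
  have h1 : ∀ {a : ℝ}, a ≤ B → a ≤ (1 + M) * B := fun h => by nlinarith
  have h2 : ∀ {a b : ℝ}, a ≤ M * b → b ≤ B → a ≤ (1 + M) * B := fun h h' => by nlinarith
  have key : ∀ {E1 E2 : Set (ℝ × ℝ)}, Split Ω z E1 E2 → ∀ ε > 0, ∀ x ∈ Ω,
      |Split.tr F z E1 ε x| ≤ (1 + M) * B ∧ |pdx (Split.tr F z E1 ε) x| ≤ (1 + M) * B ∧
      |pdy (Split.tr F z E1 ε) x| ≤ (1 + M) * B := fun h ε hε x hx =>
    ⟨h1 ((Split.abs_tr_le hF hε x).trans (hB x hx).1),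
      h2 (h.abs_pdx_tr_le D.isOpen hz.smooth hF hε hx) (hB x hx).2.1,
      h2 (h.abs_pdy_tr_le D.isOpen hz.smooth hF hε hx) (hB x hx).2.2⟩
  exact ⟨F, M, (1 + M) * B, hF, by positivity,
    fun x hx => ⟨h1 (hB x hx).1, h1 (hB x hx).2.1, h1 (hB x hx).2.2⟩, key hs, key hs.symm⟩

lemma energy_nonpos (hz : SuperSol Ω p μ z) (hs : Split Ω z D1 D2) :
    ∫ x in Ω, D1.indicator (enDens μ z z) x ≤ 0 := by
  obtain ⟨F, M, B, hF, hB0, hB, h1, -⟩ := D.exists_split_bounds hz hs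
  obtain ⟨C, hC⟩ := D.exists_enDens_bound μ B
  have hlim := D.toBddDom.tendsto_integral (Φ := fun ε => enDens μ z (Split.tr F z D1 ε))
    (Φ0 := D1.indicator (enDens μ z z)) (C := C)
    (fun ε hε => (D.enDens_continuousOn hz.smooth (hs.tr_smooth D.isOpen hz.smooth hF
      hε)).aestronglyMeasurable D.isOpen.measurableSet)
    (fun ε hε x hx => hC _ _ x hx (hB x hx) (h1 ε hε x hx))
    (fun x hx => by
      filter_upwards [hs.tr_limit D.isOpen hz.smooth hF hx] with ε hε
      rw [enDens, hε.1, hε.2.1, hε.2.2]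
      by_cases hx1 : x ∈ D1
      · simp only [indicator_of_mem hx1, enDens]
      · simp only [indicator_of_notMem hx1, mul_zero, zero_div, add_zero, sub_zero])
  refine le_of_tendsto hlim ?_
  filter_upwards [self_mem_nhdsWithin] with ε hε
  exact D.weak_ineq hz (hs.tr_smooth D.isOpen hz.smooth hF hε)
    (fun x _ => Split.tr_nonpos hF hε x) (h1 ε hε)

/-- The limiting variational inequality for combinations of the pieces of `z`. -/
lemma split_varIneq (hz : SuperSol Ω p μ z) (hs : Split Ω z D1 D2) (hv : VarIneq Ω μ)
    (hη : ContDiffOn ℝ (⊤ : ℕ∞) η Ω) (hηB : ∀ x ∈ Ω, |η x| ≤ B ∧ |pdx η x| ≤ B ∧ |pdy η x| ≤ B)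
    (α β : ℝ) :
    μ * ((∫ x in Ω, (α * D1.indicator z x + β * D2.indicator z x + η x) ^ 2 / x.2 ^ 2) -
      (∫ x in Ω, (α * D1.indicator z x + β * D2.indicator z x + η x) / x.2 ^ 2) ^ 2 /
        ∫ x in Ω, 1 / x.2 ^ 2) ≤
    ∫ x in Ω, ((α * D1.indicator (pdx z) x + β * D2.indicator (pdx z) x + pdx η x) ^ 2 +
      (α * D1.indicator (pdy z) x + β * D2.indicator (pdy z) x + pdy η x) ^ 2) := by
  obtain ⟨F, M, B', hF, hB0, hB, h1, h2⟩ := D.exists_split_bounds hz hs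
  obtain ⟨K, hK, hd⟩ := D.exists_dens
  set t1 := Split.tr F z D1
  set t2 := Split.tr F z D2
  have s1 : ∀ ε > 0, ContDiffOn ℝ (⊤ : ℕ∞) (t1 ε) Ω := fun ε hε =>
    hs.tr_smooth D.isOpen hz.smooth hF hε
  have s2 : ∀ ε > 0, ContDiffOn ℝ (⊤ : ℕ∞) (t2 ε) Ω := fun ε hε =>
    hs.symm.tr_smooth D.isOpen hz.smooth hF hε
  set w : ℝ → ℝ × ℝ → ℝ := fun ε x => α * t1 ε x + β * t2 ε x + η x with hw
  have sw : ∀ ε > 0, ContDiffOn ℝ (⊤ : ℕ∞) (w ε) Ω := fun ε hε =>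
    ((contDiffOn_const.mul (s1 ε hε)).add (contDiffOn_const.mul (s2 ε hε))).add hη
  have px : ∀ ε > 0, ∀ x ∈ Ω, pdx (w ε) x = α * pdx (t1 ε) x + β * pdx (t2 ε) x + pdx η x := by
    intro ε hε x hx
    have d1 := (s1 ε hε).diffAt D.isOpen hx
    have d2 := (s2 ε hε).diffAt D.isOpen hx
    have d3 := hη.diffAt D.isOpen hx
    rw [hw]
    simp only
    rw [pdx_add (u := fun x => α * t1 ε x + β * t2 ε x) ((d1.const_mul α).add (d2.const_mul β)) d3,
      pdx_add (u := fun x => α * t1 ε x) (d1.const_mul α) (d2.const_mul β),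
      pdx_const_mul α d1, pdx_const_mul β d2]
  have py : ∀ ε > 0, ∀ x ∈ Ω, pdy (w ε) x = α * pdy (t1 ε) x + β * pdy (t2 ε) x + pdy η x := by
    intro ε hε x hx
    have d1 := (s1 ε hε).diffAt D.isOpen hx
    have d2 := (s2 ε hε).diffAt D.isOpen hx
    have d3 := hη.diffAt D.isOpen hx
    rw [hw]
    simp only
    rw [pdy_add (u := fun x => α * t1 ε x + β * t2 ε x) ((d1.const_mul α).add (d2.const_mul β)) d3,
      pdy_add (u := fun x => α * t1 ε x) (d1.const_mul α) (d2.const_mul β),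
      pdy_const_mul α d1, pdy_const_mul β d2]
  set L := |α| * B' + |β| * B' + B
  have bnd : ∀ {a b c : ℝ}, |a| ≤ B' → |b| ≤ B' → |c| ≤ B → |α * a + β * b + c| ≤ L := by
    intro a b c ha hb hc
    calc |α * a + β * b + c| ≤ |α * a| + |β * b| + |c| := abs_add_three _ _ _
      _ ≤ _ := by rw [abs_mul, abs_mul]; simp only [L]; gcongr
  have bw : ∀ ε > 0, ∀ x ∈ Ω, |w ε x| ≤ L ∧ |pdx (w ε) x| ≤ L ∧ |pdy (w ε) x| ≤ L := by
    intro ε hε x hx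
    have b1 := h1 ε hε x hx
    have b2 := h2 ε hε x hx
    have b3 := hηB x hx
    rw [px ε hε x hx, py ε hε x hx]
    exact ⟨bnd b1.1 b2.1 b3.1, bnd b1.2.1 b2.2.1 b3.2.1, bnd b1.2.2 b2.2.2 b3.2.2⟩
  have hL : 0 ≤ L := (abs_nonneg _).trans (bw 1 one_pos p D.mem).1
  have bg : ∀ ε > 0, ∀ x ∈ Ω, |gradSq (w ε) x| ≤ L ^ 2 + L ^ 2 := by
    intro ε hε x hx
    rw [gradSq, abs_of_nonneg (by positivity), ← sq_abs (pdx _ _), ← sq_abs (pdy _ _)]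
    have := bw ε hε x hx
    gcongr
    exacts [this.2.1, this.2.2]
  have cg : ∀ ε > 0, ContinuousOn (gradSq (w ε)) Ω := fun ε hε =>
    (((sw ε hε).pdx_smooth D.isOpen).continuousOn.pow 2).add
      (((sw ε hε).pdy_smooth D.isOpen).continuousOn.pow 2)
  have ineq : ∀ ε > 0, μ * ((∫ x in Ω, w ε x ^ 2 / x.2 ^ 2) - (∫ x in Ω, w ε x / x.2 ^ 2) ^ 2 /
      ∫ x in Ω, 1 / x.2 ^ 2) ≤ ∫ x in Ω, gradSq (w ε) x := fun ε hε =>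
    D.varIneq_general hv (sw ε hε) (fun x hx => (bw ε hε x hx).1)
      (D.integrableOn_of_cont (cg ε hε) (bg ε hε))
  have bdiv : ∀ {a b : ℝ}, |a| ≤ b → ∀ x ∈ Ω, |a / x.2 ^ 2| ≤ b * K := by
    intro a b ha x hx
    rw [div_eq_mul_one_div, abs_mul, abs_of_nonneg (show 0 ≤ 1 / x.2 ^ 2 by positivity)]
    exact mul_le_mul ha (hd x (subset_closure hx)) (by positivity) ((abs_nonneg _).trans ha)
  have mdiv : ∀ {f : ℝ × ℝ → ℝ}, ContinuousOn f Ω →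
      AEStronglyMeasurable (fun x => f x / x.2 ^ 2) (volume.restrict Ω) := by
    intro f hf
    refine ContinuousOn.aestronglyMeasurable (hf.div (by fun_prop) fun x hx => ?_)
      D.isOpen.measurableSet
    have : 0 < x.2 := D.sub hx
    positivity
  have l1 := D.toBddDom.tendsto_integral (Φ := fun ε x => w ε x ^ 2 / x.2 ^ 2)
    (Φ0 := fun x => (α * D1.indicator z x + β * D2.indicator z x + η x) ^ 2 / x.2 ^ 2)
    (C := L ^ 2 * K) (fun ε hε => mdiv (f := fun x => w ε x ^ 2) ((sw ε hε).continuousOn.pow 2))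
    (fun ε hε x hx => bdiv (by
      rw [abs_pow]; exact pow_le_pow_left₀ (abs_nonneg _) (bw ε hε x hx).1 2) x hx)
    (fun x hx => by
      filter_upwards [hs.tr_limit D.isOpen hz.smooth hF hx,
        hs.symm.tr_limit D.isOpen hz.smooth hF hx] with ε e1 e2
      simp only [hw, t1, t2, e1.1, e2.1])
  have l2 := D.toBddDom.tendsto_integral (Φ := fun ε x => w ε x / x.2 ^ 2)
    (Φ0 := fun x => (α * D1.indicator z x + β * D2.indicator z x + η x) / x.2 ^ 2)
    (C := L * K) (fun ε hε => mdiv (f := w ε) (sw ε hε).continuousOn)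
    (fun ε hε x hx => bdiv (bw ε hε x hx).1 x hx)
    (fun x hx => by
      filter_upwards [hs.tr_limit D.isOpen hz.smooth hF hx,
        hs.symm.tr_limit D.isOpen hz.smooth hF hx] with ε e1 e2
      simp only [hw, t1, t2, e1.1, e2.1])
  have l3 := D.toBddDom.tendsto_integral (Φ := fun ε => gradSq (w ε))
    (Φ0 := fun x => (α * D1.indicator (pdx z) x + β * D2.indicator (pdx z) x + pdx η x) ^ 2 +
      (α * D1.indicator (pdy z) x + β * D2.indicator (pdy z) x + pdy η x) ^ 2)
    (C := L ^ 2 + L ^ 2) (fun ε hε => (cg ε hε).aestronglyMeasurable D.isOpen.measurableSet)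
    bg
    (fun x hx => by
      filter_upwards [hs.tr_limit D.isOpen hz.smooth hF hx,
        hs.symm.tr_limit D.isOpen hz.smooth hF hx, self_mem_nhdsWithin] with ε e1 e2 hε
      rw [gradSq, px ε hε x hx, py ε hε x hx, e1.2.1, e1.2.2, e2.2.1, e2.2.2])
  refine le_of_tendsto_of_tendsto ((l1.sub ((l2.pow 2).div_const _)).const_mul μ) l3 ?_
  filter_upwards [self_mem_nhdsWithin] with ε hε using ineq ε hε

/-- Each piece of the negative set carries a weak solution across its boundary. -/
lemma split_weak (hz : SuperSol Ω p μ z) (hs : Split Ω z D1 D2) (hne : D2.Nonempty)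
    (hv : VarIneq Ω μ) (hη : ContDiffOn ℝ (⊤ : ℕ∞) η Ω)
    (hηB : ∀ x ∈ Ω, |η x| ≤ B ∧ |pdx η x| ≤ B ∧ |pdy η x| ≤ B)
    (hη2 : ∀ x ∈ D2, η x = 0 ∧ pdx η x = 0 ∧ pdy η x = 0) :
    ∫ x in Ω, D1.indicator (enDens μ z η) x = 0 := by
  obtain ⟨B', hB'⟩ := hz.bdd
  have hzs := hz.smooth
  have hzM : ∀ x ∈ Ω, |z x| ≤ max B B' ∧ |pdx z x| ≤ max B B' ∧ |pdy z x| ≤ max B B' := fun x hx =>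
    ⟨le_max_of_le_right (hB' x hx).1, le_max_of_le_right (hB' x hx).2.1,
      le_max_of_le_right (hB' x hx).2.2⟩
  have hηM : ∀ x ∈ Ω, |η x| ≤ max B B' ∧ |pdx η x| ≤ max B B' ∧ |pdy η x| ≤ max B B' :=
    fun x hx => ⟨le_max_of_le_left (hηB x hx).1, le_max_of_le_left (hηB x hx).2.1,
      le_max_of_le_left (hηB x hx).2.2⟩
  have izz := D.enDens_integrableOn (μ := μ) hzs hzs hzM hzM
  have izη := D.enDens_integrableOn (μ := μ) hzs hη hzM hηM
  have iηη := D.enDens_integrableOn (μ := μ) hη hη hηM hηM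
  have iz : IntegrableOn (fun x => z x / x.2 ^ 2) Ω :=
    D.integrableOn_div_of_cont hzs.continuousOn fun x hx => (hB' x hx).1
  have iη : IntegrableOn (fun x => η x / x.2 ^ 2) Ω :=
    D.integrableOn_div_of_cont hη.continuousOn fun x hx => (hηB x hx).1
  have mD1 := hs.open1.measurableSet
  have mD2 := hs.open2.measurableSet
  have j1 : IntegrableOn (D1.indicator (enDens μ z z)) Ω := Integrable.indicator izz mD1
  have j2 : IntegrableOn (D2.indicator (enDens μ z z)) Ω := Integrable.indicator izz mD2
  have j3 : IntegrableOn (D1.indicator (enDens μ z η)) Ω := Integrable.indicator izη mD1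
  have k1 : IntegrableOn (D1.indicator (fun x => z x / x.2 ^ 2)) Ω := Integrable.indicator iz mD1
  have k2 : IntegrableOn (D2.indicator (fun x => z x / x.2 ^ 2)) Ω := Integrable.indicator iz mD2
  set m1 := ∫ x in Ω, D1.indicator (fun x => z x / x.2 ^ 2) x with hm1
  set m2 := ∫ x in Ω, D2.indicator (fun x => z x / x.2 ^ 2) x with hm2
  set n := ∫ x in Ω, η x / x.2 ^ 2 with hn
  set e1 := ∫ x in Ω, D1.indicator (enDens μ z z) x with he1
  set e2 := ∫ x in Ω, D2.indicator (enDens μ z z) x with he2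
  set e3 := ∫ x in Ω, enDens μ η η x with he3
  set l := ∫ x in Ω, D1.indicator (enDens μ z η) x with hl
  have e1n : e1 ≤ 0 := D.energy_nonpos hz hs
  have e2n : e2 ≤ 0 := D.energy_nonpos hz hs.symm
  have m2n : m2 ≠ 0 := by
    have hpos : 0 < ∫ x in Ω, -D2.indicator (fun x => z x / x.2 ^ 2) x := by
      have k4 : IntegrableOn (fun x => -D2.indicator (fun x => z x / x.2 ^ 2) x) Ω := k2.neg
      refine (setIntegral_pos_iff_support_of_nonneg_ae ?_ k4).2 ?_
      · filter_upwards with x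
        rw [Pi.zero_apply]
        by_cases hx : x ∈ D2
        · have h1 := hs.symm.sub hx
          have : 0 ≤ -z x := by linarith [h1.2]
          rw [indicator_of_mem hx, ← neg_div]
          positivity
        · rw [indicator_of_notMem hx, neg_zero]
      · refine (hs.open2.measure_pos volume hne).trans_le (measure_mono fun x hx => ?_)
        have h1 := hs.symm.sub hx
        have h2 : 0 < x.2 := D.sub h1.1
        refine ⟨?_, h1.1⟩
        rw [Function.mem_support, indicator_of_mem hx, ← neg_div]
        have : 0 < -z x := by linarith [h1.2]
        positivity
    rw [integral_neg] at hpos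
    intro h0
    rw [← hm2, h0] at hpos
    simp at hpos
  have main : ∀ α : ℝ, 0 ≤ e3 + 2 * α * l := by
    intro α
    set β := -(α * m1 + n) / m2 with hβ
    have hmean : ∫ x in Ω, (α * D1.indicator z x + β * D2.indicator z x + η x) / x.2 ^ 2 = 0 := by
      have : ∀ x, (α * D1.indicator z x + β * D2.indicator z x + η x) / x.2 ^ 2 =
          α * D1.indicator (fun x => z x / x.2 ^ 2) x +
            β * D2.indicator (fun x => z x / x.2 ^ 2) x + η x / x.2 ^ 2 := by
        intro x
        by_cases hx1 : x ∈ D1 <;> by_cases hx2 : x ∈ D2 <;> simp [hx1, hx2] <;> ring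
      simp only [this]
      have k3 : IntegrableOn (fun x => α * D1.indicator (fun x => z x / x.2 ^ 2) x +
          β * D2.indicator (fun x => z x / x.2 ^ 2) x) Ω := (k1.const_mul α).add (k2.const_mul β)
      rw [integral_add k3 iη,
        integral_add (k1.const_mul α) (k2.const_mul β), integral_const_mul, integral_const_mul,
        ← hm1, ← hm2, ← hn, hβ]
      field_simp
      ring
    have hv' := D.split_varIneq hz hs hv hη hηB α β
    rw [hmean] at hv'
    have q1 : IntegrableOn (fun x => z x * z x / x.2 ^ 2) Ω :=
      D.integrableOn_div_of_cont (f := fun x => z x * z x) (hzs.continuousOn.mul hzs.continuousOn)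
        (C := B' * B') fun x hx => by
          rw [abs_mul]
          exact mul_le_mul (hB' x hx).1 (hB' x hx).1 (abs_nonneg _)
            ((abs_nonneg _).trans (hB' x hx).1)
    have q2 : IntegrableOn (fun x => z x * η x / x.2 ^ 2) Ω :=
      D.integrableOn_div_of_cont (f := fun x => z x * η x) (hzs.continuousOn.mul hη.continuousOn)
        (C := B' * B) fun x hx => by
          rw [abs_mul]
          exact mul_le_mul (hB' x hx).1 (hηB x hx).1 (abs_nonneg _)
            ((abs_nonneg _).trans (hB' x hx).1)
    have q3 : IntegrableOn (fun x => η x * η x / x.2 ^ 2) Ω :=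
      D.integrableOn_div_of_cont (f := fun x => η x * η x) (hη.continuousOn.mul hη.continuousOn)
        (C := B * B) fun x hx => by
          rw [abs_mul]
          exact mul_le_mul (hηB x hx).1 (hηB x hx).1 (abs_nonneg _)
            ((abs_nonneg _).trans (hηB x hx).1)
    have r1 : IntegrableOn (D1.indicator fun x => z x * z x / x.2 ^ 2) Ω :=
      Integrable.indicator q1 mD1
    have r2 : IntegrableOn (D2.indicator fun x => z x * z x / x.2 ^ 2) Ω :=
      Integrable.indicator q1 mD2
    have r3 : IntegrableOn (D1.indicator fun x => z x * η x / x.2 ^ 2) Ω :=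
      Integrable.indicator q2 mD1
    have hdec : ∀ x, x ∈ D1 ∧ x ∉ D2 ∨ x ∉ D1 ∧ x ∈ D2 ∧ η x = 0 ∧ pdx η x = 0 ∧ pdy η x = 0 ∨
        x ∉ D1 ∧ x ∉ D2 := by
      intro x
      by_cases hx1 : x ∈ D1
      · exact Or.inl ⟨hx1, hs.notMem hx1⟩
      · by_cases hx2 : x ∈ D2
        · exact Or.inr (Or.inl ⟨hx1, hx2, hη2 x hx2⟩)
        · exact Or.inr (Or.inr ⟨hx1, hx2⟩)
    have f2 : (fun x : ℝ × ℝ => (α * D1.indicator z x + β * D2.indicator z x + η x) ^ 2 / x.2 ^ 2) =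
        fun x => α ^ 2 * D1.indicator (fun x => z x * z x / x.2 ^ 2) x +
          β ^ 2 * D2.indicator (fun x => z x * z x / x.2 ^ 2) x + η x * η x / x.2 ^ 2 +
          2 * α * D1.indicator (fun x => z x * η x / x.2 ^ 2) x := by
      funext x
      rcases hdec x with h | h | h <;> simp [h] <;> ring
    have i2 : IntegrableOn (fun x : ℝ × ℝ =>
        (α * D1.indicator z x + β * D2.indicator z x + η x) ^ 2 / x.2 ^ 2) Ω := by
      rw [f2]
      exact (((r1.const_mul _).add (r2.const_mul _)).add q3).add (r3.const_mul _)
    have t1 : IntegrableOn (fun x => α ^ 2 * D1.indicator (enDens μ z z) x +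
        β ^ 2 * D2.indicator (enDens μ z z) x) Ω := (j1.const_mul _).add (j2.const_mul _)
    have t2 : IntegrableOn (fun x => α ^ 2 * D1.indicator (enDens μ z z) x +
        β ^ 2 * D2.indicator (enDens μ z z) x + enDens μ η η x) Ω := t1.add iηη
    have t3 : IntegrableOn (fun x => α ^ 2 * D1.indicator (enDens μ z z) x +
        β ^ 2 * D2.indicator (enDens μ z z) x + enDens μ η η x +
        2 * α * D1.indicator (enDens μ z η) x) Ω := t2.add (j3.const_mul _)
    have f3 : (fun x => (α * D1.indicator (pdx z) x + β * D2.indicator (pdx z) x + pdx η x) ^ 2 +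
        (α * D1.indicator (pdy z) x + β * D2.indicator (pdy z) x + pdy η x) ^ 2) =
        fun x => (α ^ 2 * D1.indicator (enDens μ z z) x +
          β ^ 2 * D2.indicator (enDens μ z z) x + enDens μ η η x +
          2 * α * D1.indicator (enDens μ z η) x) +
          μ * ((α * D1.indicator z x + β * D2.indicator z x + η x) ^ 2 / x.2 ^ 2) := by
      funext x
      rcases hdec x with h | h | h <;> simp [h, enDens] <;> ring
    rw [f3, integral_add t3 (i2.const_mul _), integral_const_mul,
      integral_add t2 (j3.const_mul _), integral_add t1 iηη,
      integral_add (j1.const_mul _) (j2.const_mul _), integral_const_mul, integral_const_mul,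
      integral_const_mul, ← he1, ← he2, ← he3, ← hl] at hv'
    have g1 : α ^ 2 * e1 ≤ 0 := mul_nonpos_of_nonneg_of_nonpos (sq_nonneg _) e1n
    have g2 : β ^ 2 * e2 ≤ 0 := mul_nonpos_of_nonneg_of_nonpos (sq_nonneg _) e2n
    simp only [ne_eq, OfNat.ofNat_ne_zero, not_false_eq_true, zero_pow, zero_div, sub_zero] at hv'
    linarith
  by_contra hl0
  have := main (-(e3 + 1) / (2 * l))
  have h2 : 2 * (-(e3 + 1) / (2 * l)) * l = -(e3 + 1) := by
    have : l ≠ 0 := hl0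
    field_simp
  linarith

end ConvDom

/-- A bump function near a regular zero of `z` that increases in the direction of the gradient
wherever `z` is negative. -/
lemma exists_flux_bump {z : ℝ × ℝ → ℝ} {q v : ℝ × ℝ} {L : ℝ × ℝ →L[ℝ] ℝ} (hd : HasFDerivAt z L q)
    (hL : ∀ w, L w = v.1 * w.1 + v.2 * w.2) (hv : v ≠ 0) (hz : z q = 0) {U : Set (ℝ × ℝ)}
    (hU : U ∈ 𝓝 q) : ∃ η : ℝ × ℝ → ℝ, ContDiff ℝ (⊤ : ℕ∞) η ∧ HasCompactSupport η ∧
      tsupport η ⊆ U ∧ (∀ x, 0 ≤ η x) ∧ (∀ x, z x < 0 → 0 ≤ fderiv ℝ η x v) ∧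
      ∃ x ∈ U, z x < 0 ∧ 0 < fderiv ℝ η x v := by
  obtain ⟨S, M, hS⟩ := exists_step
  have hvn : 0 < ‖v‖ := norm_pos_iff.2 hv
  set n := v.1 ^ 2 + v.2 ^ 2 with hn
  have hn0 : 0 < n := by
    rcases eq_or_ne v.1 0 with h1 | h1
    · have h2 : v.2 ≠ 0 := fun h2 => hv (Prod.ext h1 h2)
      positivity
    · positivity
  obtain ⟨ρ, hρ, hball⟩ := Metric.mem_nhds_iff.1 hU
  have hκ : 0 < n / (10 * ‖v‖) := by positivity
  obtain ⟨ρ', hρ', hest⟩ := Metric.eventually_nhds_iff_ball.1 (hd.isLittleO.def hκ)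
  set R := min ρ ρ'
  have hR : 0 < R := lt_min hρ hρ'
  set δ := R * n / (10 * ‖v‖) with hδ
  have hδ0 : 0 < δ := by positivity
  have hδR : 5 * ‖v‖ * δ / n < R := by
    rw [hδ]
    have : 5 * ‖v‖ * (R * n / (10 * ‖v‖)) / n = R / 2 := by field_simp; norm_num
    rw [this]; linarith
  set l : ℝ × ℝ → ℝ := fun x => v.1 * (x.1 - q.1) + v.2 * (x.2 - q.2) with hl
  set m : ℝ × ℝ → ℝ := fun x => -v.2 * (x.1 - q.1) + v.1 * (x.2 - q.2) with hm
  set α : ℝ → ℝ := fun s => S (2 - ((s - δ) / δ) ^ 2) with hα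
  set β : ℝ → ℝ := fun s => S (2 - (s / δ) ^ 2) with hβ
  have hnorm : ∀ x, |l x| ≤ 3 * δ → |m x| ≤ 2 * δ → ‖x - q‖ ≤ 5 * ‖v‖ * δ / n := by
    intro x h1 h2
    have e1 : (x - q).1 = (v.1 * l x - v.2 * m x) / n := by
      rw [eq_div_iff hn0.ne', hn, hl, hm]; simp only [Prod.fst_sub]; ring
    have e2 : (x - q).2 = (v.2 * l x + v.1 * m x) / n := by
      rw [eq_div_iff hn0.ne', hn, hl, hm]; simp only [Prod.snd_sub]; ring
    have n1 : |v.1| ≤ ‖v‖ := norm_fst_le v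
    have n2 : |v.2| ≤ ‖v‖ := norm_snd_le v
    rw [Prod.norm_def, max_le_iff, e1, e2, Real.norm_eq_abs, Real.norm_eq_abs, abs_div, abs_div,
      abs_of_pos hn0]
    constructor
    · gcongr
      calc |v.1 * l x - v.2 * m x| ≤ |v.1 * l x| + |v.2 * m x| := abs_sub _ _
        _ = |v.1| * |l x| + |v.2| * |m x| := by rw [abs_mul, abs_mul]
        _ ≤ ‖v‖ * (3 * δ) + ‖v‖ * (2 * δ) := by gcongr
        _ = _ := by ring
    · gcongr
      calc |v.2 * l x + v.1 * m x| ≤ |v.2 * l x| + |v.1 * m x| := abs_add_le _ _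
        _ = |v.2| * |l x| + |v.1| * |m x| := by rw [abs_mul, abs_mul]
        _ ≤ ‖v‖ * (3 * δ) + ‖v‖ * (2 * δ) := by gcongr
        _ = _ := by ring
  have hzl : ∀ x, ‖x - q‖ < R → |z x - l x| ≤ n / (10 * ‖v‖) * ‖x - q‖ := by
    intro x hx
    have := hest x (by rw [mem_ball_iff_norm]; exact hx.trans_le (min_le_right _ _))
    rw [hz, sub_zero, hL] at this
    simpa [hl] using this
  have hαs : ∀ s, α s ≠ 0 → |s| ≤ 3 * δ := by
    intro s hs
    have h1 : ((s - δ) / δ) ^ 2 ≤ 2 := by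
      by_contra hcon
      exact hs (hS.zero _ (by linarith [not_le.1 hcon]))
    have h2 : |(s - δ) / δ| ≤ 2 := abs_le_of_sq_le_sq (by linarith) (by norm_num)
    rw [abs_div, abs_of_pos hδ0, div_le_iff₀ hδ0, abs_le] at h2
    rw [abs_le]; constructor <;> linarith
  have hβs : ∀ s, β s ≠ 0 → |s| ≤ 2 * δ := by
    intro s hs
    have h1 : (s / δ) ^ 2 ≤ 2 := by
      by_contra hcon
      exact hs (hS.zero _ (by linarith [not_le.1 hcon]))
    have h2 : |s / δ| ≤ 2 := abs_le_of_sq_le_sq (by linarith) (by norm_num)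
    rwa [abs_div, abs_of_pos hδ0, div_le_iff₀ hδ0] at h2
  have hηs : ContDiff ℝ (⊤ : ℕ∞) fun x => α (l x) * β (m x) := by
    have c1 : ContDiff ℝ (⊤ : ℕ∞) l := by fun_prop
    have c2 : ContDiff ℝ (⊤ : ℕ∞) m := by fun_prop
    refine (hS.smooth.comp (contDiff_const.sub (((c1.sub contDiff_const).div_const δ).pow 2))).mul
      (hS.smooth.comp (contDiff_const.sub ((c2.div_const δ).pow 2)))
  set η : ℝ × ℝ → ℝ := fun x => α (l x) * β (m x) with hη
  have hline : ∀ x (t : ℝ), HasDerivAt (fun t : ℝ => η (x + t • v)) (fderiv ℝ η (x + t • v) v) t := by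
    intro x t
    have h0 : HasDerivAt (fun t : ℝ => x + t • v) v t := by
      simpa using ((hasDerivAt_id t).smul_const v).const_add x
    exact HasFDerivAt.comp_hasDerivAt t (f := fun t : ℝ => x + t • v)
      ((hηs.differentiable (by simp)) _).hasFDerivAt h0
  have hdη : ∀ x, fderiv ℝ η x v =
      n * (deriv S (2 - ((l x - δ) / δ) ^ 2) * (-(2 * (l x - δ)) / δ ^ 2)) * β (m x) := by
    intro x
    have h1 := hline x 0
    simp only [zero_smul, add_zero] at h1
    have e : (fun t : ℝ => η (x + t • v)) = fun t => S (2 - ((l x + t * n - δ) / δ) ^ 2) * β (m x) := by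
      funext t
      have a1 : l (x + t • v) = l x + t * n := by
        simp only [hl, Prod.fst_add, Prod.snd_add, Prod.smul_fst, Prod.smul_snd, smul_eq_mul, hn]
        ring
      have a2 : m (x + t • v) = m x := by
        simp only [hm, Prod.fst_add, Prod.snd_add, Prod.smul_fst, Prod.smul_snd, smul_eq_mul]
        ring
      simp only [hη, a1, a2, hα]
    rw [e] at h1
    have h2 : HasDerivAt (fun t => 2 - ((l x + t * n - δ) / δ) ^ 2) (-(2 * (l x - δ)) / δ ^ 2 * n) 0 := by
      have h3 : HasDerivAt (fun t => (l x + t * n - δ) / δ) (n / δ) (0 : ℝ) := by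
        have := ((((hasDerivAt_id (0 : ℝ)).mul_const n).const_add (l x)).sub_const δ).div_const δ
        simpa using this
      refine ((h3.fun_pow 2).const_sub 2).congr_deriv ?_
      simp
      field_simp
    have h4 := (HasDerivAt.comp (0 : ℝ) (h₂ := S)
      (hS.differentiableAt _).hasDerivAt h2).mul_const (β (m x))
    have := h1.unique h4
    rw [this]
    simp only [zero_mul, add_zero]
    ring
  have hsup : Function.support η ⊆ Metric.closedBall q (5 * ‖v‖ * δ / n) := by
    intro x hx
    have hx' : α (l x) * β (m x) ≠ 0 := hx
    rw [mem_closedBall_iff_norm]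
    exact hnorm x (hαs _ (left_ne_zero_of_mul hx')) (hβs _ (right_ne_zero_of_mul hx'))
  refine ⟨η, hηs, HasCompactSupport.of_support_subset_isCompact (isCompact_closedBall _ _) hsup,
    ?_, fun x => mul_nonneg (hS.nonneg _) (hS.nonneg _), fun x hx => ?_, ?_⟩
  · refine (closure_minimal hsup Metric.isClosed_closedBall).trans
      ((Metric.closedBall_subset_ball (hδR.trans_le (min_le_left _ _))).trans hball)
  · rw [hdη]
    rcases le_or_gt (l x) δ with h | h
    · refine mul_nonneg (mul_nonneg hn0.le (mul_nonneg (hS.deriv_nonneg _) ?_)) (hS.nonneg _)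
      apply div_nonneg _ (sq_nonneg δ)
      linarith
    · by_cases hb : β (m x) = 0
      · rw [hb, mul_zero]
      · by_cases ha : α (l x) = 0
        · have : 2 - ((l x - δ) / δ) ^ 2 ≤ 0 := by
            by_contra hcon
            exact (hS.pos _ (not_le.1 hcon)).ne' ha
          rw [hS.deriv_zero _ this]; simp
        · exfalso
          have h1 := hnorm x (hαs _ ha) (hβs _ hb)
          have h2 := (abs_le.1 (hzl x (h1.trans_lt hδR))).1
          have h3 : n / (10 * ‖v‖) * ‖x - q‖ ≤ n / (10 * ‖v‖) * (5 * ‖v‖ * δ / n) := by gcongr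
          have h4 : n / (10 * ‖v‖) * (5 * ‖v‖ * δ / n) = δ / 2 := by field_simp; norm_num
          linarith
  · have hcont : ContinuousOn (fun t : ℝ => η (q + t • v)) (Icc (-(δ / n)) 0) := fun t _ =>
      (hline q t).continuousAt.continuousWithinAt
    have hlt : -(δ / n) < 0 := by have : 0 < δ / n := by positivity
                                  linarith
    obtain ⟨t, ht, hslope⟩ := exists_hasDerivAt_eq_slope _ _ hlt hcont fun t _ => hline q t
    have e0 : η (q + (0 : ℝ) • v) = 1 := by
      simp only [hη, hα, hβ, hl, hm]
      rw [hS.one, hS.one, one_mul]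
      · simp
      · simp only [zero_smul, add_zero, sub_self, mul_zero, zero_sub, neg_div, div_self hδ0.ne']
        norm_num
    have e1 : η (q + (-(δ / n)) • v) = 0 := by
      have : l (q + (-(δ / n)) • v) = -δ := by
        simp only [hl, Prod.fst_add, Prod.snd_add, Prod.smul_fst, Prod.smul_snd, smul_eq_mul]
        have : v.1 * (q.1 + -(δ / n) * v.1 - q.1) + v.2 * (q.2 + -(δ / n) * v.2 - q.2) =
          -(δ / n) * n := by rw [hn]; ring
        rw [this]; field_simp
      simp only [hη, hα, this]
      rw [hS.zero, zero_mul]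
      rw [show (-δ - δ) / δ = -2 by field_simp; ring]
      norm_num
    have hnm : ‖q + t • v - q‖ = -t * ‖v‖ := by
      rw [add_sub_cancel_left, norm_smul, Real.norm_eq_abs, abs_of_neg ht.2]
    have hn1 : -t * ‖v‖ < R := by
      have h1 : -t < δ / n := by linarith [ht.1]
      calc -t * ‖v‖ ≤ δ / n * ‖v‖ := by gcongr
        _ ≤ 5 * ‖v‖ * δ / n := by
          rw [div_mul_eq_mul_div]
          exact div_le_div_of_nonneg_right (by nlinarith [mul_pos hδ0 hvn]) hn0.le
        _ < R := hδR
    refine ⟨q + t • v, hball ?_, ?_, ?_⟩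
    · rw [mem_ball_iff_norm, hnm]; exact hn1.trans_le (min_le_left _ _)
    · have h1 := (abs_le.1 (hzl (q + t • v) (hnm ▸ hn1))).2
      rw [hnm] at h1
      have h2 : n / (10 * ‖v‖) * (-t * ‖v‖) = -t * n / 10 := by field_simp
      have h3 : l (q + t • v) = t * n := by
        simp only [hl, Prod.fst_add, Prod.snd_add, Prod.smul_fst, Prod.smul_snd, smul_eq_mul, hn]
        ring
      have h4 : t * n < 0 := mul_neg_of_neg_of_pos ht.2 hn0
      nlinarith
    · rw [hslope, e0, e1]
      have : 0 < δ / n := by positivity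
      simp only [sub_zero, sub_neg_eq_add, zero_add]
      positivity

namespace Split
variable {Ω D1 D2 : Set (ℝ × ℝ)} {z : ℝ × ℝ → ℝ}

lemma subset_of_preconnected (hs : Split Ω z D1 D2) {T : Set (ℝ × ℝ)} (hT : IsPreconnected T)
    (h : ∀ x ∈ T, x ∈ Ω ∧ z x < 0) {x : ℝ × ℝ} (hx : x ∈ T) (hx1 : x ∈ D1) : T ⊆ D1 :=
  hT.subset_left_of_subset_union hs.open1 hs.open2 hs.disj
    (fun y hy => by rw [hs.union]; exact h y hy) ⟨x, hx, hx1⟩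

lemma not_frontier (hs : Split Ω z D1 D2) (ho : IsOpen Ω) (hz : ContinuousOn z Ω) {q : ℝ × ℝ}
    (hq : q ∈ Ω) (hf : q ∈ frontier D1) : z q = 0 := by
  have hc : ContinuousAt z q := hz.continuousAt (ho.mem_nhds hq)
  have h1 : z q ≤ 0 := by
    by_contra hcon
    obtain ⟨y, hy, hy1⟩ := mem_closure_iff_nhds.1 (frontier_subset_closure hf) _
      (hc.eventually (lt_mem_nhds (not_le.1 hcon)))
    have := (hs.sub hy1).2
    have hy : 0 < z y := hy
    linarith
  refine le_antisymm h1 (not_lt.1 fun hcon => ?_)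
  have : q ∈ D1 ∪ D2 := by rw [hs.union]; exact ⟨hq, hcon⟩
  rcases this with h | h
  · rw [hs.open1.frontier_eq] at hf
    exact hf.2 h
  · obtain ⟨y, hy, hy1⟩ := mem_closure_iff_nhds.1 (frontier_subset_closure hf) _
      (hs.open2.mem_nhds h)
    exact hs.notMem hy1 hy

/-- Near a regular boundary point of one piece, that piece is the whole negative set. -/
lemma exists_local_piece (hs : Split Ω z D1 D2) (ho : IsOpen Ω) (hz : ContDiffOn ℝ (⊤ : ℕ∞) z Ω)
    {q : ℝ × ℝ} (hq : q ∈ Ω) (hf : q ∈ frontier D1) (hd : fderiv ℝ z q ≠ 0) :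
    ∃ v : ℝ × ℝ, v ≠ 0 ∧ (∀ w, fderiv ℝ z q w = v.1 * w.1 + v.2 * w.2) ∧ ∃ U ∈ 𝓝 q, U ⊆ Ω ∧
      (∀ x ∈ U, z x < 0 → x ∈ D1) ∧ ∀ x ∈ U, (v.1 ^ 2 + v.2 ^ 2) / 2 ≤ fderiv ℝ z x v := by
  set v : ℝ × ℝ := (pdx z q, pdy z q) with hv
  have hL : ∀ w, fderiv ℝ z q w = v.1 * w.1 + v.2 * w.2 := fun w => by
    rw [fderiv_apply_eq_pd]; ring
  have hv0 : v ≠ 0 := by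
    intro h0
    refine hd (ContinuousLinearMap.ext fun w => ?_)
    rw [hL, h0]; simp
  have hn : 0 < v.1 ^ 2 + v.2 ^ 2 := by
    rcases eq_or_ne v.1 0 with h1 | h1
    · have h2 : v.2 ≠ 0 := fun h2 => hv0 (Prod.ext h1 h2)
      positivity
    · positivity
  refine ⟨v, hv0, hL, ?_⟩
  have hvn : 0 < ‖v‖ := norm_pos_iff.2 hv0
  have hz0 := hs.not_frontier ho hz.continuousOn hq hf
  have hcf : ContinuousAt (fun x => fderiv ℝ z x v) q := by
    have := ((hz.fderiv_smooth ho).continuousOn.continuousAt (ho.mem_nhds hq))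
    exact this.clm_apply continuousAt_const
  have h1 : ∀ᶠ x in 𝓝 q, x ∈ Ω ∧ (v.1 ^ 2 + v.2 ^ 2) / 2 < fderiv ℝ z x v := by
    have h2 : (v.1 ^ 2 + v.2 ^ 2) / 2 < fderiv ℝ z q v := by rw [hL]; nlinarith
    have h3 : ∀ᶠ x in 𝓝 q, (v.1 ^ 2 + v.2 ^ 2) / 2 < fderiv ℝ z x v :=
      hcf.eventually (lt_mem_nhds h2)
    filter_upwards [ho.mem_nhds hq, h3] with x h4 h5 using ⟨h4, h5⟩
  obtain ⟨r, hr, hball⟩ := Metric.eventually_nhds_iff_ball.1 h1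
  have hmono : ∀ (x : ℝ × ℝ) (s t : ℝ), s < t → x + s • v ∈ Metric.ball q r → x + t • v ∈ Metric.ball q r →
      z (x + s • v) < z (x + t • v) := by
    intro x s t hst h1 h2
    have hseg : ∀ τ ∈ Icc s t, x + τ • v ∈ Metric.ball q r := by
      intro τ hτ
      have := (convex_ball q r).segment_subset h1 h2
      refine this ⟨(t - τ) / (t - s), (τ - s) / (t - s), ?_, ?_, ?_, ?_⟩
      · exact div_nonneg (by linarith [hτ.2]) (by linarith)
      · exact div_nonneg (by linarith [hτ.1]) (by linarith)
      · rw [← add_div, sub_add_sub_cancel, div_self (by linarith)]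
      · have : t - s ≠ 0 := by linarith
        ext <;> simp <;> field_simp <;> ring
    have hder : ∀ τ ∈ Icc s t, HasDerivAt (fun τ : ℝ => z (x + τ • v))
        (fderiv ℝ z (x + τ • v) v) τ := by
      intro τ hτ
      have h0 : HasDerivAt (fun t : ℝ => x + t • v) v τ := by
        simpa using ((hasDerivAt_id τ).smul_const v).const_add x
      exact HasFDerivAt.comp_hasDerivAt τ (f := fun t : ℝ => x + t • v)
        (hz.diffAt ho (hball _ (hseg τ hτ)).1).hasFDerivAt h0
    obtain ⟨τ, hτ, he⟩ := exists_hasDerivAt_eq_slope _ _ hst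
      (fun τ hτ => (hder τ hτ).continuousAt.continuousWithinAt)
      fun τ hτ => hder τ ⟨hτ.1.le, hτ.2.le⟩
    have h3 := (hball _ (hseg τ ⟨hτ.1.le, hτ.2.le⟩)).2
    rw [he, lt_div_iff₀ (by linarith)] at h3
    have : 0 < (v.1 ^ 2 + v.2 ^ 2) / 2 * (t - s) := mul_pos (by linarith) (by linarith)
    linarith
  set s := r / (2 * ‖v‖) with hsdef
  have hspos : 0 < s := by positivity
  have hsv : s * ‖v‖ = r / 2 := by rw [hsdef]; field_simp
  have hshift : ∀ x, dist x q < r / 2 → ∀ t, 0 ≤ t → t ≤ s → x + (-t) • v ∈ Metric.ball q r := by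
    intro x hx t ht hts
    rw [Metric.mem_ball]
    calc dist (x + (-t) • v) q ≤ dist (x + (-t) • v) x + dist x q := dist_triangle _ _ _
      _ = t * ‖v‖ + dist x q := by
        rw [dist_eq_norm, add_sub_cancel_left, norm_smul, norm_neg, Real.norm_eq_abs,
          abs_of_nonneg ht]
      _ ≤ s * ‖v‖ + dist x q := by gcongr
      _ < r := by rw [hsv]; linarith
  have hq' := hshift q (by simpa using hr) s hspos.le le_rfl
  have hneg : z (q + (-s) • v) < 0 := by
    have := hmono q (-s) 0 (by linarith) hq' (by simpa using hr)
    simpa [hz0] using this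
  have hcz : ContinuousAt z (q + (-s) • v) :=
    hz.continuousOn.continuousAt (ho.mem_nhds (hball _ hq').1)
  obtain ⟨r2, hr2, hball2⟩ := Metric.eventually_nhds_iff_ball.1
    ((hcz.eventually (gt_mem_nhds hneg)).and (ho.eventually_mem (hball _ hq').1))
  have hr1 : 0 < min (r / 2) r2 := lt_min (by linarith) hr2
  have hdown : ∀ x, dist x q < r / 2 → z x < 0 → ∀ t, 0 ≤ t → t ≤ s →
      x + (-t) • v ∈ Ω ∧ z (x + (-t) • v) < 0 := by
    intro x hx hxz t ht hts
    refine ⟨(hball _ (hshift x hx t ht hts)).1, ?_⟩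
    rcases ht.eq_or_lt with h | h
    · simpa [← h] using hxz
    · have := hmono x (-t) 0 (by linarith) (hshift x hx t ht hts)
        (by simpa using hx.trans (by linarith))
      simp only [zero_smul, add_zero] at this
      linarith
  have hsegc : ∀ x : ℝ × ℝ, IsPreconnected ((fun t : ℝ => x + (-t) • v) '' Icc 0 s) := fun x =>
    isPreconnected_Icc.image _ (by fun_prop)
  have hmem0 : ∀ x : ℝ × ℝ, x ∈ (fun t : ℝ => x + (-t) • v) '' Icc 0 s := fun x =>
    ⟨0, ⟨le_rfl, hspos.le⟩, by simp⟩
  have hmems : ∀ x : ℝ × ℝ, x + (-s) • v ∈ (fun t : ℝ => x + (-t) • v) '' Icc 0 s := fun x =>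
    ⟨s, ⟨hspos.le, le_rfl⟩, rfl⟩
  have hsegn : ∀ x, dist x q < r / 2 → z x < 0 →
      ∀ y ∈ (fun t : ℝ => x + (-t) • v) '' Icc 0 s, y ∈ Ω ∧ z y < 0 := by
    rintro x hx hxz _ ⟨t, ht, rfl⟩
    exact hdown x hx hxz t ht.1 ht.2
  have hshift2 : ∀ x, dist x q < r2 → x + (-s) • v ∈ Metric.ball (q + (-s) • v) r2 := by
    intro x hx
    simpa [Metric.mem_ball] using hx
  refine ⟨Metric.ball q (min (r / 2) r2), Metric.ball_mem_nhds q hr1, fun x hx => ?_,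
    fun x hx hxz => ?_, fun x hx => ?_⟩
  · exact (hball x (Metric.ball_subset_ball ((min_le_left _ _).trans (by linarith)) hx)).1
  · obtain ⟨y, hy, hy1⟩ := mem_closure_iff_nhds.1 (frontier_subset_closure hf) _
      (Metric.ball_mem_nhds q hr1)
    have hx1 : dist x q < r / 2 := (Metric.mem_ball.1 hx).trans_le (min_le_left _ _)
    have hx2 : dist x q < r2 := (Metric.mem_ball.1 hx).trans_le (min_le_right _ _)
    have hy3 : dist y q < r / 2 := (Metric.mem_ball.1 hy).trans_le (min_le_left _ _)
    have hy4 : dist y q < r2 := (Metric.mem_ball.1 hy).trans_le (min_le_right _ _)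
    have s1 := hs.subset_of_preconnected (hsegc y) (hsegn y hy3 (hs.sub hy1).2) (hmem0 y) hy1
    have s2 := hs.subset_of_preconnected (convex_ball (q + (-s) • v) r2).isPreconnected
      (fun w hw => (hball2 w hw).symm) (hshift2 y hy4) (s1 (hmems y))
    exact hs.subset_of_preconnected (hsegc x) (hsegn x hx1 hxz) (hmems x) (s2 (hshift2 x hx2))
      (hmem0 x)
  · exact (hball x (Metric.ball_subset_ball ((min_le_left _ _).trans (by linarith)) hx)).2.le

end Split

namespace ConvDom
variable {Ω D1 D2 : Set (ℝ × ℝ)} {p : ℝ × ℝ} {μ : ℝ} {z : ℝ × ℝ → ℝ} (D : ConvDom Ω p)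
include D

lemma split_regular_false (hz : SuperSol Ω p μ z) (hs : Split Ω z D1 D2) (hne : D2.Nonempty)
    (hv : VarIneq Ω μ) {q : ℝ × ℝ} (hq : q ∈ Ω) (hf : q ∈ frontier D1)
    (hd : fderiv ℝ z q ≠ 0) : False := by
  have ho := D.isOpen
  have hzs := hz.smooth
  obtain ⟨v, hv0, hL, U, hU, hUΩ, hU1, hUd⟩ := hs.exists_local_piece ho hzs hq hf hd
  obtain ⟨η, hη, hηc, hηU, hη0, hηneg, x0, hx0U, hx0z, hx0⟩ := exists_flux_bump
    (hzs.diffAt ho hq).hasFDerivAt hL hv0 (hs.not_frontier ho hzs.continuousOn hq hf) hU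
  obtain ⟨K, hK⟩ := hη.lipschitzWith_of_hasCompactSupport hηc (by simp)
  obtain ⟨B0, hB0⟩ := hη.continuous.bounded_above_of_compact_support hηc
  have hK0 : ∀ x w, |fderiv ℝ η x w| ≤ K * ‖w‖ := fun x w =>
    (ContinuousLinearMap.le_opNorm _ _).trans
      (mul_le_mul_of_nonneg_right (norm_fderiv_le_of_lipschitz ℝ hK) (norm_nonneg _))
  have hp1 : ‖((1 : ℝ), (0 : ℝ))‖ = 1 := by simp [Prod.norm_def]
  have hp2 : ‖((0 : ℝ), (1 : ℝ))‖ = 1 := by simp [Prod.norm_def]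
  have hηB : ∀ x ∈ Ω, |η x| ≤ max B0 K ∧ |pdx η x| ≤ max B0 K ∧ |pdy η x| ≤ max B0 K := by
    intro x _
    refine ⟨le_max_of_le_left (hB0 x), le_max_of_le_right ?_, le_max_of_le_right ?_⟩
    · have := hK0 x (1, 0)
      rw [hp1, mul_one] at this
      exact this
    · have := hK0 x (0, 1)
      rw [hp2, mul_one] at this
      exact this
  have hout : ∀ x, x ∉ tsupport η → η x = 0 ∧ pdx η x = 0 ∧ pdy η x = 0 ∧ fderiv ℝ η x v = 0 := by
    intro x hx
    have he := notMem_tsupport_iff_eventuallyEq.1 hx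
    have h2 : fderiv ℝ η x = 0 := by rw [he.fderiv_eq]; simp
    refine ⟨he.eq_of_nhds, ?_, ?_, ?_⟩ <;> simp [pdx, pdy, h2]
  have hη2 : ∀ x ∈ D2, x ∉ tsupport η := fun x hx h =>
    hs.notMem (hU1 x (hηU h) (hs.symm.sub hx).2) hx
  have hweak := D.split_weak hz hs hne hv hη.contDiffOn hηB
    fun x hx => ⟨(hout x (hη2 x hx)).1, (hout x (hη2 x hx)).2.1, (hout x (hη2 x hx)).2.2.1⟩
  obtain ⟨S, M, hS⟩ := exists_step
  set G : ℝ → ℝ × ℝ → ℝ := fun ε x => S (-z x / ε - 1) with hG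
  set g : ℝ → ℝ × ℝ → ℝ := fun ε x => deriv S (-z x / ε - 1) / ε with hg
  set Ψ : ℝ × ℝ → ℝ := fun x => enDens μ z η x - fderiv ℝ η x v / 2 with hΨ
  have hGs : ∀ ε, ContDiffOn ℝ (⊤ : ℕ∞) (G ε) Ω := fun ε =>
    hS.smooth.comp_contDiffOn ((hzs.neg.div_const ε).sub contDiffOn_const)
  have hGd : ∀ ε, ∀ x ∈ Ω, pdx (G ε) x = -(g ε x) * pdx z x ∧ pdy (G ε) x = -(g ε x) * pdy z x := by
    intro ε x hx
    have hdz := hzs.diffAt ho hx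
    have h1 : HasDerivAt (fun t => S (-t / ε - 1)) (-(g ε x)) (z x) := by
      have h2 : HasDerivAt (fun t : ℝ => -t / ε - 1) (-1 / ε) (z x) :=
        ((hasDerivAt_id _).neg.div_const ε).sub_const 1
      refine ((hS.differentiableAt _).hasDerivAt.comp (z x) h2).congr_deriv ?_
      simp only [hg]; ring
    constructor
    · have := pdx_comp (f := fun t => S (-t / ε - 1)) h1.differentiableAt hdz
      rw [h1.deriv] at this
      exact this
    · have := pdy_comp (f := fun t => S (-t / ε - 1)) h1.differentiableAt hdz
      rw [h1.deriv] at this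
      exact this
  have hzx := hzs.pdx_smooth ho
  have hzy := hzs.pdy_smooth ho
  obtain ⟨B', hB'⟩ := hz.bdd
  have iΨc : ContinuousOn Ψ Ω := by
    refine (D.enDens_continuousOn hzs hη.contDiffOn).sub (ContinuousOn.div_const ?_ 2)
    exact ((hη.continuous_fderiv (by simp)).clm_apply continuous_const).continuousOn
  obtain ⟨C0, hC0⟩ := D.exists_enDens_bound μ (max (max B0 K) B')
  have hΨb : ∀ x ∈ Ω, |Ψ x| ≤ C0 + K * ‖v‖ := by
    intro x hx
    have h1 := hC0 z η x hx ⟨le_max_of_le_right (hB' x hx).1, le_max_of_le_right (hB' x hx).2.1,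
      le_max_of_le_right (hB' x hx).2.2⟩ ⟨le_max_of_le_left (hηB x hx).1,
      le_max_of_le_left (hηB x hx).2.1, le_max_of_le_left (hηB x hx).2.2⟩
    have h2 := hK0 x v
    calc |Ψ x| ≤ |enDens μ z η x| + |fderiv ℝ η x v / 2| := abs_sub _ _
      _ ≤ C0 + K * ‖v‖ := by
        rw [abs_div, abs_two]
        have := abs_nonneg (fderiv ℝ η x v)
        linarith
  have hGb : ∀ ε, ∀ x, |G ε x| ≤ 1 := fun ε x => by
    rw [abs_of_nonneg (hS.nonneg _)]; exact hS.le_one _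
  have hGΨb : ∀ ε, ∀ x ∈ Ω, |G ε x * Ψ x| ≤ C0 + K * ‖v‖ := fun ε x hx => by
    rw [abs_mul]
    calc |G ε x| * |Ψ x| ≤ 1 * |Ψ x| := mul_le_mul_of_nonneg_right (hGb ε x) (abs_nonneg _)
      _ ≤ _ := by rw [one_mul]; exact hΨb x hx
  have hGΨc : ∀ ε, ContinuousOn (fun x => G ε x * Ψ x) Ω := fun ε => (hGs ε).continuousOn.mul iΨc
  have hnn : ∀ ε > 0, 0 ≤ ∫ x in Ω, G ε x * Ψ x := by
    intro ε hε
    obtain ⟨a1, b1, c1⟩ := parts ho hK hηc (hηU.trans hUΩ)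
      (V1 := fun x => G ε x * pdx z x) (V2 := fun x => G ε x * pdy z x)
      (((hGs ε).mul hzx).of_le (by simp)) (((hGs ε).mul hzy).of_le (by simp))
    obtain ⟨a2, b2, c2⟩ := parts ho hK hηc (hηU.trans hUΩ)
      (V1 := fun x => G ε x * v.1) (V2 := fun x => G ε x * v.2)
      (((hGs ε).mul contDiffOn_const).of_le (by simp))
      (((hGs ε).mul contDiffOn_const).of_le (by simp))
    have i1 : IntegrableOn (fun x => η x * (pdx (fun x => G ε x * pdx z x) x +
        pdy (fun x => G ε x * pdy z x) x) + fderiv ℝ η x (G ε x * pdx z x, G ε x * pdy z x)) Ω :=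
      a1.add b1
    have i2 : IntegrableOn (fun x => η x * (pdx (fun x => G ε x * v.1) x +
        pdy (fun x => G ε x * v.2) x) + fderiv ℝ η x (G ε x * v.1, G ε x * v.2)) Ω :=
      a2.add b2
    have e0 : ∫ x in Ω, ((η x * (pdx (fun x => G ε x * pdx z x) x +
        pdy (fun x => G ε x * pdy z x) x) + fderiv ℝ η x (G ε x * pdx z x, G ε x * pdy z x)) -
        (η x * (pdx (fun x => G ε x * v.1) x +
        pdy (fun x => G ε x * v.2) x) + fderiv ℝ η x (G ε x * v.1, G ε x * v.2)) / 2) = 0 := by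
      rw [integral_sub i1 (i2.div_const 2), integral_div, integral_add a1 b1, integral_add a2 b2,
        c1, c2]
      ring
    rw [← e0]
    refine setIntegral_mono_on (i1.sub (i2.div_const 2)) (D.integrableOn_of_cont (hGΨc ε) (hGΨb ε))
      ho.measurableSet fun x hx => ?_
    have dG := (hGs ε).diffAt ho hx
    have dx := hzx.diffAt ho hx
    have dy := hzy.diffAt ho hx
    rw [pdx_mul dG dx, pdy_mul dG dy, pdx_mul dG (differentiableAt_const v.1),
      pdy_mul dG (differentiableAt_const v.2), (hGd ε x hx).1, (hGd ε x hx).2]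
    have c1 : pdx (fun _ : ℝ × ℝ => v.1) x = 0 := by simp [pdx]
    have c2 : pdy (fun _ : ℝ × ℝ => v.2) x = 0 := by simp [pdy]
    have h1 := hz.eq x hx
    have hx2 : 0 < x.2 := D.sub hx
    have h2 : pdx (pdx z) x + pdy (pdy z) x = -(μ * z x) / x.2 ^ 2 := by
      rw [← h1, hypLap]; field_simp
    have h3 : fderiv ℝ η x v = v.1 * pdx η x + v.2 * pdy η x := fderiv_apply_eq_pd _ _ _
    rw [fderiv_apply_eq_pd, fderiv_apply_eq_pd, c1, c2]
    simp only [hΨ, enDens, h3]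
    have hkey : η x * g ε x * (v.1 * pdx z x + v.2 * pdy z x) / 2 ≤
        η x * g ε x * (pdx z x ^ 2 + pdy z x ^ 2) := by
      by_cases hxs : x ∈ tsupport η
      · have h4 := hUd x (hηU hxs)
        rw [fderiv_apply_eq_pd] at h4
        have h5 : (v.1 * pdx z x + v.2 * pdy z x) / 2 ≤ pdx z x ^ 2 + pdy z x ^ 2 := by
          nlinarith [sq_nonneg (pdx z x - v.1 / 2), sq_nonneg (pdy z x - v.2 / 2)]
        have h6 : 0 ≤ η x * g ε x := mul_nonneg (hη0 x) (div_nonneg (hS.deriv_nonneg _) hε.le)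
        rw [mul_div_assoc]
        exact mul_le_mul_of_nonneg_left h5 h6
      · rw [(hout x hxs).1]; simp
    have h7 : η x * (G ε x * (pdx (pdx z) x + pdy (pdy z) x)) =
        -(μ * (z x * η x / x.2 ^ 2)) * G ε x := by rw [h2]; ring
    linarith
  have hlim := D.toBddDom.tendsto_integral (Φ := fun ε x => G ε x * Ψ x)
    (Φ0 := {x | x ∈ Ω ∧ z x < 0}.indicator Ψ) (C := C0 + K * ‖v‖)
    (fun ε _ => (hGΨc ε).aestronglyMeasurable ho.measurableSet) (fun ε _ => hGΨb ε)
    (fun x hx => by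
      by_cases hxz : z x < 0
      · have h2 : ∀ᶠ ε in 𝓝[>] (0 : ℝ), ε < -z x / 2 :=
          mem_nhdsWithin_of_mem_nhds (Iio_mem_nhds (by linarith))
        filter_upwards [h2, self_mem_nhdsWithin] with ε h2 hε
        have hε : 0 < ε := hε
        have h3 : 2 ≤ -z x / ε := by rw [le_div_iff₀ hε]; linarith
        rw [indicator_of_mem (show x ∈ {x | x ∈ Ω ∧ z x < 0} from ⟨hx, hxz⟩)]
        simp only [hG]
        rw [hS.one _ (by linarith), one_mul]
      · filter_upwards [self_mem_nhdsWithin] with ε hε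
        have hε : 0 < ε := hε
        rw [indicator_of_notMem (fun h => hxz h.2)]
        have : -z x / ε ≤ 0 := div_nonpos_of_nonpos_of_nonneg (by linarith) hε.le
        simp only [hG]
        rw [hS.zero _ (by linarith), zero_mul])
  have h0 : 0 ≤ ∫ x in Ω, {x | x ∈ Ω ∧ z x < 0}.indicator Ψ x :=
    ge_of_tendsto hlim (by filter_upwards [self_mem_nhdsWithin] with ε hε using hnn ε hε)
  have hN : IsOpen {x | x ∈ Ω ∧ z x < 0} := by
    rw [← hs.union]; exact hs.open1.union hs.open2
  have hcv : Continuous fun x => fderiv ℝ η x v :=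
    (hη.continuous_fderiv (by simp)).clm_apply continuous_const
  have iv : IntegrableOn (fun x => fderiv ℝ η x v) Ω :=
    D.integrableOn_of_cont hcv.continuousOn fun x _ => hK0 x v
  have ivN : IntegrableOn ({x | x ∈ Ω ∧ z x < 0}.indicator fun x => fderiv ℝ η x v) Ω :=
    Integrable.indicator iv hN.measurableSet
  have ie : IntegrableOn (D1.indicator (enDens μ z η)) Ω :=
    Integrable.indicator (D.integrableOn_energy hz hη.contDiffOn hηB) hs.open1.measurableSet
  have hdec : ({x | x ∈ Ω ∧ z x < 0}.indicator Ψ) = fun x => D1.indicator (enDens μ z η) x -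
      ({x | x ∈ Ω ∧ z x < 0}.indicator fun x => fderiv ℝ η x v) x / 2 := by
    funext x
    rw [← hs.union]
    by_cases hx1 : x ∈ D1
    · simp [hx1, hΨ]
    · by_cases hx2 : x ∈ D2
      · have := hout x (hη2 x hx2)
        simp [hx1, hx2, hΨ, enDens, this]
      · simp [hx1, hx2]
  rw [hdec, integral_sub ie (ivN.div_const 2), hweak, integral_div] at h0
  have hpos : 0 < ∫ x in Ω, ({x | x ∈ Ω ∧ z x < 0}.indicator fun x => fderiv ℝ η x v) x := by
    refine (setIntegral_pos_iff_support_of_nonneg_ae ?_ ivN).2 ?_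
    · filter_upwards with x
      rw [Pi.zero_apply]
      by_cases hx : x ∈ {x | x ∈ Ω ∧ z x < 0}
      · rw [indicator_of_mem hx]; exact hηneg x hx.2
      · rw [indicator_of_notMem hx]
    · have ho2 : IsOpen ({x | x ∈ Ω ∧ z x < 0} ∩ {x | 0 < fderiv ℝ η x v}) :=
        hN.inter (isOpen_lt continuous_const hcv)
      refine (ho2.measure_pos volume ⟨x0, ⟨hUΩ hx0U, hx0z⟩, hx0⟩).trans_le
        (measure_mono fun x hx => ⟨?_, hx.1.1⟩)
      rw [Function.mem_support, indicator_of_mem hx.1]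
      exact (show 0 < fderiv ℝ η x v from hx.2).ne'
  linarith

/-- The negative set of a supersolution is connected. -/
theorem neg_preconnected (hμ : 0 < μ) (hz : SuperSol Ω p μ z) (hv : VarIneq Ω μ)
    (hne : ∃ x ∈ Ω, z x ≠ 0) : IsPreconnected {x | x ∈ Ω ∧ z x < 0} := by
  have ho := D.isOpen
  have hloc := (unique_continuation ho D.sub D.preconn hμ hz.smooth hz.eq).resolve_left
    (by push Not; exact hne)
  have hN : IsOpen {x | x ∈ Ω ∧ z x < 0} :=
    hz.smooth.continuousOn.isOpen_inter_preimage ho isOpen_Iio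
  rw [isPreconnected_iff_subset_of_disjoint]
  intro u w hu hw huw hdis
  by_contra hcon
  push Not at hcon
  obtain ⟨x1, hx1, hx1u⟩ := not_subset.1 hcon.1
  obtain ⟨x2, hx2, hx2w⟩ := not_subset.1 hcon.2
  have hs : Split Ω z ({x | x ∈ Ω ∧ z x < 0} ∩ u) ({x | x ∈ Ω ∧ z x < 0} ∩ w) := by
    refine ⟨hN.inter hu, hN.inter hw, disjoint_left.2 fun x h1 h2 => ?_, ?_⟩
    · have : x ∈ {x | x ∈ Ω ∧ z x < 0} ∩ (u ∩ w) := ⟨h1.1, h1.2, h2.2⟩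
      rw [hdis] at this
      exact this
    · rw [← inter_union_distrib_left]
      exact inter_eq_left.2 huw
  have n1 : ({x | x ∈ Ω ∧ z x < 0} ∩ u).Nonempty := ⟨x2, hx2, (huw hx2).resolve_right hx2w⟩
  have n2 : ({x | x ∈ Ω ∧ z x < 0} ∩ w).Nonempty := ⟨x1, hx1, (huw hx1).resolve_left hx1u⟩
  have hfr : (Ω ∩ frontier ({x | x ∈ Ω ∧ z x < 0} ∩ u)).Nonempty := by
    by_contra hcon2
    rw [not_nonempty_iff_eq_empty] at hcon2
    have hsub : Ω ⊆ {x | x ∈ Ω ∧ z x < 0} ∩ u := by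
      refine D.preconn.subset_of_closure_inter_subset hs.open1
        (n1.mono fun x hx => ⟨(hs.sub hx).1, hx⟩) fun x hx => ?_
      by_contra hx3
      have : x ∈ Ω ∩ frontier ({x | x ∈ Ω ∧ z x < 0} ∩ u) :=
        ⟨hx.2, by rw [hs.open1.frontier_eq]; exact ⟨hx.1, hx3⟩⟩
      rw [hcon2] at this
      exact this
    exact hx1u (hsub hx1.1).2
  obtain ⟨q, hq, hd⟩ := exists_regular_frontier ho D.sub hz.smooth hloc
    (fun x hx => (hs.sub hx).2) (fun x hx => hs.not_frontier ho hz.smooth.continuousOn hx.1 hx.2)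
    hfr hs.open1
  exact D.split_regular_false hz hs n2 hv hq.1 hq.2 hd

end ConvDom

/-- The function `ζ - a` has a continuous logarithm on `K`. -/
def HasLog (K : Set ℂ) (a : ℂ) : Prop :=
  ∃ L : ℂ → ℂ, ContinuousOn L K ∧ ∀ ζ ∈ K, Complex.exp (L ζ) = ζ - a

lemma one_add_mem_slitPlane {w : ℂ} (h : ‖w‖ < 1) : 1 + w ∈ Complex.slitPlane := by
  left
  have := (Complex.abs_re_le_norm w).trans_lt h
  rw [abs_lt] at this
  simp only [Complex.add_re, Complex.one_re]
  linarith [this.1]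

namespace HasLog
variable {K : Set ℂ} {a b : ℂ}

lemma of_near (h : HasLog K b) (hab : ∀ ζ ∈ K, ‖b - a‖ < ‖ζ - b‖) : HasLog K a := by
  obtain ⟨L, hL, he⟩ := h
  have hne : ∀ ζ ∈ K, ζ - b ≠ 0 := fun ζ hζ h0 => by
    have := hab ζ hζ
    rw [h0, norm_zero] at this
    exact absurd this (not_lt.2 (norm_nonneg _))
  have hs : ∀ ζ ∈ K, 1 + (b - a) / (ζ - b) ∈ Complex.slitPlane := fun ζ hζ => by
    apply one_add_mem_slitPlane
    rw [norm_div, div_lt_one (norm_pos_iff.2 (hne ζ hζ))]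
    exact hab ζ hζ
  refine ⟨fun ζ => L ζ + Complex.log (1 + (b - a) / (ζ - b)), hL.add (ContinuousOn.clog ?_ hs), ?_⟩
  · exact continuousOn_const.add (continuousOn_const.div (by fun_prop) hne)
  · intro ζ hζ
    rw [Complex.exp_add, he ζ hζ, Complex.exp_log (Complex.slitPlane_ne_zero (hs ζ hζ))]
    have := hne ζ hζ
    field_simp
    ring

lemma of_far (h : ∀ ζ ∈ K, ‖ζ‖ < ‖a‖) : HasLog K a := by
  rcases K.eq_empty_or_nonempty with rfl | ⟨ζ0, h0⟩
  · exact ⟨0, continuousOn_empty _, fun _ h => absurd h (notMem_empty _)⟩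
  have ha : a ≠ 0 := norm_pos_iff.1 ((norm_nonneg _).trans_lt (h ζ0 h0))
  have hs : ∀ ζ ∈ K, 1 + -(ζ / a) ∈ Complex.slitPlane := fun ζ hζ => by
    apply one_add_mem_slitPlane
    rw [norm_neg, norm_div, div_lt_one (norm_pos_iff.2 ha)]
    exact h ζ hζ
  refine ⟨fun ζ => Complex.log (-a) + Complex.log (1 + -(ζ / a)),
    continuousOn_const.add (ContinuousOn.clog (by fun_prop) hs), fun ζ hζ => ?_⟩
  rw [Complex.exp_add, Complex.exp_log (neg_ne_zero.2 ha),
    Complex.exp_log (Complex.slitPlane_ne_zero (hs ζ hζ))]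
  field_simp
  ring

lemma of_preconnected (hK : IsCompact K) {T : Set ℂ} (hT : IsPreconnected T)
    (hd : Disjoint T K) (hb : b ∈ T) (h : HasLog K b) (ha : a ∈ T) : HasLog K a := by
  have hloc : ∀ c ∈ T, ∃ ε > 0, ∀ c' ∈ Metric.ball c ε, HasLog K c' ↔ HasLog K c := by
    intro c hc
    have hcK : c ∈ Kᶜ := fun h => disjoint_left.1 hd hc h
    obtain ⟨ε, hε, hball⟩ := Metric.isOpen_iff.1 hK.isClosed.isOpen_compl c hcK
    have hfar : ∀ ζ ∈ K, ε ≤ ‖ζ - c‖ := fun ζ hζ => by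
      by_contra hlt
      push Not at hlt
      exact hball (by rwa [Metric.mem_ball, dist_eq_norm]) hζ
    refine ⟨ε / 2, half_pos hε, fun c' hc' => ?_⟩
    rw [Metric.mem_ball, dist_eq_norm] at hc'
    refine ⟨fun h => h.of_near fun ζ hζ => ?_, fun h => h.of_near fun ζ hζ => ?_⟩
    · have h1 := norm_sub_le_norm_sub_add_norm_sub ζ c' c
      linarith [hfar ζ hζ]
    · rw [norm_sub_rev]
      linarith [hfar ζ hζ]
  choose! ε hε hiff using hloc
  have hsub : T ⊆ {c | HasLog K c} := by
    refine fun c hc => ?_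
    by_contra hn
    obtain ⟨x, hxT, hx1, hx2⟩ := hT (⋃ c ∈ {c ∈ T | HasLog K c}, Metric.ball c (ε c))
      (⋃ c ∈ {c ∈ T | ¬ HasLog K c}, Metric.ball c (ε c))
      (isOpen_biUnion fun _ _ => Metric.isOpen_ball) (isOpen_biUnion fun _ _ => Metric.isOpen_ball)
      (fun x hx => by
        by_cases hl : HasLog K x
        · exact Or.inl (mem_biUnion (show x ∈ {c ∈ T | HasLog K c} from ⟨hx, hl⟩)
            (Metric.mem_ball_self (hε x hx)))
        · exact Or.inr (mem_biUnion (show x ∈ {c ∈ T | ¬ HasLog K c} from ⟨hx, hl⟩)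
            (Metric.mem_ball_self (hε x hx))))
      ⟨b, hb, mem_biUnion (show b ∈ {c ∈ T | HasLog K c} from ⟨hb, h⟩)
        (Metric.mem_ball_self (hε b hb))⟩
      ⟨c, hc, mem_biUnion (show c ∈ {c ∈ T | ¬ HasLog K c} from ⟨hc, hn⟩)
        (Metric.mem_ball_self (hε c hc))⟩
    obtain ⟨c1, hc1, hx1⟩ := mem_iUnion₂.1 hx1
    obtain ⟨c2, hc2, hx2⟩ := mem_iUnion₂.1 hx2
    exact hc2.2 ((hiff c2 hc2.1 x hx2).1 ((hiff c1 hc1.1 x hx1).2 hc1.2))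
  exact hsub ha

end HasLog

/-- Two continuous logarithms of the same function differ by a constant on a preconnected set. -/
lemma log_sub_const {S : Set ℂ} (hS : IsPreconnected S) {F G : ℂ → ℂ} (hF : ContinuousOn F S)
    (hG : ContinuousOn G S) (h : ∀ ζ ∈ S, Complex.exp (F ζ) = Complex.exp (G ζ)) {x y : ℂ}
    (hx : x ∈ S) (hy : y ∈ S) : F x - G x = F y - G y := by
  have hintg : ∀ ζ ∈ S, ∃ n : ℤ, F ζ - G ζ = n * (2 * Real.pi * Complex.I) := fun ζ hζ => by
    obtain ⟨n, hn⟩ := Complex.exp_eq_exp_iff_exists_int.1 (h ζ hζ)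
    exact ⟨n, by rw [hn]; ring⟩
  set φ : ℂ → ℝ := fun ζ => (F ζ - G ζ).im / (2 * Real.pi) with hφ
  have hpi : 2 * Real.pi ≠ 0 := by positivity
  have hval : ∀ (ζ : ℂ) (n : ℤ), F ζ - G ζ = n * (2 * Real.pi * Complex.I) → φ ζ = n := by
    intro ζ n hn
    have : (F ζ - G ζ).im = n * (2 * Real.pi) := by rw [hn]; simp
    simp only [hφ, this]
    field_simp
  have hc : ContinuousOn φ S := (Complex.continuous_im.comp_continuousOn (hF.sub hG)).div_const _
  have hno : ∀ u ∈ S, ∀ v ∈ S, φ u ≤ φ v → φ v ≤ φ u := by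
    intro u hu v hv huv
    obtain ⟨n, hn⟩ := hintg u hu
    obtain ⟨k, hk⟩ := hintg v hv
    rw [hval u n hn, hval v k hk] at huv ⊢
    by_contra hlt
    push Not at hlt
    have hlt' : n + 1 ≤ k := by exact_mod_cast hlt
    have hk' : (n : ℝ) + 1 ≤ k := by exact_mod_cast hlt'
    obtain ⟨w, hw, hw2⟩ := hS.intermediate_value hu hv hc
      (show (n : ℝ) + 1 / 2 ∈ Icc (φ u) (φ v) by
        rw [hval u n hn, hval v k hk]; constructor <;> linarith)
    obtain ⟨l, hl⟩ := hintg w hw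
    rw [hval w l hl] at hw2
    have : (2 * l : ℝ) = 2 * n + 1 := by linarith
    have : 2 * l = 2 * n + 1 := by exact_mod_cast this
    omega
  have heq : φ x = φ y := by
    rcases le_total (φ x) (φ y) with h1 | h1
    · exact le_antisymm h1 (hno x hx y hy h1)
    · exact le_antisymm (hno y hy x hx h1) h1
  obtain ⟨n, hn⟩ := hintg x hx
  obtain ⟨k, hk⟩ := hintg y hy
  rw [hval x n hn, hval y k hk] at heq
  rw [hn, hk]
  have : n = k := by exact_mod_cast heq
  rw [this]

lemma crossing_quotient (w h : ℝ) (ζ : ℂ) :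
    ((ζ - (w - h * Complex.I)) / (ζ - (w + h * Complex.I))).re =
      ((ζ.re - w) ^ 2 + ζ.im ^ 2 - h ^ 2) / ((ζ.re - w) ^ 2 + (ζ.im - h) ^ 2) ∧
    ((ζ - (w - h * Complex.I)) / (ζ - (w + h * Complex.I))).im =
      2 * (ζ.re - w) * h / ((ζ.re - w) ^ 2 + (ζ.im - h) ^ 2) := by
  rw [Complex.div_re, Complex.div_im, Complex.normSq_apply]
  simp only [Complex.sub_re, Complex.sub_im, Complex.add_re, Complex.add_im, Complex.ofReal_re,
    Complex.ofReal_im, Complex.mul_re, Complex.mul_im, Complex.I_re, Complex.I_im]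
  constructor <;> · rw [← sub_eq_zero]; ring

/-- A connected set crossing the open vertical segment between `w - ih` and `w + ih` exactly once
and transversally, whose complement of the crossing point is connected, separates the end points:
the quotient has no continuous logarithm on it. -/
lemma crossing_false {K : Set ℂ} {w h : ℝ} (hh : 0 < h)
    (hconn : IsPreconnected (K \ {(w : ℂ)}))
    (hseg : ∀ ζ ∈ K, ζ.re = w → |ζ.im| ≤ h → ζ = w)
    (hline : ∀ᶠ t in 𝓝 (0 : ℝ), ((w + t : ℝ) : ℂ) ∈ K)
    (h1 : HasLog K (w - h * Complex.I)) (h3 : HasLog K (w + h * Complex.I)) : False := by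
  obtain ⟨L1, hL1, he1⟩ := h1
  obtain ⟨L3, hL3, he3⟩ := h3
  set Q : ℂ → ℂ := fun ζ => (ζ - (w - h * Complex.I)) / (ζ - (w + h * Complex.I)) with hQ
  have hne3 : ∀ ζ ∈ K, ζ - (w + h * Complex.I) ≠ 0 := fun ζ hζ => by
    rw [← he3 ζ hζ]; exact Complex.exp_ne_zero _
  have hden : ∀ ζ ∈ K, 0 < (ζ.re - w) ^ 2 + (ζ.im - h) ^ 2 := fun ζ hζ => by
    have := Complex.normSq_pos.2 (hne3 ζ hζ)
    rw [Complex.normSq_apply] at this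
    simp only [Complex.sub_re, Complex.sub_im, Complex.add_re, Complex.add_im, Complex.ofReal_re,
      Complex.ofReal_im, Complex.mul_re, Complex.mul_im, Complex.I_re, Complex.I_im] at this
    nlinarith
  set G : ℂ → ℂ := fun ζ => L1 ζ - L3 ζ with hG
  have hGc : ContinuousOn G K := hL1.sub hL3
  have hGe : ∀ ζ ∈ K, Complex.exp (G ζ) = Q ζ := fun ζ hζ => by
    rw [hG, Complex.exp_sub, he1 ζ hζ, he3 ζ hζ]
  have hslit : ∀ ζ ∈ K \ {(w : ℂ)}, Q ζ ∈ Complex.slitPlane := by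
    rintro ζ ⟨hζ, hζw⟩
    obtain ⟨hre, him⟩ := crossing_quotient w h ζ
    by_cases ha : ζ.re = w
    · left
      rw [hQ, hre, ha, sub_self]
      have hb : h < |ζ.im| := by
        by_contra hle
        exact hζw (hseg ζ hζ ha (not_lt.1 hle))
      have : h ^ 2 < ζ.im ^ 2 := by rw [← sq_abs ζ.im]; gcongr
      have hd := hden ζ hζ
      rw [ha, sub_self] at hd
      exact div_pos (by linarith) hd
    · right
      rw [hQ, him]
      have : ζ.re - w ≠ 0 := sub_ne_zero.2 ha
      exact div_ne_zero (by positivity) (hden ζ hζ).ne'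
  have hlogc : ContinuousOn (fun ζ => Complex.log (Q ζ)) (K \ {(w : ℂ)}) :=
    ContinuousOn.clog (ContinuousOn.div (by fun_prop) (by fun_prop)
      fun ζ hζ => hne3 ζ hζ.1) hslit
  have hconst : ∀ x ∈ K \ {(w : ℂ)}, ∀ y ∈ K \ {(w : ℂ)},
      G x - Complex.log (Q x) = G y - Complex.log (Q y) := fun x hx y hy =>
    log_sub_const hconn (hGc.mono sdiff_subset) hlogc (fun ζ hζ => by
      rw [hGe ζ hζ.1, Complex.exp_log (Complex.slitPlane_ne_zero (hslit ζ hζ))]) hx hy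
  have hwK : (w : ℂ) ∈ K := by simpa using hline.self_of_nhds
  have hmem : ∀ᶠ t in 𝓝[≠] (0 : ℝ), ((w + t : ℝ) : ℂ) ∈ K \ {(w : ℂ)} := by
    filter_upwards [nhdsWithin_le_nhds hline, self_mem_nhdsWithin] with t ht ht0
    refine ⟨ht, fun h => ht0 ?_⟩
    have h' : ((w + t : ℝ) : ℂ) = w := h
    have : w + t = w := by exact_mod_cast h'
    simpa using this
  obtain ⟨t0, ht0⟩ := hmem.exists
  set c := G ((w + t0 : ℝ) : ℂ) - Complex.log (Q ((w + t0 : ℝ) : ℂ)) with hc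
  have hval : ∀ᶠ t in 𝓝[≠] (0 : ℝ),
      Complex.log (Q ((w + t : ℝ) : ℂ)) = G ((w + t : ℝ) : ℂ) - c := by
    filter_upwards [hmem] with t ht
    have := hconst _ ht _ ht0
    rw [← hc] at this
    rw [← this]; ring
  have hmap : Tendsto (fun t : ℝ => ((w + t : ℝ) : ℂ)) (𝓝 0) (𝓝 (w : ℂ)) := by
    have : Continuous fun t : ℝ => ((w + t : ℝ) : ℂ) := by fun_prop
    simpa using this.tendsto 0
  have hGlim : Tendsto (fun t : ℝ => G ((w + t : ℝ) : ℂ) - c) (𝓝[≠] 0) (𝓝 (G w - c)) := by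
    have h1 : Tendsto (fun t : ℝ => ((w + t : ℝ) : ℂ)) (𝓝[≠] 0) (𝓝[K] (w : ℂ)) :=
      tendsto_nhdsWithin_iff.2 ⟨hmap.mono_left nhdsWithin_le_nhds, hmem.mono fun _ h => h.1⟩
    exact ((hGc w hwK).tendsto.comp h1).sub_const c
  have hQw : Q w = -1 := by
    have : (h : ℂ) ≠ 0 := by exact_mod_cast hh.ne'
    simp only [hQ]
    rw [div_eq_iff (hne3 _ hwK)]
    ring
  have hQc : Tendsto (fun t : ℝ => Q ((w + t : ℝ) : ℂ)) (𝓝 0) (𝓝 (-1)) := by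
    rw [← hQw]
    have : ContinuousAt Q w := by
      have := hne3 _ hwK
      simp only [hQ]
      fun_prop (disch := assumption)
    exact this.tendsto.comp hmap
  have hQim : ∀ t : ℝ, (Q ((w + t : ℝ) : ℂ)).im = 2 * t * h / (t ^ 2 + h ^ 2) := fun t => by
    rw [hQ, (crossing_quotient w h _).2]
    simp
  have hup : Tendsto (fun t : ℝ => Complex.log (Q ((w + t : ℝ) : ℂ))) (𝓝[>] 0)
      (𝓝 (Real.log ‖(-1 : ℂ)‖ + Real.pi * Complex.I)) := by
    refine (Complex.tendsto_log_nhdsWithin_im_nonneg_of_re_neg_of_im_zero (by simp)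
      (by simp)).comp (tendsto_nhdsWithin_iff.2 ⟨hQc.mono_left nhdsWithin_le_nhds, ?_⟩)
    filter_upwards [self_mem_nhdsWithin] with t ht
    have ht : 0 < t := ht
    show 0 ≤ (Q ((w + t : ℝ) : ℂ)).im
    rw [hQim]; positivity
  have hdn : Tendsto (fun t : ℝ => Complex.log (Q ((w + t : ℝ) : ℂ))) (𝓝[<] 0)
      (𝓝 (Real.log ‖(-1 : ℂ)‖ - Real.pi * Complex.I)) := by
    refine (Complex.tendsto_log_nhdsWithin_im_neg_of_re_neg_of_im_zero (by simp)
      (by simp)).comp (tendsto_nhdsWithin_iff.2 ⟨hQc.mono_left nhdsWithin_le_nhds, ?_⟩)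
    filter_upwards [self_mem_nhdsWithin] with t ht
    have ht : t < 0 := ht
    show (Q ((w + t : ℝ) : ℂ)).im < 0
    rw [hQim]
    exact div_neg_of_neg_of_pos (by nlinarith) (by positivity)
  have hl : 𝓝[<] (0 : ℝ) ≤ 𝓝[≠] 0 := nhdsWithin_mono _ fun x hx => ne_of_lt hx
  have hr : 𝓝[>] (0 : ℝ) ≤ 𝓝[≠] 0 := nhdsWithin_mono _ fun x hx => ne_of_gt hx
  have e1 := tendsto_nhds_unique (hup.congr' (hr hval)) (hGlim.mono_left hr)
  have e2 := tendsto_nhds_unique (hdn.congr' (hl hval)) (hGlim.mono_left hl)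
  have e3 := congrArg Complex.im (e1.trans e2.symm)
  simp at e3
  linarith [Real.pi_pos]

/-- The Klein chart at `p` as a complex coordinate, rotated by the angle `-α`. -/
def kleinC (p : ℝ × ℝ) (α : ℝ) (x : ℝ × ℝ) : ℂ :=
  ((klein p x).1 + (klein p x).2 * Complex.I) * Complex.exp (-α * Complex.I)

section kleinC
variable {p : ℝ × ℝ} (hp : p ∈ H2) (α : ℝ)

lemma kleinC_eq_smul {x y : ℝ × ℝ} {s : ℝ} :
    kleinC p α x = s * kleinC p α y ↔ klein p x = s • klein p y := by
  unfold kleinC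
  rw [← mul_assoc, mul_left_inj' (Complex.exp_ne_zero _), Complex.ext_iff, Prod.ext_iff]
  simp

lemma kleinC_self : kleinC p α p = 0 := by simp [kleinC, klein_self]

include hp

lemma kleinC_continuous : Continuous (kleinC p α) := by
  have := (klein_smooth hp).continuous
  exact ((Complex.continuous_ofReal.comp this.fst).add
    ((Complex.continuous_ofReal.comp this.snd).mul continuous_const)).mul continuous_const

lemma kleinC_injOn : InjOn (kleinC p α) H2 := fun x hx y hy h =>
  klein_injOn hp hx hy (by
    have := (kleinC_eq_smul (p := p) α (x := x) (y := y) (s := 1)).1 (by simpa using h)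
    simpa using this)

lemma kleinC_pol {r : ℝ} (hr : |r| < 1) (θ : ℝ) : kleinC p α (pol p (r, θ)) =
    ((2 * r / (1 + r ^ 2) * Real.cos (θ - α) : ℝ) : ℂ) +
      ((2 * r / (1 + r ^ 2) * Real.sin (θ - α) : ℝ) : ℂ) * Complex.I := by
  have h1 : Complex.exp (-α * Complex.I) = Real.cos α - Real.sin α * Complex.I := by
    rw [Complex.exp_mul_I, Complex.cos_neg, Complex.sin_neg]
    push_cast; ring
  rw [kleinC, klein_pol hp hr, h1, Real.cos_sub, Real.sin_sub]
  apply Complex.ext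
  · simp; ring
  · simp; ring

end kleinC

namespace ConvDom
variable {Ω : Set (ℝ × ℝ)} {p : ℝ × ℝ} (D : ConvDom Ω p)
include D

/-- A connected set reaching the boundary continues to infinity along a Klein ray. -/
lemma hasLog_of_escape (α : ℝ) {S C : Set (ℝ × ℝ)} (hS : S ⊆ Ω) (hSc : IsCompact S)
    (hC : C ⊆ Ω) (hd : Disjoint C S) (hCc : IsPreconnected C) {q : ℝ × ℝ} (hq : q ∈ closure C)
    (hqΩ : q ∉ Ω) {x : ℝ × ℝ} (hx : x ∈ C) : HasLog (kleinC p α '' S) (kleinC p α x) := by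
  have hqH : q ∈ H2 := D.closure_sub (closure_mono hC hq)
  have hcont := kleinC_continuous D.base α
  have hne : kleinC p α q ≠ 0 := by
    intro h
    have := kleinC_injOn D.base α hqH D.base (by rw [h, kleinC_self])
    exact hqΩ (this ▸ D.mem)
  set ray : Set ℂ := (fun s : ℝ => (s : ℂ) * kleinC p α q) '' Ici 1 with hray
  have hrayc : IsPreconnected ray :=
    isPreconnected_Ici.image _ (by fun_prop)
  have hqray : kleinC p α q ∈ ray := ⟨1, by simp, by simp⟩
  have hT1 : IsPreconnected (kleinC p α '' insert q C) := by
    refine IsPreconnected.image ?_ _ hcont.continuousOn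
    exact hCc.subset_closure (subset_insert _ _) (insert_subset hq subset_closure)
  have hT : IsPreconnected (kleinC p α '' insert q C ∪ ray) :=
    hT1.union _ (mem_image_of_mem _ (mem_insert _ _)) hqray hrayc
  have hrayS : ∀ s : ℝ, 1 ≤ s → ∀ y ∈ S, kleinC p α y ≠ s * kleinC p α q := by
    intro s hs y hy h
    rw [kleinC_eq_smul] at h
    have h1 : klein p q = s⁻¹ • klein p y := by
      rw [h, smul_smul, inv_mul_cancel₀ (by positivity), one_smul]
    have h2 : klein p q ∈ klein p '' Ω := by
      rw [h1]
      exact D.convex_image.smul_mem_of_zero_mem D.zero_mem (mem_image_of_mem _ (hS hy))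
        ⟨by positivity, inv_le_one_of_one_le₀ hs⟩
    exact hqΩ ((D.klein_mem_image hqH).1 h2)
  have hdis : Disjoint (kleinC p α '' insert q C ∪ ray) (kleinC p α '' S) := by
    rw [disjoint_left]
    rintro _ (⟨y, hy, rfl⟩ | ⟨s, hs, rfl⟩) ⟨w, hw, hyw⟩
    · rcases mem_insert_iff.1 hy with rfl | hy
      · exact hrayS 1 le_rfl w hw (by simpa using hyw)
      · have := kleinC_injOn D.base α (D.sub (hS hw)) (D.sub (hC hy)) hyw
        exact disjoint_left.1 hd hy (this ▸ hw)
    · exact hrayS s hs w hw hyw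
  have hK : IsCompact (kleinC p α '' S) := hSc.image hcont
  obtain ⟨B, hB⟩ := hK.isBounded.exists_norm_le
  have hpos : 0 < ‖kleinC p α q‖ := norm_pos_iff.2 hne
  set s := max 1 ((B + 1) / ‖kleinC p α q‖) with hs
  have hs1 : 1 ≤ s := le_max_left _ _
  have hfar : ∀ ζ ∈ kleinC p α '' S, ‖ζ‖ < ‖(s : ℂ) * kleinC p α q‖ := fun ζ hζ => by
    have h1 : (B + 1) / ‖kleinC p α q‖ ≤ s := le_max_right _ _
    rw [div_le_iff₀ hpos] at h1
    rw [norm_mul, Complex.norm_real, Real.norm_of_nonneg (by linarith)]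
    linarith [hB ζ hζ]
  exact (HasLog.of_far hfar).of_preconnected hK hT hdis (Or.inr ⟨s, hs1, rfl⟩)
    (Or.inl (mem_image_of_mem _ (mem_insert_of_mem _ hx)))

/-- Two negative rays at `p` separated by positive rays on both sides of one of them are
incompatible with a connected negative set, if all positive components reach the boundary. -/
lemma crossing_rays_false {z : ℝ × ℝ → ℝ} (hz : ContinuousOn z Ω) (hzp : z p = 0)
    (hneg : IsPreconnected {x | x ∈ Ω ∧ z x < 0})
    (hpos : ∀ x ∈ Ω, 0 < z x → ∃ C, x ∈ C ∧ C ⊆ Ω ∧ (∀ y ∈ C, 0 < z y) ∧ IsPreconnected C ∧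
      ∃ q ∈ closure C, q ∉ Ω)
    {α σ τ δ : ℝ} (hσ : 0 < σ) (hσ2 : σ < Real.pi / 2) (hτ : 0 < Real.sin (τ - σ))
    (hδ : 0 < δ) (hδ1 : δ < 1)
    (h2 : ∀ r ∈ Ioc 0 δ, pol p (r, α) ∈ Ω ∧ z (pol p (r, α)) < 0)
    (h4 : ∀ r ∈ Ioc 0 δ, pol p (r, α + τ) ∈ Ω ∧ z (pol p (r, α + τ)) < 0)
    (h3 : ∀ r ∈ Ioc 0 δ, pol p (r, α + σ) ∈ Ω ∧ 0 < z (pol p (r, α + σ)))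
    (h1 : ∀ r ∈ Ioc 0 δ, pol p (r, α - σ) ∈ Ω ∧ 0 < z (pol p (r, α - σ))) : False := by
  have hcont := kleinC_continuous D.base α
  have hNo : IsOpen {x | x ∈ Ω ∧ z x < 0} := hz.isOpen_inter_preimage D.isOpen isOpen_Iio
  have hδm : δ ∈ Ioc 0 δ := ⟨hδ, le_rfl⟩
  have hpath : JoinedIn {x | x ∈ Ω ∧ z x < 0} (pol p (δ, α + τ)) (pol p (δ, α)) :=
    ((hNo.isConnected_iff_isPathConnected.1 ⟨⟨_, h2 δ hδm⟩, hneg⟩).joinedIn _ (h4 δ hδm) _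
      (h2 δ hδm))
  obtain ⟨γ, hγ⟩ := hpath
  set Γ : Set (ℝ × ℝ) := range γ with hΓ
  have hΓc : IsCompact Γ := isCompact_range γ.continuous
  have hΓn : ∀ x ∈ Γ, x ∈ Ω ∧ z x < 0 := by rintro _ ⟨t, rfl⟩; exact hγ t
  have hΓconn : IsPreconnected Γ := isPreconnected_range γ.continuous
  have hΓ0 : pol p (δ, α + τ) ∈ Γ := ⟨0, by simp⟩
  have hΓ1 : pol p (δ, α) ∈ Γ := ⟨1, by simp⟩
  have hKΓ : ∀ x ∈ Γ, kleinC p α x ≠ 0 := fun x hx h => by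
    have := kleinC_injOn D.base α (D.sub (hΓn x hx).1) D.base (by rw [h, kleinC_self])
    have h5 := (hΓn x hx).2
    rw [this, hzp] at h5
    exact lt_irrefl _ h5
  obtain ⟨ε0, hε0, hε0Γ⟩ : ∃ ε0 > 0, ∀ x ∈ Γ, ε0 ≤ ‖kleinC p α x‖ := by
    obtain ⟨x0, hx0, hmin⟩ := hΓc.exists_isMinOn ⟨_, hΓ0⟩ (hcont.norm.continuousOn)
    exact ⟨_, norm_pos_iff.2 (hKΓ x0 hx0), fun x hx => hmin hx⟩
  set k : ℝ → ℝ := fun r => 2 * r / (1 + r ^ 2) with hk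
  have hkc : Continuous k := by
    have : ∀ r : ℝ, 1 + r ^ 2 ≠ 0 := fun r => by positivity
    simp only [hk]; fun_prop (disch := exact this _)
  have hk0 : k 0 = 0 := by simp [hk]
  have hkpos : ∀ r, 0 < r → 0 < k r := fun r hr => by simp only [hk]; positivity
  have hkinj : ∀ r ∈ Icc 0 δ, ∀ r' ∈ Icc 0 δ, k r = k r' → r = r' := by
    intro r hr r' hr' h
    simp only [hk] at h
    rw [div_eq_div_iff (by positivity) (by positivity)] at h
    have h5 : (r - r') * (1 - r * r') = 0 := by linarith
    have h6 : r * r' < 1 := by nlinarith [hr.1, hr.2, hr'.1, hr'.2]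
    rcases mul_eq_zero.1 h5 with h7 | h7 <;> linarith
  obtain ⟨r1, hr1, hr1δ, hr1ε⟩ : ∃ r1, 0 < r1 ∧ r1 < δ ∧ k r1 < ε0 := by
    have e1 : ∀ᶠ r in 𝓝[>] (0 : ℝ), k r < ε0 := by
      have : Tendsto k (𝓝 0) (𝓝 0) := by simpa [hk0] using hkc.tendsto 0
      exact nhdsWithin_le_nhds (this.eventually (gt_mem_nhds hε0))
    have e2 : ∀ᶠ r in 𝓝[>] (0 : ℝ), r < δ := nhdsWithin_le_nhds (gt_mem_nhds hδ)
    obtain ⟨r, h5, h6, h7⟩ := (e1.and (e2.and self_mem_nhdsWithin)).exists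
    exact ⟨r, h7, h6, h5⟩
  set ε := k r1 with hε
  have hεpos : 0 < ε := hkpos r1 hr1
  have hcos : 0 < Real.cos σ := Real.cos_pos_of_mem_Ioo ⟨by linarith, hσ2⟩
  have hcos1 : Real.cos σ < 1 := by
    have := Real.cos_lt_cos_of_nonneg_of_le_pi_div_two le_rfl hσ2.le hσ
    simpa using this
  have hsin : 0 < Real.sin σ := Real.sin_pos_of_pos_of_lt_pi hσ (by linarith)
  set w := ε * Real.cos σ with hw
  set h := ε * Real.sin σ with hh
  have hw0 : 0 < w := by positivity
  have hwε : w < ε := by nlinarith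
  have hh0 : 0 < h := by positivity
  have hivt : Icc 0 ε ⊆ k '' Icc 0 r1 := by
    have := intermediate_value_Icc hr1.le hkc.continuousOn
    rwa [hk0] at this
  obtain ⟨r0, hr0, hr0w⟩ := hivt ⟨hw0.le, hwε.le⟩
  have hr00 : 0 < r0 := lt_of_le_of_ne hr0.1 fun h => by rw [← h, hk0] at hr0w; linarith
  have hr0δ : r0 < δ := hr0.2.trans_lt hr1δ
  have habs : ∀ r ∈ Icc 0 δ, |r| < 1 := fun r hr => by
    rw [abs_of_nonneg hr.1]; exact hr.2.trans_lt hδ1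
  have hKray : ∀ r ∈ Icc 0 δ, kleinC p α (pol p (r, α)) = (k r : ℝ) := fun r hr => by
    rw [kleinC_pol D.base α (habs r hr)]; simp [hk]
  have hpolc : ∀ θ, ContinuousOn (fun r : ℝ => pol p (r, θ)) (Icc 0 δ) := fun θ =>
    (pol_smooth p).continuousOn.comp (by fun_prop) fun r hr => habs r hr
  set R2 : Set (ℝ × ℝ) := (fun r : ℝ => pol p (r, α)) '' Icc 0 δ with hR2
  set R4 : Set (ℝ × ℝ) := (fun r : ℝ => pol p (r, α + τ)) '' Icc 0 δ with hR4
  set S : Set (ℝ × ℝ) := R2 ∪ R4 ∪ Γ with hS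
  have hSc : IsCompact S :=
    ((isCompact_Icc.image_of_continuousOn (hpolc _)).union
      (isCompact_Icc.image_of_continuousOn (hpolc _))).union hΓc
  have hSn : ∀ x ∈ S, x ∈ Ω ∧ z x ≤ 0 := by
    rintro x ((⟨r, hr, rfl⟩ | ⟨r, hr, rfl⟩) | hx)
    · rcases hr.1.eq_or_lt with rfl | hr'
      · simp only [pol_zero]; exact ⟨D.mem, hzp.le⟩
      · exact ⟨(h2 r ⟨hr', hr.2⟩).1, (h2 r ⟨hr', hr.2⟩).2.le⟩
    · rcases hr.1.eq_or_lt with rfl | hr'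
      · simp only [pol_zero]; exact ⟨D.mem, hzp.le⟩
      · exact ⟨(h4 r ⟨hr', hr.2⟩).1, (h4 r ⟨hr', hr.2⟩).2.le⟩
    · exact ⟨(hΓn x hx).1, (hΓn x hx).2.le⟩
  have hlog : ∀ x ∈ Ω, 0 < z x → HasLog (kleinC p α '' S) (kleinC p α x) := by
    intro x hx hzx
    obtain ⟨C, hxC, hCΩ, hCz, hCc, q, hq, hqΩ⟩ := hpos x hx hzx
    exact D.hasLog_of_escape α (fun y hy => (hSn y hy).1) hSc hCΩ
      (disjoint_left.2 fun y hy hyS => absurd (hSn y hyS).2 (not_le.2 (hCz y hy))) hCc hq hqΩ hxC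
  have hr1m : r1 ∈ Ioc 0 δ := ⟨hr1, hr1δ.le⟩
  have hr1I : r1 ∈ Icc 0 δ := ⟨hr1.le, hr1δ.le⟩
  have hx3 : kleinC p α (pol p (r1, α + σ)) = w + h * Complex.I := by
    rw [kleinC_pol D.base α (habs r1 hr1I), add_sub_cancel_left]
  have hx1 : kleinC p α (pol p (r1, α - σ)) = w - h * Complex.I := by
    rw [kleinC_pol D.base α (habs r1 hr1I), show α - σ - α = -σ by ring, Real.cos_neg,
      Real.sin_neg, hw, hh, hε, hk]
    push_cast; ring
  have hR4seg : ∀ x ∈ R4, (kleinC p α x).re = w → |(kleinC p α x).im| ≤ h → False := by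
    rintro _ ⟨r, hr, rfl⟩ hre him
    simp only at hre him
    rw [kleinC_pol D.base α (habs r hr), add_sub_cancel_left] at hre him
    simp only [Complex.add_re, Complex.add_im, Complex.mul_re, Complex.mul_im, Complex.ofReal_re,
      Complex.ofReal_im, Complex.I_re, Complex.I_im, mul_zero, mul_one, add_zero,
      zero_add, sub_self] at hre him
    have him' := (abs_le.1 him).2
    have hkr : 0 ≤ k r := by
      have := hr.1
      simp only [hk]; positivity
    have e1 : k r * Real.cos τ = w := hre
    have e2 : k r * Real.sin τ ≤ h := him'
    have e3 : k r * Real.sin (τ - σ) ≤ 0 := by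
      rw [Real.sin_sub]
      have : k r * Real.sin τ * Real.cos σ ≤ h * Real.cos σ := by gcongr
      have e5 : k r * Real.cos τ * Real.sin σ = w * Real.sin σ := by rw [e1]
      have e6 : w * Real.sin σ = h * Real.cos σ := by rw [hw, hh]; ring
      linarith
    have e4 : k r = 0 := by
      by_contra hne
      have : 0 < k r := lt_of_le_of_ne hkr (Ne.symm hne)
      have := mul_pos this hτ
      linarith
    rw [e4] at e1
    linarith
  have hΓseg : ∀ x ∈ Γ, (kleinC p α x).re = w → |(kleinC p α x).im| ≤ h → False := by
    intro x hx hre him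
    have e1 : ‖kleinC p α x‖ ^ 2 ≤ ε ^ 2 := by
      rw [← Complex.normSq_eq_norm_sq, Complex.normSq_apply, hre]
      have : (kleinC p α x).im * (kleinC p α x).im ≤ h * h := by
        rw [← abs_mul_abs_self (kleinC p α x).im]; gcongr
      have e2 : w * w + h * h = ε ^ 2 := by
        rw [hw, hh]; nlinarith [Real.sin_sq_add_cos_sq σ]
      linarith
    have e2 : ‖kleinC p α x‖ ≤ ε := le_of_sq_le_sq e1 hεpos.le
    linarith [hε0Γ x hx]
  refine crossing_false (K := kleinC p α '' S) (w := w) hh0 ?_ ?_ ?_ ?_ ?_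
  · set A : Set (ℝ × ℝ) := (fun r : ℝ => pol p (r, α)) '' Ico 0 r0 with hA
    set B : Set (ℝ × ℝ) := (fun r : ℝ => pol p (r, α)) '' Ioc r0 δ with hB
    have hAc : IsPreconnected A := isPreconnected_Ico.image _
      ((hpolc _).mono fun r hr => ⟨hr.1, (hr.2.trans hr0δ).le⟩)
    have hBc : IsPreconnected B := isPreconnected_Ioc.image _
      ((hpolc _).mono fun r hr => ⟨(hr00.trans hr.1).le, hr.2⟩)
    have hR4c : IsPreconnected R4 := isPreconnected_Icc.image _ (hpolc _)
    have hall : IsPreconnected (A ∪ R4 ∪ (Γ ∪ B)) := by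
      refine IsPreconnected.union (pol p (δ, α + τ)) (Or.inr ⟨δ, ⟨hδ.le, le_rfl⟩, rfl⟩)
        (Or.inl hΓ0) (IsPreconnected.union p ⟨0, ⟨le_rfl, hr00⟩, pol_zero _ _⟩
          ⟨0, ⟨le_rfl, hδ.le⟩, pol_zero _ _⟩ hAc hR4c)
        (IsPreconnected.union (pol p (δ, α)) hΓ1 ⟨δ, ⟨hr0δ, le_rfl⟩, rfl⟩ hΓconn hBc)
    have hset : kleinC p α '' S \ {(w : ℂ)} = kleinC p α '' (A ∪ R4 ∪ (Γ ∪ B)) := by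
      ext ζ
      constructor
      · rintro ⟨⟨x, hx, rfl⟩, hne⟩
        refine mem_image_of_mem _ ?_
        rcases hx with (⟨r, hr, rfl⟩ | hx) | hx
        · rcases lt_trichotomy r r0 with hlt | heq | hgt
          · exact Or.inl (Or.inl ⟨r, ⟨hr.1, hlt⟩, rfl⟩)
          · refine absurd ?_ hne
            show kleinC p α (pol p (r, α)) = w
            rw [hKray r hr, heq, hr0w]
          · exact Or.inr (Or.inr ⟨r, ⟨hgt, hr.2⟩, rfl⟩)
        · exact Or.inl (Or.inr hx)
        · exact Or.inr (Or.inl hx)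
      · have hrne : ∀ r ∈ Icc 0 δ, r ≠ r0 → kleinC p α (pol p (r, α)) ≠ w := by
          intro r hr hne heq
          rw [hKray r hr] at heq
          have heq' : k r = w := by exact_mod_cast heq
          exact hne (hkinj r hr r0 ⟨hr00.le, hr0δ.le⟩ (heq'.trans hr0w.symm))
        rintro ⟨x, (⟨r, hr, rfl⟩ | hx) | (hx | ⟨r, hr, rfl⟩), rfl⟩
        · have hrI : r ∈ Icc 0 δ := ⟨hr.1, (hr.2.trans hr0δ).le⟩
          exact ⟨mem_image_of_mem _ (Or.inl (Or.inl ⟨r, hrI, rfl⟩)), hrne r hrI hr.2.ne⟩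
        · exact ⟨mem_image_of_mem _ (Or.inl (Or.inr hx)), fun heq => by
            have heq : kleinC p α x = w := heq
            exact hR4seg x hx (by rw [heq]; simp) (by rw [heq]; simpa using hh0.le)⟩
        · exact ⟨mem_image_of_mem _ (Or.inr hx), fun heq => by
            have heq : kleinC p α x = w := heq
            exact hΓseg x hx (by rw [heq]; simp) (by rw [heq]; simpa using hh0.le)⟩
        · have hrI : r ∈ Icc 0 δ := ⟨(hr00.trans hr.1).le, hr.2⟩
          exact ⟨mem_image_of_mem _ (Or.inl (Or.inl ⟨r, hrI, rfl⟩)), hrne r hrI hr.1.ne'⟩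
    rw [hset]
    exact hall.image _ hcont.continuousOn
  · rintro _ ⟨x, (⟨r, hr, rfl⟩ | hx) | hx, rfl⟩ hre him
    · simp only at hre him ⊢
      rw [hKray r hr] at hre ⊢
      simpa using hre
    · exact (hR4seg x hx hre him).elim
    · exact (hΓseg x hx hre him).elim
  · have e1 : ∀ᶠ t in 𝓝 (0 : ℝ), w + t ∈ Ioo 0 ε := by
      have : Continuous fun t : ℝ => w + t := by fun_prop
      exact this.tendsto 0 (by simpa using Ioo_mem_nhds hw0 hwε)
    filter_upwards [e1] with t ht
    obtain ⟨r, hr, hrt⟩ := hivt ⟨ht.1.le, ht.2.le⟩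
    have hrI : r ∈ Icc 0 δ := ⟨hr.1, hr.2.trans hr1δ.le⟩
    exact ⟨pol p (r, α), Or.inl (Or.inl ⟨r, hrI, rfl⟩), by rw [hKray r hrI, hrt]⟩
  · rw [← hx1]; exact hlog _ (h1 r1 hr1m).1 (h1 r1 hr1m).2
  · rw [← hx3]; exact hlog _ (h3 r1 hr1m).1 (h3 r1 hr1m).2

end ConvDom

lemma second_deriv_nonpos {f f' : ℝ → ℝ} {f'' x : ℝ} (hmax : IsLocalMax f x)
    (h1 : ∀ᶠ t in 𝓝 x, HasDerivAt f (f' t) t) (h2 : HasDerivAt f' f'' x) : f'' ≤ 0 := by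
  by_contra hpos
  push Not at hpos
  have e1 : deriv f =ᶠ[𝓝 x] f' := h1.mono fun t ht => ht.deriv
  have e2 : deriv (deriv f) x = f'' := e1.deriv_eq.trans h2.deriv
  have hmin : IsLocalMin f x :=
    isLocalMin_of_deriv_deriv_pos (by rw [e2]; exact hpos) hmax.deriv_eq_zero
      h1.self_of_nhds.continuousAt
  have hc : f =ᶠ[𝓝 x] fun _ => f x := by
    filter_upwards [hmax, hmin] with t h3 h4 using le_antisymm h3 h4
  have e3 : deriv f =ᶠ[𝓝 x] fun _ => 0 := by
    filter_upwards [hc.eventuallyEq_nhds] with t ht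
    rw [ht.deriv_eq]; simp
  have e4 : deriv (deriv f) x = 0 := by rw [e3.deriv_eq]; simp
  linarith

section maximum
variable {Ω : Set (ℝ × ℝ)} {z : ℝ × ℝ → ℝ} {μ : ℝ}

/-- Comparison with the positive supersolution `√y`. -/
lemma no_local_max_ratio (ho : IsOpen Ω) (hΩ : Ω ⊆ H2) (hμ : μ < 1 / 4)
    (hz : ContDiffOn ℝ (⊤ : ℕ∞) z Ω) (heq : ∀ x ∈ Ω, -hypLap z x = μ * z x) {q : ℝ × ℝ}
    (hq : q ∈ Ω) {M : ℝ} (hM : 0 < M) (hzq : z q = M * Real.sqrt q.2)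
    (hmax : ∀ᶠ x in 𝓝 q, z x ≤ M * Real.sqrt x.2) : False := by
  have hy : 0 < q.2 := hΩ hq
  set s := Real.sqrt q.2 with hs
  have hs0 : 0 < s := Real.sqrt_pos.2 hy
  have hss : s * s = q.2 := Real.mul_self_sqrt hy.le
  have hcx : Tendsto (fun t : ℝ => (t, q.2)) (𝓝 q.1) (𝓝 q) :=
    (Continuous.prodMk_left q.2).tendsto q.1
  have hcy : Tendsto (fun t : ℝ => (q.1, t)) (𝓝 q.2) (𝓝 q) :=
    (Continuous.prodMk_right q.1).tendsto q.2
  have dx : ∀ {w : ℝ × ℝ → ℝ}, ContDiffOn ℝ (⊤ : ℕ∞) w Ω → ∀ t, (t, q.2) ∈ Ω →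
      HasDerivAt (fun t => w (t, q.2)) (pdx w (t, q.2)) t := fun hw t ht =>
    (hw.diffAt ho ht).hasFDerivAt.comp_hasDerivAt t
      ((hasDerivAt_id t).prodMk (hasDerivAt_const t q.2))
  have dy : ∀ {w : ℝ × ℝ → ℝ}, ContDiffOn ℝ (⊤ : ℕ∞) w Ω → ∀ t, (q.1, t) ∈ Ω →
      HasDerivAt (fun t => w (q.1, t)) (pdy w (q.1, t)) t := fun hw t ht =>
    (hw.diffAt ho ht).hasFDerivAt.comp_hasDerivAt t
      ((hasDerivAt_const t q.1).prodMk (hasDerivAt_id t))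
  have hxx : pdx (pdx z) q ≤ 0 := by
    refine second_deriv_nonpos (f := fun t => z (t, q.2) - M * s)
      (f' := fun t => pdx z (t, q.2)) (x := q.1) ?_ ?_ (dx (hz.pdx_smooth ho) q.1 hq)
    · filter_upwards [hcx.eventually hmax] with t ht
      have e : z (q.1, q.2) = M * s := hzq
      simp only [e]
      linarith
    · filter_upwards [hcx.eventually (ho.mem_nhds hq)] with t ht
      exact (dx hz t ht).sub_const _
  have hyy : pdy (pdy z) q - M * (-(2 * (1 / (2 * s))) / (2 * s) ^ 2) ≤ 0 := by
    refine second_deriv_nonpos (f := fun t => z (q.1, t) - M * Real.sqrt t)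
      (f' := fun t => pdy z (q.1, t) - M * (2 * Real.sqrt t)⁻¹) (x := q.2) ?_ ?_ ?_
    · filter_upwards [hcy.eventually hmax] with t ht
      have e : z (q.1, q.2) = M * Real.sqrt q.2 := hzq
      simp only [e]
      linarith
    · filter_upwards [hcy.eventually (ho.mem_nhds hq)] with t ht
      have ht0 : 0 < t := hΩ ht
      have h2 := (Real.hasDerivAt_sqrt ht0.ne').const_mul M
      rw [one_div] at h2
      exact (dy hz t ht).sub h2
    · have h1 := (dy (hz.pdy_smooth ho) q.2 hq)
      have h2 := ((Real.hasDerivAt_sqrt hy.ne').const_mul 2).fun_inv (by positivity)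
      exact h1.sub (h2.const_mul M)
  have h1 := heq q hq
  rw [hypLap, hzq, ← hss] at h1
  have h2 : M * (-(2 * (1 / (2 * s))) / (2 * s) ^ 2) = -(M / (4 * s ^ 3)) := by
    field_simp; ring
  rw [h2] at hyy
  have h3 : pdx (pdx z) q + pdy (pdy z) q ≤ -(M / (4 * s ^ 3)) := by linarith
  have h4 : (s * s) ^ 2 * (pdx (pdx z) q + pdy (pdy z) q) ≤ (s * s) ^ 2 * -(M / (4 * s ^ 3)) :=
    mul_le_mul_of_nonneg_left h3 (by positivity)
  have h5 : (s * s) ^ 2 * -(M / (4 * s ^ 3)) = -(1 / 4 * (M * s)) := by field_simp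
  have h6 : 0 < M * s := by positivity
  nlinarith

/-- Positive components reach the boundary. -/
lemma exists_component_escape (ho : IsOpen Ω) (hΩ : Ω ⊆ H2) (hcpt : IsCompact (closure Ω))
    (hμ : μ < 1 / 4) (hz : ContDiffOn ℝ (⊤ : ℕ∞) z Ω)
    (heq : ∀ x ∈ Ω, -hypLap z x = μ * z x) {x : ℝ × ℝ} (hx : x ∈ Ω) (hzx : 0 < z x) :
    ∃ C, x ∈ C ∧ C ⊆ Ω ∧ (∀ y ∈ C, 0 < z y) ∧ IsPreconnected C ∧ ∃ q ∈ closure C, q ∉ Ω := by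
  set P : Set (ℝ × ℝ) := {x | x ∈ Ω ∧ 0 < z x} with hP
  have hPo : IsOpen P := hz.continuousOn.isOpen_inter_preimage ho isOpen_Ioi
  have hxP : x ∈ P := ⟨hx, hzx⟩
  set C := connectedComponentIn P x with hC
  have hCP : C ⊆ P := connectedComponentIn_subset P x
  have hxC : x ∈ C := mem_connectedComponentIn hxP
  have hCc : IsPreconnected C := isPreconnected_connectedComponentIn
  refine ⟨C, hxC, fun y hy => (hCP hy).1, fun y hy => (hCP hy).2, hCc, ?_⟩
  by_contra hno
  push Not at hno
  have hclo : closure C ⊆ Ω := hno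
  have hcC : IsCompact (closure C) :=
    hcpt.of_isClosed_subset isClosed_closure (closure_mono fun y hy => (hCP hy).1)
  have hsq : ∀ y ∈ Ω, 0 < Real.sqrt y.2 := fun y hy => Real.sqrt_pos.2 (hΩ hy)
  obtain ⟨q, hq, hmax⟩ := hcC.exists_isMaxOn ⟨x, subset_closure hxC⟩
    (f := fun y : ℝ × ℝ => z y / Real.sqrt y.2)
    ((hz.continuousOn.mono hclo).div (by fun_prop) fun y hy => (hsq y (hclo hy)).ne')
  have hqΩ := hclo hq
  have hge : z x / Real.sqrt x.2 ≤ z q / Real.sqrt q.2 := hmax (subset_closure hxC)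
  have hMpos : 0 < z q / Real.sqrt q.2 := (div_pos hzx (hsq x hx)).trans_le hge
  have hzq : 0 < z q := (div_pos_iff_of_pos_right (hsq q hqΩ)).1 hMpos
  have hqC : q ∈ C := by
    have h1 : IsPreconnected (insert q C) :=
      hCc.subset_closure (subset_insert _ _) (insert_subset hq subset_closure)
    exact h1.subset_connectedComponentIn (mem_insert_of_mem _ hxC)
      (insert_subset (show q ∈ P from ⟨hqΩ, hzq⟩) hCP) (mem_insert _ _)
  refine no_local_max_ratio ho hΩ hμ hz heq hqΩ hMpos
    (div_mul_cancel₀ _ (hsq q hqΩ).ne').symm ?_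
  filter_upwards [(hPo.connectedComponentIn).mem_nhds hqC] with y hy
  have h2 : z y / Real.sqrt y.2 ≤ z q / Real.sqrt q.2 := hmax (subset_closure hy)
  exact (div_le_iff₀ (hsq y (hCP hy).1)).1 h2

end maximum

namespace ConvDom
variable {Ω : Set (ℝ × ℝ)} {p : ℝ × ℝ} (D : ConvDom Ω p)
include D

/-- A second order zero is incompatible with a connected negative set. -/
lemma double_zero_false {z : ℝ × ℝ → ℝ} {μ : ℝ} (hμ0 : 0 < μ) (hμ : μ < 1 / 4)
    (hz : SuperSol Ω p μ z) (hv : VarIneq Ω μ) (hne : ∃ x ∈ Ω, z x ≠ 0) (hzp : z p = 0)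
    (hd : fderiv ℝ z p = 0) : False := by
  have hneg := D.neg_preconnected hμ0 hz hv hne
  have hloc := (unique_continuation D.isOpen D.sub D.preconn hμ0 hz.smooth hz.eq).resolve_left
    (by push Not; exact hne)
  obtain ⟨m, A, θ0, ρ, H, h⟩ := hloc p D.mem
  have hm := h.order_ge_two D.isOpen hz.smooth D.mem hzp hd
  have hA := h.amp_pos (by omega)
  have hm2 : (2 : ℝ) ≤ m := by exact_mod_cast hm
  have hm0 : (m : ℝ) ≠ 0 := by positivity
  have hpi := Real.pi_pos
  set α := θ0 + Real.pi / m with hα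
  set σ := 3 * Real.pi / (4 * m) with hσ
  set τ := 2 * Real.pi / m with hτ
  have n2 := h.eventually_neg (θ := α) (by
    rw [show (m : ℝ) * (α - θ0) = Real.pi by rw [hα]; field_simp; ring, Real.cos_pi]
    linarith)
  have n4 := h.eventually_neg (θ := α + τ) (by
    rw [show (m : ℝ) * (α + τ - θ0) = Real.pi + 2 * Real.pi by rw [hα, hτ]; field_simp; ring,
      Real.cos_add_two_pi, Real.cos_pi]
    linarith)
  have hcos : 0 < A * Real.cos (Real.pi / 4) :=
    mul_pos hA (Real.cos_pos_of_mem_Ioo ⟨by linarith, by linarith⟩)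
  have n3 := h.eventually_pos (θ := α + σ) (by
    rw [show (m : ℝ) * (α + σ - θ0) = -(Real.pi / 4) + 2 * Real.pi by
      rw [hα, hσ]; field_simp; ring, Real.cos_add_two_pi, Real.cos_neg]
    exact hcos)
  have n1 := h.eventually_pos (θ := α - σ) (by
    rw [show (m : ℝ) * (α - σ - θ0) = Real.pi / 4 by rw [hα, hσ]; field_simp; ring]
    exact hcos)
  obtain ⟨δ, hδ, hδ'⟩ := (mem_nhdsGT_iff_exists_Ioc_subset).1 (n2.and (n4.and (n3.and n1)))
  have hδ : 0 < δ := hδ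
  have hsub : ∀ r ∈ Ioc 0 (min δ (1 / 2)), r ∈ Ioc 0 δ := fun r hr =>
    ⟨hr.1, hr.2.trans (min_le_left _ _)⟩
  have hτσ : τ - σ = 5 * Real.pi / (4 * m) := by rw [hτ, hσ]; field_simp; ring
  refine D.crossing_rays_false (α := α) (σ := σ) (τ := τ) (δ := min δ (1 / 2))
    hz.smooth.continuousOn hzp hneg
    (fun x hx hzx => exists_component_escape D.isOpen D.sub D.compact hμ hz.smooth hz.eq hx hzx)
    (by positivity) ?_ ?_ (lt_min hδ (by norm_num))
    ((min_le_right _ _).trans_lt (by norm_num))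
    (fun r hr => (hδ' (hsub r hr)).1) (fun r hr => (hδ' (hsub r hr)).2.1)
    (fun r hr => (hδ' (hsub r hr)).2.2.1) (fun r hr => (hδ' (hsub r hr)).2.2.2)
  · rw [hσ, div_lt_div_iff₀ (by positivity) (by norm_num)]
    nlinarith
  · rw [hτσ]
    refine Real.sin_pos_of_pos_of_lt_pi (by positivity) ?_
    rw [div_lt_iff₀ (by positivity)]
    nlinarith

lemma critical_point_false {u : ℝ × ℝ → ℝ} {μ : ℝ} (hμ0 : 0 < μ) (hμ : μ ≤ 1 / 8)
    (hv : VarIneq Ω μ) (hnc : ¬ ∃ c : ℝ, ∀ x ∈ Ω, u x = c)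
    (hu : ContDiffOn ℝ (⊤ : ℕ∞) u Ω) (hu1 : ContDiffOn ℝ 1 u (closure Ω))
    (heq : ∀ x ∈ Ω, -hypLap u x = μ * u x)
    (hn : ∀ q ∈ frontier Ω, ∀ ν : ℝ × ℝ, IsOutwardNormalAt Ω q ν →
      fderivWithin ℝ u (closure Ω) q ν = 0)
    (hneg : SuperSol Ω p μ fun x => -u x) (hup : 0 ≤ u p) (hd : fderiv ℝ u p = 0) : False := by
  obtain ⟨g, hg0, hg, hgpos, hg', hode⟩ := exists_radial hμ0 hμ
  set f : ℝ × ℝ → ℝ := fun x => g (tfun p.1 p.2 x) with hf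
  have hp2 : 0 < p.2 := D.base
  have hsol : ∀ c, 0 ≤ c → SuperSol Ω p μ fun x => u x + -c * f x := fun c hc =>
    D.superSol hc hf hg hg' hode hu hu1 heq hn
  have hz := hsol (u p) hup
  have hfp : f p = 1 := by
    have : tfun p.1 p.2 p = 0 := tfun_self p.1 p.2
    simp only [hf, this, hg0]
  have htp : fderiv ℝ (tfun p.1 p.2) p = 0 := by
    refine ContinuousLinearMap.ext fun v => ?_
    rw [fderiv_apply_eq_pd, pdx_tfun hp2 D.base, pdy_tfun hp2 D.base]; simp
  have hfd : HasFDerivAt f (0 : ℝ × ℝ →L[ℝ] ℝ) p := by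
    have h1 := ((tfun_smooth (a := p.1) hp2).diffAt isOpen_H2 D.base).hasFDerivAt
    rw [htp] at h1
    have ht0 : tfun p.1 p.2 p = 0 := tfun_self p.1 p.2
    have h2 : DifferentiableAt ℝ g (tfun p.1 p.2 p) := by
      rw [ht0]
      exact (hg.contDiffAt (isOpen_Ioo.mem_nhds (by norm_num))).differentiableAt (by simp)
    have h3 := h2.hasDerivAt.comp_hasFDerivAt p h1
    rw [smul_zero] at h3
    exact h3
  have hzd : fderiv ℝ (fun x => u x + -u p * f x) p = 0 := by
    have h1 := (hu.diffAt D.isOpen D.mem).hasFDerivAt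
    rw [hd] at h1
    have h2 := h1.add (hfd.const_mul (-u p))
    rw [smul_zero, add_zero] at h2
    exact h2.fderiv
  refine D.double_zero_false hμ0 (by linarith) hz hv ?_ (by simp [hfp]) hzd
  by_contra hall
  push Not at hall
  have huf : ∀ x ∈ Ω, u x = u p * f x := fun x hx => by linarith [hall x hx]
  have hfpos : ∀ x ∈ Ω, 0 < f x := fun x hx => hgpos _ (tfun_mem hp2 (D.sub hx))
  rcases hup.eq_or_lt with h0 | hpos
  · exact hnc ⟨0, fun x hx => by rw [huf x hx, ← h0, zero_mul]⟩
  · have hu0 : SuperSol Ω p μ u := by simpa using hsol 0 le_rfl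
    have hmean := D.mean_zero hμ0 hu0 hneg
    obtain ⟨B, hB⟩ := hu0.bdd
    have hintg : IntegrableOn (fun x : ℝ × ℝ => u x / x.2 ^ 2) Ω volume :=
      D.toBddDom.integrableOn_div_of_cont hu.continuousOn fun x hx => (hB x hx).1
    have hupos : ∀ x ∈ Ω, 0 < u x / x.2 ^ 2 := fun x hx => by
      have : 0 < x.2 := D.sub hx
      have := hfpos x hx
      rw [huf x hx]; positivity
    have := (setIntegral_pos_iff_support_of_nonneg_ae
      ((ae_restrict_mem D.isOpen.measurableSet).mono fun x hx => (hupos x hx).le) hintg).2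
      (lt_of_lt_of_le (D.isOpen.measure_pos volume ⟨p, D.mem⟩)
        (measure_mono fun x hx => ⟨(hupos x hx).ne', hx⟩))
    linarith

end ConvDom

lemma hypLap_neg (u : ℝ × ℝ → ℝ) (x : ℝ × ℝ) : hypLap (fun y => -u y) x = -hypLap u x := by
  have hx : ∀ w : ℝ × ℝ → ℝ, pdx (fun y => -w y) = fun y => -pdx w y := fun w => by
    funext y; simp [pdx]
  have hy : ∀ w : ℝ × ℝ → ℝ, pdy (fun y => -w y) = fun y => -pdy w y := fun w => by
    funext y; simp [pdy]
  rw [hypLap, hx, hx, hy, hy, hypLap]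
  ring

/-- **Corollary (large bounded convex domains).** There exists `A > 0` such that on every
bounded open connected geodesically convex domain `Ω ⊆ ℍ²` of hyperbolic area at least `A`,
a nonconstant second Neumann eigenfunction (i.e. one whose eigenvalue `μ > 0` is least in
the variational sense) has no interior critical points. -/
theorem hot_spots_large_bounded_convex :
    ∃ A : ℝ, 0 < A ∧
      ∀ Ω : Set (ℝ × ℝ), Ω ⊆ H2 → Ω.Nonempty → IsOpen Ω → IsConnected Ω →
        GeodesicallyConvex Ω → IsCompact (closure Ω) → closure Ω ⊆ H2 →
        A ≤ (∫ p in Ω, 1 / p.2 ^ 2) →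
        ∀ μ : ℝ, 0 < μ →
        ∀ u : ℝ × ℝ → ℝ,
          (¬ ∃ c : ℝ, ∀ p ∈ Ω, u p = c) →
          ContDiffOn ℝ (⊤ : ℕ∞) u Ω →
          ContDiffOn ℝ 1 u (closure Ω) →
          IntegrableOn (fun p : ℝ × ℝ => u p ^ 2 / p.2 ^ 2) Ω volume →
          IntegrableOn (gradSq u) Ω volume →
          (∀ p ∈ Ω, -hypLap u p = μ * u p) →
          (∀ q ∈ frontier Ω, ∀ ν : ℝ × ℝ, IsOutwardNormalAt Ω q ν →
            fderivWithin ℝ u (closure Ω) q ν = 0) →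
          (∀ w : ℝ × ℝ → ℝ, ContDiffOn ℝ (⊤ : ℕ∞) w Ω →
            (∫ p in Ω, w p / p.2 ^ 2) = 0 →
            IntegrableOn (fun p : ℝ × ℝ => w p ^ 2 / p.2 ^ 2) Ω volume →
            IntegrableOn (gradSq w) Ω volume →
            μ * ∫ p in Ω, w p ^ 2 / p.2 ^ 2 ≤ ∫ p in Ω, gradSq w p) →
          ∀ p ∈ Ω, fderiv ℝ u p ≠ 0 := by
  obtain ⟨A, hA, hsmall⟩ := exists_area_eigenvalue_small
  refine ⟨A, hA, fun Ω _ hne ho hconn hgc hcpt hclo hArea μ hμ0 u hnc hu hu1 _ _ heq hn hv p hp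
    hd => ?_⟩
  have D : ConvDom Ω p :=
    { nonempty := hne, isOpen := ho, preconn := hconn.isPreconnected, compact := hcpt,
      closure_sub := hclo, conv := hgc, mem := hp }
  have hμ := hsmall Ω μ D.toBddDom hv hArea
  have heq' : ∀ x ∈ Ω, -hypLap (fun y => -u y) x = μ * -u x := fun x hx => by
    rw [hypLap_neg]; linarith [heq x hx]
  have hn' : ∀ q ∈ frontier Ω, ∀ ν : ℝ × ℝ, IsOutwardNormalAt Ω q ν →
      fderivWithin ℝ (fun y => -u y) (closure Ω) q ν = 0 := fun q hq ν hν => by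
    rw [fderivWithin_fun_neg (D.uniqueDiffOn q (frontier_subset_closure hq))]
    simp [hn q hq ν hν]
  obtain ⟨g, -, hg, -, hg', hode⟩ := exists_radial hμ0 hμ
  have hs : SuperSol Ω p μ u := by
    simpa using D.superSol le_rfl rfl hg hg' hode hu hu1 heq hn
  have hs' : SuperSol Ω p μ fun x => -u x := by
    simpa using D.superSol le_rfl rfl hg hg' hode hu.neg hu1.neg heq' hn'
  rcases le_total 0 (u p) with h | h
  · exact D.critical_point_false hμ0 hμ hv hnc hu hu1 heq hn hs' h hd
  · refine D.critical_point_false (u := fun y => -u y) hμ0 hμ hv ?_ hu.neg hu1.neg heq' hn'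
      (by simpa using hs) (by linarith) (by rw [fderiv_fun_neg, hd, neg_zero])
    rintro ⟨c, hc⟩
    exact hnc ⟨-c, fun x hx => by rw [← hc x hx, neg_neg]⟩
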